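/- Let Ω be a bounded domain in ℝ^N with boundary ∂Ω of class C^{2,α} for some α ∈ (0,1), let g ∈ C^{2,α}(∂Ω), and let f₁ : Ω̄ × ℝ × ℝ^N → ℝ be continuous with continuous partial derivatives ∂f₁/∂η and ∂f₁/∂ξ^i (i = 1,…,N) on Ω̄ × ℝ × ℝ^N. Assume: (AM1) for each (η,ξ), x ↦ f₁(x,η,ξ) is α-Hölder continuous on Ω̄, uniformly for (η,ξ) in bounded subsets of ℝ × ℝ^N; (AM2) there exists f₂ : [0,∞) → [0,∞) such that |f₁(x,η,ξ)| ≤ f₂(ρ)·(1+|ξ|²) for every ρ ≥ 0 and all (x,η,ξ) ∈ Ω̄ × [−ρ,ρ] × ℝ^N. Suppose the problem −Δu = f₁(x,u,∇u) in Ω, u = g on ∂Ω, admits a sub solution u̲ ∈ C^{2,α}(Ω̄) and a super solution ū ∈ C^{2,α}(Ω̄) with u̲(x) ≤ ū(x) for all x ∈ Ω̄. Then there exists u ∈ C^{2,α}(Ω̄) with u̲ ≤ u ≤ ū on Ω̄ satisfying −Δu(x) = f₁(x,u(x),∇u(x)) for all x ∈ Ω and u = g on ∂Ω; moreover there exist a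 minimal solution ũ and a maximal solution û in [u̲, ū], in the sense that every solution u with u̲ ≤ u ≤ ū satisfies ũ ≤ u ≤ û pointwise. -/

import Mathlib

open Set Filter

/-- The Laplacian of `u : ℝ^N → ℝ`: the sum of its second partial derivatives. -/
noncomputable def lap {N : ℕ} (u : EuclideanSpace ℝ (Fin N) → ℝ)
    (x : EuclideanSpace ℝ (Fin N)) : ℝ :=
  ∑ i : Fin N, fderiv ℝ (fun y => fderiv ℝ u y (EuclideanSpace.single i 1)) x
    (EuclideanSpace.single i 1)

/-- `f ∈ C^{2,α}(Ω̄)`: `f` is twice continuously differentiable on `Ω̄` and its second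
derivatives are α-Hölder continuous on `Ω̄`. -/
def C2HolderOnClosure {N : ℕ} (α : NNReal) (f : EuclideanSpace ℝ (Fin N) → ℝ)
    (Ω : Set (EuclideanSpace ℝ (Fin N))) : Prop :=
  ContDiffOn ℝ 2 f (closure Ω) ∧
  ∃ C : NNReal, HolderOnWith C α (iteratedFDerivWithin ℝ 2 f (closure Ω)) (closure Ω)

/-- The boundary `∂Ω` is of class `C^{2,α}`: near each boundary point, after a rigid motion,
`Ω` coincides with the region above the graph of a `C^{2,α}` function of `N - 1` variables. -/
def IsC2HolderBoundary {N : ℕ} (α : NNReal) (Ω : Set (EuclideanSpace ℝ (Fin N))) : Prop :=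
  ∀ x ∈ frontier Ω, ∃ U : Set (EuclideanSpace ℝ (Fin N)), IsOpen U ∧ x ∈ U ∧
    ∃ T : EuclideanSpace ℝ (Fin N) ≃ᵃⁱ[ℝ] WithLp 2 (EuclideanSpace ℝ (Fin (N - 1)) × ℝ),
    ∃ ψ : EuclideanSpace ℝ (Fin (N - 1)) → ℝ,
      ContDiff ℝ 2 ψ ∧
      (∀ K : Set (EuclideanSpace ℝ (Fin (N - 1))), IsCompact K →
        ∃ C : NNReal, HolderOnWith C α (iteratedFDeriv ℝ 2 ψ) K) ∧
      Ω ∩ U = {y | ψ (WithLp.equiv 2 _ (T y)).1 < (WithLp.equiv 2 _ (T y)).2} ∩ U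

open Topology Asymptotics
set_option linter.all false
set_option linter.unusedSectionVars false

/-! ## Part 1: jets -/

abbrev Du (E : Type*) [NormedAddCommGroup E] [InnerProductSpace ℝ E] := E →L[ℝ] ℝ
abbrev Bi (E : Type*) [NormedAddCommGroup E] [InnerProductSpace ℝ E] := E →L[ℝ] E →L[ℝ] ℝ

section basic
variable {E : Type*} [NormedAddCommGroup E] [InnerProductSpace ℝ E] [FiniteDimensional ℝ E]

/-- trace of a bilinear form -/
noncomputable def bt (A : Bi E) : ℝ :=
  ∑ i, A (stdOrthonormalBasis ℝ E i) (stdOrthonormalBasis ℝ E i)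

/-- dimension -/
noncomputable def dm (E : Type*) [NormedAddCommGroup E] [InnerProductSpace ℝ E] : ℝ :=
  (Module.finrank ℝ E : ℝ)

/-- the inner product as a bilinear form -/
noncomputable def ip : Bi E := innerSL ℝ

@[simp] lemma ip_apply (x y : E) : ip x y = inner ℝ x y := rfl

@[simp] lemma bt_add (A B : Bi E) : bt (A + B) = bt A + bt B := by
  simp [bt, Finset.sum_add_distrib]
@[simp] lemma bt_sub (A B : Bi E) : bt (A - B) = bt A - bt B := by
  simp [bt, Finset.sum_sub_distrib]
@[simp] lemma bt_neg (A : Bi E) : bt (-A) = - bt A := by simp [bt]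
@[simp] lemma bt_smul (c : ℝ) (A : Bi E) : bt (c • A) = c * bt A := by
  simp [bt, Finset.mul_sum]
@[simp] lemma bt_zero : bt (0 : Bi E) = 0 := by simp [bt]

lemma bt_basis (A : Bi E) {ι : Type*} [Fintype ι] (b : OrthonormalBasis ι ℝ (E)) :
    ∑ i, A (b i) (b i) = bt A := by
  classical
  let e := stdOrthonormalBasis ℝ E
  have hexp : ∀ v w : E, A v w = ∑ j, ∑ k, inner ℝ (e j) v * inner ℝ (e k) w * A (e j) (e k) := by
    intro v w
    conv_lhs => rw [← e.sum_repr' v, ← e.sum_repr' w]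
    simp only [map_sum, map_smul, sum_apply, smul_apply,
      smul_eq_mul, Finset.mul_sum]
    rw [Finset.sum_comm]
    refine Finset.sum_congr rfl fun j _ => Finset.sum_congr rfl fun k _ => by ring
  have : ∀ i, A (b i) (b i) = ∑ j, ∑ k, inner ℝ (e j) (b i) * inner ℝ (b i) (e k) * A (e j) (e k) := by
    intro i
    rw [hexp]
    refine Finset.sum_congr rfl fun j _ => Finset.sum_congr rfl fun k _ => ?_
    rw [real_inner_comm (b i) (e k)]
  simp_rw [this]
  rw [Finset.sum_comm]
  have h2 : ∀ j, ∑ i, ∑ k, inner ℝ (e j) (b i) * inner ℝ (b i) (e k) * A (e j) (e k)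
      = A (e j) (e j) := by
    intro j
    rw [Finset.sum_comm]
    simp_rw [← Finset.sum_mul, b.sum_inner_mul_inner, e.inner_eq_ite]
    simp
  simp_rw [h2]
  simp [bt, e]

lemma bt_ip : bt (ip : Bi E) = dm E := by
  simp [bt, dm]

/-- rank one form -/
noncomputable def rk (p q : Du E) : Bi E := p.smulRight q

@[simp] lemma rk_apply (p q : Du E) (x y : E) : rk p q x y = p x * q y := by
  simp [rk]

lemma bt_rk (v w : E) : bt (rk (ip v) (ip w)) = inner ℝ v w := by
  simp only [bt, rk_apply, ip_apply]
  have := (stdOrthonormalBasis ℝ E).sum_inner_mul_inner v w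
  rw [← this]
  refine Finset.sum_congr rfl fun i _ => ?_
  rw [real_inner_comm w]

lemma bt_le (A : Bi E) : |bt A| ≤ dm E * ‖A‖ := by
  unfold bt
  refine (Finset.abs_sum_le_sum_abs _ _).trans ?_
  calc _ ≤ ∑ _i : Fin (Module.finrank ℝ E), ‖A‖ := by
        refine Finset.sum_le_sum fun i _ => ?_
        have := A.le_opNorm₂ (stdOrthonormalBasis ℝ E i) (stdOrthonormalBasis ℝ E i)
        simpa using this
    _ = _ := by simp [dm]

def Jet (u : E → ℝ) (x : E) (p : Du E) (A : Bi E) : Prop :=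
  (fun y => u y - u x - p (y - x) - 1 / 2 * A (y - x) (y - x)) =o[𝓝 x] fun y => ‖y - x‖ ^ 2

lemma Jet.add {u v : E → ℝ} {x p q A B} (h : Jet u x p A) (k : Jet v x q B) :
    Jet (fun y => u y + v y) x (p + q) (A + B) := by
  refine (IsLittleO.add h k).congr_left fun y => ?_
  simp; ring

lemma Jet.smul {u : E → ℝ} {x p A} (h : Jet u x p A) (c : ℝ) :
    Jet (fun y => c * u y) x (c • p) (c • A) := by
  refine (IsLittleO.const_mul_left h c).congr_left fun y => ?_
  simp; ring

lemma Jet.neg {u : E → ℝ} {x p A} (h : Jet u x p A) :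
    Jet (fun y => - u y) x (-p) (-A) := by
  refine (IsLittleO.neg_left h).congr_left fun y => ?_
  simp; ring

lemma Jet.sub {u v : E → ℝ} {x p q A B} (h : Jet u x p A) (k : Jet v x q B) :
    Jet (fun y => u y - v y) x (p - q) (A - B) := by
  rw [sub_eq_add_neg p, sub_eq_add_neg A]
  simpa [sub_eq_add_neg] using h.add k.neg

lemma Jet.congr {u v : E → ℝ} {x p A} (h : Jet u x p A) (e : u =ᶠ[𝓝 x] v) : Jet v x p A := by
  refine IsLittleO.congr' h ?_ EventuallyEq.rfl
  filter_upwards [e] with y hy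
  rw [hy, e.self_of_nhds]

lemma jet_const (c : ℝ) (x : E) : Jet (fun _ => c) x 0 0 := by
  refine (isLittleO_zero _ _).congr_left fun y => by simp

lemma Jet.hasFDerivAt {u : E → ℝ} {x p A} (h : Jet u x p A) : HasFDerivAt u p x := by
  rw [hasFDerivAt_iff_isLittleO]
  have h1 : (fun y => ‖y - x‖ ^ 2) =o[𝓝 x] fun y => y - x := by
    have : (fun y : E => ‖y - x‖ ^ 2) = fun y => ‖y - x‖ * ‖y - x‖ := by ext; ring
    rw [this]
    rw [← isLittleO_norm_right]
    have h0 : Tendsto (fun y : E => ‖y - x‖) (𝓝 x) (𝓝 0) := by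
      have : Continuous fun y : E => ‖y - x‖ := by fun_prop
      simpa using this.tendsto x
    simpa using ((isLittleO_one_iff ℝ).2 h0).mul_isBigO (isBigO_refl (fun y : E => ‖y - x‖) (𝓝 x))
  have h2 : (fun y => 1 / 2 * A (y - x) (y - x)) =o[𝓝 x] fun y => y - x := by
    refine IsBigO.trans_isLittleO ?_ h1
    refine IsBigO.of_bound (‖A‖) (Eventually.of_forall fun y => ?_)
    have := A.le_opNorm₂ (y - x) (y - x)
    rw [norm_mul, norm_pow, norm_norm]
    have h3 := norm_nonneg (A (y - x) (y - x))
    have h4 : ‖(1 / 2 : ℝ)‖ = 1 / 2 := by norm_num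
    rw [h4]
    nlinarith
  have := (h.trans h1).add h2
  refine this.congr_left fun y => ?_
  ring

lemma Jet.continuousAt {u : E → ℝ} {x p A} (h : Jet u x p A) : ContinuousAt u x :=
  h.hasFDerivAt.continuousAt

lemma jet_of_eq {u : E → ℝ} {x p A}
    (h : ∀ y, u y = u x + p (y - x) + 1 / 2 * A (y - x) (y - x)) : Jet u x p A := by
  refine (isLittleO_zero _ _).congr_left fun y => ?_
  rw [h y]; ring

/-- jets of quadratic polynomials at other points -/
lemma jet_quad (c : ℝ) (p : Du E) (A : Bi E) (x₀ x : E) :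
    Jet (fun y => c + p (y - x₀) + 1 / 2 * A (y - x₀) (y - x₀)) x
      (p + (1 / 2 : ℝ) • (A (x - x₀) + A.flip (x - x₀))) A := by
  refine jet_of_eq fun y => ?_
  have e : y - x₀ = (y - x) + (x - x₀) := by abel
  rw [e]
  simp only [map_add, add_apply, smul_apply,
    ContinuousLinearMap.flip_apply, smul_eq_mul]
  ring

lemma jet_sq (x₀ x : E) : Jet (fun y => ‖y - x₀‖ ^ 2) x
    ((2 : ℝ) • ip (x - x₀)) ((2 : ℝ) • ip) := by
  refine jet_of_eq fun y => ?_
  have e : y - x₀ = (y - x) + (x - x₀) := by abel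
  rw [e, norm_add_sq_real]
  simp only [smul_apply, ip_apply, smul_eq_mul,
    real_inner_self_eq_norm_sq]
  rw [real_inner_comm]
  ring

lemma jet_lin (p : Du E) (x₀ x : E) : Jet (fun y => p (y - x₀)) x p 0 := by
  refine jet_of_eq fun y => ?_
  simp

/-- one-dimensional max -/
lemma oned_max {f : ℝ → ℝ} {a b : ℝ} (h : (fun t => f t - f 0 - a * t - b / 2 * t ^ 2) =o[𝓝 0] fun t => t ^ 2)
    (hm : ∀ᶠ t in 𝓝 0, f t ≤ f 0) : a = 0 ∧ b ≤ 0 := by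
  have key : ∀ ε > 0, ∀ᶠ t in 𝓝 (0:ℝ), a * t + b / 2 * t ^ 2 ≤ ε * t ^ 2 := by
    intro ε hε
    filter_upwards [h.bound hε, hm] with t h1 h2
    rw [Real.norm_eq_abs, Real.norm_eq_abs, abs_of_nonneg (sq_nonneg t)] at h1
    have := (abs_le.1 h1).1
    linarith
  have ha : a = 0 := by
    obtain ⟨δ, hδ, hb⟩ := Metric.eventually_nhds_iff.1 (key 1 one_pos)
    by_contra hne
    have hpos : 0 < |a| := abs_pos.2 hne
    set t := min (δ / 2) (|a| / (2 * (1 + |b|)))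
    have ht : 0 < t := lt_min (by positivity) (by positivity)
    have ht1 : t < δ := (min_le_left _ _).trans_lt (by linarith)
    have ht2 : t * (2 * (1 + |b|)) ≤ |a| := by
      have := min_le_right (δ / 2) (|a| / (2 * (1 + |b|)))
      rwa [← le_div_iff₀ (by positivity)]
    have hb' := (abs_le.1 (le_refl |b|)).1
    rcases lt_or_gt_of_ne hne with h0 | h0
    · have := hb (y := -t) (by simpa [abs_of_pos ht] using ht1)
      rw [abs_of_neg h0] at ht2
      have h5 : 0 ≤ (b + |b|) * t ^ 2 := mul_nonneg (by linarith) (sq_nonneg t)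
      have h6 : t * (t * (2 * (1 + |b|))) ≤ t * (-a) := by gcongr
      have h7 : 0 ≤ |b| * t ^ 2 := by positivity
      have h8 : 0 < t ^ 2 := by positivity
      nlinarith
    · have := hb (y := t) (by simpa [abs_of_pos ht] using ht1)
      rw [abs_of_pos h0] at ht2
      have h5 : 0 ≤ (b + |b|) * t ^ 2 := mul_nonneg (by linarith) (sq_nonneg t)
      have h6 : t * (t * (2 * (1 + |b|))) ≤ t * a := by gcongr
      have h7 : 0 ≤ |b| * t ^ 2 := by positivity
      have h8 : 0 < t ^ 2 := by positivity
      nlinarith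
  refine ⟨ha, ?_⟩
  subst ha
  by_contra hb
  push Not at hb
  obtain ⟨δ, hδ, hb'⟩ := Metric.eventually_nhds_iff.1 (key (b / 4) (by positivity))
  have := hb' (y := δ / 2) (by simp [abs_of_pos hδ, hδ])
  have h4 : 0 < (δ / 2) ^ 2 := by positivity
  nlinarith

lemma Jet.line {u : E → ℝ} {x p A} (h : Jet u x p A) (a : E) :
    (fun t : ℝ => u (x + t • a) - u x - p a * t - A a a / 2 * t ^ 2) =o[𝓝 0] fun t => t ^ 2 := by
  have hc : Tendsto (fun t : ℝ => x + t • a) (𝓝 0) (𝓝 x) := by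
    have : Continuous fun t : ℝ => x + t • a := by fun_prop
    simpa using this.tendsto 0
  have := h.comp_tendsto hc
  have h2 : ((fun y : E => ‖y - x‖ ^ 2) ∘ fun t : ℝ => x + t • a) =O[𝓝 0] fun t : ℝ => t ^ 2 := by
    refine IsBigO.of_bound (‖a‖ ^ 2) (Eventually.of_forall fun t => ?_)
    simp [norm_smul, mul_pow, mul_comm]
  refine (this.trans_isBigO h2).congr_left fun t => ?_
  simp
  ring

lemma Jet.max {u : E → ℝ} {x p A} (h : Jet u x p A) (hm : ∀ᶠ y in 𝓝 x, u y ≤ u x) :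
    p = 0 ∧ ∀ a, A a a ≤ 0 := by
  have : ∀ a, p a = 0 ∧ A a a ≤ 0 := by
    intro a
    have hc : Tendsto (fun t : ℝ => x + t • a) (𝓝 0) (𝓝 x) := by
      have : Continuous fun t : ℝ => x + t • a := by fun_prop
      simpa using this.tendsto 0
    refine oned_max (f := fun t => u (x + t • a)) ?_ ?_
    · simpa using h.line a
    · simpa using hc.eventually hm
  exact ⟨by ext a; simpa using (this a).1, fun a => (this a).2⟩

lemma bt_nonpos {A : Bi E} (h : ∀ a, A a a ≤ 0) : bt A ≤ 0 :=
  Finset.sum_nonpos fun _ _ => h _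

lemma Jet.unique {u : E → ℝ} {x p A q B} (h : Jet u x p A) (k : Jet u x q B) :
    p = q ∧ bt A = bt B := by
  have h1 := (h.sub k).max (by simp)
  have h2 := (k.sub h).max (by simp)
  have h3 := bt_nonpos h1.2
  have h4 := bt_nonpos h2.2
  simp at h3 h4
  exact ⟨sub_eq_zero.1 h1.1, by linarith⟩

/-- jet under affine change of variables -/
lemma Jet.comp_affine {u : E → ℝ} {x₀ : E} (L : E →L[ℝ] E) {z p A}
    (h : Jet u (x₀ + L z) p A) :
    Jet (fun y => u (x₀ + L y)) z (p.comp L) ((A.bilinearComp L L)) := by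
  have hc : Tendsto (fun y : E => x₀ + L y) (𝓝 z) (𝓝 (x₀ + L z)) := by
    have : Continuous fun y : E => x₀ + L y := by fun_prop
    exact this.tendsto z
  have := IsLittleO.comp_tendsto h hc
  have h2 : ((fun y : E => ‖y - (x₀ + L z)‖ ^ 2) ∘ fun y => x₀ + L y) =O[𝓝 z]
      fun y => ‖y - z‖ ^ 2 := by
    refine IsBigO.of_bound (‖L‖ ^ 2) (Eventually.of_forall fun y => ?_)
    have e : x₀ + L y - (x₀ + L z) = L (y - z) := by simp
    have h3 := L.le_opNorm (y - z)
    simp only [Function.comp, e, norm_pow, norm_norm]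
    rw [← mul_pow]
    gcongr
  refine (this.trans_isBigO h2).congr_left fun y => ?_
  have e : x₀ + L y - (x₀ + L z) = L (y - z) := by simp
  simp [Function.comp, e]

lemma Jet.mul {u v : E → ℝ} {x p A q B} (h : Jet u x p A) (k : Jet v x q B) :
    Jet (fun y => u y * v y) x (u x • q + v x • p)
      (u x • B + v x • A + rk p q + rk q p) := by
  -- uv = u(x) v + v(x) u - u(x)v(x) + (u-u(x))(v-v(x))
  have h1 : Jet (fun y => (u y - u x) * (v y - v x)) x 0 (rk p q + rk q p) := by
    have hu : (fun y => u y - u x) =O[𝓝 x] fun y => y - x := h.hasFDerivAt.isBigO_sub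
    have hv : (fun y => v y - v x - q (y - x)) =o[𝓝 x] fun y => y - x :=
      hasFDerivAt_iff_isLittleO.1 k.hasFDerivAt
    have hu' : (fun y => u y - u x - p (y - x)) =o[𝓝 x] fun y => y - x :=
      hasFDerivAt_iff_isLittleO.1 h.hasFDerivAt
    have hq : (fun y => q (y - x)) =O[𝓝 x] fun y => y - x :=
      q.isBigO_sub (𝓝 x) x
    have h2 := (hu.norm_right.mul_isLittleO hv.norm_right)
    have h3 := (hu'.norm_right.mul_isBigO hq.norm_right)
    refine ((h2.add h3).congr_left fun y => ?_).congr_right fun y => by ring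
    simp
    ring
  have h2 := ((k.smul (u x)).add (h.smul (v x))).add (h1.add (jet_const (-(u x * v x)) x))
  have h3 := h2.congr (v := fun y => u y * v y) (Eventually.of_forall fun y => by simp; ring)
  have e1 : u x • q + v x • p = u x • q + v x • p + (0 + 0) := by rw [add_zero, add_zero]
  have e2 : u x • B + v x • A + rk p q + rk q p = u x • B + v x • A + (rk p q + rk q p + 0) := by
    ext a b
    simp only [add_apply, smul_apply, zero_apply, rk_apply]; ring
  rw [e1, e2]; exact h3

lemma jet_of_contDiffAt {u : E → ℝ} {x : E} (h : ContDiffAt ℝ 2 u x) :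
    Jet u x (fderiv ℝ u x) (fderiv ℝ (fderiv ℝ u) x) := by
  have hd : ContDiffAt ℝ 1 (fderiv ℝ u) x := h.fderiv_right (by norm_num)
  have hdd : HasFDerivAt (fderiv ℝ u) (fderiv ℝ (fderiv ℝ u) x) x :=
    (hd.differentiableAt (by norm_num)).hasFDerivAt
  have hev : ∀ᶠ y in 𝓝 x, DifferentiableAt ℝ u y := by
    filter_upwards [h.eventually (by simp)] with y hy using hy.differentiableAt (by norm_num)
  have hsymm : ∀ v w, fderiv ℝ (fderiv ℝ u) x v w = fderiv ℝ (fderiv ℝ u) x w v := by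
    have := (h.isSymmSndFDerivAt (by simp))
    exact fun v w => this v w
  set p := fderiv ℝ u x
  set A := fderiv ℝ (fderiv ℝ u) x
  set R : E → ℝ := fun y => u y - u x - p (y - x) - 1 / 2 * A (y - x) (y - x)
  have hR : ∀ᶠ y in 𝓝 x, HasFDerivAt R (fderiv ℝ u y - p - A (y - x)) y := by
    filter_upwards [hev] with y hy
    have h1 := (jet_quad (u x) p A x y).hasFDerivAt
    have h2 := hy.hasFDerivAt.sub h1
    have h3 : fderiv ℝ u y - (p + (1 / 2 : ℝ) • (A (y - x) + A.flip (y - x))) =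
        fderiv ℝ u y - p - A (y - x) := by
      ext z
      have := hsymm z (y - x)
      simp only [_root_.sub_apply, _root_.add_apply, _root_.smul_apply,
        ContinuousLinearMap.flip_apply, this, smul_eq_mul]
      ring
    rw [h3] at h2
    refine h2.congr_of_eventuallyEq (Eventually.of_forall fun z => ?_)
    simp only [R, Pi.sub_apply]
    ring
  unfold Jet
  rw [isLittleO_iff]
  intro c hc
  have hb := (hasFDerivAt_iff_isLittleO.1 hdd).bound hc
  obtain ⟨δ, hδ, hball⟩ := Metric.eventually_nhds_iff_ball.1 (hR.and hb)
  filter_upwards [Metric.ball_mem_nhds x hδ] with y hy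
  have hRx : R x = 0 := by simp [R]
  have hyx : ‖y - x‖ < δ := by simpa [dist_eq_norm] using hy
  have hmv := (convex_closedBall x ‖y - x‖).norm_image_sub_le_of_norm_hasFDerivWithin_le
    (f := R) (f' := fun y => fderiv ℝ u y - p - A (y - x)) (C := c * ‖y - x‖) (x := x) (y := y) ?_ ?_ ?_ ?_
  · rw [hRx, sub_zero] at hmv
    simp only [norm_pow, norm_norm]
    calc _ ≤ _ := hmv
      _ = _ := by ring
  · intro z hz
    have hz' : z ∈ Metric.ball x δ := by
      rw [Metric.mem_closedBall] at hz; rw [Metric.mem_ball]; linarith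
    exact (hball z hz').1.hasFDerivWithinAt
  · intro z hz
    have hz' : z ∈ Metric.ball x δ := by
      rw [Metric.mem_closedBall] at hz; rw [Metric.mem_ball]; linarith
    refine ((hball z hz').2).trans ?_
    rw [Metric.mem_closedBall, dist_eq_norm] at hz
    gcongr
  · simp
  · simp [dist_eq_norm]

end basic

lemma lap_eq {N : ℕ} {u : EuclideanSpace ℝ (Fin N) → ℝ} {x : EuclideanSpace ℝ (Fin N)}
    (h : ContDiffAt ℝ 2 u x) :
    lap u x = bt (fderiv ℝ (fderiv ℝ u) x) := by
  have hd : ContDiffAt ℝ 1 (fderiv ℝ u) x := h.fderiv_right (by norm_num)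
  rw [← bt_basis _ (EuclideanSpace.basisFun (Fin N) ℝ)]
  unfold lap
  refine Finset.sum_congr rfl fun i _ => ?_
  have := fderiv_clm_apply (c := fderiv ℝ u)
    (u := fun _ => (EuclideanSpace.single i (1:ℝ) : EuclideanSpace ℝ (Fin N))) (x := x)
    (hd.differentiableAt (by norm_num)) (by fun_prop)
  rw [this]
  simp

/-! ## Part 2: viscosity sub/super solutions -/
section visc
variable {E : Type*} [NormedAddCommGroup E] [InnerProductSpace ℝ E] [FiniteDimensional ℝ E]

def ViSub (F : E → ℝ → Du E → ℝ) (u : E → ℝ) (x : E) : Prop :=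
  ∀ (p : Du E) (A : Bi E), (∀ᶠ y in 𝓝 x, u y ≤ u x + p (y - x) + 1 / 2 * A (y - x) (y - x)) →
    -bt A ≤ F x (u x) p

def ViSup (F : E → ℝ → Du E → ℝ) (u : E → ℝ) (x : E) : Prop :=
  ∀ (p : Du E) (A : Bi E), (∀ᶠ y in 𝓝 x, u x + p (y - x) + 1 / 2 * A (y - x) (y - x) ≤ u y) →
    F x (u x) p ≤ -bt A

/-- dual nonlinearity -/
def fl (F : E → ℝ → Du E → ℝ) : E → ℝ → Du E → ℝ := fun x η p => -F x (-η) (-p)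

lemma fl_fl (F : E → ℝ → Du E → ℝ) : fl (fl F) = F := by
  funext x η p; simp [fl]

lemma ViSup.neg {F : E → ℝ → Du E → ℝ} {u : E → ℝ} {x : E} (h : ViSup F u x) :
    ViSub (fl F) (fun y => -u y) x := by
  intro p A hp
  have := h (-p) (-A) (by
    filter_upwards [hp] with y hy
    simp [-map_sub] at hy ⊢; linarith)
  simp [fl] at this ⊢; linarith

lemma ViSub.neg {F : E → ℝ → Du E → ℝ} {u : E → ℝ} {x : E} (h : ViSub F u x) :
    ViSup (fl F) (fun y => -u y) x := by
  intro p A hp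
  have := h (-p) (-A) (by
    filter_upwards [hp] with y hy
    simp [-map_sub] at hy ⊢; linarith)
  simp [fl] at this ⊢; linarith

lemma ViSub.test {F : E → ℝ → Du E → ℝ} {u φ : E → ℝ} {x : E} {p : Du E} {A : Bi E}
    (h : ViSub F u x) (hφ : Jet φ x p A) (hm : ∀ᶠ y in 𝓝 x, u y - φ y ≤ u x - φ x) :
    -bt A ≤ F x (u x) p := by
  have key : ∀ ε > 0, -bt A - 2 * ε * dm E ≤ F x (u x) p := by
    intro ε hε
    have := h p (A + (2 * ε) • ip) (by
      filter_upwards [hm, hφ.bound hε] with y h1 h2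
      rw [Real.norm_eq_abs, Real.norm_eq_abs, abs_of_nonneg (sq_nonneg ‖y - x‖)] at h2
      have h3 := (abs_le.1 h2).2
      simp only [add_apply, smul_apply, ip_apply, real_inner_self_eq_norm_sq, smul_eq_mul]
      linarith)
    simp [bt_ip] at this
    linarith
  have hd : 0 ≤ dm E := by unfold dm; positivity
  refine le_of_forall_pos_le_add fun δ hδ => ?_
  have := key (δ / (2 * (dm E + 1))) (by positivity)
  have h2 : 2 * (δ / (2 * (dm E + 1))) * dm E ≤ δ := by
    have : 2 * (δ / (2 * (dm E + 1))) * dm E = δ * (dm E / (dm E + 1)) := by field_simp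
    rw [this]
    have : dm E / (dm E + 1) ≤ 1 := by rw [div_le_one (by linarith)]; linarith
    nlinarith
  linarith

lemma ViSup.test {F : E → ℝ → Du E → ℝ} {u φ : E → ℝ} {x : E} {p : Du E} {A : Bi E}
    (h : ViSup F u x) (hφ : Jet φ x p A) (hm : ∀ᶠ y in 𝓝 x, u x - φ x ≤ u y - φ y) :
    F x (u x) p ≤ -bt A := by
  have := h.neg.test hφ.neg (by filter_upwards [hm] with y hy; linarith)
  simp [fl] at this; linarith

lemma Jet.vsub {F : E → ℝ → Du E → ℝ} {u : E → ℝ} {x : E} {p : Du E} {A : Bi E}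
    (h : Jet u x p A) (hF : -bt A ≤ F x (u x) p) : ViSub F u x := by
  intro q B hq
  have h1 := (h.sub (jet_quad (u x) q B x x)).max (by
    filter_upwards [hq] with y hy
    simp [-map_sub]; linarith)
  have h2 : p = q := by
    have := h1.1
    simp at this
    exact sub_eq_zero.1 this
  have h3 := bt_nonpos h1.2
  simp at h3
  rw [← h2]; linarith

lemma Jet.vsup {F : E → ℝ → Du E → ℝ} {u : E → ℝ} {x : E} {p : Du E} {A : Bi E}
    (h : Jet u x p A) (hF : F x (u x) p ≤ -bt A) : ViSup F u x := by
  have := (h.neg.vsub (F := fl F) (by simp [fl]; linarith)).neg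
  rw [fl_fl] at this
  simpa using this

lemma ViSub.mono {F G : E → ℝ → Du E → ℝ} {u : E → ℝ} {x : E} (h : ViSub F u x)
    (hFG : ∀ p, F x (u x) p ≤ G x (u x) p) : ViSub G u x :=
  fun p A hp => (h p A hp).trans (hFG p)

lemma ViSup.mono {F G : E → ℝ → Du E → ℝ} {u : E → ℝ} {x : E} (h : ViSup F u x)
    (hFG : ∀ p, G x (u x) p ≤ F x (u x) p) : ViSup G u x :=
  fun p A hp => (hFG p).trans (h p A hp)

/-- if `v ≥ u` near `x`, equality at `x`, and `u` is a subsolution then so is `v` -/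
lemma ViSub.of_le {F : E → ℝ → Du E → ℝ} {u v : E → ℝ} {x : E} (h : ViSub F u x)
    (hle : ∀ᶠ y in 𝓝 x, u y ≤ v y) (he : u x = v x) : ViSub F v x := by
  intro p A hp
  rw [← he]
  refine h p A ?_
  filter_upwards [hle, hp] with y h1 h2
  rw [he]; linarith

lemma ViSub.sup {F : E → ℝ → Du E → ℝ} {u v : E → ℝ} {x : E} (h : ViSub F u x)
    (k : ViSub F v x) : ViSub F (fun y => max (u y) (v y)) x := by
  rcases le_total (u x) (v x) with hc | hc
  · exact k.of_le (Eventually.of_forall fun y => le_max_right _ _) (max_eq_right hc).symm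
  · exact h.of_le (Eventually.of_forall fun y => le_max_left _ _) (max_eq_left hc).symm

/-- adding a function with a jet -/
lemma ViSub.add_jet {F G : E → ℝ → Du E → ℝ} {u φ : E → ℝ} {x : E} {p : Du E} {A : Bi E}
    (h : ViSub F u x) (hφ : Jet φ x p A)
    (hG : ∀ q, F x (u x) (q - p) - bt A ≤ G x (u x + φ x) q) :
    ViSub G (fun y => u y + φ y) x := by
  intro q B hq
  have := h.test (φ := fun y => (u x + φ x + q (y - x) + 1 / 2 * B (y - x) (y - x)) - φ y)
    ((jet_quad (u x + φ x) q B x x).sub hφ) (by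
      filter_upwards [hq] with y hy
      simp [-map_sub]; linarith)
  simp at this
  linarith [hG q]

lemma ViSup.add_jet {F G : E → ℝ → Du E → ℝ} {u φ : E → ℝ} {x : E} {p : Du E} {A : Bi E}
    (h : ViSup F u x) (hφ : Jet φ x p A)
    (hG : ∀ q, G x (u x + φ x) q ≤ F x (u x) (q - p) - bt A) :
    ViSup G (fun y => u y + φ y) x := by
  intro q B hq
  have := h.test (φ := fun y => (u x + φ x + q (y - x) + 1 / 2 * B (y - x) (y - x)) - φ y)
    ((jet_quad (u x + φ x) q B x x).sub hφ) (by
      filter_upwards [hq] with y hy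
      simp [-map_sub]; linarith)
  simp at this
  linarith [hG q]

/-- constant nonlinearity -/
def cst (c : ℝ) : E → ℝ → Du E → ℝ := fun _ _ _ => c

@[simp] lemma cst_apply (c : ℝ) (x : E) (η : ℝ) (p : Du E) : cst c x η p = c := rfl

@[simp] lemma fl_cst (c : ℝ) : fl (cst c : E → ℝ → Du E → ℝ) = cst (-c) := by
  funext x η p; simp [fl]

/-- stability under locally uniform limits -/
lemma ViSub.stable {F : E → ℝ → Du E → ℝ} {U : Set E} (hU : IsOpen U) {x : E} (hx : x ∈ U)
    (hF : ContinuousOn (fun q : E × ℝ × Du E => F q.1 q.2.1 q.2.2) (U ×ˢ univ))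
    {u : E → ℝ} (huc : ContinuousOn u U)
    (h : ∀ ε > 0, ∃ w : E → ℝ, ContinuousOn w U ∧ (∀ y ∈ U, ViSub (fun x η p => F x η p + ε) w y) ∧
      ∀ y ∈ U, |u y - w y| ≤ ε) : ViSub F u x := by
  intro p A hp
  by_contra hcon
  push Not at hcon
  -- strict test function
  obtain ⟨γ, hγ, hγ2⟩ : ∃ γ > 0, F x (u x) p + 2 * γ * dm E < -bt A := by
    have hd : 0 ≤ dm E := by unfold dm; positivity
    refine ⟨(-bt A - F x (u x) p) / (2 * (dm E + 1)) , div_pos (by linarith) (by linarith), ?_⟩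
    have h1 : 0 < -bt A - F x (u x) p := by linarith
    have : 2 * ((-bt A - F x (u x) p) / (2 * (dm E + 1))) * dm E =
      (-bt A - F x (u x) p) * (dm E / (dm E + 1)) := by field_simp
    rw [this]
    have : dm E / (dm E + 1) < 1 := by rw [div_lt_one (by linarith)]; linarith
    nlinarith
  obtain ⟨B, hB⟩ : ∃ B : Bi E, B = A + (2 * γ) • ip := ⟨_, rfl⟩
  set Q : E → ℝ := fun y => u x + p (y - x) + 1 / 2 * B (y - x) (y - x) with hQ
  have hQc : Continuous Q := by
    simp only [hQ]
    have h1 : Continuous fun y : E => p (y - x) := by fun_prop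
    have h2 : Continuous fun y : E => B (y - x) (y - x) := by fun_prop
    fun_prop
  set g : E → Du E := fun y => p + (1 / 2 : ℝ) •
    (B (y - x) + B.flip (y - x)) with hg
  have hgc : Continuous g := by
    simp only [hg]
    have h1 : Continuous fun y : E => B (y - x) := by fun_prop
    have h2 : Continuous fun y : E => B.flip (y - x) := by fun_prop
    exact continuous_const.add ((h1.add h2).const_smul (1 / 2 : ℝ))
  have hbt : bt B = bt A + 2 * γ * dm E := by simp [hB, bt_ip]
  -- near x, for |η - u y| small
  obtain ⟨τ, hτ, hτ2⟩ : ∃ τ > 0, F x (u x) p + 2 * γ * dm E + τ < -bt A :=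
    ⟨(-bt A - F x (u x) p - 2 * γ * dm E) / 2, by linarith, by linarith⟩
  have hcont : ∀ᶠ q : E × ℝ × Du E in 𝓝[U ×ˢ univ] (x, u x, p),
      F q.1 q.2.1 q.2.2 < -bt A - 2 * γ * dm E - τ := by
    have := (hF (x, u x, p) ⟨hx, mem_univ _⟩)
    refine this.eventually_lt_const ?_
    simp; linarith
  have hgx : g x = p := by simp [hg]
  obtain ⟨δ, hδ, hball⟩ := Metric.mem_nhdsWithin_iff.1 hcont
  -- choose radius
  have hev : ∀ᶠ y in 𝓝 x, y ∈ U ∧ ‖y - x‖ < δ ∧ |u y - u x| < δ / 2 ∧ ‖g y - p‖ < δ ∧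
      u y ≤ u x + p (y - x) + 1 / 2 * A (y - x) (y - x) := by
    have h1 : ∀ᶠ y in 𝓝 x, ‖y - x‖ < δ := by
      have : ∀ᶠ y in 𝓝 x, y ∈ Metric.ball x δ := Metric.ball_mem_nhds x hδ
      filter_upwards [this] with y hy using by simpa [dist_eq_norm] using hy
    have h2 : ∀ᶠ y in 𝓝 x, |u y - u x| < δ / 2 := by
      have := (huc.continuousAt (hU.mem_nhds hx))
      have := Metric.tendsto_nhds.1 this (δ / 2) (by positivity)
      simpa [Real.dist_eq] using this
    have h3 : ∀ᶠ y in 𝓝 x, ‖g y - p‖ < δ := by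
      have := Metric.tendsto_nhds.1 (hgc.continuousAt (x := x)) δ hδ
      simpa [hgx, dist_eq_norm] using this
    filter_upwards [hU.mem_nhds hx, h1, h2, h3, hp] with y a b c d e using ⟨a, b, c, d, e⟩
  obtain ⟨ρ, hρ, hρb⟩ := Metric.eventually_nhds_iff_ball.1 hev
  set r := ρ / 2 with hr
  have hrpos : 0 < r := by positivity
  have hsub : Metric.closedBall x r ⊆ Metric.ball x ρ := Metric.closedBall_subset_ball (by linarith)
  obtain ⟨ε, hε, hε1, hε2, hε3⟩ : ∃ ε > 0, ε < γ * r ^ 2 / 2 ∧ ε ≤ δ / 4 ∧ ε ≤ τ := by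
    have hp : 0 < γ * r ^ 2 := by positivity
    refine ⟨min (γ * r ^ 2 / 4) (min (δ / 4) τ), ?_, ?_, ?_, ?_⟩
    · exact lt_min (by positivity) (lt_min (by positivity) hτ)
    · exact (min_le_left _ _).trans_lt (by linarith)
    · exact (min_le_right _ _).trans (min_le_left _ _)
    · exact (min_le_right _ _).trans (min_le_right _ _)
  obtain ⟨w, hwc, hws, hwu⟩ := h ε hε
  have hsubU : Metric.closedBall x r ⊆ U := fun y hy => (hρb y (hsub hy)).1
  obtain ⟨z, hz, hmax⟩ := (isCompact_closedBall x r).exists_isMaxOn ⟨x, by simp [hrpos.le]⟩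
    (f := fun y => w y - Q y) ((hwc.mono hsubU).sub hQc.continuousOn)
  have hQx : Q x = u x := by simp [hQ]
  have hx1 := hmax (show x ∈ Metric.closedBall x r by simp [hrpos.le])
  simp only [mem_setOf_eq, hQx] at hx1
  have hx2 := abs_le.1 (hwu x hx)
  have hzU := hsubU hz
  have hz2 := abs_le.1 (hwu z hzU)
  obtain ⟨_, hz3, hz4, hz5, hz6⟩ := hρb z (hsub hz)
  have hzr : ‖z - x‖ < r := by
    have h1 : ‖z - x‖ ≤ r := by simpa [dist_eq_norm] using hz
    rcases h1.lt_or_eq with h2 | h2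
    · exact h2
    · exfalso
      have : Q z = u x + p (z - x) + 1 / 2 * A (z - x) (z - x) + γ * r ^ 2 := by
        simp only [hQ, hB, add_apply, smul_apply, ip_apply, real_inner_self_eq_norm_sq, smul_eq_mul, h2]
        ring
      linarith
  have hzn : ∀ᶠ y in 𝓝 z, y ∈ Metric.closedBall x r := by
    have : Metric.ball x r ∈ 𝓝 z := Metric.isOpen_ball.mem_nhds (by simpa [dist_eq_norm] using hzr)
    filter_upwards [this] with y hy using Metric.ball_subset_closedBall hy
  have htest := (hws z hzU).test (jet_quad (u x) p B x z) (by
    filter_upwards [hzn] with y hy using hmax hy)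
  have hFz := hball (a := (z, w z, g z)) ⟨by
    rw [Metric.mem_ball, Prod.dist_eq, Prod.dist_eq]
    refine max_lt (by simpa [dist_eq_norm] using hz3) (max_lt ?_ (by simpa [dist_eq_norm] using hz5))
    rw [Real.dist_eq]
    have := abs_lt.1 hz4
    rw [abs_lt]; constructor <;> linarith, ⟨hzU, mem_univ _⟩⟩
  simp only [mem_setOf_eq] at hFz
  rw [hbt] at htest
  change _ ≤ F z (w z) (g z) + ε at htest
  linarith

lemma ViSup.stable {F : E → ℝ → Du E → ℝ} {U : Set E} (hU : IsOpen U) {x : E} (hx : x ∈ U)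
    (hF : ContinuousOn (fun q : E × ℝ × Du E => F q.1 q.2.1 q.2.2) (U ×ˢ univ))
    {u : E → ℝ} (huc : ContinuousOn u U)
    (h : ∀ ε > 0, ∃ w : E → ℝ, ContinuousOn w U ∧ (∀ y ∈ U, ViSup (fun x η p => F x η p - ε) w y) ∧
      ∀ y ∈ U, |u y - w y| ≤ ε) : ViSup F u x := by
  have := (ViSub.stable (F := fl F) hU hx (u := fun y => -u y) ?_ huc.neg ?_).neg
  · rw [fl_fl] at this; simpa using this
  · have h1 : Continuous fun q : E × ℝ × Du E => (q.1, -q.2.1, -q.2.2) := by fun_prop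
    exact (hF.comp h1.continuousOn (fun q hq => ⟨hq.1, mem_univ _⟩)).neg
  · intro ε hε
    obtain ⟨w, h1, h2, h3⟩ := h ε hε
    refine ⟨fun y => -w y, h1.neg, fun y hy => ?_, fun y hy => ?_⟩
    · refine (h2 y hy).neg.mono fun p => ?_
      simp [fl]
    · have := h3 y hy
      rw [abs_sub_comm] at this
      have e : -u y - -w y = w y - u y := by ring
      rw [e]; exact this

/-- Comparison principle in small balls -/
lemma comparison {F : E → ℝ → Du E → ℝ} {U : Set E} {x₀ : E} {r L c ε : ℝ}
    (hU : IsOpen U) (hUr : U ⊆ Metric.ball x₀ r) (hr : 0 < r) (hL : 0 ≤ L) (hε : 0 ≤ ε)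
    (hc : 0 < c) (hcr : c ≤ 2 * dm E / r ^ 2 - L * (2 + 2 / r))
    (hF : ∀ x ∈ U, ∀ η η' p p', |F x η p - F x η' p'| ≤ L * (|η - η'| + ‖p - p'‖))
    {v h : E → ℝ} (hv : ContinuousOn v (closure U)) (hh : ContinuousOn h (closure U))
    (hsub : ∀ x ∈ U, ViSub (fun x η p => F x η p + ε) v x)
    (hsup : ∀ x ∈ U, ∃ p A, Jet h x p A ∧ F x (h x) p - ε ≤ -bt A)
    (hbd : ∀ x ∈ frontier U, v x ≤ h x + ε) :
    ∀ x ∈ closure U, v x ≤ h x + (2 + 4 / c) * ε := by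
  intro x hx
  set b : E → ℝ := fun y => 2 - ‖y - x₀‖ ^ 2 / r ^ 2 with hb
  have hbc : Continuous b := by simp only [hb]; fun_prop
  have hclr : ∀ y ∈ closure U, ‖y - x₀‖ ≤ r := by
    intro y hy
    have := (closure_mono hUr).trans Metric.closure_ball_subset_closedBall hy
    simpa [dist_eq_norm] using this
  have hb1 : ∀ y ∈ closure U, 1 ≤ b y ∧ b y ≤ 2 := by
    intro y hy
    have h1 : ‖y - x₀‖ ^ 2 / r ^ 2 ≤ 1 := by
      rw [div_le_one (by positivity)]
      have := hclr y hy
      gcongr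
    have h2 : 0 ≤ ‖y - x₀‖ ^ 2 / r ^ 2 := by positivity
    simp only [hb]; constructor <;> linarith
  have hcomp : IsCompact (closure U) :=
    (Metric.isBounded_ball.subset hUr).isCompact_closure
  obtain ⟨z, hz, hmax⟩ := hcomp.exists_isMaxOn ⟨x, hx⟩ (f := fun y => (v y - h y) / b y)
    ((hv.sub hh).div hbc.continuousOn fun y hy => (by linarith [(hb1 y hy).1] : b y ≠ 0).symm.symm)
  set t := (v z - h z) / b z with ht
  have hall : ∀ y ∈ closure U, v y - h y ≤ t * b y := by
    intro y hy
    have := hmax hy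
    simp only [mem_setOf_eq] at this
    rwa [div_le_iff₀ (by linarith [(hb1 y hy).1])] at this
  have htz : v z - h z = t * b z := by
    rw [ht, div_mul_cancel₀]
    exact (by linarith [(hb1 z hz).1] : b z ≠ 0)
  suffices hfin : t ≤ (1 + 2 / c) * ε by
    have h1 := hall x hx
    have h3 : (1 + 2 / c) * ε * b x ≤ (1 + 2 / c) * ε * 2 := by
      have := (hb1 x hx).2
      gcongr
    have h4 : t * b x ≤ (1 + 2 / c) * ε * b x := by
      have := (hb1 x hx).1
      gcongr
    have : (2 + 4 / c) * ε = (1 + 2 / c) * ε * 2 := by ring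
    linarith
  have hc' : 0 ≤ 2 / c * ε := by positivity
  by_contra hcon
  push Not at hcon
  have hte : ε < t := by nlinarith
  have htpos : 0 < t := by linarith
  have hzU : z ∈ U := by
    by_contra hzn
    have : z ∈ frontier U := ⟨hz, by rwa [hU.interior_eq]⟩
    have h1 := hbd z this
    have h2 := (hb1 z hz).1
    nlinarith
  obtain ⟨p, A, hJ, hA⟩ := hsup z hzU
  have hJ2 := hJ.add (((jet_const 2 z).sub ((jet_sq x₀ z).smul (1 / r ^ 2))).smul t)
  have htest := (hsub z hzU).test hJ2 (by
    filter_upwards [hU.mem_nhds hzU] with y hy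
    have := hall y (subset_closure hy)
    have e : ∀ y, h y + t * (2 - 1 / r ^ 2 * ‖y - x₀‖ ^ 2) = h y + t * b y := by
      intro y; simp only [hb]; ring
    rw [e, e]; linarith)
  simp only [bt_add, bt_smul, bt_sub, bt_zero, bt_ip] at htest
  set q := p + t • (0 - (1 / r ^ 2) • (2 : ℝ) • (ip (z - x₀) : Du E)) with hq
  have h1 := hF z hzU (v z) (h z) q p
  have h2 := (abs_le.1 h1).2
  have h3 : |v z - h z| ≤ 2 * t := by
    rw [htz, abs_of_nonneg (by nlinarith [(hb1 z hz).1])]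
    nlinarith [(hb1 z hz).2]
  have h4 : ‖q - p‖ ≤ 2 / r * t := by
    have e : q - p = -((t * (1 / r ^ 2) * 2) • (ip (z - x₀) : Du E)) := by
      ext a
      simp only [hq, sub_apply, add_apply, smul_apply, neg_apply, zero_apply, smul_eq_mul]; ring
    have e2 : ‖(ip (z - x₀) : Du E)‖ = ‖z - x₀‖ := innerSL_apply_norm (𝕜 := ℝ) (z - x₀)
    rw [e, norm_neg, norm_smul, e2, Real.norm_eq_abs, abs_of_nonneg (by positivity)]
    have := hclr z hz
    calc t * (1 / r ^ 2) * 2 * ‖z - x₀‖ ≤ t * (1 / r ^ 2) * 2 * r := by gcongr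
      _ = 2 / r * t := by field_simp
  have h5 : L * (|v z - h z| + ‖q - p‖) ≤ L * (2 * t + 2 / r * t) := by gcongr
  have h6 : c * t ≤ 2 * ε := by
    have h7 : c * t ≤ (2 * dm E / r ^ 2 - L * (2 + 2 / r)) * t := by gcongr
    have h8 : (2 * dm E / r ^ 2 - L * (2 + 2 / r)) * t =
      t * (1 / r ^ 2 * (2 * dm E)) - L * (2 * t + 2 / r * t) := by ring
    linarith
  have h9 : t ≤ 2 / c * ε := by
    rw [div_mul_eq_mul_div, le_div_iff₀ hc]; linarith
  nlinarith

end visc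

/-! ## Part 3: polynomials and the Dirichlet problem on balls -/
section poly
variable {E : Type*} [NormedAddCommGroup E] [InnerProductSpace ℝ E] [FiniteDimensional ℝ E]

/-- maximum principle -/
lemma maxprinc {U : Set E} (hU : IsOpen U) (hb : Bornology.IsBounded U) (hN : 1 ≤ dm E)
    {f : E → ℝ} {v h : E → ℝ} (hv : ContinuousOn v (closure U)) (hh : ContinuousOn h (closure U))
    (hsub : ∀ x ∈ U, ViSub (fun x _ _ => f x) v x)
    (hsup : ∀ x ∈ U, ∃ p A, Jet h x p A ∧ f x ≤ -bt A)
    (hbd : ∀ x ∈ frontier U, v x ≤ h x) : ∀ x ∈ closure U, v x ≤ h x := by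
  obtain ⟨r, hr, hUr⟩ := hb.subset_ball_lt 0 0
  have := comparison (F := fun x _ _ => f x) (L := 0) (c := 2 * dm E / r ^ 2) (ε := 0) hU hUr hr le_rfl
    le_rfl (by positivity) (by simp) (by simp) hv hh (by simpa using hsub) (by simpa using hsup)
    (by simpa using hbd)
  simpa using this

/-- same with `v` having jets -/
lemma maxprinc_jet {U : Set E} (hU : IsOpen U) (hb : Bornology.IsBounded U) (hN : 1 ≤ dm E)
    {v h : E → ℝ} (hv : ContinuousOn v (closure U)) (hh : ContinuousOn h (closure U))
    (hsub : ∀ x ∈ U, ∃ p A q B, Jet v x p A ∧ Jet h x q B ∧ bt B ≤ bt A)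
    (hbd : ∀ x ∈ frontier U, v x ≤ h x) : ∀ x ∈ closure U, v x ≤ h x := by
  have : ∀ x : E, ∃ c : ℝ, x ∈ U → ∃ p A q B, Jet v x p A ∧ Jet h x q B ∧ -bt A ≤ c ∧ c ≤ - bt B := by
    intro x
    by_cases hx : x ∈ U
    · obtain ⟨p, A, q, B, h1, h2, h3⟩ := hsub x hx
      exact ⟨-bt A, fun _ => ⟨p, A, q, B, h1, h2, le_rfl, by linarith⟩⟩
    · exact ⟨0, fun h => absurd h hx⟩
  choose f hf using this
  refine maxprinc (f := f) hU hb hN hv hh (fun x hx => ?_) (fun x hx => ?_) hbd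
  · obtain ⟨p, A, q, B, h1, h2, h3, h4⟩ := hf x hx
    exact h1.vsub h3
  · obtain ⟨p, A, q, B, h1, h2, h3, h4⟩ := hf x hx
    exact ⟨q, B, h2, h4⟩

lemma du_eq_ip (p : Du E) : ∃ w : E, p = ip w ∧ ‖w‖ = ‖p‖ := by
  refine ⟨(InnerProductSpace.toDual ℝ E).symm p, ?_, by simp⟩
  ext y
  simp [ip_apply]

lemma bt_rk_right (p : Du E) (v : E) : bt (rk p (ip v)) = p v := by
  obtain ⟨w, rfl, _⟩ := du_eq_ip p
  rw [bt_rk]; simp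

lemma bt_rk_left (p : Du E) (v : E) : bt (rk (ip v) p) = p v := by
  obtain ⟨w, rfl, _⟩ := du_eq_ip p
  rw [bt_rk]; simp [real_inner_comm]

/-- Laplacian for smooth functions -/
noncomputable def dl (u : E → ℝ) (x : E) : ℝ := bt (fderiv ℝ (fderiv ℝ u) x)

lemma Jet.dl_eq {u : E → ℝ} {x : E} {p A} (h : Jet u x p A) (hu : ContDiffAt ℝ 2 u x) :
    dl u x = bt A := ((jet_of_contDiffAt hu).unique h).2

noncomputable def cd (i : Fin (Module.finrank ℝ E)) : E → ℝ :=
  fun x => inner ℝ (stdOrthonormalBasis ℝ E i) x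

noncomputable def W : ℕ → Submodule ℝ (E → ℝ)
  | 0 => ⊥
  | k + 1 => Submodule.span ℝ {1} ⊔
      ⨆ i : Fin (Module.finrank ℝ E), (W k).map (LinearMap.mulLeft ℝ (cd i))

instance W_fin : ∀ k, FiniteDimensional ℝ (W (E := E) k)
  | 0 => by change FiniteDimensional ℝ (⊥ : Submodule ℝ (E → ℝ)); infer_instance
  | k + 1 => by
    have := W_fin k
    change FiniteDimensional ℝ (Submodule.span ℝ {(1 : E → ℝ)} ⊔
      ⨆ i : Fin (Module.finrank ℝ E), (W k).map (LinearMap.mulLeft ℝ (cd i)) : Submodule ℝ (E → ℝ))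
    infer_instance

lemma W_one (k : ℕ) : (1 : E → ℝ) ∈ W (E := E) (k + 1) :=
  Submodule.mem_sup_left (Submodule.mem_span_singleton_self _)

lemma W_cd {k : ℕ} {u : E → ℝ} (hu : u ∈ W (E := E) k) (i) : cd i * u ∈ W (E := E) (k + 1) :=
  Submodule.mem_sup_right (Submodule.mem_iSup_of_mem i ⟨u, hu, rfl⟩)

lemma W_ind (P : ℕ → (E → ℝ) → Prop) (h0 : ∀ k, P k 0)
    (hadd : ∀ k u v, u ∈ W (E := E) k → v ∈ W (E := E) k → P k u → P k v → P k (u + v))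
    (hsmul : ∀ k (c : ℝ) u, u ∈ W (E := E) k → P k u → P k (c • u))
    (h1 : ∀ k, P (k + 1) 1)
    (hc : ∀ k i u, u ∈ W (E := E) k → P k u → P (k + 1) (cd i * u)) :
    ∀ k u, u ∈ W (E := E) k → P k u := by
  intro k
  induction k with
  | zero =>
    intro u hu
    have : u = 0 := by simpa [W] using hu
    rw [this]; exact h0 0
  | succ k ih =>
    let S : Submodule ℝ (E → ℝ) :=
      { carrier := {u | u ∈ W (E := E) (k + 1) ∧ P (k + 1) u}
        add_mem' := fun {a b} ha hb => ⟨Submodule.add_mem _ ha.1 hb.1, hadd _ _ _ ha.1 hb.1 ha.2 hb.2⟩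
        zero_mem' := ⟨Submodule.zero_mem _, h0 _⟩
        smul_mem' := fun c u hu => ⟨Submodule.smul_mem _ _ hu.1, hsmul _ _ _ hu.1 hu.2⟩ }
    have : W (E := E) (k + 1) ≤ S := by
      conv_lhs => unfold W
      refine sup_le ?_ (iSup_le fun i => ?_)
      · rw [Submodule.span_le]
        rintro u rfl
        exact ⟨W_one k, h1 k⟩
      · rintro _ ⟨u, hu, rfl⟩
        exact ⟨W_cd hu i, hc k i u hu (ih u hu)⟩
    exact fun u hu => (this hu).2

lemma W_mono_succ : ∀ (k : ℕ) (u : E → ℝ), u ∈ W (E := E) k → u ∈ W (E := E) (k + 1) :=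
  W_ind (fun k u => u ∈ W (E := E) (k + 1)) (fun k => Submodule.zero_mem _)
    (fun k u v _ _ hu hv => Submodule.add_mem _ hu hv) (fun k c u _ hu => Submodule.smul_mem _ _ hu)
    (fun k => W_one _) (fun k i u _ hu => W_cd hu i)

lemma W_mono {j k : ℕ} (h : j ≤ k) {u : E → ℝ} (hu : u ∈ W (E := E) j) : u ∈ W (E := E) k := by
  induction h with
  | refl => exact hu
  | step _ ih => exact W_mono_succ _ _ ih

lemma W_zero {u : E → ℝ} (hu : u ∈ W (E := E) 0) : u = 0 := by simpa [W] using hu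

lemma W_mul (k : ℕ) {v : E → ℝ} (hv : v ∈ W (E := E) k) :
    ∀ (j : ℕ) (u : E → ℝ), u ∈ W (E := E) j → u * v ∈ W (E := E) (j - 1 + k) := by
  refine W_ind (fun j u => u * v ∈ W (E := E) (j - 1 + k)) ?_ ?_ ?_ ?_ ?_
  · intro j; simp
  · intro j u w _ _ h1 h2; rw [add_mul]; exact Submodule.add_mem _ h1 h2
  · intro j c u _ h1; rw [smul_mul_assoc]; exact Submodule.smul_mem _ _ h1
  · intro j; rw [one_mul]; exact W_mono (by omega) hv
  · intro j i u hu h1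
    rcases j with _ | j
    · rw [W_zero hu]; simp
    · rw [mul_assoc]
      have := W_cd h1 i
      exact W_mono (by omega) this

lemma lin_eq_sum (p : Du E) : (p : E → ℝ) = ∑ i, p (stdOrthonormalBasis ℝ E i) • cd i := by
  ext x
  conv_lhs => rw [← (stdOrthonormalBasis ℝ E).sum_repr' x]
  simp [cd, Finset.sum_apply, mul_comm]

lemma W_lin (p : Du E) : (p : E → ℝ) ∈ W (E := E) 2 := by
  rw [lin_eq_sum]
  refine Submodule.sum_mem _ fun i _ => Submodule.smul_mem _ _ ?_
  simpa using W_cd (W_one 0) i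

lemma W_const (c : ℝ) (k : ℕ) : (fun _ => c) ∈ W (E := E) (k + 1) := by
  have := Submodule.smul_mem _ c (W_one (E := E) k)
  convert this using 1
  ext; simp

lemma W_normsq : (fun x : E => ‖x‖ ^ 2) ∈ W (E := E) 3 := by
  have : (fun x : E => ‖x‖ ^ 2) = ∑ i, cd i * (cd i * 1) := by
    ext x
    rw [← (stdOrthonormalBasis ℝ E).sum_sq_norm_inner_right x]
    simp [cd, Finset.sum_apply, sq]
  rw [this]
  exact Submodule.sum_mem _ fun i _ => W_cd (W_cd (W_one 0) i) i

lemma W_beta (x₀ : E) (r : ℝ) : (fun x : E => r ^ 2 - ‖x - x₀‖ ^ 2) ∈ W (E := E) 3 := by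
  have : (fun x : E => r ^ 2 - ‖x - x₀‖ ^ 2) =
      (fun _ => r ^ 2 - ‖x₀‖ ^ 2) + (2 : ℝ) • ((ip x₀ : Du E) : E → ℝ) - fun x => ‖x‖ ^ 2 := by
    ext x
    simp only [Pi.sub_apply, Pi.add_apply, Pi.smul_apply, ip_apply, smul_eq_mul]
    rw [norm_sub_sq_real, real_inner_comm]; ring
  rw [this]
  exact Submodule.sub_mem _ (Submodule.add_mem _ (W_const _ _)
    (Submodule.smul_mem _ _ (W_mono (by norm_num) (W_lin _)))) W_normsq

lemma W_an : ∀ (k : ℕ) (u : E → ℝ), u ∈ W (E := E) k → ∀ x, AnalyticAt ℝ u x := by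
  refine W_ind (fun k u => ∀ x, AnalyticAt ℝ u x) ?_ ?_ ?_ ?_ ?_
  · intro k x; exact analyticAt_const
  · intro k u v _ _ h1 h2 x; exact (h1 x).add (h2 x)
  · intro k c u _ h x
    have := (analyticAt_const (v := c) (x := x) (𝕜 := ℝ)).mul (h x)
    exact this
  · intro k x; exact analyticAt_const
  · intro k i u _ h x
    exact ((innerSL ℝ (stdOrthonormalBasis ℝ E i)).analyticAt x).mul (h x)

lemma W_smooth {k : ℕ} {u : E → ℝ} (hu : u ∈ W (E := E) k) {n : WithTop ℕ∞} : ContDiff ℝ n u :=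
  contDiff_iff_contDiffAt.2 fun x => (W_an k u hu x).contDiffAt

lemma W_jet {k : ℕ} {u : E → ℝ} (hu : u ∈ W (E := E) k) (x : E) :
    Jet u x (fderiv ℝ u x) (fderiv ℝ (fderiv ℝ u) x) :=
  jet_of_contDiffAt (W_smooth hu).contDiffAt

lemma jet_cd (i) (x : E) : Jet (cd i) x (ip (stdOrthonormalBasis ℝ E i)) 0 := by
  have := jet_lin (ip (stdOrthonormalBasis ℝ E i)) 0 x
  simp only [sub_zero] at this
  exact this

lemma W_deriv (a : E) : ∀ (k : ℕ) (u : E → ℝ), u ∈ W (E := E) k →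
    (fun x => fderiv ℝ u x a) ∈ W (E := E) (k - 1) := by
  refine W_ind (fun k u => (fun x => fderiv ℝ u x a) ∈ W (E := E) (k - 1)) ?_ ?_ ?_ ?_ ?_
  · intro k
    have : (fun x => fderiv ℝ (0 : E → ℝ) x a) = 0 := by ext x; simp
    rw [this]; exact Submodule.zero_mem _
  · intro k u v hu hv h1 h2
    have : (fun x => fderiv ℝ (u + v) x a) = (fun x => fderiv ℝ u x a) + fun x => fderiv ℝ v x a := by
      ext x
      have := ((W_jet hu x).add (W_jet hv x)).hasFDerivAt.fderiv
      change fderiv ℝ (u + v) x = _ at this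
      rw [this]; simp
    rw [this]; exact Submodule.add_mem _ h1 h2
  · intro k c u hu h1
    have : (fun x => fderiv ℝ (c • u) x a) = c • (fun x => fderiv ℝ u x a) := by
      ext x
      have := ((W_jet hu x).smul c).hasFDerivAt.fderiv
      change fderiv ℝ (c • u) x = _ at this
      rw [this]; simp
    rw [this]; exact Submodule.smul_mem _ _ h1
  · intro k
    have : (fun x => fderiv ℝ (1 : E → ℝ) x a) = 0 := by
      ext x
      have := (jet_const 1 x).hasFDerivAt.fderiv
      change fderiv ℝ (1 : E → ℝ) x = _ at this
      rw [this]; simp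
    rw [this]; exact Submodule.zero_mem _
  · intro k i u hu h1
    have : (fun x => fderiv ℝ (cd i * u) x a) = cd i * (fun x => fderiv ℝ u x a) +
        (inner ℝ (stdOrthonormalBasis ℝ E i) a : ℝ) • u := by
      ext x
      have := ((jet_cd i x).mul (W_jet hu x)).hasFDerivAt.fderiv
      change fderiv ℝ (cd i * u) x = _ at this
      rw [this]; simp; ring
    rw [this]
    rcases k with _ | k
    · rw [W_zero h1, W_zero hu]; simp
    · exact Submodule.add_mem _ (W_cd h1 i) (Submodule.smul_mem _ _ hu)

lemma dl_add {u v : E → ℝ} {x : E} (hu : ContDiff ℝ 2 u) (hv : ContDiff ℝ 2 v) :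
    dl (u + v) x = dl u x + dl v x := by
  have := ((jet_of_contDiffAt (x := x) hu.contDiffAt).add (jet_of_contDiffAt (x := x) hv.contDiffAt)).dl_eq
    (hu.add hv).contDiffAt
  change dl (u + v) x = _ at this
  rw [this]; simp [dl]

lemma dl_smul {u : E → ℝ} {x : E} (hu : ContDiff ℝ 2 u) (c : ℝ) :
    dl (c • u) x = c * dl u x := by
  have := ((jet_of_contDiffAt (x := x) hu.contDiffAt).smul c).dl_eq (contDiff_const.mul hu).contDiffAt
  change dl (c • u) x = _ at this
  rw [this]; simp [dl]

lemma W_dl : ∀ (k : ℕ) (u : E → ℝ), u ∈ W (E := E) k → dl u ∈ W (E := E) (k - 2) := by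
  refine W_ind (fun k u => dl u ∈ W (E := E) (k - 2)) ?_ ?_ ?_ ?_ ?_
  · intro k
    have : dl (0 : E → ℝ) = 0 := by
      ext x
      exact ((jet_const 0 x).dl_eq (u := fun _ => (0:ℝ)) contDiffAt_const).trans (by simp)
    rw [this]; exact Submodule.zero_mem _
  · intro k u v hu hv h1 h2
    have : dl (u + v) = dl u + dl v := by
      ext x; exact dl_add (W_smooth hu) (W_smooth hv)
    rw [this]; exact Submodule.add_mem _ h1 h2
  · intro k c u hu h1
    have : dl (c • u) = c • dl u := by
      ext x; exact dl_smul (W_smooth hu) c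
    rw [this]; exact Submodule.smul_mem _ _ h1
  · intro k
    have : dl (1 : E → ℝ) = 0 := by
      ext x
      exact ((jet_const 1 x).dl_eq (u := fun _ => (1:ℝ)) contDiffAt_const).trans (by simp)
    rw [this]; exact Submodule.zero_mem _
  · intro k i u hu h1
    have : dl (cd i * u) = cd i * dl u +
        (2 : ℝ) • fun x => fderiv ℝ u x (stdOrthonormalBasis ℝ E i) := by
      ext x
      have h3 : ContDiff ℝ 2 (cd i * u) := W_smooth (W_cd hu i)
      have := ((jet_cd i x).mul (W_jet hu x)).dl_eq h3.contDiffAt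
      change dl (cd i * u) x = _ at this
      rw [this]
      simp [bt_rk_left, bt_rk_right, dl]; ring
    rw [this]
    have h2 := W_deriv (stdOrthonormalBasis ℝ E i) k u hu
    rcases k with _ | _ | k
    · rw [W_zero hu] at h1 h2 ⊢
      rw [W_zero h1, W_zero h2]; simp
    · rw [W_zero h1, W_zero h2]; simp
    · exact Submodule.add_mem _ (W_cd h1 i) (Submodule.smul_mem _ _ h2)

/-- polynomial Poisson problem -/
lemma poly_poisson (hN : 1 ≤ dm E) (x₀ : E) {r : ℝ} (hr : 0 < r) {k : ℕ} {f : E → ℝ}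
    (hf : f ∈ W (E := E) k) :
    ∃ q ∈ W (E := E) (k + 2), (∀ x, dl q x = f x) ∧ ∀ x, ‖x - x₀‖ = r → q x = 0 := by
  set β : E → ℝ := fun x => r ^ 2 - ‖x - x₀‖ ^ 2 with hβ
  have hm : ∀ q ∈ W (E := E) k, β * q ∈ W (E := E) (k + 2) := fun q hq =>
    W_mono (by omega) (W_mul k hq 3 β (W_beta x₀ r))
  let T : W (E := E) k →ₗ[ℝ] W (E := E) k :=
    { toFun := fun q => ⟨dl (β * q.1), by simpa using W_dl _ _ (hm q.1 q.2)⟩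
      map_add' := fun a b => by
        ext x
        simp only [Submodule.coe_add, mul_add]
        exact dl_add (W_smooth (hm _ a.2)) (W_smooth (hm _ b.2))
      map_smul' := fun c a => by
        ext x
        simp only [Submodule.coe_smul, mul_smul_comm]
        exact dl_smul (W_smooth (hm _ a.2)) c }
  have hinj : Function.Injective T := by
    rw [← LinearMap.ker_eq_bot, LinearMap.ker_eq_bot']
    rintro ⟨q, hq⟩ h0
    have h1 : ∀ x, dl (β * q) x = 0 := fun x => congrFun (congrArg Subtype.val h0) x
    have hc : Continuous (β * q) := (W_smooth (n := 2) (hm q hq)).continuous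
    have hsph : ∀ x ∈ frontier (Metric.ball x₀ r), (β * q) x = 0 := by
      intro x hx
      rw [frontier_ball _ hr.ne'] at hx
      have : ‖x - x₀‖ = r := by simpa [dist_eq_norm] using hx
      simp [hβ, this]
    have hz : ∀ x ∈ closure (Metric.ball x₀ r), (β * q) x = 0 := by
      intro x hx
      refine le_antisymm ?_ ?_
      · exact maxprinc_jet Metric.isOpen_ball Metric.isBounded_ball hN hc.continuousOn
          (h := fun _ => 0) continuousOn_const
          (fun y _ => ⟨_, _, 0, 0, W_jet (hm q hq) y, jet_const 0 y, by
            rw [bt_zero]; exact (h1 y).ge⟩) (fun y hy => (hsph y hy).le) x hx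
      · exact maxprinc_jet Metric.isOpen_ball Metric.isBounded_ball hN
          (v := fun _ => 0) continuousOn_const hc.continuousOn
          (fun y _ => ⟨0, 0, _, _, jet_const 0 y, W_jet (hm q hq) y, by
            rw [bt_zero]; exact (h1 y).le⟩) (fun y hy => (hsph y hy).ge) x hx
    have : q = 0 := by
      refine AnalyticOnNhd.eq_of_eventuallyEq (𝕜 := ℝ) (z₀ := x₀) (fun x _ => W_an k q hq x)
        (fun x _ => analyticAt_const) ?_
      filter_upwards [Metric.ball_mem_nhds x₀ hr] with x hx
      have h2 := hz x (subset_closure hx)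
      have h3 : β x ≠ 0 := by
        have : ‖x - x₀‖ < r := by simpa [dist_eq_norm] using hx
        have h4 : ‖x - x₀‖ ^ 2 < r ^ 2 := by gcongr
        simp only [hβ]; linarith
      simpa [h3] using h2
    ext x; simp [this]
  obtain ⟨⟨q, hq⟩, hqf⟩ := (LinearMap.injective_iff_surjective.1 hinj) ⟨f, hf⟩
  refine ⟨β * q, hm q hq, fun x => congrFun (congrArg Subtype.val hqf) x, fun x hx => ?_⟩
  simp [hβ, hx]

/-- polynomial Dirichlet problem -/
lemma poly_dirichlet (hN : 1 ≤ dm E) (x₀ : E) {r : ℝ} (hr : 0 < r) {k j : ℕ} {f g : E → ℝ}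
    (hf : f ∈ W (E := E) k) (hg : g ∈ W (E := E) j) :
    ∃ n, ∃ q ∈ W (E := E) n, (∀ x, dl q x = f x) ∧ ∀ x, ‖x - x₀‖ = r → q x = g x := by
  have h1 := W_dl _ _ hg
  obtain ⟨q, hq, h2, h3⟩ := poly_poisson hN x₀ hr (k := max k j) (f := f - dl g)
    (Submodule.sub_mem _ (W_mono (le_max_left _ _) hf)
      (W_mono ((Nat.sub_le _ _).trans (le_max_right _ _)) h1))
  have hg' : g ∈ W (E := E) (max k j + 2) := W_mono (by omega) hg
  refine ⟨max k j + 2, q + g, Submodule.add_mem _ hq hg', fun x => ?_, fun x hx => ?_⟩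
  · rw [dl_add (W_smooth hq) (W_smooth hg'), h2]; simp
  · simp [h3 x hx]

/-- Stone-Weierstrass -/
lemma W_dense {K : Set E} (hK : IsCompact K) {f : E → ℝ} (hf : ContinuousOn f K) {ε : ℝ} (hε : 0 < ε) :
    ∃ k, ∃ u ∈ W (E := E) k, ∀ x ∈ K, |u x - f x| ≤ ε := by
  haveI : CompactSpace K := isCompact_iff_compactSpace.1 hK
  let A : Subalgebra ℝ C(K, ℝ) :=
    { carrier := {g | ∃ k, ∃ u ∈ W (E := E) k, ∀ x : K, g x = u x}
      mul_mem' := by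
        rintro a b ⟨k, u, hu, h1⟩ ⟨j, v, hv, h2⟩
        exact ⟨_, u * v, W_mul j hv k u hu, fun x => by simp [h1, h2]⟩
      add_mem' := by
        rintro a b ⟨k, u, hu, h1⟩ ⟨j, v, hv, h2⟩
        exact ⟨max k j, u + v, Submodule.add_mem _ (W_mono (le_max_left _ _) hu)
          (W_mono (le_max_right _ _) hv), fun x => by simp [h1, h2]⟩
      algebraMap_mem' := fun c => ⟨1, fun _ => c, W_const c 0, fun x => by simp⟩ }
  have hsep : A.SeparatesPoints := by
    intro x y hxy
    have hne : (x : E) - y ≠ 0 := sub_ne_zero.2 fun h => hxy (Subtype.ext h)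
    let p : Du E := ip ((x : E) - y)
    refine ⟨fun z => p z, ⟨⟨fun z => p z, by fun_prop⟩, ⟨2, p, W_lin p, fun z => rfl⟩, rfl⟩, ?_⟩
    intro h
    have h2 : p ((x : E) - y) = 0 := by rw [map_sub]; exact sub_eq_zero.2 h
    simp only [p, ip_apply] at h2
    exact hne (inner_self_eq_zero.1 h2)
  obtain ⟨⟨g, k, u, hu, hgu⟩, hg⟩ :=
    ContinuousMap.exists_mem_subalgebra_near_continuous_of_separatesPoints A hsep (K.restrict f)
      (continuousOn_iff_continuous_restrict.1 hf) ε hε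
  refine ⟨k, u, hu, fun x hx => ?_⟩
  have := hg ⟨x, hx⟩
  simp only [restrict_apply] at this
  rw [← hgu ⟨x, hx⟩]
  exact this.le

end poly

/-! ## Part 4: doubling of variables -/
section dbl
variable {E : Type*} [NormedAddCommGroup E] [InnerProductSpace ℝ E] [FiniteDimensional ℝ E]

lemma bt_le_of_nonpos {A : Bi E} (h : ∀ a, A a a ≤ 0) {e : E} (he : ‖e‖ = 1) : bt A ≤ A e e := by
  classical
  have ho : Orthonormal ℝ ((↑) : ({e} : Set E) → E) := by
    rw [orthonormal_subtype_iff_ite]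
    intro v hv w hw
    rw [mem_singleton_iff] at hv hw
    subst hv; subst hw
    simp [he]
  obtain ⟨u, b, hu, hb⟩ := ho.exists_orthonormalBasis_extension
  rw [← bt_basis A b]
  have hm : e ∈ u := by
    have := hu (mem_singleton e)
    exact_mod_cast this
  have h1 := Finset.add_sum_erase Finset.univ (fun i => A (b i) (b i)) (Finset.mem_univ (⟨e, hm⟩ : u))
  have h2 : ∑ i ∈ Finset.univ.erase (⟨e, hm⟩ : u), A (b i) (b i) ≤ 0 := Finset.sum_nonpos fun i _ => h _
  have h3 : A (b ⟨e, hm⟩) (b ⟨e, hm⟩) = A e e := by simp [hb]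
  linarith

/-- second order expansion in one variable -/
def Exp2 (φ : ℝ → ℝ) (s a b : ℝ) : Prop :=
  (fun t => φ (s + t) - φ s - a * t - b / 2 * t ^ 2) =o[𝓝 0] fun t : ℝ => t ^ 2

lemma exp2_quad (c k s : ℝ) : Exp2 (fun t => c * t - k * t ^ 2) s (c - 2 * k * s) (-2 * k) := by
  refine (isLittleO_zero _ _).congr_left fun t => ?_
  ring

lemma exp2_of_deriv {φ φ' : ℝ → ℝ} {s b : ℝ} (h1 : ∀ᶠ y in 𝓝 s, HasDerivAt φ (φ' y) y)
    (h2 : HasDerivAt φ' b s) : Exp2 φ s (φ' s) b := by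
  unfold Exp2
  rw [isLittleO_iff]
  intro c hc
  have h3 := (hasDerivAt_iff_isLittleO.1 h2).bound hc
  obtain ⟨δ, hδ, hball⟩ := Metric.eventually_nhds_iff_ball.1 (h1.and h3)
  filter_upwards [Metric.ball_mem_nhds (0:ℝ) hδ] with t ht
  have ht' : |t| < δ := by simpa using ht
  set R : ℝ → ℝ := fun y => φ y - φ s - φ' s * (y - s) - b / 2 * (y - s) ^ 2 with hR
  have hd : ∀ z ∈ Metric.closedBall s |t|, HasDerivAt R (φ' z - φ' s - b * (z - s)) z := by
    intro z hz
    have hz' : z ∈ Metric.ball s δ := by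
      rw [Metric.mem_closedBall] at hz; rw [Metric.mem_ball]; linarith
    have e1 := (hball z hz').1
    have e2 : HasDerivAt (fun y : ℝ => y - s) 1 z := (hasDerivAt_id z).sub_const s
    have e3 := ((e1.sub_const (φ s)).sub (e2.const_mul (φ' s))).sub ((e2.pow 2).const_mul (b / 2))
    refine e3.congr_deriv ?_
    norm_num; ring
  have hmv := (convex_closedBall s |t|).norm_image_sub_le_of_norm_hasDerivWithin_le
    (f := R) (C := c * |t|) (x := s) (y := s + t) (fun z hz => (hd z hz).hasDerivWithinAt) ?_ ?_ ?_
  · have : R s = 0 := by simp [hR]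
    rw [this, sub_zero] at hmv
    simp only [hR, add_sub_cancel_left] at hmv
    refine hmv.trans (le_of_eq ?_)
    rw [Real.norm_eq_abs, Real.norm_eq_abs, abs_of_nonneg (sq_nonneg t), ← sq_abs t]; ring
  · intro z hz
    have hz' : z ∈ Metric.ball s δ := by
      rw [Metric.mem_closedBall] at hz; rw [Metric.mem_ball]; linarith
    have := (hball z hz').2
    rw [Metric.mem_closedBall, Real.dist_eq] at hz
    have e : φ' z - φ' s - b * (z - s) = φ' z - φ' s - (z - s) • b := by simp; ring
    rw [e]
    refine this.trans ?_
    rw [Real.norm_eq_abs]; gcongr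
  · simp
  · simp

lemma doubling_core {u1 u2 : E → ℝ} {φ : ℝ → ℝ} {x y : E} {p1 p2 : Du E} {A1 A2 : Bi E} {a b : ℝ}
    (h1 : Jet u1 x p1 A1) (h2 : Jet u2 y p2 A2) (hxy : x ≠ y) (hφ : Exp2 φ ‖x - y‖ a b)
    (hm : ∀ᶠ z : E × E in 𝓝 (x, y), u1 z.1 - u2 z.2 - φ ‖z.1 - z.2‖ ≤ u1 x - u2 y - φ ‖x - y‖) :
    bt A1 - bt A2 ≤ 4 * b := by
  have hs : 0 < ‖x - y‖ := norm_pos_iff.2 (sub_ne_zero.2 hxy)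
  set s := ‖x - y‖ with hsdef
  have hline : ∀ a1 a2 : E, ∀ᶠ t : ℝ in 𝓝 0,
      u1 (x + t • a1) - u2 (y + t • a2) - φ ‖(x + t • a1) - (y + t • a2)‖ ≤ u1 x - u2 y - φ s := by
    intro a1 a2
    have hc : Tendsto (fun t : ℝ => (x + t • a1, y + t • a2)) (𝓝 0) (𝓝 (x, y)) := by
      have : Continuous fun t : ℝ => (x + t • a1, y + t • a2) := by fun_prop
      simpa using this.tendsto 0
    exact hc.eventually hm
  have hneg : ∀ c, (A1 - A2) c c ≤ 0 := by
    intro c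
    have := oned_max (f := fun t => u1 (x + t • c) - u2 (y + t • c)) (a := p1 c - p2 c)
      (b := A1 c c - A2 c c) ?_ ?_
    · simpa using this.2
    · refine ((h1.line c).sub (h2.line c)).congr_left fun t => ?_
      simp; ring
    · filter_upwards [hline c c] with t ht
      have e : x + t • c - (y + t • c) = x - y := by abel
      rw [e] at ht
      simp; linarith
  set e : E := s⁻¹ • (x - y) with he
  have hen : ‖e‖ = 1 := by
    rw [he, norm_smul, norm_inv, Real.norm_eq_abs, abs_of_pos hs, ← hsdef, inv_mul_cancel₀ hs.ne']
  have hse : x - y = s • e := by rw [he, smul_smul, mul_inv_cancel₀ hs.ne', one_smul]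
  have hee : (A1 - A2) e e ≤ 4 * b := by
    have hφ2 : (fun t : ℝ => φ (s + 2 * t) - φ s - (2 * a) * t - (4 * b) / 2 * t ^ 2) =o[𝓝 0]
        fun t : ℝ => t ^ 2 := by
      have hc : Tendsto (fun t : ℝ => 2 * t) (𝓝 0) (𝓝 0) := by
        have : Continuous fun t : ℝ => 2 * t := by fun_prop
        simpa using this.tendsto 0
      have := IsLittleO.comp_tendsto hφ hc
      have h2 : ((fun t : ℝ => t ^ 2) ∘ fun t => 2 * t) =O[𝓝 0] fun t : ℝ => t ^ 2 := by
        refine IsBigO.of_bound 4 (Eventually.of_forall fun t => ?_)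
        simp [mul_pow]; norm_num
      refine (this.trans_isBigO h2).congr_left fun t => ?_
      simp; ring
    have := oned_max (f := fun t => u1 (x + t • e) - u2 (y + t • (-e)) - φ (s + 2 * t))
      (a := p1 e - p2 (-e) - 2 * a) (b := A1 e e - A2 (-e) (-e) - 4 * b) ?_ ?_
    · have := this.2
      simp at this ⊢; linarith
    · refine (((h1.line e).sub (h2.line (-e))).sub hφ2).congr_left fun t => ?_
      simp; ring
    · have hpos : ∀ᶠ t : ℝ in 𝓝 0, 0 < s + 2 * t := by
        have : Continuous fun t : ℝ => s + 2 * t := by fun_prop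
        refine this.continuousAt.eventually_const_lt ?_
        simpa using hs
      filter_upwards [hline e (-e), hpos] with t ht hp
      have e1 : x + t • e - (y + t • (-e)) = (s + 2 * t) • e := by
        rw [add_smul, ← hse, smul_neg, mul_smul, two_smul]; abel
      rw [e1, norm_smul, hen, mul_one, Real.norm_eq_abs, abs_of_pos hp] at ht
      simp at ht ⊢; linarith
  have := (bt_le_of_nonpos hneg hen).trans hee
  simpa using this

lemma deriv_nonpos_right {g : ℝ → ℝ} {g' : ℝ} (h : HasDerivAt g g' 0)
    (hle : ∀ᶠ t in 𝓝[>] (0:ℝ), g t ≤ g 0) : g' ≤ 0 := by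
  have h1 := (hasDerivWithinAt_iff_tendsto_slope' (s := Ioi 0) (by simp)).1
    (h.hasDerivWithinAt (s := Ioi 0))
  refine le_of_tendsto h1 ?_
  filter_upwards [hle, self_mem_nhdsWithin] with t ht ht0
  rw [slope_def_field]
  exact div_nonpos_of_nonpos_of_nonneg (by linarith) (by simpa using (le_of_lt ht0))

lemma doubling_grad {u1 : E → ℝ} {φ : ℝ → ℝ} {x y : E} {p1 : Du E} {a : ℝ}
    (h1 : HasFDerivAt u1 p1 x) (hφ : HasDerivAt φ a ‖x - y‖)
    (hmono : MonotoneOn φ (Ici 0)) (ha : 0 ≤ a)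
    (hm : ∀ᶠ z : E in 𝓝 x, u1 z - φ ‖z - y‖ ≤ u1 x - φ ‖x - y‖) :
    ‖p1‖ ≤ a := by
  have key : ∀ c : E, p1 c ≤ a * ‖c‖ := by
    intro c
    have hd : HasDerivAt (fun t : ℝ => u1 (x + t • c) - φ (‖x - y‖ + t * ‖c‖)) (p1 c - a * ‖c‖) 0 := by
      have e1 : HasDerivAt (fun t : ℝ => x + t • c) c 0 := by
        simpa using ((hasDerivAt_id (0:ℝ)).smul_const c).const_add x
      have e2 : HasDerivAt (fun t : ℝ => ‖x - y‖ + t * ‖c‖) ‖c‖ 0 := by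
        simpa using ((hasDerivAt_id (0:ℝ)).mul_const ‖c‖).const_add ‖x - y‖
      have e3 : HasDerivAt (fun t : ℝ => u1 (x + t • c)) (p1 c) 0 := by
        refine HasFDerivAt.comp_hasDerivAt (0:ℝ) (f := fun t : ℝ => x + t • c) ?_ e1
        simpa using h1
      have e4 : HasDerivAt (fun t : ℝ => φ (‖x - y‖ + t * ‖c‖)) (a * ‖c‖) 0 := by
        refine HasDerivAt.comp (0:ℝ) (h := fun t : ℝ => ‖x - y‖ + t * ‖c‖) ?_ e2
        simpa using hφ
      exact e3.sub e4
    have := deriv_nonpos_right hd ?_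
    · linarith
    · have hc : Tendsto (fun t : ℝ => x + t • c) (𝓝[>] 0) (𝓝 x) := by
        have : Continuous fun t : ℝ => x + t • c := by fun_prop
        have := this.tendsto 0
        simp at this
        exact this.mono_left nhdsWithin_le_nhds
      filter_upwards [hc.eventually hm, self_mem_nhdsWithin] with t ht ht0
      have ht0' : (0:ℝ) < t := ht0
      have h3 : ‖x + t • c - y‖ ≤ ‖x - y‖ + t * ‖c‖ := by
        have e : x + t • c - y = (x - y) + t • c := by abel
        rw [e]
        refine (norm_add_le _ _).trans ?_
        rw [norm_smul, Real.norm_eq_abs, abs_of_pos ht0']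
      have h4 := hmono (show (0:ℝ) ≤ ‖x + t • c - y‖ from norm_nonneg _)
        (show (0:ℝ) ≤ ‖x - y‖ + t * ‖c‖ by positivity) h3
      simp; linarith
  refine p1.opNorm_le_bound ha fun c => ?_
  rw [Real.norm_eq_abs, abs_le]
  have := key (-c)
  simp at this
  exact ⟨by linarith, key c⟩

lemma doubling {S : Set E} (hS : IsCompact S) {u1 u2 : E → ℝ} (h1 : ContinuousOn u1 S)
    (h2 : ContinuousOn u2 S) {φ : ℝ → ℝ} {δ : ℝ} (hφ : ContinuousOn φ (Icc 0 δ))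
    (H : ∀ x ∈ S, ∀ y ∈ S, ‖x - y‖ ≤ δ → 0 < u1 x - u2 y - φ ‖x - y‖ →
      x ∈ interior S ∧ y ∈ interior S ∧ ‖x - y‖ < δ ∧
      ((∀ᶠ z : E × E in 𝓝 (x, y), u1 z.1 - u2 z.2 - φ ‖z.1 - z.2‖ ≤ u1 x - u2 y - φ ‖x - y‖) → False)) :
    ∀ x ∈ S, ∀ y ∈ S, ‖x - y‖ ≤ δ → u1 x - u2 y ≤ φ ‖x - y‖ := by
  intro x hx y hy hxy
  set R : Set (E × E) := (S ×ˢ S) ∩ {z | ‖z.1 - z.2‖ ≤ δ} with hR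
  have hRc : IsCompact R := (hS.prod hS).inter_right (isClosed_le (by fun_prop) continuous_const)
  have hcont : ContinuousOn (fun z : E × E => u1 z.1 - u2 z.2 - φ ‖z.1 - z.2‖) R := by
    refine ((h1.comp continuousOn_fst fun z hz => hz.1.1).sub
      (h2.comp continuousOn_snd fun z hz => hz.1.2)).sub
      (hφ.comp (f := fun z : E × E => ‖z.1 - z.2‖) (by fun_prop) fun z hz => ⟨norm_nonneg _, hz.2⟩)
  obtain ⟨⟨a, b⟩, hab, hmax⟩ := hRc.exists_isMaxOn ⟨(x, y), ⟨hx, hy⟩, hxy⟩ hcont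
  by_contra hcon
  push Not at hcon
  have h3 := hmax (show (x, y) ∈ R from ⟨⟨hx, hy⟩, hxy⟩)
  simp only [mem_setOf_eq] at h3
  obtain ⟨i1, i2, i3, i4⟩ := H a hab.1.1 b hab.1.2 hab.2 (by linarith)
  refine i4 ?_
  have n1 : ∀ᶠ z : E × E in 𝓝 (a, b), z.1 ∈ interior S :=
    continuousAt_fst.eventually (isOpen_interior.mem_nhds i1)
  have n2 : ∀ᶠ z : E × E in 𝓝 (a, b), z.2 ∈ interior S :=
    continuousAt_snd.eventually (isOpen_interior.mem_nhds i2)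
  have n3 : ∀ᶠ z : E × E in 𝓝 (a, b), ‖z.1 - z.2‖ < δ := by
    have : Continuous fun z : E × E => ‖z.1 - z.2‖ := by fun_prop
    exact this.continuousAt.eventually_lt_const i3
  filter_upwards [n1, n2, n3] with z z1 z2 z3
  exact hmax (show z ∈ R from ⟨⟨interior_subset z1, interior_subset z2⟩, z3.le⟩)

/-- interior Lipschitz estimate -/
lemma int_lip (hN : 1 ≤ dm E) {h : E → ℝ} {x₀ : E} {ρ M K : ℝ} (hρ : 0 < ρ) (hM : 0 < M) (hK : 0 ≤ K)
    (hc : ContinuousOn h (Metric.closedBall x₀ ρ)) (hb : ∀ x ∈ Metric.closedBall x₀ ρ, |h x| ≤ M)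
    (hj : ∀ x ∈ Metric.ball x₀ ρ, ∃ p A, Jet h x p A ∧ |bt A| ≤ K) :
    ∀ x ∈ Metric.closedBall x₀ ρ, |h x - h x₀| ≤
      (6 * M * dm E / ρ + 2 * ρ * K) * ‖x - x₀‖ := by
  set m := 2 * M / ρ ^ 2 with hm
  have hmpos : 0 < m := by positivity
  set k := m * dm E + K with hk
  have hkpos : 0 < k := by positivity
  have key := doubling (isCompact_closedBall x₀ ρ) (u1 := fun x => h x - m * ‖x - x₀‖ ^ 2)
    (u2 := fun x => h x + m * ‖x - x₀‖ ^ 2) (φ := fun s => 2 * ρ * k * s - k * s ^ 2) (δ := 2 * ρ + 1)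
    (hc.sub (by fun_prop)) (hc.add (by fun_prop)) (by fun_prop) ?_
  · intro x hx
    have hx0 : x₀ ∈ Metric.closedBall x₀ ρ := by simp [hρ.le]
    have hxn : ‖x - x₀‖ ≤ ρ := by simpa [dist_eq_norm] using hx
    have e1 := key x hx x₀ hx0 (by linarith)
    have e2 := key x₀ hx0 x hx (by rw [norm_sub_rev]; linarith)
    rw [norm_sub_rev x₀ x] at e2
    simp only [sub_self, norm_zero] at e1 e2
    have e3 : m * ‖x - x₀‖ ^ 2 ≤ m * ρ * ‖x - x₀‖ := by
      have := mul_le_mul_of_nonneg_left hxn (mul_nonneg hmpos.le (norm_nonneg (x - x₀)))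
      linarith
    have e4 : 0 ≤ k * ‖x - x₀‖ ^ 2 := by positivity
    have e5 : (6 * M * dm E / ρ + 2 * ρ * K) * ‖x - x₀‖ =
        (m * ρ * dm E + 2 * ρ * k) * ‖x - x₀‖ := by
      rw [hk, hm]; field_simp; ring
    have e6 : m * ρ * ‖x - x₀‖ ≤ m * ρ * dm E * ‖x - x₀‖ := by
      have : m * ρ ≤ m * ρ * dm E := le_mul_of_one_le_right (by positivity) hN
      gcongr
    rw [e5, abs_le]
    constructor <;> linarith
  · intro x hx y hy hxy hpos
    have hxn : ‖x - x₀‖ ≤ ρ := by simpa [dist_eq_norm] using hx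
    have hyn : ‖y - x₀‖ ≤ ρ := by simpa [dist_eq_norm] using hy
    have hxy2 : ‖x - y‖ ≤ 2 * ρ := by
      have : x - y = (x - x₀) - (y - x₀) := by abel
      rw [this]; exact (norm_sub_le _ _).trans (by linarith)
    have hφ0 : 0 ≤ 2 * ρ * k * ‖x - y‖ - k * ‖x - y‖ ^ 2 := by
      have : 2 * ρ * k * ‖x - y‖ - k * ‖x - y‖ ^ 2 = k * ‖x - y‖ * (2 * ρ - ‖x - y‖) := by ring
      rw [this]; exact mul_nonneg (by positivity) (by linarith)
    have hhx := abs_le.1 (hb x hx)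
    have hhy := abs_le.1 (hb y hy)
    have hmr : m * ρ ^ 2 = 2 * M := by rw [hm]; field_simp
    have n1 : 0 ≤ m * ‖x - x₀‖ ^ 2 := by positivity
    have n2 : 0 ≤ m * ‖y - x₀‖ ^ 2 := by positivity
    have hx' : x ∈ Metric.ball x₀ ρ := by
      rw [Metric.mem_ball, dist_eq_norm]
      rcases hxn.lt_or_eq with h1 | h1
      · exact h1
      · rw [h1] at hpos; linarith
    have hy' : y ∈ Metric.ball x₀ ρ := by
      rw [Metric.mem_ball, dist_eq_norm]
      rcases hyn.lt_or_eq with h1 | h1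
      · exact h1
      · rw [h1] at hpos; linarith
    refine ⟨?_, ?_, by linarith, ?_⟩
    · exact interior_maximal Metric.ball_subset_closedBall Metric.isOpen_ball hx'
    · exact interior_maximal Metric.ball_subset_closedBall Metric.isOpen_ball hy'
    · intro hev
      have hne : x ≠ y := by
        rintro rfl
        simp at hpos; linarith
      obtain ⟨p, A, hJ, hA⟩ := hj x hx'
      obtain ⟨q, B, hJ', hB⟩ := hj y hy'
      have := doubling_core (hJ.sub ((jet_sq x₀ x).smul m)) (hJ'.add ((jet_sq x₀ y).smul m)) hne
        (exp2_quad (2 * ρ * k) k ‖x - y‖) hev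
      simp only [bt_add, bt_sub, bt_smul, bt_ip] at this
      have a1 := abs_le.1 hA
      have a2 := abs_le.1 hB
      have a3 : 0 < m * dm E := by positivity
      rw [hk] at this
      linarith

/-- zero boundary values on a ball -/
lemma ball_lip (hN : 1 ≤ dm E) {w : E → ℝ} {x₀ : E} {r κ : ℝ} (hr : 0 < r) (hκ : 0 < κ)
    (hc : ContinuousOn w (Metric.closedBall x₀ r)) (h0 : ∀ x, ‖x - x₀‖ = r → w x = 0)
    (hj : ∀ x ∈ Metric.ball x₀ r, ∃ p A, Jet w x p A ∧ |bt A| ≤ κ) :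
    (∀ x ∈ Metric.closedBall x₀ r, |w x| ≤ κ * r ^ 2) ∧
    ∀ x ∈ Metric.closedBall x₀ r, ∀ y ∈ Metric.closedBall x₀ r, |w x - w y| ≤ 2 * r * κ * ‖x - y‖ := by
  have hN0 : 0 < dm E := by linarith
  have hcl : closure (Metric.ball x₀ r) = Metric.closedBall x₀ r := closure_ball _ hr.ne'
  have hfr : ∀ x ∈ frontier (Metric.ball x₀ r), ‖x - x₀‖ = r := fun x hx => by
    rw [frontier_ball _ hr.ne'] at hx; simpa [dist_eq_norm] using hx
  set bar : E → ℝ := fun x => κ / (2 * dm E) * (r ^ 2 - ‖x - x₀‖ ^ 2) with hbar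
  have hbc : Continuous bar := by simp only [hbar]; fun_prop
  have hbj : ∀ x, Jet bar x ((κ / (2 * dm E)) • (0 - (2:ℝ) • ip (x - x₀)))
      ((κ / (2 * dm E)) • (0 - (2:ℝ) • ip)) := fun x => ((jet_const (r ^ 2) x).sub (jet_sq x₀ x)).smul _
  have hbb : bt ((κ / (2 * dm E)) • (0 - (2:ℝ) • ip) : Bi E) = -κ := by
    simp only [bt_smul, bt_sub, bt_zero, bt_ip]; field_simp; ring
  have hup : ∀ x ∈ Metric.closedBall x₀ r, |w x| ≤ bar x := by
    intro x hx
    rw [← hcl] at hx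
    rw [abs_le]
    constructor
    · have := maxprinc_jet Metric.isOpen_ball Metric.isBounded_ball hN (v := fun x => -bar x) (h := w)
        hbc.neg.continuousOn (by rwa [hcl]) (fun y hy => ?_) (fun y hy => ?_) x hx
      · linarith
      · obtain ⟨p, A, h1, h2⟩ := hj y hy
        refine ⟨_, _, p, A, (hbj y).neg, h1, ?_⟩
        rw [bt_neg, hbb]; linarith [(abs_le.1 h2).2]
      · simp [hbar, hfr y hy, h0 y (hfr y hy)]
    · refine maxprinc_jet Metric.isOpen_ball Metric.isBounded_ball hN (v := w) (h := bar)
        (by rwa [hcl]) hbc.continuousOn (fun y hy => ?_) (fun y hy => ?_) x hx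
      · obtain ⟨p, A, h1, h2⟩ := hj y hy
        refine ⟨p, A, _, _, h1, hbj y, ?_⟩
        rw [hbb]; linarith [(abs_le.1 h2).1]
      · simp [hbar, hfr y hy, h0 y (hfr y hy)]
  have hcoef : κ / (2 * dm E) ≤ κ / 2 := by
    gcongr; linarith
  refine ⟨fun x hx => (hup x hx).trans ?_, ?_⟩
  · have hxn : ‖x - x₀‖ ≤ r := by simpa [dist_eq_norm] using hx
    have h1 : 0 ≤ r ^ 2 - ‖x - x₀‖ ^ 2 := by
      have : ‖x - x₀‖ ^ 2 ≤ r ^ 2 := by gcongr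
      linarith
    calc bar x ≤ κ / 2 * (r ^ 2 - ‖x - x₀‖ ^ 2) := by simp only [hbar]; gcongr
      _ ≤ κ * r ^ 2 := by nlinarith [sq_nonneg ‖x - x₀‖, mul_nonneg hκ.le (sq_nonneg ‖x - x₀‖), mul_nonneg hκ.le (sq_nonneg r)]
  -- bound near boundary
  have hlin : ∀ x ∈ Metric.closedBall x₀ r, |w x| ≤ κ * r * (r - ‖x - x₀‖) := by
    intro x hx
    have hxn : ‖x - x₀‖ ≤ r := by simpa [dist_eq_norm] using hx
    refine (hup x hx).trans ?_
    have h1 : 0 ≤ r - ‖x - x₀‖ := by linarith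
    have h2 : r ^ 2 - ‖x - x₀‖ ^ 2 ≤ 2 * r * (r - ‖x - x₀‖) := by nlinarith
    calc bar x ≤ κ / (2 * dm E) * (2 * r * (r - ‖x - x₀‖)) := by simp only [hbar]; gcongr
      _ ≤ κ / 2 * (2 * r * (r - ‖x - x₀‖)) := by gcongr
      _ = _ := by ring
  have key := doubling (isCompact_closedBall x₀ r) (u1 := w) (u2 := w)
    (φ := fun s => 2 * r * κ * s - κ / 3 * s ^ 2) (δ := 2 * r + 1) hc hc (by fun_prop) ?_
  · intro x hx y hy
    have hxn : ‖x - x₀‖ ≤ r := by simpa [dist_eq_norm] using hx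
    have hyn : ‖y - x₀‖ ≤ r := by simpa [dist_eq_norm] using hy
    have hxy2 : ‖x - y‖ ≤ 2 * r := by
      have : x - y = (x - x₀) - (y - x₀) := by abel
      rw [this]; exact (norm_sub_le _ _).trans (by linarith)
    have e1 := key x hx y hy (by linarith)
    have e2 := key y hy x hx (by rw [norm_sub_rev]; linarith)
    rw [norm_sub_rev y x] at e2
    have e4 : 0 ≤ κ / 3 * ‖x - y‖ ^ 2 := by positivity
    rw [abs_le]; constructor <;> linarith
  · intro x hx y hy hxy hpos
    have hxn : ‖x - x₀‖ ≤ r := by simpa [dist_eq_norm] using hx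
    have hyn : ‖y - x₀‖ ≤ r := by simpa [dist_eq_norm] using hy
    have hxy2 : ‖x - y‖ ≤ 2 * r := by
      have : x - y = (x - x₀) - (y - x₀) := by abel
      rw [this]; exact (norm_sub_le _ _).trans (by linarith)
    have hφ0 : κ * r * ‖x - y‖ ≤ 2 * r * κ * ‖x - y‖ - κ / 3 * ‖x - y‖ ^ 2 := by
      have h5 : ‖x - y‖ * ‖x - y‖ ≤ 2 * r * ‖x - y‖ := by gcongr
      have h6 : κ / 3 * (‖x - y‖ * ‖x - y‖) ≤ κ / 3 * (2 * r * ‖x - y‖) := by gcongr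
      have h7 : 0 ≤ κ * r * ‖x - y‖ := by positivity
      nlinarith
    have hd1 : ‖y - x₀‖ - ‖x - x₀‖ ≤ ‖x - y‖ := by
      have := norm_sub_norm_le (y - x₀) (x - x₀)
      rw [sub_sub_sub_cancel_right, norm_sub_rev y x] at this; exact this
    have hd2 : ‖x - x₀‖ - ‖y - x₀‖ ≤ ‖x - y‖ := by
      have := norm_sub_norm_le (x - x₀) (y - x₀)
      rw [sub_sub_sub_cancel_right] at this; exact this
    have hkr : 0 < κ * r := by positivity
    have hx' : x ∈ Metric.ball x₀ r := by
      rw [Metric.mem_ball, dist_eq_norm]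
      rcases hxn.lt_or_eq with h1 | h1
      · exact h1
      · exfalso
        rw [h0 x h1] at hpos
        have h3 := (abs_le.1 (hlin y hy)).1
        have h4 : κ * r * (r - ‖y - x₀‖) ≤ κ * r * ‖x - y‖ := by gcongr; linarith
        linarith
    have hy' : y ∈ Metric.ball x₀ r := by
      rw [Metric.mem_ball, dist_eq_norm]
      rcases hyn.lt_or_eq with h1 | h1
      · exact h1
      · exfalso
        rw [h0 y h1] at hpos
        have h3 := (abs_le.1 (hlin x hx)).2
        have h4 : κ * r * (r - ‖x - x₀‖) ≤ κ * r * ‖x - y‖ := by gcongr; linarith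
        linarith
    refine ⟨?_, ?_, by linarith, ?_⟩
    · exact interior_maximal Metric.ball_subset_closedBall Metric.isOpen_ball hx'
    · exact interior_maximal Metric.ball_subset_closedBall Metric.isOpen_ball hy'
    · intro hev
      have hne : x ≠ y := by
        rintro rfl
        simp at hpos
      obtain ⟨p, A, hJ, hA⟩ := hj x hx'
      obtain ⟨q, B, hJ', hB⟩ := hj y hy'
      have := doubling_core hJ hJ' hne (exp2_quad (2 * r * κ) (κ / 3) ‖x - y‖) hev
      have a1 := abs_le.1 hA
      have a2 := abs_le.1 hB
      linarith

lemma norm_le_of_lip {u : E → ℝ} {x : E} {p : Du E} {C : ℝ} (hC : 0 ≤ C) (h : HasFDerivAt u p x)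
    (hl : ∀ᶠ y in 𝓝 x, |u y - u x| ≤ C * ‖y - x‖) : ‖p‖ ≤ C :=
  h.le_of_lip' hC (by simpa using hl)

/-- global gradient bound -/
lemma global_grad {K M C : ℝ} (hK : 0 < K) (hM : 0 ≤ M) (hC : 0 < C) :
    ∃ G : ℝ, 0 < G ∧ ∀ (Ω : Set E) (u : E → ℝ), IsOpen Ω → Bornology.IsBounded Ω →
      ContinuousOn u (closure Ω) → (∀ x ∈ closure Ω, |u x| ≤ M) →
      (∀ x ∈ closure Ω, ∀ y ∈ frontier Ω, |u x - u y| ≤ C * ‖x - y‖) →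
      (∀ x ∈ Ω, ∃ p A, Jet u x p A ∧ |bt A| ≤ K * (1 + ‖p‖ ^ 2)) →
      ∀ x ∈ Ω, ∀ p : Du E, HasFDerivAt u p x → ‖p‖ ≤ G := by
  set δ := 1 / (2 * K * (1 + C)) with hδ
  have hδpos : 0 < δ := by positivity
  set Λ := Real.exp (2 * M * K) / δ with hΛ
  have hΛpos : 0 < Λ := by positivity
  have hΛδ : Λ * δ = Real.exp (2 * M * K) := by rw [hΛ]; field_simp
  have hΛδ1 : 1 ≤ Λ * δ := by rw [hΛδ]; exact Real.one_le_exp (by positivity)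
  refine ⟨Λ / K, by positivity, ?_⟩
  intro Ω u hΩ hb hc hM' hC' hj
  set φ : ℝ → ℝ := fun s => 1 / K * Real.log (1 + Λ * s) with hφ
  set φ' : ℝ → ℝ := fun s => Λ / (K * (1 + Λ * s)) with hφ'
  have hd1 : ∀ s, 0 ≤ s → HasDerivAt φ (φ' s) s := by
    intro s hs
    have h1 : HasDerivAt (fun s : ℝ => 1 + Λ * s) Λ s := by
      simpa using ((hasDerivAt_id s).const_mul Λ).const_add 1
    have h2 : (0:ℝ) < 1 + Λ * s := by positivity
    have := (h1.log h2.ne').const_mul (1 / K)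
    refine this.congr_deriv ?_
    simp only [hφ']; field_simp
  have hd2 : ∀ s, 0 ≤ s → HasDerivAt φ' (-K * φ' s ^ 2) s := by
    intro s hs
    have h1 : HasDerivAt (fun s : ℝ => K * (1 + Λ * s)) (K * Λ) s := by
      simpa using (((hasDerivAt_id s).const_mul Λ).const_add 1).const_mul K
    have h2 : (0:ℝ) < K * (1 + Λ * s) := by positivity
    have := (hasDerivAt_const s Λ).div h1 h2.ne'
    refine this.congr_deriv ?_
    simp only [hφ']; field_simp; ring
  have hφpos : ∀ s, 0 ≤ s → 0 < φ' s := fun s hs => by simp only [hφ']; positivity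
  have hφlow : ∀ s, 0 ≤ s → s ≤ δ → 1 + C ≤ φ' s := by
    intro s hs hs'
    simp only [hφ']
    rw [le_div_iff₀ (by positivity)]
    have h1 : Λ * s ≤ Λ * δ := by gcongr
    have h2 : 2 * K * (1 + C) * δ = 1 := by rw [hδ]; field_simp
    calc (1 + C) * (K * (1 + Λ * s)) ≤ (1 + C) * (K * (Λ * δ + Λ * δ)) := by gcongr
      _ = Λ * (2 * K * (1 + C) * δ) := by ring
      _ = Λ := by rw [h2, mul_one]
  have hφc : ContinuousOn φ (Icc 0 δ) := fun s hs => (hd1 s hs.1).continuousAt.continuousWithinAt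
  have hφ0 : φ 0 = 0 := by simp [hφ]
  have hmono : MonotoneOn φ (Ici 0) := by
    intro a ha b hb hab
    simp only [hφ]
    have ha' : (0:ℝ) ≤ a := ha
    have : Real.log (1 + Λ * a) ≤ Real.log (1 + Λ * b) :=
      Real.log_le_log (by positivity) (by gcongr)
    gcongr
  have hφlin : ∀ s, 0 ≤ s → s ≤ δ → (1 + C) * s ≤ φ s := by
    intro s hs hs'
    have := (convex_Icc (0:ℝ) δ).mul_sub_le_image_sub_of_le_deriv (f := φ) (C := 1 + C) hφc
      (fun t ht => (hd1 t (interior_subset ht).1).differentiableAt.differentiableWithinAt)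
      (fun t ht => by
        rw [(hd1 t (interior_subset ht).1).deriv]
        exact hφlow t (interior_subset ht).1 (interior_subset ht).2) 0 ⟨le_rfl, hδpos.le⟩ s ⟨hs, hs'⟩ hs
    simpa [hφ0] using this
  have hφup : ∀ s, 0 ≤ s → φ s ≤ Λ / K * s := by
    intro s hs
    simp only [hφ]
    have : Real.log (1 + Λ * s) ≤ Λ * s := by
      have := Real.log_le_sub_one_of_pos (show 0 < 1 + Λ * s by positivity)
      linarith
    calc 1 / K * Real.log (1 + Λ * s) ≤ 1 / K * (Λ * s) := by gcongr
      _ = _ := by ring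
  have hφδ : 2 * M < φ δ := by
    simp only [hφ]
    have : 2 * M * K < Real.log (1 + Λ * δ) := by
      rw [Real.lt_log_iff_exp_lt (by positivity), hΛδ]; linarith
    rw [one_div, inv_mul_eq_div, lt_div_iff₀ hK]; exact this
  have hsubint : Ω ⊆ interior (closure Ω) := interior_maximal subset_closure hΩ
  have key := doubling hb.isCompact_closure (u1 := u) (u2 := u) (φ := φ) (δ := δ) hc hc hφc ?_
  · intro x hx p hp
    refine norm_le_of_lip (by positivity) hp ?_
    filter_upwards [hΩ.mem_nhds hx, Metric.ball_mem_nhds x hδpos] with y hy hyδ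
    have hyd : ‖y - x‖ ≤ δ := by
      rw [Metric.mem_ball, dist_eq_norm] at hyδ; exact hyδ.le
    have e1 := key y (subset_closure hy) x (subset_closure hx) hyd
    have e2 := key x (subset_closure hx) y (subset_closure hy) (by rwa [norm_sub_rev])
    rw [norm_sub_rev x y] at e2
    have e3 := hφup ‖y - x‖ (norm_nonneg _)
    rw [abs_le]; constructor <;> linarith
  · intro x hx y hy hxy hpos
    have hs := norm_nonneg (x - y)
    have hCs : C * ‖x - y‖ ≤ φ ‖x - y‖ := by
      have := hφlin _ hs hxy
      nlinarith
    have hx' : x ∈ Ω := by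
      by_contra hn
      have hf : x ∈ frontier Ω := ⟨hx, by rwa [hΩ.interior_eq]⟩
      have := (abs_le.1 (hC' y hy x hf)).1
      rw [norm_sub_rev] at this
      linarith
    have hy' : y ∈ Ω := by
      by_contra hn
      have hf : y ∈ frontier Ω := ⟨hy, by rwa [hΩ.interior_eq]⟩
      have := (abs_le.1 (hC' x hx y hf)).2
      linarith
    refine ⟨hsubint hx', hsubint hy', ?_, ?_⟩
    · rcases hxy.lt_or_eq with h1 | h1
      · exact h1
      · rw [h1] at hpos
        have a1 := abs_le.1 (hM' x hx)
        have a2 := abs_le.1 (hM' y hy)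
        linarith
    · intro hev
      have hne : x ≠ y := by
        rintro rfl
        simp [hφ0] at hpos
      have hs0 : 0 < ‖x - y‖ := norm_pos_iff.2 (sub_ne_zero.2 hne)
      obtain ⟨p, A, hJ, hA⟩ := hj x hx'
      obtain ⟨q, B, hJ', hB⟩ := hj y hy'
      have hd := hφpos _ hs
      have hexp : Exp2 φ ‖x - y‖ (φ' ‖x - y‖) (-K * φ' ‖x - y‖ ^ 2) :=
        exp2_of_deriv (by filter_upwards [lt_mem_nhds hs0] with s hs using hd1 s hs.le) (hd2 _ hs)
      have h1 := doubling_core hJ hJ' hne hexp hev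
      have hp : ‖p‖ ≤ φ' ‖x - y‖ := by
        refine doubling_grad hJ.hasFDerivAt (hd1 _ hs) hmono hd.le ?_
        have hc2 : Tendsto (fun z : E => (z, y)) (𝓝 x) (𝓝 (x, y)) := by
          have : Continuous fun z : E => (z, y) := by fun_prop
          exact this.tendsto x
        filter_upwards [hc2.eventually hev] with z hz
        simp at hz ⊢; linarith
      have hq : ‖q‖ ≤ φ' ‖x - y‖ := by
        have := doubling_grad (u1 := fun z => - u z) (x := y) (y := x) (φ := φ) (p1 := -q)
          (a := φ' ‖x - y‖) hJ'.neg.hasFDerivAt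
          (by rw [norm_sub_rev y x]; exact hd1 _ hs) hmono hd.le ?_
        · simpa using this
        have hc2 : Tendsto (fun z : E => (x, z)) (𝓝 y) (𝓝 (x, y)) := by
          have : Continuous fun z : E => (x, z) := by fun_prop
          exact this.tendsto y
        filter_upwards [hc2.eventually hev] with z hz
        rw [norm_sub_rev z x, norm_sub_rev y x]
        simp at hz ⊢; linarith
      have hlow := hφlow _ hs hxy
      set d := φ' ‖x - y‖
      have hp2 : ‖p‖ ^ 2 ≤ d ^ 2 := by gcongr
      have hq2 : ‖q‖ ^ 2 ≤ d ^ 2 := by gcongr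
      have a1 := (abs_le.1 hA).1
      have a2 := (abs_le.1 hB).2
      have a3 : K * (1 + ‖p‖ ^ 2) ≤ K * (1 + d ^ 2) := by gcongr
      have a4 : K * (1 + ‖q‖ ^ 2) ≤ K * (1 + d ^ 2) := by gcongr
      have a5 : 1 < d ^ 2 := by nlinarith
      have a6 : K * 1 < K * d ^ 2 := by gcongr
      linarith

end dbl

/-! ## Part 5: harmonic polynomials -/
section har
variable {E : Type*} [NormedAddCommGroup E] [InnerProductSpace ℝ E] [FiniteDimensional ℝ E]

def Har (h : E → ℝ) : Prop := ∃ k, h ∈ W (E := E) k ∧ ∀ x, dl h x = 0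

lemma Har.cd {h : E → ℝ} (H : Har h) {n : WithTop ℕ∞} : ContDiff ℝ n h := W_smooth H.choose_spec.1

lemma Har.cont {h : E → ℝ} (H : Har h) : Continuous h := H.cd.continuous (n := 0)

lemma Har.jet {h : E → ℝ} (H : Har h) (x : E) :
    ∃ p A, Jet h x p A ∧ bt A = 0 :=
  ⟨_, _, jet_of_contDiffAt H.cd.contDiffAt, H.choose_spec.2 x⟩

lemma second_apply {h : E → ℝ} (H : ContDiff ℝ 2 h) (x a b : E) :
    fderiv ℝ (fun y => fderiv ℝ h y a) x b = fderiv ℝ (fderiv ℝ h) x b a := by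
  have hd : DifferentiableAt ℝ (fderiv ℝ h) x :=
    ((H.contDiffAt.fderiv_right (m := 1) (by norm_num)).differentiableAt (by norm_num))
  have := (hd.hasFDerivAt.clm_apply (hasFDerivAt_const a x)).fderiv
  rw [this]; simp

lemma second_symm {h : E → ℝ} (H : ContDiff ℝ 2 h) (x a b : E) :
    fderiv ℝ (fderiv ℝ h) x a b = fderiv ℝ (fderiv ℝ h) x b a :=
  (H.contDiffAt.isSymmSndFDerivAt (by simp)) a b

lemma Har.deriv {h : E → ℝ} (H : Har h) (a : E) : Har (fun x => fderiv ℝ h x a) := by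
  obtain ⟨k, hk, hd⟩ := id H
  refine ⟨k - 1, W_deriv a k h hk, fun x => ?_⟩
  have hs : ∀ {n : WithTop ℕ∞} (b : E), ContDiff ℝ n (fun x => fderiv ℝ h x b) := fun b =>
    W_smooth (W_deriv b k h hk)
  have e1 : ∀ u : E → ℝ, ContDiff ℝ 2 u → ∀ x, dl u x =
      ∑ i, fderiv ℝ (fun y => fderiv ℝ u y (stdOrthonormalBasis ℝ E i)) x (stdOrthonormalBasis ℝ E i) := by
    intro u hu x
    unfold dl bt
    exact Finset.sum_congr rfl fun i _ => (second_apply hu _ _ _).symm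
  rw [e1 _ (hs a)]
  have e2 : ∀ i, fderiv ℝ (fun y => fderiv ℝ (fun x => fderiv ℝ h x a) y (stdOrthonormalBasis ℝ E i)) x
      (stdOrthonormalBasis ℝ E i) = fderiv ℝ (fun y => fderiv ℝ (fun z => fderiv ℝ h z
        (stdOrthonormalBasis ℝ E i)) y (stdOrthonormalBasis ℝ E i)) x a := by
    intro i
    set e := stdOrthonormalBasis ℝ E i
    have : (fun y => fderiv ℝ (fun x => fderiv ℝ h x a) y e) =
        fun y => fderiv ℝ (fun x => fderiv ℝ h x e) y a := by
      ext y
      rw [second_apply H.cd, second_apply H.cd, second_symm H.cd]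
    rw [this, second_apply (hs e), second_apply (hs e), second_symm (hs e)]
  simp_rw [e2]
  have e3 : dl h = fun _ => 0 := funext hd
  have e4 : (fun y => ∑ i, fderiv ℝ (fun z => fderiv ℝ h z (stdOrthonormalBasis ℝ E i)) y
      (stdOrthonormalBasis ℝ E i)) = fun _ => (0:ℝ) := by
    ext y; rw [← e1 h H.cd y, e3]
  have e5 := congrArg (fun g => fderiv ℝ g x a) e4
  rw [fderiv_fun_sum] at e5
  · simpa using e5
  · intro i _
    have : (fun y => fderiv ℝ (fun z => fderiv ℝ h z (stdOrthonormalBasis ℝ E i)) y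
      (stdOrthonormalBasis ℝ E i)) ∈ W (E := E) (k - 1 - 1) := W_deriv _ _ _ (W_deriv _ _ _ hk)
    exact ((W_smooth this (n := 1)).differentiable (by norm_num)).differentiableAt

lemma Har.grad (hN : 1 ≤ dm E) {h : E → ℝ} (H : Har h) {x : E} {ρ M : ℝ} (hρ : 0 < ρ)
    (hb : ∀ y ∈ Metric.closedBall x ρ, |h y| ≤ M) : ‖fderiv ℝ h x‖ ≤ 6 * dm E / ρ * M := by
  have hN0 : 0 < dm E := by linarith
  have key : ∀ M > 0, (∀ y ∈ Metric.closedBall x ρ, |h y| ≤ M) → ‖fderiv ℝ h x‖ ≤ 6 * dm E / ρ * M := by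
    intro M hM hb
    have := int_lip hN hρ hM le_rfl H.cont.continuousOn hb
      (fun y _ => by obtain ⟨p, A, h1, h2⟩ := H.jet y; exact ⟨p, A, h1, by simp [h2]⟩)
    refine norm_le_of_lip (by positivity)
      ((H.cd (n := 1)).differentiable (by norm_num) x).hasFDerivAt ?_
    filter_upwards [Metric.closedBall_mem_nhds x hρ] with y hy
    refine (this y hy).trans (le_of_eq ?_)
    ring
  have hM : 0 ≤ M := (abs_nonneg _).trans (hb x (by simp [hρ.le]))
  rcases hM.lt_or_eq with h1 | h1
  · exact key M h1 hb
  · by_contra hcon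
    rw [← h1] at hcon hb
    push Not at hcon
    rw [mul_zero] at hcon
    have := key (‖fderiv ℝ h x‖ * ρ / (12 * dm E)) (by positivity)
      (fun y hy => (hb y hy).trans (by positivity))
    have e : 6 * dm E / ρ * (‖fderiv ℝ h x‖ * ρ / (12 * dm E)) = ‖fderiv ℝ h x‖ / 2 := by
      field_simp; ring
    linarith

lemma mv_pow {g : E → ℝ} {g' : E → Du E} {x₀ : E} {r C : ℝ} {m : ℕ} (hC : 0 ≤ C)
    (hd : ∀ z, HasFDerivAt g (g' z) z) (hb : ∀ z ∈ Metric.closedBall x₀ r, ‖g' z‖ ≤ C * ‖z - x₀‖ ^ m)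
    (h0 : g x₀ = 0) : ∀ y ∈ Metric.closedBall x₀ r, |g y| ≤ C * ‖y - x₀‖ ^ (m + 1) := by
  intro y hy
  have := (convex_closedBall x₀ ‖y - x₀‖).norm_image_sub_le_of_norm_hasFDerivWithin_le
    (f := g) (f' := g') (C := C * ‖y - x₀‖ ^ m) (x := x₀) (y := y)
    (fun z _ => (hd z).hasFDerivWithinAt) ?_ (by simp) (by simp [dist_eq_norm])
  · rw [h0, sub_zero, Real.norm_eq_abs] at this
    rw [pow_succ, ← mul_assoc]; exact this
  · intro z hz
    rw [Metric.mem_closedBall, dist_eq_norm] at hz hy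
    refine (hb z (by rw [Metric.mem_closedBall, dist_eq_norm]; linarith)).trans ?_
    gcongr

/-- Taylor estimates for harmonic polynomials. -/
lemma har_taylor (hN : 1 ≤ dm E) {h : E → ℝ} (H : Har h) {x₀ : E} {r M : ℝ} (hr : 0 < r)
    (hb : ∀ y ∈ Metric.closedBall x₀ r, |h y| ≤ M) :
    ∃ (p : Du E) (A : Bi E), Jet h x₀ p A ∧ bt A = 0 ∧ ‖p‖ ≤ (48 * dm E / r) * M ∧
      ‖A‖ ≤ (48 * dm E / r) ^ 2 * M ∧
      (∀ y ∈ Metric.closedBall x₀ (r / 2), |h y - h x₀ - p (y - x₀)| ≤ (48 * dm E / r) ^ 2 * M * ‖y - x₀‖ ^ 2) ∧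
      (∀ y ∈ Metric.closedBall x₀ (r / 2), |h y - h x₀ - p (y - x₀) - 1 / 2 * A (y - x₀) (y - x₀)| ≤
        (48 * dm E / r) ^ 3 * M * ‖y - x₀‖ ^ 3) := by
  have hN0 : 0 < dm E := by linarith
  set D := 48 * dm E / r with hD
  have hD0 : 0 < D := by positivity
  have hM : 0 ≤ M := (abs_nonneg _).trans (hb x₀ (by simp [hr.le]))
  have step : ∀ (k : E → ℝ), Har k → ∀ B t, (∀ y ∈ Metric.closedBall x₀ t, |k y| ≤ B) →
      ∀ y ∈ Metric.closedBall x₀ (t - r / 8), ‖fderiv ℝ k y‖ ≤ D * B := by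
    intro k K B t hk y hy
    have := K.grad hN (x := y) (ρ := r / 8) (by positivity) (M := B) fun z hz => hk z (by
      rw [Metric.mem_closedBall] at hy hz ⊢
      linarith [dist_triangle z y x₀])
    refine this.trans (le_of_eq ?_)
    rw [hD]; field_simp; ring
  have s1 := step h H M r hb
  have s2 : ∀ a, ∀ y ∈ Metric.closedBall x₀ (r - r / 8 - r / 8), ‖fderiv ℝ (fun x => fderiv ℝ h x a) y‖ ≤
      D * (D * M * ‖a‖) := fun a => step _ (H.deriv a) _ _ fun y hy =>
        ((fderiv ℝ h y).le_opNorm a).trans (by gcongr; exact s1 y hy)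
  have s3 : ∀ a b, ∀ y ∈ Metric.closedBall x₀ (r - r / 8 - r / 8 - r / 8),
      ‖fderiv ℝ (fun x => fderiv ℝ (fun x => fderiv ℝ h x a) x b) y‖ ≤
      D * (D * (D * M * ‖a‖) * ‖b‖) := fun a b => step _ ((H.deriv a).deriv b) _ _ fun y hy =>
        ((fderiv ℝ (fun x => fderiv ℝ h x a) y).le_opNorm b).trans (by gcongr; exact s2 a y hy)
  have hsub2 : Metric.closedBall x₀ (r / 2) ⊆ Metric.closedBall x₀ (r - r / 8 - r / 8) :=
    Metric.closedBall_subset_closedBall (by linarith)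
  have hsub3 : Metric.closedBall x₀ (r / 2) ⊆ Metric.closedBall x₀ (r - r / 8 - r / 8 - r / 8) :=
    Metric.closedBall_subset_closedBall (by linarith)
  have t0 : ∀ (k : E → ℝ), Har k → ∀ B, 0 ≤ B → (∀ y ∈ Metric.closedBall x₀ (r / 2), ‖fderiv ℝ k y‖ ≤ B) →
      ∀ y ∈ Metric.closedBall x₀ (r / 2), |k y - k x₀| ≤ B * ‖y - x₀‖ := by
    intro k K B hB hk y hy
    have := mv_pow (g := fun y => k y - k x₀) (m := 0) hB
      (fun z => (((K.cd (n := 1)).differentiable (by norm_num) z).hasFDerivAt).sub_const (k x₀))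
      (fun z hz => by simpa using hk z hz) (by simp) y hy
    simpa using this
  have t1 : ∀ (k : E → ℝ), Har k → ∀ B, 0 ≤ B → (∀ a, ∀ y ∈ Metric.closedBall x₀ (r / 2),
      ‖fderiv ℝ (fun x => fderiv ℝ k x a) y‖ ≤ B * ‖a‖) →
      ∀ y ∈ Metric.closedBall x₀ (r / 2), |k y - k x₀ - fderiv ℝ k x₀ (y - x₀)| ≤ B * ‖y - x₀‖ ^ 2 := by
    intro k K B hB hk
    refine mv_pow (g := fun y => k y - k x₀ - fderiv ℝ k x₀ (y - x₀)) (m := 1) hB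
      (g' := fun z => fderiv ℝ k z - fderiv ℝ k x₀)
      (fun z => ((((K.cd (n := 1)).differentiable (by norm_num) z).hasFDerivAt).sub_const (k x₀)).sub
        (jet_lin (fderiv ℝ k x₀) x₀ z).hasFDerivAt)
      (fun z hz => ?_) (by simp)
    refine ContinuousLinearMap.opNorm_le_bound _ (by positivity) fun a => ?_
    have := t0 _ (K.deriv a) _ (by positivity) (hk a) z hz
    rw [Real.norm_eq_abs]
    refine this.trans (le_of_eq (by ring))
  refine ⟨fderiv ℝ h x₀, fderiv ℝ (fderiv ℝ h) x₀, jet_of_contDiffAt H.cd.contDiffAt,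
    H.choose_spec.2 x₀, s1 x₀ (Metric.mem_closedBall_self (by linarith)), ?_, ?_, ?_⟩
  · refine ContinuousLinearMap.opNorm_le_bound _ (by positivity) fun a => ?_
    refine ContinuousLinearMap.opNorm_le_bound _ (by positivity) fun b => ?_
    have := ((fderiv ℝ (fun x => fderiv ℝ h x b) x₀).le_opNorm a).trans
      (mul_le_mul_of_nonneg_right (s2 b x₀ (Metric.mem_closedBall_self (by linarith))) (norm_nonneg a))
    rw [second_apply H.cd] at this
    refine this.trans (le_of_eq (by ring))
  · refine t1 h H (D ^ 2 * M) (by positivity) fun a y hy => (s2 a y (hsub2 hy)).trans (le_of_eq (by ring))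
  · refine mv_pow (m := 2) (by positivity)
      (g' := fun z => fderiv ℝ h z - fderiv ℝ h x₀ - (1 / 2 : ℝ) • (fderiv ℝ (fderiv ℝ h) x₀ (z - x₀) +
        (fderiv ℝ (fderiv ℝ h) x₀).flip (z - x₀)))
      (fun z => ?_) (fun z hz => ?_) (by simp)
    · have e1 := ((((H.cd (n := 1)).differentiable (by norm_num) z).hasFDerivAt).sub_const (h x₀)).sub
        (jet_lin (fderiv ℝ h x₀) x₀ z).hasFDerivAt
      have e2 := (jet_quad 0 0 (fderiv ℝ (fderiv ℝ h) x₀) x₀ z).hasFDerivAt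
      refine ((e1.sub e2).congr_of_eventuallyEq (Eventually.of_forall fun y => ?_)).congr_fderiv ?_
      · simp [-map_sub]
      · ext b; simp [-map_sub]
    · refine ContinuousLinearMap.opNorm_le_bound _ (by positivity) fun a => ?_
      have := t1 _ (H.deriv a) (D ^ 3 * M * ‖a‖) (by positivity) (fun b y hy =>
        (s3 a b y (hsub3 hy)).trans (le_of_eq (by ring))) z hz
      rw [second_apply H.cd] at this
      rw [Real.norm_eq_abs]
      have e : (fderiv ℝ h z - fderiv ℝ h x₀ - (1 / 2 : ℝ) • (fderiv ℝ (fderiv ℝ h) x₀ (z - x₀) +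
        (fderiv ℝ (fderiv ℝ h) x₀).flip (z - x₀))) a =
        fderiv ℝ h z a - fderiv ℝ h x₀ a - fderiv ℝ (fderiv ℝ h) x₀ (z - x₀) a := by
        simp only [ContinuousLinearMap.sub_apply, ContinuousLinearMap.smul_apply,
          ContinuousLinearMap.add_apply, ContinuousLinearMap.flip_apply, smul_eq_mul]
        rw [second_symm H.cd x₀ a (z - x₀)]; ring
      rw [e]
      refine this.trans (le_of_eq (by ring))

end har

/-! ## Part 6: Campanato iteration -/
section camp

lemma rpow_geo {l d τ : ℝ} (hl : 0 < l) (hd : 0 < d) (k : ℕ) :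
    (l ^ k * d) ^ τ = (l ^ τ) ^ k * d ^ τ := by
  rw [Real.mul_rpow (by positivity) hd.le, ← Real.rpow_natCast, ← Real.rpow_natCast,
    ← Real.rpow_mul hl.le, ← Real.rpow_mul hl.le, mul_comm τ]

lemma camp_limit {Z : Type*} [NormedAddCommGroup Z] [CompleteSpace Z] {z : ℕ → Z} {C τ l d : ℝ}
    (hl : 0 < l) (hl1 : l < 1) (hd : 0 < d) (hτ : C = 0 ∨ 0 < τ)
    (h : ∀ k, ‖z (k + 1) - z k‖ ≤ C * (l ^ k * d) ^ τ) :
    ∃ z', Tendsto z atTop (𝓝 z') ∧ ∀ k, ‖z k - z'‖ ≤ C / (1 - l ^ τ) * (l ^ k * d) ^ τ := by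
  rcases hτ with hC | hτ
  · have hc : ∀ k, z k = z 0 := by
      intro k
      induction k with
      | zero => rfl
      | succ k ih =>
        have := h k
        rw [hC, zero_mul] at this
        have := norm_le_zero_iff.1 this
        rw [sub_eq_zero] at this
        rw [this, ih]
    refine ⟨z 0, ?_, fun k => by rw [hc k, hC]; simp⟩
    have : z = fun _ => z 0 := funext hc
    rw [this]; exact tendsto_const_nhds
  · have hr : l ^ τ < 1 := Real.rpow_lt_one hl.le hl1 hτ
    have hg : ∀ n, dist (z n) (z (n + 1)) ≤ (C * d ^ τ) * (l ^ τ) ^ n := by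
      intro n
      rw [dist_eq_norm, norm_sub_rev]
      refine (h n).trans (le_of_eq ?_)
      rw [rpow_geo hl hd]; ring
    obtain ⟨z', hz'⟩ := cauchySeq_tendsto_of_complete (cauchySeq_of_le_geometric _ _ hr hg)
    refine ⟨z', hz', fun k => ?_⟩
    have := dist_le_of_le_geometric_of_tendsto _ _ hr hg hz' k
    rw [dist_eq_norm] at this
    refine this.trans (le_of_eq ?_)
    rw [rpow_geo hl hd]; ring

lemma campanato {E Z0 Z1 Z2 : Type*} [NormedAddCommGroup E]
    [NormedAddCommGroup Z0] [CompleteSpace Z0]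
    [NormedAddCommGroup Z1] [CompleteSpace Z1] [NormedAddCommGroup Z2] [CompleteSpace Z2]
    {C C2 L l s : ℝ} (hC : 0 ≤ C) (hC2 : 0 ≤ C2) (hL : 0 ≤ L) (hl : 0 < l) (hl1 : l < 1) (hs : 1 < s)
    (hs2 : C2 = 0 ∨ 2 < s) :
    ∃ C' : ℝ, 0 ≤ C' ∧ ∀ (Q : Z0 → Z1 → Z2 → E → ℝ) (P : Set (Z0 × Z1 × Z2)) (u : E → ℝ) (D : Set E) (x₀ : E)
      (d K : ℝ) (z0 : Z0) (z1 : Z1) (z2 : Z2), 0 < d → 0 ≤ K → IsClosed P →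
      (∀ z0 z1 z2 z0' z1' z2', ∀ y ∈ D, ‖y - x₀‖ ≤ d → |Q z0 z1 z2 y - Q z0' z1' z2' y| ≤
        L * (‖z0 - z0'‖ + ‖z1 - z1'‖ * ‖y - x₀‖ + ‖z2 - z2'‖ * ‖y - x₀‖ ^ 2)) →
      (∀ (r : ℝ) w0 w1 w2, 0 < r → r ≤ d → (w0, w1, w2) ∈ P →
        ‖w1 - z1‖ ≤ C' * K * d ^ (s - 1) → ‖w2 - z2‖ ≤ C' * K * d ^ (s - 2) →
        (∀ y ∈ D, ‖y - x₀‖ ≤ r → |u y - Q w0 w1 w2 y| ≤ K * r ^ s) →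
        ∃ z0' z1' z2', (z0', z1', z2') ∈ P ∧ ‖z0' - w0‖ ≤ C * K * r ^ s ∧
          ‖z1' - w1‖ ≤ C * K * r ^ (s - 1) ∧ ‖z2' - w2‖ ≤ C2 * K * r ^ (s - 2) ∧
          ∀ y ∈ D, ‖y - x₀‖ ≤ l * r → |u y - Q z0' z1' z2' y| ≤ K * (l * r) ^ s) →
      (z0, z1, z2) ∈ P → (∀ y ∈ D, ‖y - x₀‖ ≤ d → |u y - Q z0 z1 z2 y| ≤ K * d ^ s) →
      ∃ z0' z1' z2', (z0', z1', z2') ∈ P ∧ ‖z0' - z0‖ ≤ C' * K * d ^ s ∧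
          ‖z1' - z1‖ ≤ C' * K * d ^ (s - 1) ∧ ‖z2' - z2‖ ≤ C' * K * d ^ (s - 2) ∧
          ∀ y ∈ D, ‖y - x₀‖ ≤ d → |u y - Q z0' z1' z2' y| ≤ C' * K * ‖y - x₀‖ ^ s := by
  have h0 : 0 < 1 - l ^ s := by linarith [Real.rpow_lt_one hl.le hl1 (show 0 < s by linarith)]
  have h1 : 0 < 1 - l ^ (s - 1) := by linarith [Real.rpow_lt_one hl.le hl1 (show 0 < s - 1 by linarith)]
  set D0 := C / (1 - l ^ s) with hD0
  set D1 := C / (1 - l ^ (s - 1)) with hD1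
  set D2 := C2 / (1 - l ^ (s - 2)) with hD2
  have p0 : 0 ≤ D0 := by positivity
  have p1 : 0 ≤ D1 := by positivity
  have p2 : 0 ≤ D2 := by
    rcases hs2 with h | h
    · rw [hD2, h]; simp
    · have : 0 < 1 - l ^ (s - 2) := by linarith [Real.rpow_lt_one hl.le hl1 (show 0 < s - 2 by linarith)]
      positivity
  have c1 : C = D1 * (1 - l ^ (s - 1)) := by rw [hD1]; field_simp
  have c2 : C2 = D2 * (1 - l ^ (s - 2)) := by
    rcases hs2 with h | h
    · rw [hD2, h]; simp
    · have : 0 < 1 - l ^ (s - 2) := by linarith [Real.rpow_lt_one hl.le hl1 (show 0 < s - 2 by linarith)]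
      rw [hD2]; field_simp
  set X := 1 + L * (D0 + D1 + D2) with hX
  have hX1 : 0 ≤ X := by positivity
  have hls : 0 < l ^ s := by positivity
  refine ⟨X / l ^ s + D0 + D1 + D2, by positivity, ?_⟩
  intro Q P u D x₀ d K z0 z1 z2 hd hK hP hQ hstep hz hu
  -- build the sequence
  let Good : ℕ → Z0 × Z1 × Z2 → Prop := fun k z => z ∈ P ∧
    (‖z.2.1 - z1‖ ≤ D1 * K * (d ^ (s - 1) - (l ^ k * d) ^ (s - 1)) ∧
     ‖z.2.2 - z2‖ ≤ D2 * K * (d ^ (s - 2) - (l ^ k * d) ^ (s - 2))) ∧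
    ∀ y ∈ D, ‖y - x₀‖ ≤ l ^ k * d → |u y - Q z.1 z.2.1 z.2.2 y| ≤ K * (l ^ k * d) ^ s
  have hrk : ∀ k : ℕ, 0 < l ^ k * d ∧ l ^ k * d ≤ d := fun k =>
    ⟨by positivity, mul_le_of_le_one_left hd.le (pow_le_one₀ hl.le hl1.le)⟩
  have hbd : ∀ (A τ : ℝ) (k : ℕ), 0 ≤ A → A ≤ X / l ^ s + D0 + D1 + D2 →
      A * K * (d ^ τ - (l ^ k * d) ^ τ) ≤ (X / l ^ s + D0 + D1 + D2) * K * d ^ τ := by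
    intro A τ k hA hA'
    have q1 : 0 ≤ (l ^ k * d) ^ τ := Real.rpow_nonneg (hrk k).1.le _
    calc A * K * (d ^ τ - (l ^ k * d) ^ τ) ≤ A * K * d ^ τ := by gcongr; linarith
      _ ≤ _ := by gcongr
  have next : ∀ k (z : Z0 × Z1 × Z2), Good k z → ∃ z' : Z0 × Z1 × Z2, Good (k + 1) z' ∧
      ‖z'.1 - z.1‖ ≤ C * K * (l ^ k * d) ^ s ∧
      ‖z'.2.1 - z.2.1‖ ≤ C * K * (l ^ k * d) ^ (s - 1) ∧
      ‖z'.2.2 - z.2.2‖ ≤ C2 * K * (l ^ k * d) ^ (s - 2) := by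
    intro k z hg
    obtain ⟨a, b, c, e1, e2, e3, e4, e5⟩ := hstep (l ^ k * d) z.1 z.2.1 z.2.2 (hrk k).1 (hrk k).2 hg.1
      (hg.2.1.1.trans (hbd _ _ _ p1 (by have : 0 ≤ X / l ^ s := by positivity
                                        linarith)))
      (hg.2.1.2.trans (hbd _ _ _ p2 (by have : 0 ≤ X / l ^ s := by positivity
                                        linarith))) hg.2.2
    have hlk : l ^ (k + 1) * d = l * (l ^ k * d) := by ring
    have hmr : ∀ τ : ℝ, (l * (l ^ k * d)) ^ τ = l ^ τ * (l ^ k * d) ^ τ := fun τ =>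
      Real.mul_rpow hl.le (hrk k).1.le
    refine ⟨(a, b, c), ⟨e1, ⟨?_, ?_⟩, ?_⟩, e2, e3, e4⟩
    · rw [hlk, hmr]
      refine (norm_sub_le_norm_sub_add_norm_sub b z.2.1 z1).trans ?_
      refine (add_le_add e3 hg.2.1.1).trans (le_of_eq ?_)
      rw [c1]; ring
    · rw [hlk, hmr]
      refine (norm_sub_le_norm_sub_add_norm_sub c z.2.2 z2).trans ?_
      refine (add_le_add e4 hg.2.1.2).trans (le_of_eq ?_)
      rw [c2]; ring
    · rw [hlk]
      exact e5
  choose! nx hnx using next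
  let seq : ℕ → Z0 × Z1 × Z2 := fun k => Nat.rec (z0, z1, z2) (fun k z => nx k z) k
  have hseq : ∀ k, Good k (seq k) := by
    intro k
    induction k with
    | zero => exact ⟨hz, by simp [seq], by simpa [seq] using hu⟩
    | succ k ih => exact (hnx k _ ih).1
  have hd0 : ∀ k, ‖(seq (k+1)).1 - (seq k).1‖ ≤ C * K * (l ^ k * d) ^ s := fun k => (hnx k _ (hseq k)).2.1
  have hd1 : ∀ k, ‖(seq (k+1)).2.1 - (seq k).2.1‖ ≤ C * K * (l ^ k * d) ^ (s - 1) :=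
    fun k => (hnx k _ (hseq k)).2.2.1
  have hd2 : ∀ k, ‖(seq (k+1)).2.2 - (seq k).2.2‖ ≤ C2 * K * (l ^ k * d) ^ (s - 2) :=
    fun k => (hnx k _ (hseq k)).2.2.2
  obtain ⟨a, ha, ha'⟩ := camp_limit (z := fun k => (seq k).1) hl hl1 hd (Or.inr (by linarith)) hd0
  obtain ⟨b, hb, hb'⟩ := camp_limit (z := fun k => (seq k).2.1) hl hl1 hd (Or.inr (by linarith)) hd1
  obtain ⟨c, hc, hc'⟩ := camp_limit (z := fun k => (seq k).2.2) hl hl1 hd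
    (by rcases hs2 with h | h
        · left; rw [h, zero_mul]
        · right; linarith) hd2
  have f0 : ∀ k, ‖(seq k).1 - a‖ ≤ D0 * K * (l ^ k * d) ^ s := fun k =>
    (ha' k).trans (le_of_eq (by rw [hD0]; ring))
  have f1 : ∀ k, ‖(seq k).2.1 - b‖ ≤ D1 * K * (l ^ k * d) ^ (s - 1) := fun k =>
    (hb' k).trans (le_of_eq (by rw [hD1]; ring))
  have f2 : ∀ k, ‖(seq k).2.2 - c‖ ≤ D2 * K * (l ^ k * d) ^ (s - 2) := fun k =>
    (hc' k).trans (le_of_eq (by rw [hD2]; ring))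
  have est : ∀ k, ∀ y ∈ D, ‖y - x₀‖ ≤ l ^ k * d → |u y - Q a b c y| ≤ X * K * (l ^ k * d) ^ s := by
    intro k y hy hyk
    obtain ⟨hr0, hr1⟩ := hrk k
    set r := l ^ k * d
    have g1 := (hseq k).2.2 y hy hyk
    have g2 := hQ (seq k).1 (seq k).2.1 (seq k).2.2 a b c y hy (hyk.trans hr1)
    have e1 : r ^ (s - 1) * r = r ^ s := by
      rw [Real.rpow_sub_one hr0.ne']; field_simp
    have e2 : r ^ (s - 2) * r ^ 2 = r ^ s := by
      rw [← Real.rpow_natCast, ← Real.rpow_add hr0]; norm_num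
    have g3 : ‖(seq k).2.1 - b‖ * ‖y - x₀‖ ≤ D1 * K * r ^ s := by
      rw [← e1, ← mul_assoc]; exact mul_le_mul (f1 k) hyk (norm_nonneg _) (by positivity)
    have g4 : ‖(seq k).2.2 - c‖ * ‖y - x₀‖ ^ 2 ≤ D2 * K * r ^ s := by
      rw [← e2, ← mul_assoc]
      exact mul_le_mul (f2 k) (by gcongr) (by positivity) (by positivity)
    have g5 := f0 k
    calc |u y - Q a b c y| ≤ |u y - Q (seq k).1 (seq k).2.1 (seq k).2.2 y| +
          |Q (seq k).1 (seq k).2.1 (seq k).2.2 y - Q a b c y| := abs_sub_le _ _ _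
      _ ≤ K * r ^ s + L * (D0 * K * r ^ s + D1 * K * r ^ s + D2 * K * r ^ s) := by
          refine add_le_add g1 (g2.trans ?_)
          gcongr
      _ = X * K * r ^ s := by rw [hX]; ring
  refine ⟨a, b, c, ?_, ?_, ?_, ?_, ?_⟩
  · exact hP.mem_of_tendsto (ha.prodMk_nhds (hb.prodMk_nhds hc)) (Eventually.of_forall fun k => (hseq k).1)
  · have := f0 0
    simp only [pow_zero, one_mul] at this
    rw [norm_sub_rev]
    refine this.trans ?_
    gcongr
    have : 0 ≤ X / l ^ s := by positivity
    linarith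
  · have := f1 0
    simp only [pow_zero, one_mul] at this
    rw [norm_sub_rev]
    refine this.trans ?_
    gcongr
    have : 0 ≤ X / l ^ s := by positivity
    linarith
  · have := f2 0
    simp only [pow_zero, one_mul] at this
    rw [norm_sub_rev]
    refine this.trans ?_
    gcongr
    have : 0 ≤ X / l ^ s := by positivity
    linarith
  · intro y hy hyd
    rcases (norm_nonneg (y - x₀)).lt_or_eq with hpos | hzero
    · obtain ⟨k, hk1, hk2⟩ := exists_nat_pow_near_of_lt_one (x := ‖y - x₀‖ / d) (by positivity)
        ((div_le_one hd).2 hyd) hl hl1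
      rw [lt_div_iff₀ hd] at hk1
      rw [div_le_iff₀ hd] at hk2
      refine (est k y hy hk2).trans ?_
      have : (l * (l ^ k * d)) ^ s ≤ ‖y - x₀‖ ^ s := by
        refine Real.rpow_le_rpow (by positivity) ?_ (by linarith)
        have : l * (l ^ k * d) = l ^ (k + 1) * d := by ring
        rw [this]; exact hk1.le
      rw [Real.mul_rpow hl.le (by positivity)] at this
      have h2 : (l ^ k * d) ^ s ≤ ‖y - x₀‖ ^ s / l ^ s := by
        rw [le_div_iff₀ hls]; linarith
      calc X * K * (l ^ k * d) ^ s ≤ X * K * (‖y - x₀‖ ^ s / l ^ s) := by gcongr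
        _ = (X / l ^ s) * K * ‖y - x₀‖ ^ s := by ring
        _ ≤ _ := by gcongr; linarith
    · rw [← hzero, Real.zero_rpow (by linarith), mul_zero]
      have ht : Tendsto (fun k : ℕ => X * K * (l ^ k * d) ^ s) atTop (𝓝 (X * K * 0)) := by
        refine Tendsto.const_mul _ ?_
        have : (fun k : ℕ => (l ^ k * d) ^ s) = fun k => (l ^ s) ^ k * d ^ s := by
          ext k; exact rpow_geo hl hd k
        rw [this]
        have := (tendsto_pow_atTop_nhds_zero_of_lt_one hls.le (show l ^ s < 1 by linarith)).mul_const (d ^ s)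
        simpa using this
      rw [mul_zero] at ht
      exact ge_of_tendsto' ht fun k => est k y hy (by rw [← hzero]; exact (hrk k).1.le)

end camp

/-! ## Part 7: interior regularity -/
section intreg
variable {E : Type*} [NormedAddCommGroup E] [InnerProductSpace ℝ E] [FiniteDimensional ℝ E]

lemma bi_norm_zero : ‖(0 : Bi E)‖ = 0 :=
  le_antisymm ((0 : Bi E).opNorm_le_bound le_rfl fun x => by
    have : (0 : Bi E) x = 0 := rfl
    rw [this, norm_zero, zero_mul]) (ContinuousLinearMap.opNorm_nonneg _)

lemma bi_norm_smul (c : ℝ) (A : Bi E) : ‖c • A‖ ≤ |c| * ‖A‖ :=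
  ContinuousLinearMap.opNorm_smul_le c A

lemma bi_norm_add (A B : Bi E) : ‖A + B‖ ≤ ‖A‖ + ‖B‖ := ContinuousLinearMap.opNorm_add_le A B

lemma bi_norm_le (A B : Bi E) : ‖A‖ ≤ ‖A - B‖ + ‖B‖ := by
  have : A = (A - B) + B := by ext a b; simp
  exact (congrArg norm this).le.trans (bi_norm_add _ _)

lemma bi_norm_neg (A : Bi E) : ‖-A‖ = ‖A‖ := ContinuousLinearMap.opNorm_neg A

lemma bi_norm_sub (A B : Bi E) : ‖A - B‖ ≤ ‖A‖ + ‖B‖ := by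
  have : A - B = A + -B := by ext a b; simp; ring
  rw [this, ← bi_norm_neg B]; exact bi_norm_add _ _

lemma bi_sub_comm (A B : Bi E) : ‖A - B‖ = ‖B - A‖ := by
  have : A - B = -(B - A) := by ext a b; simp
  rw [this, bi_norm_neg]

lemma bi_add_sub (A B : Bi E) : A + B - A = B := by ext a b; simp

lemma alg_aux {r : ℝ} (hr : r ≠ 0) (B K l : ℝ) (x : ℝ) (n : ℕ) :
    (B / r) ^ n * (2 * K * x) * (l * r) ^ n = (2 * B ^ n * l ^ n) * K * x := by
  rw [div_pow, mul_pow]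
  have := pow_ne_zero n hr
  field_simp

lemma bi_norm_le_of {A : Bi E} {C : ℝ} (hC : 0 ≤ C) (h : ∀ a b, |A a b| ≤ C * ‖a‖ * ‖b‖) : ‖A‖ ≤ C :=
  A.opNorm_le_bound₂ hC fun a b => h a b

lemma Har.smul {h : E → ℝ} (H : Har h) (c : ℝ) : Har (fun x => c * h x) := by
  obtain ⟨k, hk, hd⟩ := id H
  refine ⟨k, Submodule.smul_mem _ c hk, fun x => ?_⟩
  have : dl (c • h) x = c * dl h x := dl_smul H.cd c
  rw [hd x, mul_zero] at this
  exact this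

lemma Har.neg {h : E → ℝ} (H : Har h) : Har (fun x => - h x) := by
  simpa using H.smul (-1)

/-- one-sided comparison with a harmonic polynomial -/
lemma har_comp (hN : 1 ≤ dm E) {u h : E → ℝ} (H : Har h) {U : Set E} (hU : IsOpen U) {x₀ : E} {r κ e : ℝ}
    (hr : 0 < r) (hκ : 0 ≤ κ) (hUr : U ⊆ Metric.ball x₀ r)
    (hc : ContinuousOn u (closure U)) (hs : ∀ x ∈ U, ViSub (cst κ) u x)
    (hb : ∀ x ∈ frontier U, u x ≤ h x + e) : ∀ x ∈ closure U, u x ≤ h x + e + κ * r ^ 2 / 2 := by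
  have hN0 : 0 < dm E := by linarith
  have hsubc : closure U ⊆ Metric.closedBall x₀ r :=
    (closure_mono hUr).trans Metric.closure_ball_subset_closedBall
  set b : ℝ := κ / (2 * dm E) with hbdef
  have hb0 : 0 ≤ b := by positivity
  have hb1 : b ≤ κ / 2 := by rw [hbdef]; gcongr; linarith
  have hpos : ∀ x ∈ closure U, 0 ≤ r ^ 2 - ‖x - x₀‖ ^ 2 := fun x hx => by
    have := hsubc hx
    rw [Metric.mem_closedBall, dist_eq_norm] at this
    have : ‖x - x₀‖ ^ 2 ≤ r ^ 2 := by gcongr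
    linarith
  have key := maxprinc hU (Metric.isBounded_ball.subset hUr) hN (f := fun _ => κ) (v := u)
    (h := fun x => (h x + e) + b * (r ^ 2 - ‖x - x₀‖ ^ 2)) hc
    (by have := H.cont; fun_prop) (fun x hx => hs x hx) (fun x hx => ?_) (fun x hx => ?_)
  · intro x hx
    refine (key x hx).trans ?_
    have : b * (r ^ 2 - ‖x - x₀‖ ^ 2) ≤ κ / 2 * r ^ 2 :=
      mul_le_mul hb1 (by linarith [sq_nonneg ‖x - x₀‖]) (hpos x hx) (by positivity)
    linarith
  · obtain ⟨p, A, h1, h2⟩ := H.jet x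
    refine ⟨_, _, (h1.add (jet_const e x)).add (((jet_const (r ^ 2) x).sub (jet_sq x₀ x)).smul b), ?_⟩
    simp only [bt_add, bt_smul, bt_sub, bt_zero, bt_ip, h2, hbdef]
    apply le_of_eq; field_simp; ring
  · have := hb x hx
    have := mul_nonneg hb0 (hpos x (frontier_subset_closure hx))
    linarith

lemma har_approx (hN : 1 ≤ dm E) {u : E → ℝ} {x₀ : E} {r κ : ℝ} (hr : 0 < r) (hκ : 0 < κ)
    (hc : ContinuousOn u (Metric.closedBall x₀ r))
    (hs : ∀ x ∈ Metric.ball x₀ r, ViSub (cst κ) u x ∧ ViSup (cst (-κ)) u x) :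
    ∃ h, Har h ∧ ∀ x ∈ Metric.closedBall x₀ r, |u x - h x| ≤ κ * r ^ 2 := by
  have hcl : closure (Metric.ball x₀ r) = Metric.closedBall x₀ r := closure_ball _ hr.ne'
  obtain ⟨k, g, hg, hga⟩ := W_dense (isCompact_sphere x₀ r)
    (hc.mono Metric.sphere_subset_closedBall) (show 0 < κ * r ^ 2 / 2 by positivity)
  obtain ⟨n, h, hh, h1, h2⟩ := poly_dirichlet hN x₀ hr (Submodule.zero_mem (W (E := E) 0)) hg
  have H : Har h := ⟨n, hh, fun x => by simpa using h1 x⟩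
  have hfr : ∀ x ∈ frontier (Metric.ball x₀ r), |h x - u x| ≤ κ * r ^ 2 / 2 := by
    intro x hx
    rw [frontier_ball _ hr.ne'] at hx
    rw [h2 x (by simpa [dist_eq_norm] using hx)]
    exact hga x hx
  refine ⟨h, H, fun x hx => ?_⟩
  rw [← hcl] at hx hc
  have a1 := har_comp hN H Metric.isOpen_ball hr hκ.le subset_rfl hc (fun x hx => (hs x hx).1)
    (e := κ * r ^ 2 / 2) (fun y hy => by linarith [(abs_le.1 (hfr y hy)).1]) x hx
  have a2 := har_comp hN (u := fun y => -u y) H.neg Metric.isOpen_ball hr hκ.le subset_rfl hc.neg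
    (fun x hx => by simpa using (hs x hx).2.neg)
    (e := κ * r ^ 2 / 2) (fun y hy => by linarith [(abs_le.1 (hfr y hy)).2]) x hx
  rw [abs_le]; constructor <;> linarith

lemma exists_small {τ B : ℝ} (hτ : 0 < τ) (hB : 0 < B) : ∃ l : ℝ, 0 < l ∧ l ≤ 1 / 2 ∧ B * l ^ τ ≤ 1 / 2 := by
  refine ⟨min (1 / 2) ((1 / (2 * B)) ^ (1 / τ)), by positivity, min_le_left _ _, ?_⟩
  have : (min (1 / 2) ((1 / (2 * B)) ^ (1 / τ))) ^ τ ≤ ((1 / (2 * B)) ^ (1 / τ)) ^ τ :=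
    Real.rpow_le_rpow (by positivity) (min_le_right _ _) hτ.le
  rw [← Real.rpow_mul (by positivity), one_div_mul_cancel hτ.ne', Real.rpow_one] at this
  calc B * _ ≤ B * (1 / (2 * B)) := by gcongr
    _ = 1 / 2 := by field_simp

/-- Taylor to order `m`, `m = 1` or `m = 2`. -/
lemma har_taylor_m (hN : 1 ≤ dm E) {m : ℕ} (hm : m = 1 ∨ m = 2) {h : E → ℝ} (H : Har h) {x₀ : E} {r M : ℝ}
    (hr : 0 < r) (hb : ∀ y ∈ Metric.closedBall x₀ r, |h y| ≤ M) :
    ∃ (p : Du E) (A A' : Bi E), Jet h x₀ p A ∧ bt A = 0 ∧ (m = 1 → A' = 0) ∧ (m = 2 → A' = A) ∧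
      bt A' = 0 ∧ ‖p‖ ≤ (48 * dm E / r) * M ∧
      ‖A'‖ ≤ (48 * dm E / r) ^ 2 * M ∧
      (∀ y ∈ Metric.closedBall x₀ (r / 2), |h y - (h x₀ + p (y - x₀) + 1 / 2 * A' (y - x₀) (y - x₀))| ≤
        (48 * dm E / r) ^ (m + 1) * M * ‖y - x₀‖ ^ (m + 1)) := by
  obtain ⟨p, A, h1, h2, h3, h4, h5, h6⟩ := har_taylor hN H hr hb
  have hM : 0 ≤ M := (abs_nonneg _).trans (hb x₀ (by simp [hr.le]))
  rcases hm with rfl | rfl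
  · refine ⟨p, A, 0, h1, h2, fun _ => rfl, fun h => by omega, bt_zero, h3, le_of_eq_of_le bi_norm_zero (by positivity), fun y hy => ?_⟩
    have := h5 y hy
    simp [-map_sub] at this ⊢
    rwa [← sub_sub]
  · refine ⟨p, A, A, h1, h2, fun h => by omega, fun _ => rfl, h2, h3, h4, fun y hy => ?_⟩
    have := h6 y hy
    rwa [← sub_sub, ← sub_sub]

lemma bt_continuous : Continuous (bt : Bi E → ℝ) := by
  unfold bt
  refine continuous_finset_sum _ fun i _ => ?_
  exact (continuous_id.clm_apply continuous_const).clm_apply continuous_const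

/-- quadratic polynomial -/
noncomputable def qd (x₀ : E) (c : ℝ) (p : Du E) (A : Bi E) (y : E) : ℝ := c + p (y - x₀) + 1 / 2 * A (y - x₀) (y - x₀)

lemma qd_sub (x₀ : E) (c c' : ℝ) (p p' : Du E) (A A' : Bi E) (y : E) :
    qd x₀ c p A y - qd x₀ c' p' A' y = qd x₀ (c - c') (p - p') (A - A') y := by
  simp [qd, -map_sub]; ring

lemma qd_add (x₀ : E) (c c' : ℝ) (p p' : Du E) (A A' : Bi E) (y : E) :
    qd x₀ (c + c') (p + p') (A + A') y = qd x₀ c p A y + qd x₀ c' p' A' y := by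
  simp [qd, -map_sub]; ring

lemma qd_le (x₀ : E) (c : ℝ) (p : Du E) (A : Bi E) (y : E) :
    |qd x₀ c p A y| ≤ |c| + ‖p‖ * ‖y - x₀‖ + 1 / 2 * (‖A‖ * ‖y - x₀‖ ^ 2) := by
  unfold qd
  refine (abs_add_le _ _).trans (add_le_add ((abs_add_le _ _).trans (add_le_add le_rfl ?_)) ?_)
  · exact p.le_opNorm _
  · rw [abs_mul, abs_of_pos (by norm_num : (0:ℝ) < 1 / 2)]
    gcongr
    have := A.le_opNorm₂ (y - x₀) (y - x₀)
    rw [Real.norm_eq_abs] at this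
    linarith

lemma jet_qd (x₀ : E) (c : ℝ) (p : Du E) (A : Bi E) (x : E) :
    Jet (qd x₀ c p A) x (p + (1 / 2 : ℝ) • (A (x - x₀) + A.flip (x - x₀))) A := jet_quad c p A x₀ x

lemma qd_cont (x₀ : E) (c : ℝ) (p : Du E) (A : Bi E) : Continuous (qd x₀ c p A) :=
  continuous_iff_continuousAt.2 fun x => (jet_qd x₀ c p A x).continuousAt

set_option maxHeartbeats 1000000 in
/-- pointwise expansion at an interior point -/
lemma int_reg (hN : 1 ≤ dm E) {m : ℕ} (hm : m = 1 ∨ m = 2) {s : ℝ} (hs1 : m < s) (hs2 : s < m + 1) :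
    ∃ C : ℝ, 0 ≤ C ∧ ∀ (u : E → ℝ) (x₀ : E) (d K c₁ : ℝ), 0 < d → 0 < K → (m = 1 → c₁ = 0) →
      |c₁| ≤ K * d ^ (s - 2) → ContinuousOn u (Metric.closedBall x₀ d) →
      (∀ x ∈ Metric.closedBall x₀ d, |u x| ≤ K * d ^ s) →
      (∀ r, 0 < r → r ≤ d → ∀ x ∈ Metric.ball x₀ r, ViSub (cst (c₁ + K * r ^ (s - 2))) u x ∧
        ViSup (cst (c₁ - K * r ^ (s - 2))) u x) →
      ∃ (c : ℝ) (p : Du E) (A : Bi E), bt A = -c₁ ∧ (m = 1 → A = 0) ∧ |c| ≤ C * K * d ^ s ∧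
        ‖p‖ ≤ C * K * d ^ (s - 1) ∧ ‖A‖ ≤ C * K * d ^ (s - 2) ∧
        ∀ y ∈ Metric.closedBall x₀ d, |u y - qd x₀ c p A y| ≤ C * K * ‖y - x₀‖ ^ s := by
  have hN0 : 0 < dm E := by linarith
  have hm1 : (1:ℝ) ≤ m := by rcases hm with rfl | rfl <;> norm_num
  set B := 48 * dm E with hB
  have hB0 : 0 < B := by positivity
  obtain ⟨l, hl0, hl1, hl2⟩ := exists_small (τ := m + 1 - s) (B := 2 * B ^ (m + 1)) (by linarith) (by positivity)
  set δ := l ^ s / 2 with hδ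
  have hδ0 : 0 < δ := by positivity
  have hδ1 : δ ≤ 1 / 2 := by
    have : l ^ s ≤ 1 := Real.rpow_le_one hl0.le (by linarith) (by linarith)
    rw [hδ]; linarith
  obtain ⟨C', hC', hcamp⟩ := campanato (E := E) (Z0 := ℝ) (Z1 := Du E) (Z2 := Bi E)
    (C := 2 + 2 * B) (C2 := if m = 1 then 0 else 2 * B ^ 2) (L := 1) (l := l) (s := s)
    (by positivity) (by split_ifs <;> positivity) zero_le_one hl0 (by linarith) (by linarith)
    (by rcases hm with rfl | rfl
        · simp
        · right; exact_mod_cast hs1)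
  set nI := ‖(ip : Bi E)‖ / dm E with hnI
  refine ⟨C' * (2 / δ) + nI, by positivity, ?_⟩
  intro u x₀ d K c₁ hd hK hc1 hc1' hcont hbd hvis
  set K' := 2 * K / δ with hK'
  have hK'0 : 0 < K' := by positivity
  have hKK' : K = δ * K' / 2 := by rw [hK']; field_simp
  set A₀ : Bi E := (-c₁ / dm E) • ip with hA0
  have hA0n : ‖A₀‖ ≤ nI * K * d ^ (s - 2) := by
    refine (bi_norm_smul _ _).trans ?_
    rw [abs_div, abs_neg, abs_of_pos hN0, hnI]
    calc |c₁| / dm E * ‖(ip : Bi E)‖ ≤ (K * d ^ (s - 2)) / dm E * ‖(ip : Bi E)‖ := by gcongr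
      _ = _ := by ring
  have hA0b : bt A₀ = -c₁ := by rw [hA0, bt_smul, bt_ip]; field_simp
  set P : Set (ℝ × Du E × Bi E) := {z | bt z.2.2 = -c₁ ∧ (m = 1 → z.2.2 = 0)} with hP
  have hPc : IsClosed P := by
    have e1 : IsClosed {z : ℝ × Du E × Bi E | bt z.2.2 = -c₁} :=
      isClosed_eq (bt_continuous.comp (by fun_prop)) continuous_const
    have e2 : IsClosed {z : ℝ × Du E × Bi E | m = 1 → z.2.2 = 0} := by
      by_cases h : m = 1
      · simp only [h, true_imp_iff]
        exact isClosed_eq (by fun_prop) continuous_const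
      · simp [h]
    exact e1.inter e2
  have hstart : ∀ y ∈ (univ : Set E), ‖y - x₀‖ ≤ d → |u y - qd x₀ 0 0 A₀ y| ≤ K' * d ^ s := by
    intro y _ hy
    have h1 := hbd y (by rwa [Metric.mem_closedBall, dist_eq_norm])
    have e2 : d ^ (s - 2) * d ^ 2 = d ^ s := by
      rw [← Real.rpow_natCast, ← Real.rpow_add hd]; norm_num
    have h2 : |qd x₀ 0 0 A₀ y| ≤ K * d ^ s := by
      have : qd x₀ 0 0 A₀ y = 1 / 2 * (-c₁ / dm E) * ‖y - x₀‖ ^ 2 := by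
        simp only [qd, hA0]
        have : (innerSL ℝ (y - x₀)) (y - x₀) = ‖y - x₀‖ ^ 2 := by
          rw [innerSL_apply_apply]; exact real_inner_self_eq_norm_sq _
        simp [-map_sub, ip, -innerSL_apply_apply, this]
        ring
      rw [this, abs_mul, abs_mul, abs_of_pos (by norm_num : (0:ℝ) < 1/2), abs_div, abs_neg, abs_of_pos hN0,
        abs_of_nonneg (sq_nonneg ‖y - x₀‖), ← e2]
      have : |c₁| / dm E ≤ |c₁| := div_le_self (abs_nonneg _) hN
      have : ‖y - x₀‖ ^ 2 ≤ d ^ 2 := by gcongr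
      calc 1 / 2 * (|c₁| / dm E) * ‖y - x₀‖ ^ 2 ≤ 1 * (K * d ^ (s - 2)) * d ^ 2 := by
            gcongr
            · norm_num
            · linarith
        _ = _ := by ring
    have h3 : 2 * K * d ^ s ≤ K' * d ^ s := by
      have : 2 * K ≤ K' := by rw [hK', le_div_iff₀ hδ0]; nlinarith
      gcongr
    calc |u y - qd x₀ 0 0 A₀ y| ≤ |u y| + |qd x₀ 0 0 A₀ y| := abs_sub _ _
      _ ≤ _ := by linarith
  obtain ⟨c, p, A, hz, z1, z2, z3, z4⟩ := hcamp (qd x₀) P u univ x₀ d K' 0 0 A₀ hd hK'0.le hPc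
    (fun c p A c' p' A' y _ _ => by
      rw [qd_sub, one_mul]
      refine (qd_le _ _ _ _ _).trans ?_
      rw [← Real.norm_eq_abs]
      have : 0 ≤ ‖A - A'‖ * ‖y - x₀‖ ^ 2 := by positivity
      linarith)
    (by
      intro r c p A hr hrd hPz _ _ hu
      have e1 : r ^ (s - 1) * r = r ^ s := by
        rw [Real.rpow_sub_one hr.ne']; field_simp
      have e2 : r ^ (s - 2) * r ^ 2 = r ^ s := by
        rw [← Real.rpow_natCast, ← Real.rpow_add hr]; norm_num
      have hrs : 0 < r ^ s := by positivity
      have hsubr : Metric.closedBall x₀ r ⊆ Metric.closedBall x₀ d := Metric.closedBall_subset_closedBall hrd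
      obtain ⟨h, H, hh⟩ := har_approx hN (u := fun y => u y + -qd x₀ c p A y) (x₀ := x₀) hr
        (κ := K * r ^ (s - 2)) (by positivity)
        ((hcont.mono hsubr).add (qd_cont x₀ c p A).neg.continuousOn) (fun x hx => by
          have hv := hvis r hr hrd x hx
          have hj := (jet_qd x₀ c p A x).neg
          refine ⟨hv.1.add_jet hj fun q => ?_, hv.2.add_jet hj fun q => ?_⟩
          · simp only [cst, bt_neg, hPz.1]; linarith
          · simp only [cst, bt_neg, hPz.1]; linarith)
      have hκ : K * r ^ (s - 2) * r ^ 2 = K * r ^ s := by rw [mul_assoc, e2]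
      rw [hκ] at hh
      have hM : ∀ y ∈ Metric.closedBall x₀ r, |h y| ≤ 2 * K' * r ^ s := by
        intro y hy
        have a1 := abs_le.1 (hh y hy)
        have a2 := abs_le.1 (hu y trivial (by rwa [Metric.mem_closedBall, dist_eq_norm] at hy))
        have a3 : K * r ^ s ≤ K' * r ^ s := by
          have : K ≤ K' := by rw [hKK']; nlinarith
          gcongr
        rw [abs_le]; constructor <;> linarith
      obtain ⟨p', A1, A', -, -, i1, i2, i3, i4, i5, i6⟩ := har_taylor_m hN hm H hr hM
      refine ⟨c + h x₀, p + p', A + A', ⟨by rw [bt_add, hPz.1, i3, add_zero], fun hm => by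
        show A + A' = 0
        have e1 : A = 0 := hPz.2 hm
        rw [e1, i1 hm]; ext a b; simp⟩, ?_, ?_, ?_, ?_⟩
      · rw [add_sub_cancel_left, Real.norm_eq_abs]
        refine (hM x₀ (by simp [hr.le])).trans ?_
        have : 0 ≤ 2 * B * K' * r ^ s := by positivity
        linarith
      · rw [add_sub_cancel_left]
        refine i4.trans ?_
        have : 48 * dm E / r * (2 * K' * r ^ s) = 2 * B * K' * r ^ (s - 1) := by
          rw [← e1, hB]; field_simp
        rw [this]
        have : 0 ≤ K' * r ^ (s - 1) := by positivity
        linarith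
      · rw [bi_add_sub]
        split_ifs with hm'
        · rw [i1 hm', bi_norm_zero]; simp
        · refine i5.trans (le_of_eq ?_)
          rw [← e2, hB]; field_simp
      · intro y _ hy
        have hyr : ‖y - x₀‖ ≤ r := hy.trans (mul_le_of_le_one_left hr.le (by linarith))
        have hyr2 : ‖y - x₀‖ ≤ r / 2 := hy.trans (by nlinarith)
        have a1 := hh y (by rwa [Metric.mem_closedBall, dist_eq_norm])
        have a2 := i6 y (by rwa [Metric.mem_closedBall, dist_eq_norm])
        have e3 : u y - qd x₀ (c + h x₀) (p + p') (A + A') y =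
            (u y + -qd x₀ c p A y - h y) + (h y - (h x₀ + p' (y - x₀) + 1 / 2 * A' (y - x₀) (y - x₀))) := by
          rw [qd_add]; unfold qd; ring
        rw [e3]
        refine (abs_add_le _ _).trans ((add_le_add a1 a2).trans ?_)
        have a3 : (48 * dm E / r) ^ (m + 1) * (2 * K' * r ^ s) * ‖y - x₀‖ ^ (m + 1) ≤
            (2 * B ^ (m + 1) * l ^ (m + 1)) * K' * r ^ s := by
          calc (48 * dm E / r) ^ (m + 1) * (2 * K' * r ^ s) * ‖y - x₀‖ ^ (m + 1)
              ≤ (48 * dm E / r) ^ (m + 1) * (2 * K' * r ^ s) * (l * r) ^ (m + 1) := by gcongr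
            _ = _ := by rw [← hB]; exact alg_aux hr.ne' _ _ _ _ _
        have a4 : 2 * B ^ (m + 1) * l ^ (m + 1) ≤ l ^ s / 2 := by
          have : l ^ (m + 1) = l ^ ((m:ℝ) + 1 - s) * l ^ s := by
            rw [← Real.rpow_add hl0, ← Real.rpow_natCast]; push_cast; ring_nf
          rw [this]
          have h3 : 0 < l ^ s := by positivity
          calc _ = (2 * B ^ (m + 1) * l ^ ((m:ℝ) + 1 - s)) * l ^ s := by ring
            _ ≤ 1 / 2 * l ^ s := by gcongr
            _ = _ := by ring
        rw [Real.mul_rpow hl0.le hr.le, hKK', hδ]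
        have a5 : (2 * B ^ (m + 1) * l ^ (m + 1)) * K' * r ^ s ≤ l ^ s / 2 * K' * r ^ s := by gcongr
        have a6 : 0 < l ^ s * K' * r ^ s := by positivity
        linarith)
    ⟨hA0b, fun h => by rw [hA0, hc1 h]; ext a b; simp⟩ hstart
  have e1 : C' * K' = C' * (2 / δ) * K := by rw [hK']; ring
  have e0 : 0 ≤ nI := by positivity
  refine ⟨c, p, A, hz.1, hz.2, ?_, ?_, ?_, ?_⟩
  · rw [sub_zero, Real.norm_eq_abs, e1] at z1
    refine z1.trans ?_
    gcongr; linarith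
  · rw [sub_zero, e1] at z2
    refine z2.trans ?_
    gcongr; linarith
  · have : ‖A‖ ≤ ‖A - A₀‖ + ‖A₀‖ := bi_norm_le _ _
    rw [e1] at z3
    calc ‖A‖ ≤ C' * (2 / δ) * K * d ^ (s - 2) + nI * K * d ^ (s - 2) := by linarith
      _ = _ := by ring
  · intro y hy
    have := z4 y trivial (by rwa [Metric.mem_closedBall, dist_eq_norm] at hy)
    rw [e1] at this
    refine this.trans ?_
    gcongr; linarith

end intreg

/-! ## Part 8: bounded Lipschitz nonlinearities, local solvability -/
section local_solve
variable {E : Type*} [NormedAddCommGroup E] [InnerProductSpace ℝ E] [FiniteDimensional ℝ E]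

structure Nice (F : E → ℝ → Du E → ℝ) (U : Set E) (L K H α : ℝ) : Prop where
  L0 : 0 ≤ L
  K0 : 0 ≤ K
  H0 : 0 ≤ H
  a0 : 0 < α
  a1 : α < 1
  lip : ∀ x ∈ U, ∀ η η' p p', |F x η p - F x η' p'| ≤ L * (|η - η'| + ‖p - p'‖)
  bdd : ∀ x ∈ U, ∀ η p, |F x η p| ≤ K
  hol : ∀ x ∈ U, ∀ y ∈ U, ∀ η p, |F x η p - F y η p| ≤ H * ‖x - y‖ ^ α

lemma Nice.mono {F : E → ℝ → Du E → ℝ} {U V : Set E} {L K H α : ℝ} (h : Nice F U L K H α) (hV : V ⊆ U) :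
    Nice F V L K H α :=
  ⟨h.L0, h.K0, h.H0, h.a0, h.a1, fun x hx => h.lip x (hV hx), fun x hx => h.bdd x (hV hx),
    fun x hx y hy => h.hol x (hV hx) y (hV hy)⟩

lemma Nice.diff {F : E → ℝ → Du E → ℝ} {U : Set E} {L K H α : ℝ} (h : Nice F U L K H α) {x y : E}
    (hx : x ∈ U) (hy : y ∈ U) (η η' : ℝ) (p p' : Du E) :
    |F x η p - F y η' p'| ≤ H * ‖x - y‖ ^ α + L * (|η - η'| + ‖p - p'‖) := by
  have h1 := h.hol x hx y hy η p
  have h2 := h.lip y hy η η' p p'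
  calc |F x η p - F y η' p'| = |(F x η p - F y η p) + (F y η p - F y η' p')| := by ring_nf
    _ ≤ _ := (abs_add_le _ _).trans (add_le_add h1 h2)

lemma Nice.cont {F : E → ℝ → Du E → ℝ} {U : Set E} {L K H α : ℝ} (h : Nice F U L K H α) :
    ContinuousOn (fun q : E × ℝ × Du E => F q.1 q.2.1 q.2.2) (U ×ˢ univ) := by
  rintro ⟨x, η, p⟩ hx
  have hx' : x ∈ U := hx.1
  rw [ContinuousWithinAt, tendsto_iff_norm_sub_tendsto_zero]
  have hc : Tendsto (fun q : E × ℝ × Du E => H * ‖q.1 - x‖ ^ α + L * (|q.2.1 - η| + ‖q.2.2 - p‖))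
      (𝓝[U ×ˢ univ] (x, η, p)) (𝓝 0) := by
    have : Continuous (fun q : E × ℝ × Du E => H * ‖q.1 - x‖ ^ α + L * (|q.2.1 - η| + ‖q.2.2 - p‖)) := by
      have h1 : Continuous fun q : E × ℝ × Du E => ‖q.1 - x‖ ^ α :=
        (continuous_fst.sub continuous_const).norm.rpow_const fun _ => Or.inr h.a0.le
      have h2 : Continuous fun q : E × ℝ × Du E => |q.2.1 - η| := by fun_prop
      have h3 : Continuous fun q : E × ℝ × Du E => ‖q.2.2 - p‖ := by fun_prop
      exact (h1.const_mul _).add ((h2.add h3).const_mul _)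
    have := (this.tendsto (x, η, p)).mono_left (nhdsWithin_le_nhds (s := U ×ˢ univ))
    simpa [Real.zero_rpow h.a0.ne'] using this
  refine squeeze_zero' (Eventually.of_forall fun _ => norm_nonneg _) ?_ hc
  filter_upwards [self_mem_nhdsWithin] with q hq
  exact h.diff hq.1 hx' _ _ _ _

lemma Nice.cont_comp {F : E → ℝ → Du E → ℝ} {U : Set E} {L K H α : ℝ} (h : Nice F U L K H α)
    {u : E → ℝ} {p : E → Du E} {S : Set E} (hS : S ⊆ U) (hu : ContinuousOn u S) (hp : ContinuousOn p S) :
    ContinuousOn (fun x => F x (u x) (p x)) S :=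
  h.cont.comp (f := fun x => (x, u x, p x)) (continuousOn_id.prodMk (hu.prodMk hp)) fun x hx => ⟨hS hx, trivial⟩

lemma rpow_isLittleO (x : E) {s : ℝ} {k : ℕ} (hs : k < s) :
    (fun y : E => ‖y - x‖ ^ s) =o[𝓝 x] fun y => ‖y - x‖ ^ k := by
  have h0 : Tendsto (fun y : E => ‖y - x‖ ^ (s - k)) (𝓝 x) (𝓝 0) := by
    have : Continuous fun y : E => ‖y - x‖ ^ (s - k) :=
      (continuous_id.sub continuous_const).norm.rpow_const fun _ => Or.inr (by linarith)
    have := this.tendsto x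
    simpa [Real.zero_rpow (by linarith : s - k ≠ 0)] using this
  have h1 : (fun y : E => ‖y - x‖ ^ (s - k)) =o[𝓝 x] fun _ => (1:ℝ) := (isLittleO_one_iff ℝ).2 h0
  refine (h1.mul_isBigO (isBigO_refl (fun y : E => ‖y - x‖ ^ k) _)).congr_left (fun y => ?_) |>.congr_right
    fun y => by ring
  rw [← Real.rpow_natCast, ← Real.rpow_add_of_nonneg (norm_nonneg _) (by linarith) (by positivity)]
  ring_nf

lemma hasFDerivAt_of_rpow {u : E → ℝ} {x : E} {p : Du E} {C s : ℝ} (hs : 1 < s)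
    (h : ∀ᶠ y in 𝓝 x, |u y - u x - p (y - x)| ≤ C * ‖y - x‖ ^ s) : HasFDerivAt u p x := by
  rw [hasFDerivAt_iff_isLittleO]
  have h1 : (fun y => u y - u x - p (y - x)) =O[𝓝 x] fun y : E => ‖y - x‖ ^ s := by
    refine IsBigO.of_bound C ?_
    filter_upwards [h] with y hy
    rw [Real.norm_eq_abs, Real.norm_eq_abs, abs_of_nonneg (by positivity : (0:ℝ) ≤ ‖y - x‖ ^ s)]; exact hy
  have := h1.trans_isLittleO (rpow_isLittleO x (k := 1) (by simpa using hs))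
  simp only [pow_one] at this
  exact this.of_norm_right

lemma jet_of_rpow {u : E → ℝ} {x : E} {p : Du E} {A : Bi E} {C s : ℝ} (hs : 2 < s)
    (h : ∀ᶠ y in 𝓝 x, |u y - u x - p (y - x) - 1 / 2 * A (y - x) (y - x)| ≤ C * ‖y - x‖ ^ s) : Jet u x p A := by
  have h1 : (fun y => u y - u x - p (y - x) - 1 / 2 * A (y - x) (y - x)) =O[𝓝 x] fun y : E => ‖y - x‖ ^ s := by
    refine IsBigO.of_bound C ?_
    filter_upwards [h] with y hy
    rw [Real.norm_eq_abs, Real.norm_eq_abs, abs_of_nonneg (by positivity : (0:ℝ) ≤ ‖y - x‖ ^ s)]; exact hy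
  exact h1.trans_isLittleO (rpow_isLittleO x (k := 2) (by simpa using hs))

lemma ViSub.deriv {F : E → ℝ → Du E → ℝ} {u : E → ℝ} {y : E} {p : Du E} (h : ViSub F u y)
    (hu : HasFDerivAt u p y) : ViSub (cst (F y (u y) p)) u y := by
  intro q A hq
  have e : p = q := by
    have h1 := hu.sub (jet_quad (u y) q A y y).hasFDerivAt
    have h2 : IsLocalMax (u - fun z => u y + q (z - y) + 1 / 2 * A (z - y) (z - y)) y := by
      filter_upwards [hq] with z hz
      simp only [Pi.sub_apply, sub_self, map_zero]
      simp only [ContinuousLinearMap.map_sub₂, map_sub] at hz ⊢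
      linarith
    have h3 := h2.hasFDerivAt_eq_zero h1
    have h4 : (A (y - y) + A.flip (y - y)) = 0 := by simp
    rw [h4, smul_zero, add_zero] at h3
    exact sub_eq_zero.1 h3
  rw [cst_apply, e]
  exact h q A hq

lemma ViSup.deriv {F : E → ℝ → Du E → ℝ} {u : E → ℝ} {y : E} {p : Du E} (h : ViSup F u y)
    (hu : HasFDerivAt u p y) : ViSup (cst (F y (u y) p)) u y := by
  have := (h.neg.deriv hu.neg).neg
  simpa [fl] using this

lemma aff_norm {p : Du E} {c M ρ : ℝ} (hρ : 0 < ρ) (h : ∀ v, ‖v‖ ≤ ρ → |c + p v| ≤ M) : ‖p‖ ≤ M / ρ := by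
  have h1 : ∀ v, ‖v‖ ≤ ρ → |p v| ≤ M := fun v hv => by
    have a := abs_le.1 (h v hv)
    have b := abs_le.1 (h (-v) (by simpa using hv))
    rw [map_neg] at b
    rw [abs_le]; constructor <;> linarith
  have hM : 0 ≤ M := (abs_nonneg _).trans (h1 0 (by simpa using hρ.le))
  refine p.opNorm_le_bound (by positivity) fun v => ?_
  rcases eq_or_ne v 0 with rfl | hv
  · simp
  have hv' : 0 < ‖v‖ := norm_pos_iff.2 hv
  have := h1 ((ρ / ‖v‖) • v) (by rw [norm_smul, Real.norm_eq_abs, abs_of_pos (by positivity)]; field_simp; exact le_rfl)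
  rw [map_smul, smul_eq_mul, abs_mul, abs_of_pos (by positivity : 0 < ρ / ‖v‖)] at this
  rw [Real.norm_eq_abs, div_mul_eq_mul_div, le_div_iff₀ hρ]
  rw [div_mul_eq_mul_div, div_le_iff₀ hv'] at this
  linarith

lemma aff_diff {a b : ℝ} {p q : Du E} {x y ξ : E} {ρ M : ℝ} (hρ : 0 < ρ)
    (h : ∀ z ∈ Metric.closedBall ξ ρ, |(a + p (z - x)) - (b + q (z - y))| ≤ M) : ‖p - q‖ ≤ M / ρ := by
  refine aff_norm (c := a + p (ξ - x) - b - q (ξ - y)) hρ fun v hv => ?_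
  have := h (ξ + v) (by simpa using hv)
  refine le_of_eq_of_le (congrArg _ ?_) this
  have e1 : ξ + v - x = (ξ - x) + v := by abel
  have e2 : ξ + v - y = (ξ - y) + v := by abel
  rw [e1, e2, map_add, map_add, ContinuousLinearMap.sub_apply]; ring

/-- from a bound on a scaled ball: gradient expansion -/
lemma int_reg1 (hN : 1 ≤ dm E) {α : ℝ} (h0 : 0 < α) (h1 : α < 1) :
    ∃ C : ℝ, 0 ≤ C ∧ ∀ (u : E → ℝ) (x₀ : E) (d M K : ℝ), 0 < d → 0 ≤ M → 0 ≤ K →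
      ContinuousOn u (Metric.closedBall x₀ d) → (∀ x ∈ Metric.closedBall x₀ d, |u x| ≤ M) →
      (∀ x ∈ Metric.ball x₀ d, ViSub (cst K) u x ∧ ViSup (cst (-K)) u x) →
      ∃ p : Du E, ‖p‖ ≤ C * (M / d ^ (1 + α) + K * d ^ (1 - α) + 1) * d ^ α ∧
        ∀ y ∈ Metric.closedBall x₀ d, |u y - u x₀ - p (y - x₀)| ≤
          C * (M / d ^ (1 + α) + K * d ^ (1 - α) + 1) * ‖y - x₀‖ ^ (1 + α) := by
  obtain ⟨C, hC, hr⟩ := int_reg hN (m := 1) (Or.inl rfl) (s := 1 + α) (by push_cast; linarith)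
    (by push_cast; linarith)
  refine ⟨C, hC, fun u x₀ d M K hd hM hK hc hb hv => ?_⟩
  have hK1 : 0 < M / d ^ (1 + α) + K * d ^ (1 - α) + 1 := by positivity
  have hd1 : 0 < d ^ (1 + α) := by positivity
  obtain ⟨c, p, A, -, hA, -, hp, -, hu⟩ := hr u x₀ d _ 0 hd hK1 (fun _ => rfl)
    (by rw [abs_zero]; positivity) hc (fun x hx => (hb x hx).trans (by
      have : M = M / d ^ (1 + α) * d ^ (1 + α) := by field_simp
      calc M = M / d ^ (1 + α) * d ^ (1 + α) := this
        _ ≤ _ := by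
          gcongr
          have : 0 ≤ K * d ^ (1 - α) := by positivity
          linarith)) (fun r hr0 hrd x hx => by
      have hx' := hv x (Metric.ball_subset_ball hrd hx)
      have key : K ≤ (M / d ^ (1 + α) + K * d ^ (1 - α) + 1) * r ^ (1 + α - 2) := by
        have e : r ^ (1 + α - 2) = (r ^ (1 - α))⁻¹ := by
          rw [← Real.rpow_neg hr0.le]; ring_nf
        have e2 : r ^ (1 - α) ≤ d ^ (1 - α) := Real.rpow_le_rpow hr0.le hrd (by linarith)
        have e3 : 0 < r ^ (1 - α) := by positivity
        rw [e, ← div_eq_mul_inv, le_div_iff₀ e3]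
        have : 0 ≤ M / d ^ (1 + α) := by positivity
        have : K * r ^ (1 - α) ≤ K * d ^ (1 - α) := by gcongr
        linarith
      exact ⟨hx'.1.mono fun q => by simp only [cst_apply]; linarith,
        hx'.2.mono fun q => by simp only [cst_apply]; linarith⟩)
  have hA0 := hA rfl
  have hc' : c = u x₀ := by
    have := hu x₀ (by simp [hd.le])
    simp [qd, Real.zero_rpow (by linarith : 1 + α ≠ 0)] at this
    linarith
  refine ⟨p, by simpa using hp, fun y hy => ?_⟩
  have := hu y hy
  rw [hA0, hc'] at this
  simpa [qd, sub_sub, -map_sub] using this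

lemma visc_jet (hN : 1 ≤ dm E) {F : E → ℝ → Du E → ℝ} {U : Set E} {L K H α : ℝ} (hF : Nice F U L K H α)
    (hU : IsOpen U) {u : E → ℝ} (hu : ContinuousOn u U) (hs : ∀ x ∈ U, ViSub F u x ∧ ViSup F u x) :
    ∀ x ∈ U, ∃ p A, Jet u x p A ∧ bt A = -F x (u x) p := by
  intro x₀ hx₀
  have ha0 := hF.a0
  have ha1 := hF.a1
  obtain ⟨d, hd, hdU⟩ : ∃ d > 0, Metric.closedBall x₀ (2 * d) ⊆ U := by
    obtain ⟨e, he, h⟩ := Metric.nhds_basis_closedBall.mem_iff.1 (hU.mem_nhds hx₀)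
    exact ⟨e / 2, by positivity, by rwa [mul_div_cancel₀ _ (by norm_num : (2:ℝ) ≠ 0)]⟩
  obtain ⟨M, hM⟩ := (isCompact_closedBall x₀ (2 * d)).exists_bound_of_continuousOn (hu.mono hdU)
  have hM0 : 0 ≤ M := (norm_nonneg _).trans (hM x₀ (by simp [hd.le]))
  obtain ⟨C, hC, hr⟩ := int_reg1 hN ha0 ha1
  set C1 := C * (M / d ^ (1 + α) + K * d ^ (1 - α) + 1) with hC1
  have hK0 := hF.K0
  have hC10 : 0 ≤ C1 := by positivity
  have hex : ∀ x ∈ Metric.closedBall x₀ d, ∃ p : Du E, ∀ y ∈ Metric.closedBall x d,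
      |u y - u x - p (y - x)| ≤ C1 * ‖y - x‖ ^ (1 + α) := by
    intro x hx
    have hsub : Metric.closedBall x d ⊆ Metric.closedBall x₀ (2 * d) :=
      Metric.closedBall_subset_closedBall' (by rw [Metric.mem_closedBall] at hx; linarith)
    obtain ⟨p, -, hp⟩ := hr u x d M K hd hM0 hF.K0 (hu.mono (hsub.trans hdU)) (fun y hy => hM y (hsub hy))
      (fun y hy => by
        have hyU := hdU (hsub (Metric.ball_subset_closedBall hy))
        refine ⟨(hs y hyU).1.mono fun q => ?_, (hs y hyU).2.mono fun q => ?_⟩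
        · exact (abs_le.1 (hF.bdd y hyU _ _)).2
        · exact (abs_le.1 (hF.bdd y hyU _ _)).1)
    exact ⟨p, hp⟩
  choose! p hp using hex
  have hder : ∀ x ∈ Metric.closedBall x₀ d, HasFDerivAt u (p x) x := fun x hx =>
    hasFDerivAt_of_rpow (by linarith : 1 < 1 + α) (by
      filter_upwards [Metric.closedBall_mem_nhds x hd] with y hy using hp x hx y hy)
  set K2 := H + L * ((‖p x₀‖ * d ^ (1 - α) + C1 * d) + 5 * C1) with hK2
  have hK20 : 0 ≤ K2 := by have := hF.L0; have := hF.H0; positivity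
  have hx0 : x₀ ∈ Metric.closedBall x₀ d := by simp [hd.le]
  have hf : ∀ y ∈ Metric.closedBall x₀ (d / 2), |F y (u y) (p y) - F x₀ (u x₀) (p x₀)| ≤ K2 * ‖y - x₀‖ ^ α := by
    intro y hy
    rcases eq_or_ne y x₀ with rfl | hne
    · simp [Real.zero_rpow ha0.ne']
    set ρ := ‖y - x₀‖ with hρ
    have hρ0 : 0 < ρ := norm_pos_iff.2 (sub_ne_zero.2 hne)
    rw [Metric.mem_closedBall, dist_eq_norm, ← hρ] at hy
    have hyd : y ∈ Metric.closedBall x₀ d := by rw [Metric.mem_closedBall, dist_eq_norm]; linarith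
    have hd2 : d ≤ 2 * d := by linarith
    refine (hF.diff (hdU (Metric.closedBall_subset_closedBall hd2 hyd)) hx₀ _ _ _ _).trans ?_
    have e1 : ρ ^ (1 + α) = ρ * ρ ^ α := by rw [Real.rpow_add hρ0, Real.rpow_one]
    have e2 : ρ ≤ d ^ (1 - α) * ρ ^ α := by
      calc ρ = ρ ^ (1 - α) * ρ ^ α := by rw [← Real.rpow_add hρ0]; simp
        _ ≤ _ := by gcongr <;> linarith
    have b1 : |u y - u x₀| ≤ (‖p x₀‖ * d ^ (1 - α) + C1 * d) * ρ ^ α := by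
      have i1 := hp x₀ hx0 y hyd
      have i2 : |p x₀ (y - x₀)| ≤ ‖p x₀‖ * ρ := (p x₀).le_opNorm _
      calc |u y - u x₀| = |(u y - u x₀ - p x₀ (y - x₀)) + p x₀ (y - x₀)| := by ring_nf
        _ ≤ C1 * ρ ^ (1 + α) + ‖p x₀‖ * ρ := (abs_add_le _ _).trans (add_le_add i1 i2)
        _ ≤ C1 * (d * ρ ^ α) + ‖p x₀‖ * (d ^ (1 - α) * ρ ^ α) := by
            rw [e1]; gcongr; linarith
        _ = _ := by ring
    have b2 : ‖p y - p x₀‖ ≤ 5 * C1 * ρ ^ α := by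
      have : ‖p y - p x₀‖ ≤ (5 * C1 * ρ ^ (1 + α)) / ρ := by
        refine aff_diff (a := u y) (b := u x₀) (ξ := x₀) (x := y) (y := x₀) hρ0 fun z hz => ?_
        rw [Metric.mem_closedBall, dist_eq_norm] at hz
        have hzy : ‖z - y‖ ≤ 2 * ρ := by
          have := norm_sub_le_norm_sub_add_norm_sub z x₀ y
          rw [norm_sub_rev x₀ y] at this; linarith
        have j1 := hp x₀ hx0 z (by rw [Metric.mem_closedBall, dist_eq_norm]; linarith)
        have j2 := hp y hyd z (by rw [Metric.mem_closedBall, dist_eq_norm]; linarith)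
        have j3 : ‖z - x₀‖ ^ (1 + α) ≤ ρ ^ (1 + α) := by gcongr
        have j4 : ‖z - y‖ ^ (1 + α) ≤ 4 * ρ ^ (1 + α) := by
          calc ‖z - y‖ ^ (1 + α) ≤ (2 * ρ) ^ (1 + α) := by gcongr
            _ = 2 ^ (1 + α) * ρ ^ (1 + α) := Real.mul_rpow (by norm_num) hρ0.le
            _ ≤ (2:ℝ) ^ (2:ℝ) * ρ ^ (1 + α) := by gcongr <;> linarith
            _ = _ := by norm_num
        have j5 := mul_le_mul_of_nonneg_left j3 hC10
        have j6 := mul_le_mul_of_nonneg_left j4 hC10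
        have k1 := abs_le.1 j1
        have k2 := abs_le.1 j2
        rw [abs_le]; constructor <;> linarith
      refine this.trans (le_of_eq ?_)
      rw [e1]; field_simp
    have hL := hF.L0
    calc H * ρ ^ α + L * (|u y - u x₀| + ‖p y - p x₀‖)
        ≤ H * ρ ^ α + L * ((‖p x₀‖ * d ^ (1 - α) + C1 * d) * ρ ^ α + 5 * C1 * ρ ^ α) := by gcongr
      _ = _ := by rw [hK2]; ring
  obtain ⟨C3, hC3, hr2⟩ := int_reg hN (m := 2) (Or.inr rfl) (s := 2 + α) (by push_cast; linarith)
    (by push_cast; linarith)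
  set c₁ := F x₀ (u x₀) (p x₀) with hc1
  set d2 := d / 2 with hd2
  have hd20 : 0 < d2 := by positivity
  set K3 := K2 + |c₁| / d2 ^ α + M / d2 ^ (2 + α) + 1 with hK3
  have hK30 : 0 < K3 := by positivity
  have q1 : 0 ≤ |c₁| / d2 ^ α := by positivity
  have q2 : 0 ≤ M / d2 ^ (2 + α) := by positivity
  have hsub2 : Metric.closedBall x₀ d2 ⊆ Metric.closedBall x₀ d :=
    Metric.closedBall_subset_closedBall (by linarith)
  have hsub3 : Metric.closedBall x₀ d2 ⊆ Metric.closedBall x₀ (2 * d) :=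
    Metric.closedBall_subset_closedBall (by linarith)
  have e2 : 2 + α - 2 = α := by ring
  obtain ⟨c, q, A, hbA, -, -, -, -, hq⟩ := hr2 u x₀ d2 K3 c₁ hd20 hK30 (fun h => by omega)
    (by
      rw [e2]
      calc |c₁| = |c₁| / d2 ^ α * d2 ^ α := by field_simp
        _ ≤ _ := by gcongr; linarith)
    (hu.mono (hsub3.trans hdU))
    (fun x hx => (hM x (hsub3 hx)).trans (by
      calc M = M / d2 ^ (2 + α) * d2 ^ (2 + α) := by field_simp
        _ ≤ _ := by gcongr; linarith))
    (fun r hr0 hrd x hx => by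
      rw [e2]
      have hx2 : x ∈ Metric.closedBall x₀ d2 := Metric.closedBall_subset_closedBall hrd (Metric.ball_subset_closedBall hx)
      have hxU := hdU (hsub3 hx2)
      have hff := abs_le.1 (hf x hx2)
      have hK : K2 * ‖x - x₀‖ ^ α ≤ K3 * r ^ α := by
        rw [Metric.mem_ball, dist_eq_norm] at hx
        gcongr; linarith
      refine ⟨((hs x hxU).1.deriv (hder x (hsub2 hx2))).mono fun q => ?_,
        ((hs x hxU).2.deriv (hder x (hsub2 hx2))).mono fun q => ?_⟩
      · simp only [cst_apply]; linarith
      · simp only [cst_apply]; linarith)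
  have hc' : c = u x₀ := by
    have := hq x₀ (by simp [hd20.le])
    simp [qd, Real.zero_rpow (by linarith : 2 + α ≠ 0)] at this
    linarith
  have hJ : Jet u x₀ q A := jet_of_rpow (C := C3 * K3) (by linarith : 2 < 2 + α) (by
    filter_upwards [Metric.closedBall_mem_nhds x₀ hd20] with y hy
    have := hq y hy
    rw [hc'] at this
    simpa only [qd, sub_sub, add_assoc] using this)
  refine ⟨q, A, hJ, ?_⟩
  rw [hbA, hc1, hJ.hasFDerivAt.unique (hder x₀ hx0)]

end local_solve

/-! ## Part 9: local solvability -/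
section picard
variable {E : Type*} [NormedAddCommGroup E] [InnerProductSpace ℝ E] [FiniteDimensional ℝ E]

lemma poly_diff (hN : 1 ≤ dm E) {x₀ : E} {r κ : ℝ} (hr : 0 < r) (hκ : 0 < κ) {j k : ℕ} {P Q : E → ℝ}
    (hP : P ∈ W (E := E) j) (hQ : Q ∈ W (E := E) k) (h0 : ∀ x, ‖x - x₀‖ = r → Q x = P x)
    (hd : ∀ x ∈ Metric.ball x₀ r, |dl Q x - dl P x| ≤ κ) :
    ∀ x ∈ Metric.ball x₀ r, |Q x - P x| ≤ κ * r ^ 2 ∧ ‖fderiv ℝ Q x - fderiv ℝ P x‖ ≤ 2 * r * κ := by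
  have hcP : Continuous P := (W_smooth hP (n := 0)).continuous
  have hcQ : Continuous Q := (W_smooth hQ (n := 0)).continuous
  obtain ⟨h1, h2⟩ := ball_lip hN (w := fun x => Q x - P x) hr hκ (hcQ.sub hcP).continuousOn
    (fun x hx => by rw [h0 x hx, sub_self]) (fun x hx => ⟨_, _, (W_jet hQ x).sub (W_jet hP x), by
      rw [bt_sub]; exact hd x hx⟩)
  intro x hx
  refine ⟨h1 x (Metric.ball_subset_closedBall hx), ?_⟩
  refine norm_le_of_lip (by positivity) ((W_jet hQ x).sub (W_jet hP x)).hasFDerivAt ?_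
  filter_upwards [Metric.isOpen_ball.mem_nhds hx] with y hy
  exact h2 y (Metric.ball_subset_closedBall hy) x (Metric.ball_subset_closedBall hx)

lemma picard (hN : 1 ≤ dm E) {F : E → ℝ → Du E → ℝ} {x₀ : E} {r L K H α : ℝ} (hr : 0 < r)
    (hF : Nice F (Metric.closedBall x₀ r) L K H α) (hLr : L * (r ^ 2 + 2 * r) ≤ 1 / 2)
    {φ : E → ℝ} (hφ : ContinuousOn φ (Metric.sphere x₀ r)) {ε : ℝ} (hε : 0 < ε) :
    ∃ k, ∃ P ∈ W (E := E) k, (∀ x, ‖x - x₀‖ = r → |P x - φ x| ≤ ε) ∧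
      ∀ x ∈ Metric.ball x₀ r, |-dl P x - F x (P x) (fderiv ℝ P x)| ≤ ε := by
  obtain ⟨k₀, g, hg, hgφ⟩ := W_dense (isCompact_sphere x₀ r) hφ hε
  set e := ε / 5 with he
  have he0 : 0 < e := by positivity
  have step : ∀ (j : ℕ) (P : E → ℝ), P ∈ W (E := E) j → ∃ k, ∃ Q ∈ W (E := E) k,
      (∀ x, ‖x - x₀‖ = r → Q x = g x) ∧
      ∀ x ∈ Metric.ball x₀ r, |-dl Q x - F x (P x) (fderiv ℝ P x)| ≤ e := by
    intro j P hP
    obtain ⟨k, f, hf, hf2⟩ := W_dense (isCompact_closedBall x₀ r) (f := fun x => F x (P x) (fderiv ℝ P x))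
      (hF.cont_comp subset_rfl (W_smooth hP (n := 0)).continuous.continuousOn
        ((W_smooth hP (n := 1)).continuous_fderiv (by norm_num)).continuousOn) he0
    obtain ⟨n, Q, hQ, h1, h2⟩ := poly_dirichlet hN x₀ hr (Submodule.neg_mem _ hf) hg
    refine ⟨n, Q, hQ, h2, fun x hx => ?_⟩
    rw [h1 x, Pi.neg_apply, neg_neg]
    exact hf2 x (Metric.ball_subset_closedBall hx)
  obtain ⟨κ, hκ0, hind⟩ : ∃ κ : ℝ, 0 < κ ∧ ∀ n : ℕ, ∃ j, ∃ P ∈ W (E := E) j, ∃ k, ∃ Q ∈ W (E := E) k,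
      (∀ x, ‖x - x₀‖ = r → P x = g x) ∧ (∀ x, ‖x - x₀‖ = r → Q x = g x) ∧
      (∀ x ∈ Metric.ball x₀ r, |-dl Q x - F x (P x) (fderiv ℝ P x)| ≤ e) ∧
      ∀ x ∈ Metric.ball x₀ r, |dl Q x - dl P x| ≤ κ / 2 ^ n + 4 * e := by
    obtain ⟨k, Q, hQ, h1, h2⟩ := step k₀ g hg
    have hcont : Continuous fun x => dl Q x - dl g x :=
      (W_smooth (W_dl _ _ hQ) (n := 0)).continuous.sub (W_smooth (W_dl _ _ hg) (n := 0)).continuous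
    obtain ⟨M, hM⟩ := (isCompact_closedBall x₀ r).exists_bound_of_continuousOn hcont.continuousOn
    have hM0 : 0 ≤ M := (norm_nonneg _).trans (hM x₀ (by simp [hr.le]))
    refine ⟨M + 1, by linarith, fun n => ?_⟩
    induction n with
    | zero =>
      refine ⟨k₀, g, hg, k, Q, hQ, fun _ _ => rfl, h1, h2, fun x hx => ?_⟩
      have := hM x (Metric.ball_subset_closedBall hx)
      rw [Real.norm_eq_abs] at this
      simp only [pow_zero, div_one]; linarith
    | succ n ih =>
      obtain ⟨j, P, hP, k', Q', hQ', a1, a2, a3, a4⟩ := ih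
      obtain ⟨k'', R, hR, b1, b2⟩ := step k' Q' hQ'
      refine ⟨k', Q', hQ', k'', R, hR, a2, b1, b2, fun x hx => ?_⟩
      set κn := (M + 1) / 2 ^ n + 4 * e with hκn
      have hκn0 : 0 < κn := by positivity
      obtain ⟨c1, c2⟩ := poly_diff hN hr hκn0 hP hQ' (fun x hx => by rw [a1 x hx, a2 x hx]) a4 x hx
      have c3 := hF.lip x (Metric.ball_subset_closedBall hx) (Q' x) (P x) (fderiv ℝ Q' x) (fderiv ℝ P x)
      have c4 : L * (|Q' x - P x| + ‖fderiv ℝ Q' x - fderiv ℝ P x‖) ≤ κn / 2 := by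
        have := hF.L0
        calc _ ≤ L * (κn * r ^ 2 + 2 * r * κn) := by gcongr
          _ = (L * (r ^ 2 + 2 * r)) * κn := by ring
          _ ≤ 1 / 2 * κn := by gcongr
          _ = _ := by ring
      have c5 := abs_le.1 (c3.trans c4)
      have c6 := abs_le.1 (a3 x hx)
      have c7 := abs_le.1 (b2 x hx)
      have c8 : (M + 1) / 2 ^ (n + 1) + 4 * e = κn / 2 + 2 * e := by rw [hκn, pow_succ]; field_simp; ring
      rw [c8, abs_le]; constructor <;> linarith
  obtain ⟨n, hn⟩ : ∃ n : ℕ, κ / 2 ^ n ≤ e := by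
    obtain ⟨n, hn⟩ := exists_pow_lt_of_lt_one (show 0 < e / κ by positivity) (by norm_num : (1 / 2 : ℝ) < 1)
    refine ⟨n, ?_⟩
    rw [lt_div_iff₀ hκ0, one_div, inv_pow] at hn
    rw [div_eq_mul_inv]; linarith
  obtain ⟨j, P, hP, k, Q, hQ, a1, a2, a3, a4⟩ := hind n
  refine ⟨k, Q, hQ, fun x hx => ?_, fun x hx => ?_⟩
  · rw [a2 x hx]; exact hgφ x (by simpa [dist_eq_norm] using hx)
  obtain ⟨c1, c2⟩ := poly_diff hN hr (κ := 5 * e) (by positivity) hP hQ (fun x hx => by rw [a1 x hx, a2 x hx])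
    (fun x hx => (a4 x hx).trans (by linarith)) x hx
  have c3 := hF.lip x (Metric.ball_subset_closedBall hx) (Q x) (P x) (fderiv ℝ Q x) (fderiv ℝ P x)
  have c4 : L * (|Q x - P x| + ‖fderiv ℝ Q x - fderiv ℝ P x‖) ≤ 5 / 2 * e := by
    have := hF.L0
    calc _ ≤ L * (5 * e * r ^ 2 + 2 * r * (5 * e)) := by gcongr
      _ = (L * (r ^ 2 + 2 * r)) * (5 * e) := by ring
      _ ≤ 1 / 2 * (5 * e) := by gcongr
      _ = _ := by ring
  have c5 := abs_le.1 (c3.trans c4)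
  have c6 := abs_le.1 (a3 x hx)
  rw [abs_le]; constructor <;> linarith

/-- comparison on small sets, convenient form -/
lemma small_comparison (hN : 1 ≤ dm E) {F : E → ℝ → Du E → ℝ} {x₀ : E} {r L K H α ε : ℝ} (hr : 0 < r)
    (hF : Nice F (Metric.ball x₀ r) L K H α) (hLr : L * (r ^ 2 + 2 * r) ≤ 1 / 2) (hε : 0 ≤ ε)
    {v h : E → ℝ} (hv : ContinuousOn v (Metric.closedBall x₀ r)) (hh : ContinuousOn h (Metric.closedBall x₀ r))
    (hsub : ∀ x ∈ Metric.ball x₀ r, ViSub (fun x η p => F x η p + ε) v x)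
    (hsup : ∀ x ∈ Metric.ball x₀ r, ∃ p A, Jet h x p A ∧ F x (h x) p - ε ≤ -bt A)
    (hbd : ∀ x, ‖x - x₀‖ = r → v x ≤ h x + ε) :
    ∀ x ∈ Metric.closedBall x₀ r, v x ≤ h x + (2 + 4 * r ^ 2) * ε := by
  have hcl : closure (Metric.ball x₀ r) = Metric.closedBall x₀ r := closure_ball _ hr.ne'
  have hL := hF.L0
  have hc : 1 / r ^ 2 ≤ 2 * dm E / r ^ 2 - L * (2 + 2 / r) := by
    have e : L * (2 + 2 / r) = (L * (2 * r ^ 2 + 2 * r)) / r ^ 2 := by field_simp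
    rw [e, ← sub_div]
    gcongr
    nlinarith [mul_nonneg hL hr.le]
  have := comparison Metric.isOpen_ball subset_rfl hr hL hε (by positivity : 0 < 1 / r ^ 2) hc
    hF.lip (v := v) (h := h) (by rwa [hcl]) (by rwa [hcl]) hsub hsup
    (fun x hx => hbd x (by rwa [frontier_ball _ hr.ne', mem_sphere_iff_norm] at hx))
  rw [hcl] at this
  intro x hx
  refine (this x hx).trans (le_of_eq ?_)
  field_simp

lemma local_solve (hN : 1 ≤ dm E) {F : E → ℝ → Du E → ℝ} {x₀ : E} {r L K H α : ℝ} (hr : 0 < r)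
    (hF : Nice F (Metric.closedBall x₀ r) L K H α) (hLr : L * (r ^ 2 + 2 * r) ≤ 1 / 2)
    {φ : E → ℝ} (hφ : ContinuousOn φ (Metric.sphere x₀ r)) :
    ∃ h : E → ℝ, ContinuousOn h (Metric.closedBall x₀ r) ∧ (∀ x, ‖x - x₀‖ = r → h x = φ x) ∧
      ∀ x ∈ Metric.ball x₀ r, ∃ p A, Jet h x p A ∧ bt A = -F x (h x) p := by
  have hFb := hF.mono Metric.ball_subset_closedBall
  have hp := fun n : ℕ => picard hN hr hF hLr hφ (ε := 1 / ((n:ℝ) + 1)) (by positivity)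
  choose k P hPW hPb hPe using hp
  set Cc := 2 + 4 * r ^ 2 with hCc
  have hCc0 : 0 < Cc := by positivity
  have hcont : ∀ n, Continuous (P n) := fun n => (W_smooth (hPW n) (n := 0)).continuous
  have hsubP : ∀ n : ℕ, ∀ ε, 1 / ((n:ℝ) + 1) ≤ ε → ∀ x ∈ Metric.ball x₀ r, ViSub (fun x η p => F x η p + ε) (P n) x := by
    intro n ε hε x hx
    refine (W_jet (hPW n) x).vsub ?_
    have := abs_le.1 (hPe n x hx)
    have e : dl (P n) x = bt (fderiv ℝ (fderiv ℝ (P n)) x) := rfl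
    rw [← e]; linarith
  have hsupP : ∀ n : ℕ, ∀ ε, 1 / ((n:ℝ) + 1) ≤ ε → ∀ x ∈ Metric.ball x₀ r,
      F x (P n x) (fderiv ℝ (P n) x) - ε ≤ -bt (fderiv ℝ (fderiv ℝ (P n)) x) := by
    intro n ε hε x hx
    have := abs_le.1 (hPe n x hx)
    have e : dl (P n) x = bt (fderiv ℝ (fderiv ℝ (P n)) x) := rfl
    rw [← e]; linarith
  have hcmp : ∀ n m : ℕ, ∀ x ∈ Metric.closedBall x₀ r, P n x ≤ P m x + Cc * (1 / ((n:ℝ) + 1) + 1 / ((m:ℝ) + 1)) := by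
    intro n m
    have i1 : (0:ℝ) < 1 / ((n:ℝ) + 1) := by positivity
    have i2 : (0:ℝ) < 1 / ((m:ℝ) + 1) := by positivity
    refine small_comparison hN hr hFb hLr (ε := 1 / ((n:ℝ) + 1) + 1 / ((m:ℝ) + 1)) (by positivity) (hcont n).continuousOn (hcont m).continuousOn
      (hsubP n _ (by linarith)) (fun x hx => ⟨_, _, W_jet (hPW m) x, hsupP m _ (by linarith) x hx⟩) fun x hx => ?_
    have a := abs_le.1 (hPb n x hx)
    have b := abs_le.1 (hPb m x hx)
    linarith
  have hlim : ∀ x ∈ Metric.closedBall x₀ r, ∃ y, Tendsto (fun n => P n x) atTop (𝓝 y) := by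
    intro x hx
    refine cauchySeq_tendsto_of_complete (Metric.cauchySeq_iff'.2 fun ε hε => ?_)
    obtain ⟨n, hn⟩ := exists_nat_one_div_lt (show 0 < ε / (2 * Cc) by positivity)
    refine ⟨n, fun m hm => ?_⟩
    have h1 : 1 / ((m:ℝ) + 1) ≤ 1 / ((n:ℝ) + 1) := Nat.one_div_le_one_div hm
    have h2 : Cc * (1 / ((n:ℝ) + 1) + 1 / ((m:ℝ) + 1)) < ε := by
      rw [lt_div_iff₀ (by positivity)] at hn
      nlinarith
    have h3 := hcmp n m x hx
    have h4 := hcmp m n x hx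
    rw [add_comm] at h4
    rw [Real.dist_eq, abs_lt]; constructor <;> linarith
  choose! h hh using hlim
  have hclose : ∀ n : ℕ, ∀ x ∈ Metric.closedBall x₀ r, |h x - P n x| ≤ Cc * (1 / ((n:ℝ) + 1)) := by
    intro n x hx
    have t0 : Tendsto (fun m : ℕ => Cc * (1 / ((n:ℝ) + 1) + 1 / ((m:ℝ) + 1))) atTop (𝓝 (Cc * (1 / ((n:ℝ) + 1) + 0))) :=
      (tendsto_one_div_add_atTop_nhds_zero_nat.const_add _).const_mul _
    rw [add_zero] at t0
    rw [abs_le]; constructor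
    · have := le_of_tendsto_of_tendsto' tendsto_const_nhds ((hh x hx).add t0) fun m => hcmp n m x hx
      linarith
    · have := le_of_tendsto_of_tendsto' (hh x hx) (t0.const_add (P n x)) fun m => by
        have := hcmp m n x hx
        rw [add_comm (1 / ((m:ℝ) + 1))] at this; exact this
      linarith
  have hsmall : ∀ ε > 0, ∃ n : ℕ, 1 / ((n:ℝ) + 1) ≤ ε ∧ Cc * (1 / ((n:ℝ) + 1)) ≤ ε := by
    intro ε hε
    obtain ⟨n, hn⟩ := exists_nat_one_div_lt (show 0 < ε / Cc by positivity)
    rw [lt_div_iff₀ hCc0] at hn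
    have h2 : (1:ℝ) ≤ Cc := by rw [hCc]; nlinarith [sq_nonneg r]
    have h1 : (0:ℝ) < 1 / ((n:ℝ) + 1) := by positivity
    exact ⟨n, by nlinarith, by linarith⟩
  have hhc : ContinuousOn h (Metric.closedBall x₀ r) := by
    refine continuousOn_of_uniform_approx_of_continuousOn fun u hu => ?_
    obtain ⟨ε, hε, hu⟩ := Metric.mem_uniformity_dist.1 hu
    obtain ⟨n, -, hn⟩ := hsmall (ε / 2) (by positivity)
    exact ⟨P n, (hcont n).continuousOn, fun x hx => hu (by
      rw [Real.dist_eq]; exact ((hclose n x hx).trans hn).trans_lt (by linarith))⟩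
  refine ⟨h, hhc, fun x hx => ?_, ?_⟩
  · refine tendsto_nhds_unique (hh x (by rw [Metric.mem_closedBall, dist_eq_norm, hx])) ?_
    rw [tendsto_iff_norm_sub_tendsto_zero]
    exact squeeze_zero (fun _ => norm_nonneg _) (fun n => hPb n x hx) tendsto_one_div_add_atTop_nhds_zero_nat
  · have hbb : Metric.ball x₀ r ⊆ Metric.closedBall x₀ r := Metric.ball_subset_closedBall
    refine visc_jet hN hFb Metric.isOpen_ball (hhc.mono hbb) fun x hx => ⟨?_, ?_⟩
    · refine ViSub.stable Metric.isOpen_ball hx hFb.cont (hhc.mono hbb) fun ε hε => ?_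
      obtain ⟨n, h1, h2⟩ := hsmall ε hε
      exact ⟨P n, (hcont n).continuousOn, hsubP n ε h1, fun y hy => (hclose n y (hbb hy)).trans h2⟩
    · refine ViSup.stable Metric.isOpen_ball hx hFb.cont (hhc.mono hbb) fun ε hε => ?_
      obtain ⟨n, h1, h2⟩ := hsmall ε hε
      exact ⟨P n, (hcont n).continuousOn, fun y hy => (W_jet (hPW n) y).vsup (hsupP n ε h1 y hy),
        fun y hy => (hclose n y (hbb hy)).trans h2⟩

end picard

/-! ## Part 10: the Perron method -/
section perron
variable {E : Type*} [NormedAddCommGroup E] [InnerProductSpace ℝ E] [FiniteDimensional ℝ E]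

structure PS (F : E → ℝ → Du E → ℝ) (Ω : Set E) (s S v : E → ℝ) : Prop where
  c : ContinuousOn v (closure Ω)
  lo : ∀ x ∈ closure Ω, s x ≤ v x
  hi : ∀ x ∈ closure Ω, v x ≤ S x
  v : ∀ x ∈ Ω, ViSub F v x

lemma PS.max {F : E → ℝ → Du E → ℝ} {Ω : Set E} {s S v w : E → ℝ} (h : PS F Ω s S v) (k : PS F Ω s S w) :
    PS F Ω s S (fun y => max (v y) (w y)) :=
  ⟨h.c.sup k.c, fun x hx => (h.lo x hx).trans (le_max_left _ _), fun x hx => max_le (h.hi x hx) (k.hi x hx),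
    fun x hx => (h.v x hx).sup (k.v x hx)⟩

lemma PS.lift (hN : 1 ≤ dm E) {F : E → ℝ → Du E → ℝ} {Ω : Set E} {s S v : E → ℝ} {L K H α : ℝ}
    (hF : Nice F Ω L K H α) (hΩ : IsOpen Ω) (hSc : ContinuousOn S (closure Ω))
    (hS : ∀ x ∈ Ω, ∃ p A, Jet S x p A ∧ F x (S x) p ≤ -bt A)
    (h : PS F Ω s S v) {x₀ : E} {r : ℝ} (hr : 0 < r) (hLr : L * (r ^ 2 + 2 * r) ≤ 1 / 2)
    (hb : Metric.closedBall x₀ r ⊆ Ω) :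
    ∃ w, PS F Ω s S w ∧ (∀ x ∈ closure Ω, v x ≤ w x) ∧
      ∀ x ∈ Metric.ball x₀ r, ∃ p A, Jet w x p A ∧ bt A = -F x (w x) p := by
  classical
  have hbc : Metric.closedBall x₀ r ⊆ closure Ω := hb.trans subset_closure
  have hss : Metric.sphere x₀ r ⊆ Metric.closedBall x₀ r := Metric.sphere_subset_closedBall
  obtain ⟨g, hgc, hgb, hgj⟩ := local_solve hN hr (hF.mono hb) hLr (φ := v) (h.c.mono (hss.trans hbc))
  have hbb : Metric.ball x₀ r ⊆ Metric.closedBall x₀ r := Metric.ball_subset_closedBall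
  have hFb := hF.mono (hbb.trans hb)
  have hvg : ∀ x ∈ Metric.closedBall x₀ r, v x ≤ g x := by
    have := small_comparison hN hr hFb hLr le_rfl (h.c.mono hbc) hgc
      (fun x hx => (h.v x (hb (hbb hx))).mono (fun p => by simp))
      (fun x hx => by
        obtain ⟨p, A, hj, hA⟩ := hgj x hx
        exact ⟨p, A, hj, by rw [hA]; simp⟩)
      (fun x hx => by rw [hgb x hx]; simp)
    intro x hx; simpa using this x hx
  have hgS : ∀ x ∈ Metric.closedBall x₀ r, g x ≤ S x := by
    have := small_comparison hN hr hFb hLr le_rfl hgc (hSc.mono hbc)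
      (fun x hx => by
        obtain ⟨p, A, hj, hA⟩ := hgj x hx
        exact hj.vsub (by rw [hA]; simp))
      (fun x hx => by
        obtain ⟨p, A, hj, hA⟩ := hS x (hb (hbb hx))
        exact ⟨p, A, hj, by simpa using hA⟩)
      (fun x hx => by
        rw [hgb x hx, add_zero]
        exact h.hi x (hbc (hss (by simpa [dist_eq_norm] using hx))))
    intro x hx; simpa using this x hx
  set w : E → ℝ := fun y => if ‖y - x₀‖ ≤ r then g y else v y with hw
  have w1 : ∀ y ∈ Metric.closedBall x₀ r, w y = g y := fun y hy => by
    rw [Metric.mem_closedBall, dist_eq_norm] at hy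
    simp [hw, hy]
  have w2 : ∀ y, y ∉ Metric.ball x₀ r → w y = v y := fun y hy => by
    rw [Metric.mem_ball, dist_eq_norm, not_lt] at hy
    by_cases h' : ‖y - x₀‖ ≤ r
    · simp [hw, h', hgb y (le_antisymm h' hy)]
    · simp [hw, h']
  have w3 : ∀ x ∈ closure Ω, v x ≤ w x := fun x hx => by
    by_cases h' : x ∈ Metric.closedBall x₀ r
    · rw [w1 x h']; exact hvg x h'
    · rw [w2 x (fun h'' => h' (hbb h''))]
  have w4 : ∀ x ∈ Metric.ball x₀ r, ∃ p A, Jet w x p A ∧ bt A = -F x (w x) p := fun x hx => by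
    obtain ⟨p, A, hj, hA⟩ := hgj x hx
    refine ⟨p, A, hj.congr ?_, by rw [w1 x (hbb hx)]; exact hA⟩
    filter_upwards [Metric.isOpen_ball.mem_nhds hx] with y hy using (w1 y (hbb hy)).symm
  refine ⟨w, ⟨?_, fun x hx => (h.lo x hx).trans (w3 x hx), fun x hx => ?_, fun x hx => ?_⟩, w3, w4⟩
  · have e : closure Ω = Metric.closedBall x₀ r ∪ (closure Ω ∩ (Metric.ball x₀ r)ᶜ) := by
      ext y; constructor
      · intro hy
        by_cases h' : y ∈ Metric.ball x₀ r
        · exact Or.inl (hbb h')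
        · exact Or.inr ⟨hy, h'⟩
      · rintro (hy | hy)
        · exact hbc hy
        · exact hy.1
    rw [e]
    refine ContinuousOn.union_of_isClosed (hgc.congr w1) ((h.c.mono inter_subset_left).congr fun y hy => w2 y hy.2)
      Metric.isClosed_closedBall (isClosed_closure.inter Metric.isOpen_ball.isClosed_compl)
  · by_cases h' : x ∈ Metric.closedBall x₀ r
    · rw [w1 x h']; exact hgS x h'
    · rw [w2 x (fun h'' => h' (hbb h''))]; exact h.hi x hx
  · by_cases h' : x ∈ Metric.ball x₀ r
    · obtain ⟨p, A, hj, hA⟩ := w4 x h'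
      exact hj.vsub (by rw [hA]; simp)
    · refine (h.v x hx).of_le ?_ (w2 x h').symm
      filter_upwards [hΩ.mem_nhds hx] with y hy using w3 y (subset_closure hy)

lemma perron (hN : 1 ≤ dm E) {F : E → ℝ → Du E → ℝ} {Ω : Set E} {s S : E → ℝ} {L K H α : ℝ}
    (hF : Nice F Ω L K H α) (hΩ : IsOpen Ω) (hΩb : Bornology.IsBounded Ω)
    (hsc : ContinuousOn s (closure Ω)) (hSc : ContinuousOn S (closure Ω))
    (hs : ∀ x ∈ Ω, ViSub F s x)
    (hS : ∀ x ∈ Ω, ∃ p A, Jet S x p A ∧ F x (S x) p ≤ -bt A)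
    (hsS : ∀ x ∈ closure Ω, s x ≤ S x) (hfr : ∀ x ∈ frontier Ω, s x = S x) :
    ∃ u, ContinuousOn u (closure Ω) ∧ (∀ x ∈ closure Ω, s x ≤ u x ∧ u x ≤ S x) ∧
      (∀ x ∈ Ω, ∃ p A, Jet u x p A ∧ bt A = -F x (u x) p) ∧
      ∀ v, PS F Ω s S v → ∀ x ∈ closure Ω, v x ≤ u x := by
  have hPs : PS F Ω s S s := ⟨hsc, fun x _ => le_rfl, hsS, hs⟩
  have hcomp : IsCompact (closure Ω) := hΩb.isCompact_closure
  set u : E → ℝ := fun x => sSup {a | ∃ v, PS F Ω s S v ∧ v x = a} with hu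
  have hub : ∀ v, PS F Ω s S v → ∀ x ∈ closure Ω, v x ≤ u x := fun v hv x hx =>
    le_csSup ⟨S x, by rintro _ ⟨w, hw, rfl⟩; exact hw.hi x hx⟩ ⟨v, hv, rfl⟩
  have hle : ∀ x, ∀ c, (∀ v, PS F Ω s S v → v x ≤ c) → u x ≤ c := fun x c h =>
    csSup_le ⟨_, s, hPs, rfl⟩ (by rintro _ ⟨w, hw, rfl⟩; exact h w hw)
  have hnear : ∀ x, ∀ ε > 0, ∃ v, PS F Ω s S v ∧ u x - ε < v x := fun x ε hε => by
    by_contra hcon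
    push Not at hcon
    have := hle x _ hcon
    linarith
  obtain ⟨M, hM0, hM⟩ : ∃ M : ℝ, 0 < M ∧ ∀ v, PS F Ω s S v → ∀ x ∈ closure Ω, |v x| ≤ M := by
    obtain ⟨M1, h1⟩ := hcomp.exists_bound_of_continuousOn hsc
    obtain ⟨M2, h2⟩ := hcomp.exists_bound_of_continuousOn hSc
    refine ⟨max (max M1 M2) 1, by positivity, fun v hv x hx => ?_⟩
    have a1 := abs_le.1 (h1 x hx)
    have a2 := abs_le.1 (h2 x hx)
    have a3 := hv.lo x hx
    have a4 := hv.hi x hx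
    have b1 := le_max_left (max M1 M2) 1
    have b2 := le_max_left M1 M2
    have b3 := le_max_right M1 M2
    rw [abs_le]; constructor <;> linarith
  have key : ∀ x₀ ∈ Ω, ∃ p A, Jet u x₀ p A ∧ bt A = -F x₀ (u x₀) p := by
    intro x₀ hx₀
    obtain ⟨r, hr, hLr, hb⟩ : ∃ r > 0, L * (r ^ 2 + 2 * r) ≤ 1 / 2 ∧ Metric.closedBall x₀ r ⊆ Ω := by
      obtain ⟨r₁, hr₁, h1⟩ := Metric.nhds_basis_closedBall.mem_iff.1 (hΩ.mem_nhds hx₀)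
      refine ⟨min (min r₁ 1) (1 / (6 * (L + 1))), by have := hF.L0; positivity, ?_, ?_⟩
      · set r := min (min r₁ 1) (1 / (6 * (L + 1)))
        have hL := hF.L0
        have q1 : r ≤ 1 := (min_le_left _ _).trans (min_le_right _ _)
        have q2 : r ≤ 1 / (6 * (L + 1)) := min_le_right _ _
        have q0 : 0 < r := by positivity
        rw [le_div_iff₀ (by positivity)] at q2
        nlinarith [mul_nonneg hL q0.le, mul_nonneg (mul_nonneg hL q0.le) (sub_nonneg.2 q1)]
      · exact (Metric.closedBall_subset_closedBall ((min_le_left _ _).trans (min_le_left _ _))).trans h1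
    have hbc : Metric.closedBall x₀ r ⊆ closure Ω := hb.trans subset_closure
    have hbb : Metric.ball x₀ r ⊆ Metric.closedBall x₀ r := Metric.ball_subset_closedBall
    set Λ := 6 * M * dm E / (r / 2) + 2 * (r / 2) * K with hΛ
    have hΛ0 : 0 ≤ Λ := by have := hF.K0; positivity
    set B := Metric.ball x₀ (r / 4) with hB
    have hBr : B ⊆ Metric.ball x₀ r := Metric.ball_subset_ball (by linarith)
    have hlip : ∀ v, PS F Ω s S v → (∀ x ∈ Metric.ball x₀ r, ∃ p A, Jet v x p A ∧ bt A = -F x (v x) p) →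
        ∀ x ∈ B, ∀ y ∈ B, |v y - v x| ≤ Λ * ‖y - x‖ := by
      intro v hv hj x hx y hy
      rw [hB, Metric.mem_ball] at hx hy
      have hsub : Metric.closedBall x (r / 2) ⊆ Metric.ball x₀ r := fun z hz => by
        rw [Metric.mem_closedBall] at hz
        rw [Metric.mem_ball]
        linarith [dist_triangle z x x₀]
      refine int_lip hN (by positivity) hM0 hF.K0 (hv.c.mono ((hsub.trans hbb).trans hbc))
        (fun z hz => hM v hv z (hbc (hbb (hsub hz)))) (fun z hz => ?_) y ?_
      · have hz' := hsub (Metric.ball_subset_closedBall hz)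
        obtain ⟨p, A, h1, h2⟩ := hj z hz'
        exact ⟨p, A, h1, by rw [h2, abs_neg]; exact hF.bdd z (hb (hbb hz')) _ _⟩
      · rw [Metric.mem_closedBall]
        linarith [dist_triangle_right y x x₀]
    have happ : ∀ ε > 0, ∃ w, PS F Ω s S w ∧ (∀ x ∈ Metric.ball x₀ r, ∃ p A, Jet w x p A ∧ bt A = -F x (w x) p) ∧
        ∀ x ∈ B, |u x - w x| ≤ ε := by
      intro ε hε
      set δ := ε / (3 * (Λ + 1)) with hδ
      have hδ0 : 0 < δ := by positivity
      have hΛδ : Λ * δ ≤ ε / 3 := by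
        have : (Λ + 1) * δ = ε / 3 := by rw [hδ]; field_simp
        nlinarith
      have htb : TotallyBounded B := (isCompact_closedBall x₀ (r / 4)).totallyBounded.subset Metric.ball_subset_closedBall
      obtain ⟨t, htB, htf, htc⟩ := Metric.finite_approx_of_totallyBounded htb δ hδ0
      obtain ⟨w0, hw0, hw0t⟩ : ∃ w0, PS F Ω s S w0 ∧ ∀ z ∈ t, u z - ε / 3 ≤ w0 z := by
        refine htf.induction_on_subset (motive := fun t' _ => ∃ w0, PS F Ω s S w0 ∧ ∀ z ∈ t', u z - ε / 3 ≤ w0 z) _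
          ⟨s, hPs, by simp⟩ ?_
        rintro a t' ha - - ⟨w0, h1, h2⟩
        obtain ⟨v, hv, hva⟩ := hnear a (ε / 3) (by positivity)
        refine ⟨_, h1.max hv, fun z hz => ?_⟩
        rcases hz with rfl | hz
        · exact hva.le.trans (le_max_right _ _)
        · exact (h2 z hz).trans (le_max_left _ _)
      obtain ⟨w, hw, hw0w, hwj⟩ := hw0.lift hN hF hΩ hSc hS hr hLr hb
      refine ⟨w, hw, hwj, fun x hx => ?_⟩
      have hxc : x ∈ closure Ω := hbc (hbb (hBr hx))
      rw [abs_of_nonneg (by linarith [hub w hw x hxc])]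
      rw [sub_le_iff_le_add]
      refine hle x _ fun v hv => ?_
      obtain ⟨v', hv', hvv', hvj⟩ := hv.lift hN hF hΩ hSc hS hr hLr hb
      obtain ⟨z, hz, hxz⟩ := mem_iUnion₂.1 (htc hx)
      have hzB := htB hz
      have hzc : z ∈ closure Ω := hbc (hbb (hBr hzB))
      have i1 := abs_le.1 (hlip v' hv' hvj x hx z hzB)
      have i2 := abs_le.1 (hlip w hw hwj x hx z hzB)
      have i3 := hub v' hv' z hzc
      have i4 := hw0t z hz
      have i5 := hw0w z hzc
      have i6 := hvv' x hxc
      have i7 : Λ * ‖z - x‖ ≤ Λ * δ := by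
        rw [Metric.mem_ball, dist_comm, dist_eq_norm] at hxz
        gcongr
      linarith
    have hBo : IsOpen B := Metric.isOpen_ball
    have hx₀B : x₀ ∈ B := Metric.mem_ball_self (by positivity)
    have hFB := hF.mono ((hBr.trans hbb).trans hb)
    have huc : ContinuousOn u B := by
      refine continuousOn_of_uniform_approx_of_continuousOn fun V hV => ?_
      obtain ⟨ε, hε, hu⟩ := Metric.mem_uniformity_dist.1 hV
      obtain ⟨w, hw, -, hn⟩ := happ (ε / 2) (by positivity)
      exact ⟨w, hw.c.mono ((hBr.trans hbb).trans hbc), fun x hx => hu (by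
        rw [Real.dist_eq]; exact (hn x hx).trans_lt (by linarith))⟩
    refine visc_jet hN hFB hBo huc (fun x hx => ⟨?_, ?_⟩) x₀ hx₀B
    · refine ViSub.stable hBo hx hFB.cont huc fun ε hε => ?_
      obtain ⟨w, hw, hwj, hn⟩ := happ ε hε
      refine ⟨w, hw.c.mono ((hBr.trans hbb).trans hbc), fun y hy => ?_, hn⟩
      obtain ⟨p, A, h1, h2⟩ := hwj y (hBr hy)
      exact h1.vsub (by rw [h2]; linarith)
    · refine ViSup.stable hBo hx hFB.cont huc fun ε hε => ?_
      obtain ⟨w, hw, hwj, hn⟩ := happ ε hε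
      refine ⟨w, hw.c.mono ((hBr.trans hbb).trans hbc), fun y hy => ?_, hn⟩
      obtain ⟨p, A, h1, h2⟩ := hwj y (hBr hy)
      exact h1.vsup (by rw [h2]; linarith)
  have hbnd : ∀ x ∈ closure Ω, s x ≤ u x ∧ u x ≤ S x := fun x hx =>
    ⟨hub s hPs x hx, hle x _ fun v hv => hv.hi x hx⟩
  refine ⟨u, fun x hx => ?_, hbnd, key, hub⟩
  by_cases hxo : x ∈ Ω
  · obtain ⟨p, A, hj, -⟩ := key x hxo
    exact hj.continuousAt.continuousWithinAt
  · have hf : x ∈ frontier Ω := by rw [hΩ.frontier_eq]; exact ⟨hx, hxo⟩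
    have e1 : u x = s x := le_antisymm ((hbnd x hx).2.trans (hfr x hf).ge) (hbnd x hx).1
    rw [ContinuousWithinAt, e1]
    refine tendsto_of_tendsto_of_tendsto_of_le_of_le' (hsc x hx) (by rw [hfr x hf]; exact hSc x hx) ?_ ?_
    · filter_upwards [self_mem_nhdsWithin] with y hy using (hbnd y hy).1
    · filter_upwards [self_mem_nhdsWithin] with y hy using (hbnd y hy).2

end perron

/-! ## Part 11: reflections and odd harmonic polynomials -/
section refl
variable {E : Type*} [NormedAddCommGroup E] [InnerProductSpace ℝ E] [FiniteDimensional ℝ E]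

lemma Jet.unique2 {u : E → ℝ} {x p A q B} (h : Jet u x p A) (k : Jet u x q B) :
    ∀ a : E, A a a = B a a := by
  intro a
  have h1 := (h.sub k).max (by simp)
  have h2 := (k.sub h).max (by simp)
  have h3 := h1.2 a
  have h4 := h2.2 a
  simp at h3 h4
  linarith

noncomputable def Rf (ν : E) : E →L[ℝ] E := ContinuousLinearMap.id ℝ E - (2:ℝ) • (ip ν).smulRight ν

lemma Rf_apply (ν y : E) : Rf ν y = y - (2 * inner ℝ ν y) • ν := by
  simp [Rf, smul_smul]

lemma Rf_inner {ν : E} (hν : ‖ν‖ = 1) (y : E) : inner ℝ ν (Rf ν y) = -inner ℝ ν y := by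
  rw [Rf_apply, inner_sub_right, inner_smul_right, real_inner_self_eq_norm_sq, hν]; ring

lemma Rf_Rf {ν : E} (hν : ‖ν‖ = 1) (y : E) : Rf ν (Rf ν y) = y := by
  rw [Rf_apply ν (Rf ν y), Rf_inner hν, Rf_apply, sub_sub, ← add_smul]
  simp

lemma Rf_norm {ν : E} (hν : ‖ν‖ = 1) (y : E) : ‖Rf ν y‖ = ‖y‖ := by
  have : ‖Rf ν y‖ ^ 2 = ‖y‖ ^ 2 := by
    rw [Rf_apply, norm_sub_sq_real, inner_smul_right, norm_smul, hν, real_inner_comm, mul_one, Real.norm_eq_abs, sq_abs]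
    ring
  exact (pow_left_inj₀ (norm_nonneg _) (norm_nonneg _) two_ne_zero).1 this

lemma bt_smul' (c : ℝ) (A : Bi E) : bt (c • A) = c * bt A := by simp [bt, Finset.mul_sum]

lemma bt_Rf {ν : E} (hν : ‖ν‖ = 1) (A : Bi E) : bt (A.bilinearComp (Rf ν) (Rf ν)) = bt A := by
  have e : A.bilinearComp (Rf ν) (Rf ν) = A + ((-2:ℝ) • rk (ip ν) (A ν) +
      ((-2:ℝ) • rk (A.flip ν) (ip ν) + (4 * A ν ν) • rk (ip ν) (ip ν))) := by
    ext a b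
    simp [Rf_apply, -inner_neg_left, -inner_neg_right]
    ring
  rw [e, bt_add, bt_add, bt_add, bt_smul', bt_smul', bt_smul', bt_rk_left, bt_rk_right, bt_rk,
    real_inner_self_eq_norm_sq, hν]
  simp
  ring

lemma W_comp (T : E →L[ℝ] E) : ∀ (k : ℕ) (u : E → ℝ), u ∈ W (E := E) k → ∃ j, (fun y => u (T y)) ∈ W (E := E) j := by
  refine W_ind (fun k u => ∃ j, (fun y => u (T y)) ∈ W (E := E) j) ?_ ?_ ?_ ?_ ?_
  · exact fun k => ⟨0, Submodule.zero_mem _⟩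
  · rintro k u v - - ⟨j, hj⟩ ⟨j', hj'⟩
    exact ⟨max j j', Submodule.add_mem _ (W_mono (le_max_left _ _) hj) (W_mono (le_max_right _ _) hj')⟩
  · rintro k c u - ⟨j, hj⟩
    exact ⟨j, Submodule.smul_mem _ c hj⟩
  · exact fun k => ⟨1, W_one 0⟩
  · rintro k i u - ⟨j, hj⟩
    refine ⟨_, W_mul j hj 2 _ (W_lin ((ip (stdOrthonormalBasis ℝ E i)).comp T))⟩

lemma Har.refl {h : E → ℝ} (H : Har h) {ν : E} (hν : ‖ν‖ = 1) : Har (fun y => h (Rf ν y)) := by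
  obtain ⟨k, hk, h0⟩ := H
  obtain ⟨j, hj⟩ := W_comp (Rf ν) k h hk
  refine ⟨j, hj, fun x => ?_⟩
  have hJ := (Jet.comp_affine (x₀ := 0) (Rf ν) (z := x) (by rw [zero_add]; exact W_jet hk (Rf ν x)))
  simp only [zero_add] at hJ
  rw [hJ.dl_eq (W_smooth hj).contDiffAt, bt_Rf hν]
  exact h0 _

lemma Har.add {h g : E → ℝ} (H : Har h) (G : Har g) : Har (fun x => h x + g x) := by
  obtain ⟨k, hk, h0⟩ := H
  obtain ⟨j, hj, g0⟩ := G
  refine ⟨max k j, Submodule.add_mem _ (W_mono (le_max_left _ _) hk) (W_mono (le_max_right _ _) hj), fun x => ?_⟩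
  have := dl_add (W_smooth hk (n := 2)) (W_smooth hj (n := 2)) (x := x)
  rw [h0, g0, add_zero] at this
  exact this

/-- second order Taylor polynomial of an odd harmonic function -/
lemma odd_taylor (hN : 1 ≤ dm E) {m : ℕ} (hm : m = 1 ∨ m = 2) {h : E → ℝ} (H : Har h) {ν : E} (hν : ‖ν‖ = 1)
    (hodd : ∀ y, h (Rf ν y) = -h y) {r M : ℝ} (hr : 0 < r)
    (hb : ∀ y ∈ Metric.closedBall 0 r, |h y| ≤ M) :
    ∃ (a : ℝ) (c : Du E), c ν = 0 ∧ (m = 1 → c = 0) ∧ |a| ≤ (48 * dm E / r) * M ∧ ‖c‖ ≤ (48 * dm E / r) ^ 2 * M ∧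
      ∀ y, ‖y‖ ≤ r / 2 → |h y - inner ℝ ν y * (a + c y)| ≤ (48 * dm E / r) ^ (m + 1) * M * ‖y‖ ^ (m + 1) := by
  obtain ⟨p, A, A', hJ, hA0, hA1, hA2, -, hp, hA, hT⟩ := har_taylor_m hN hm H hr hb
  have h0 : h 0 = 0 := by
    have := hodd 0
    rw [map_zero] at this; linarith
  have hJ' := ((Jet.comp_affine (x₀ := 0) (Rf ν) (z := (0:E)) (by rw [zero_add, map_zero]; exact hJ)).neg).congr
    (v := h) (Eventually.of_forall fun y => by simp [hodd])
  have hpe := (hJ.unique hJ').1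
  have hAe := hJ.unique2 hJ'
  have hp1 : ∀ y, p y = inner ℝ ν y * p ν := by
    intro y
    have := congrArg (fun q : Du E => q y) hpe
    simp [Rf_apply] at this
    linarith
  have hq : ∀ y, A y y = -A (Rf ν y) (Rf ν y) := fun y => by
    have := hAe y
    simpa using this
  have hνν : A ν ν = 0 := by
    have := hq ν
    have e : Rf ν ν = -ν := by
      rw [Rf_apply, real_inner_self_eq_norm_sq, hν]; module
    rw [e] at this; simp at this; linarith
  have hA3 : ∀ y, A y y = inner ℝ ν y * (A ν y + A y ν) := by
    intro y
    have := hq y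
    rw [Rf_apply] at this
    simp [hνν] at this
    linarith
  have hpν : |p ν| ≤ ‖p‖ := by
    have := p.le_opNorm ν
    rwa [hν, mul_one] at this
  rcases hm with rfl | rfl
  · have e := hA1 rfl
    subst e
    have hM : 0 ≤ M := (abs_nonneg _).trans (hb 0 (by simp [hr.le]))
    refine ⟨p ν, 0, by simp, fun _ => rfl, hpν.trans hp, by simp; positivity, fun y hy => ?_⟩
    have := hT y (by simpa using hy)
    rw [h0] at this
    simpa [hp1 y] using this
  · have e := hA2 rfl
    subst e
    refine ⟨p ν, (1/2:ℝ) • (A' ν + A'.flip ν), by simp [hνν], by simp, hpν.trans hp, ?_, fun y hy => ?_⟩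
    · refine ContinuousLinearMap.opNorm_le_bound _ ((ContinuousLinearMap.opNorm_nonneg _).trans hA) fun y => ?_
      have h1 := A'.le_opNorm₂ ν y
      have h2 := A'.le_opNorm₂ y ν
      rw [hν, Real.norm_eq_abs] at h1 h2
      simp only [ContinuousLinearMap.smul_apply, ContinuousLinearMap.add_apply, ContinuousLinearMap.flip_apply, smul_eq_mul,
        Real.norm_eq_abs]
      have h3 : ‖A'‖ * ‖y‖ ≤ (48 * dm E / r) ^ 2 * M * ‖y‖ := by gcongr
      rw [mul_one] at h1 h2
      have := abs_le.1 h1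
      have := abs_le.1 h2
      rw [abs_le]; constructor <;> linarith
    · have := hT y (by simpa using hy)
      rw [h0, sub_zero, hA3, hp1] at this
      convert this using 2
      simp
      ring

end refl

/-! ## Part 12: approximation near a nearly flat boundary -/
section flat
variable {E : Type*} [NormedAddCommGroup E] [InnerProductSpace ℝ E] [FiniteDimensional ℝ E]

structure Flat (ν : E) (D : Set E) (ε κ : ℝ) (v : E → ℝ) : Prop where
  o : IsOpen D
  n : ‖ν‖ = 1
  e0 : 0 ≤ ε
  e1 : ε ≤ 1 / 8
  k0 : 0 < κ
  k1 : κ ≤ 1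
  c : ContinuousOn v (Metric.closedBall 0 1)
  b : ∀ x, ‖x‖ ≤ 1 → |v x| ≤ 1
  z : ∀ x, ‖x‖ ≤ 1 → x ∉ D → v x = 0
  j : ∀ x ∈ D, ‖x‖ < 1 → ∃ p A, Jet v x p A ∧ |bt A| ≤ κ
  hin : ∀ x, ‖x‖ < 1 → ε < inner ℝ ν x → x ∈ D
  hout : ∀ x ∈ D, ‖x‖ < 1 → -ε < inner ℝ ν x

lemma Flat.neg {ν : E} {D : Set E} {ε κ : ℝ} {v : E → ℝ} (h : Flat ν D ε κ v) : Flat ν D ε κ (fun y => -v y) :=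
  { o := h.o, n := h.n, e0 := h.e0, e1 := h.e1, k0 := h.k0, k1 := h.k1, hin := h.hin, hout := h.hout
    c := h.c.neg
    b := fun x hx => by rw [abs_neg]; exact h.b x hx
    z := fun x hx hD => by rw [h.z x hx hD, neg_zero]
    j := fun x hx h1 => by
      obtain ⟨p, A, hj, hA⟩ := h.j x hx h1
      exact ⟨_, _, hj.neg, by rwa [bt_neg, abs_neg]⟩ }

lemma Flat.barrier (hN : 1 ≤ dm E) {ν : E} {D : Set E} {ε κ : ℝ} {v : E → ℝ} (h : Flat ν D ε κ v) {x : E}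
    (hx : ‖x‖ ≤ 1 / 4) (hxD : x ∈ D) : v x ≤ 144 * dm E * (inner ℝ ν x + ε) := by
  set s := inner ℝ ν x + ε with hs
  have hs0 : 0 < s := by have := h.hout x hxD (by linarith); linarith
  have hins : ∀ y : E, |inner ℝ ν y| ≤ ‖y‖ := fun y => by
    have := abs_real_inner_le_norm ν y
    rwa [h.n, one_mul] at this
  have hs1 : s ≤ 3 / 8 := by
    have := le_of_abs_le (hins x)
    have := h.e1
    linarith
  set x' := x - s • ν with hx'
  have hx'n : ‖x'‖ ≤ 5 / 8 := by
    refine (norm_sub_le _ _).trans ?_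
    rw [norm_smul, h.n, Real.norm_eq_abs, abs_of_pos hs0]; linarith
  have hνx' : inner ℝ ν x' = -ε := by
    rw [hx', inner_sub_right, inner_smul_right, real_inner_self_eq_norm_sq, h.n, hs]; ring
  set β : E → ℝ := fun y => 16 * (‖y - x'‖ ^ 2 + 8 * dm E * inner ℝ ν (y - x') - 2 * dm E * inner ℝ ν (y - x') ^ 2) with hβ
  have hβc : Continuous β := by fun_prop
  have hβj : ∀ y, ∃ p A, Jet β y p A ∧ bt A = -(32 * dm E) := by
    intro y
    refine ⟨_, _, ((((jet_sq x' y).add ((jet_lin (ip ν) x' y).smul (8 * dm E))).sub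
      (((jet_lin (ip ν) x' y).mul (jet_lin (ip ν) x' y)).smul (2 * dm E))).smul 16).congr ?_, ?_⟩
    · refine Eventually.of_forall fun z => ?_
      simp only [hβ, ip_apply]; ring
    · simp only [bt_smul, bt_sub, bt_add, bt_rk, bt_ip, real_inner_self_eq_norm_sq, h.n]
      simp [bt]
      simp [dm]
      ring
  have hcl : closure (D ∩ Metric.ball 0 1) ⊆ Metric.closedBall 0 1 :=
    (closure_mono inter_subset_right).trans Metric.closure_ball_subset_closedBall
  have hcl2 : closure (D ∩ Metric.ball 0 1) ⊆ {y | -ε ≤ inner ℝ ν y} :=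
    closure_minimal (fun y hy => (h.hout y hy.1 (by simpa using hy.2)).le)
      (isClosed_le continuous_const (by fun_prop))
  have hU : IsOpen (D ∩ Metric.ball 0 1) := h.o.inter Metric.isOpen_ball
  have := maxprinc_jet hU (Metric.isBounded_ball.subset inter_subset_right) hN
    (v := v) (h := β) (h.c.mono hcl) hβc.continuousOn (fun y hy => ?_) (fun y hy => ?_) x
    (subset_closure ⟨hxD, by simp; linarith⟩)
  · refine this.trans ?_
    have e1 : x - x' = s • ν := by rw [hx']; abel
    have e2 : ‖s • ν‖ ^ 2 = s ^ 2 := by rw [norm_smul, h.n, mul_one, Real.norm_eq_abs, sq_abs]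
    have e3 : inner ℝ ν (s • ν) = s := by rw [inner_smul_right, real_inner_self_eq_norm_sq, h.n]; ring
    simp only [hβ]
    rw [e1, e2, e3]
    nlinarith [mul_nonneg (mul_nonneg hs0.le hs0.le) (zero_le_one.trans hN), mul_nonneg hs0.le (sub_nonneg.2 hN),
      mul_nonneg hs0.le (sub_nonneg.2 hs1)]
  · obtain ⟨p, A, hj, hA⟩ := h.j y hy.1 (by simpa using hy.2)
    obtain ⟨q, B, hj', hB⟩ := hβj y
    refine ⟨p, A, q, B, hj, hj', ?_⟩
    rw [hB]
    have := abs_le.1 hA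
    have := h.k1
    linarith
  · rw [hU.frontier_eq] at hy
    have y1 : ‖y‖ ≤ 1 := by simpa using hcl hy.1
    have y2 : -ε ≤ inner ℝ ν y := hcl2 hy.1
    have y3 : inner ℝ ν (y - x') = inner ℝ ν y + ε := by rw [inner_sub_right, hνx']; ring
    have y4 := le_of_abs_le (hins y)
    have e1 := h.e1
    have y5 : 0 ≤ 8 * dm E * inner ℝ ν (y - x') - 2 * dm E * inner ℝ ν (y - x') ^ 2 := by
      rw [y3]
      have : 0 ≤ 2 * dm E * (inner ℝ ν y + ε) * (4 - (inner ℝ ν y + ε)) :=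
        mul_nonneg (mul_nonneg (by linarith) (by linarith)) (by linarith)
      nlinarith
    rcases y1.lt_or_eq with y6 | y6
    · rw [h.z y y1 (fun hD => hy.2 ⟨hD, by simpa using y6⟩)]
      simp only [hβ]
      nlinarith [sq_nonneg ‖y - x'‖]
    · have y7 : 3 / 8 ≤ ‖y - x'‖ := by
        have := norm_sub_norm_le y x'
        linarith
      have := le_of_abs_le (h.b y y1)
      simp only [hβ]
      nlinarith

lemma Flat.absb (hN : 1 ≤ dm E) {ν : E} {D : Set E} {ε κ : ℝ} {v : E → ℝ} (h : Flat ν D ε κ v) {x : E}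
    (hx : ‖x‖ ≤ 1 / 4) : |v x| ≤ 144 * dm E * max (inner ℝ ν x + ε) 0 := by
  by_cases hD : x ∈ D
  · have h1 := h.barrier hN hx hD
    have h2 := h.neg.barrier hN hx hD
    have h3 : 144 * dm E * (inner ℝ ν x + ε) ≤ 144 * dm E * max (inner ℝ ν x + ε) 0 := by
      gcongr; exact le_max_left _ _
    rw [abs_le]; constructor <;> linarith
  · rw [h.z x (by linarith) hD, abs_zero]
    exact mul_nonneg (by linarith) (le_max_right _ _)

lemma tau (θ : ℝ) (hθ : 0 ≤ θ) : ∃ τ : ℝ → ℝ, Continuous τ ∧ (∀ t, |t| ≤ θ → τ t = 0) ∧ (∀ t, |τ t| ≤ |t|) ∧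
    ∀ t, |τ t - t| ≤ θ := by
  refine ⟨fun t => t - max (-θ) (min t θ), by fun_prop, fun t ht => ?_, fun t => ?_, fun t => ?_⟩
  · have := abs_le.1 ht
    simp only
    rw [min_eq_left this.2, max_eq_right this.1, sub_self]
  · rcases le_total t θ with h1 | h1
    · rcases le_total (-θ) t with h2 | h2
      · simp [min_eq_left h1, max_eq_right h2]
      · simp only [min_eq_left h1, max_eq_left h2]
        rw [abs_of_nonpos (by linarith), abs_of_nonpos (by linarith)]; linarith
    · simp only [min_eq_right h1]
      rw [max_eq_right (by linarith), abs_of_nonneg (by linarith), abs_of_nonneg (by linarith)]; linarith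
  · have h1 : -θ ≤ max (-θ) (min t θ) := le_max_left _ _
    have h2 : max (-θ) (min t θ) ≤ θ := max_le (by linarith) (min_le_right _ _)
    rw [abs_le]; constructor <;> linarith

lemma Flat.har (hN : 1 ≤ dm E) {ν : E} {D : Set E} {ε κ : ℝ} {v : E → ℝ} (h : Flat ν D ε κ v) :
    ∃ g, Har g ∧ (∀ y, g (Rf ν y) = -g y) ∧
      (∀ y, ‖y‖ ≤ 1 / 4 → |g y| ≤ 144 * dm E * (|inner ℝ ν y| + ε) + κ) ∧
      ∀ y ∈ D, ‖y‖ ≤ 1 / 4 → |v y - g y| ≤ 4 * (144 * dm E) * ε + 3 * κ := by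
  set C := 144 * dm E with hC
  have hC0 : 0 < C := by rw [hC]; linarith
  have he0 := h.e0
  have hk0 := h.k0
  obtain ⟨τ, τc, τ0, τ1, τ2⟩ := tau (2 * C * ε) (by positivity)
  set V : E → ℝ := fun y => τ (v y) - τ (v (Rf ν y)) with hV
  have hRb : ∀ y, ‖Rf ν y‖ = ‖y‖ := Rf_norm h.n
  have hins : ∀ y : E, |inner ℝ ν y| ≤ ‖y‖ := fun y => by
    have := abs_real_inner_le_norm ν y
    rwa [h.n, one_mul] at this
  have hVc : ContinuousOn V (Metric.sphere 0 (1 / 4)) := by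
    have hc : ContinuousOn v (Metric.sphere 0 (1 / 4)) := h.c.mono (fun y hy => by
      simp at hy ⊢; rw [hy]; norm_num)
    refine (τc.comp_continuousOn hc).sub (τc.comp_continuousOn ?_)
    refine hc.comp (Rf ν).continuous.continuousOn fun y hy => ?_
    simp at hy ⊢; rw [hRb, hy]
  have hV1 : ∀ y, ‖y‖ ≤ 1 / 4 → 0 ≤ inner ℝ ν y → V y = τ (v y) := by
    intro y hy h0
    simp only [hV]
    rw [τ0 (v (Rf ν y)), sub_zero]
    refine (h.absb hN (by rw [hRb]; exact hy)).trans ?_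
    rw [Rf_inner h.n, ← hC]
    have : max (-inner ℝ ν y + ε) 0 ≤ 2 * ε := max_le (by linarith) (by linarith)
    nlinarith
  obtain ⟨k, q0, hq0, hqa⟩ := W_dense (isCompact_sphere (0:E) (1/4)) hVc hk0
  obtain ⟨n, q, hq, hq1, hq2⟩ := poly_dirichlet hN 0 (by norm_num : (0:ℝ) < 1/4) (Submodule.zero_mem (W (E := E) 0)) hq0
  have Hq : Har q := ⟨n, hq, fun x => by simpa using hq1 x⟩
  have hqV : ∀ y, ‖y‖ = 1 / 4 → |q y - V y| ≤ κ := fun y hy => by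
    rw [hq2 y (by simpa using hy)]
    exact hqa y (by simpa using hy)
  set g : E → ℝ := fun y => 1 / 2 * (q y + -q (Rf ν y)) with hg
  have Hg : Har g := (Hq.add (Hq.refl h.n).neg).smul (1 / 2)
  have hgo : ∀ y, g (Rf ν y) = -g y := fun y => by
    simp only [hg]; rw [Rf_Rf h.n]; ring
  have hgV : ∀ y, ‖y‖ = 1 / 4 → |g y - V y| ≤ κ := fun y hy => by
    have a1 := abs_le.1 (hqV y hy)
    have a2 := abs_le.1 (hqV (Rf ν y) (by rw [hRb, hy]))
    have a3 : V (Rf ν y) = - V y := by simp only [hV]; rw [Rf_Rf h.n]; ring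
    rw [a3] at a2
    simp only [hg]
    rw [abs_le]; constructor <;> linarith
  have hgl : ∀ f : E → ℝ, Har f → (∀ y, f (Rf ν y) = -f y) →
      (∀ y, ‖y‖ = 1 / 4 → 0 ≤ inner ℝ ν y → f y ≤ C * (inner ℝ ν y + ε) + κ) →
      ∀ y, ‖y‖ ≤ 1 / 4 → 0 < inner ℝ ν y → f y ≤ C * (inner ℝ ν y + ε) + κ := by
    intro f Hf hfo hfb
    set U : Set E := Metric.ball 0 (1/4) ∩ {y | 0 < inner ℝ ν y} with hU
    have hUo : IsOpen U := Metric.isOpen_ball.inter (isOpen_lt continuous_const (by fun_prop))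
    have hcl1 : closure U ⊆ Metric.closedBall 0 (1/4) :=
      (closure_mono inter_subset_left).trans Metric.closure_ball_subset_closedBall
    have hcl2 : closure U ⊆ {y | 0 ≤ inner ℝ ν y} :=
      closure_minimal (fun y hy => (show (0:ℝ) < inner ℝ ν y from hy.2).le) (isClosed_le continuous_const (by fun_prop))
    have hmp := maxprinc_jet hUo (Metric.isBounded_ball.subset inter_subset_left) hN
      (v := f) (h := fun y => C * (inner ℝ ν y + ε) + κ) Hf.cont.continuousOn (by fun_prop) (fun y hy => by
        obtain ⟨p, A, hj, hA⟩ := Hf.jet y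
        refine ⟨p, A, _, _, hj, (((jet_lin (ip ν) 0 y).smul C).add (jet_const (C * ε + κ) y)).congr
          (Eventually.of_forall fun z => ?_), ?_⟩
        · simp; ring
        · rw [hA]; simp [bt]) (fun y hy => by
        rw [hUo.frontier_eq] at hy
        have y1 : ‖y‖ ≤ 1/4 := by simpa using hcl1 hy.1
        have y2 : 0 ≤ inner ℝ ν y := hcl2 hy.1
        rcases y2.lt_or_eq with y3 | y3
        · rcases y1.lt_or_eq with y4 | y4
          · exact absurd ⟨by simpa using y4, y3⟩ hy.2
          · exact hfb y y4 y2
        · have e : Rf ν y = y := by rw [Rf_apply, ← y3]; simp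
          have := hfo y
          rw [e] at this
          have : f y = 0 := by linarith
          rw [this]; positivity)
    intro y hy h0
    refine hmp y ?_
    have hcl : y ∈ closure U := by
      rw [mem_closure_iff_nhds_basis Metric.nhds_basis_ball]
      intro δ hδ
      refine ⟨(max (1 - δ) (1/2)) • y, ⟨?_, ?_⟩, ?_⟩
      · have m1 : max (1 - δ) (1/2) < 1 := max_lt (by linarith) (by norm_num)
        have m2 : 0 < max (1 - δ) (1/2) := lt_max_of_lt_right (by norm_num)
        have : 0 < ‖y‖ := lt_of_lt_of_le h0 (le_of_abs_le (hins y))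
        simp only [Metric.mem_ball, dist_zero_right, norm_smul, Real.norm_eq_abs, abs_of_pos m2]
        nlinarith
      · have m2 : 0 < max (1 - δ) (1/2) := lt_max_of_lt_right (by norm_num)
        simp only [mem_setOf_eq, inner_smul_right]
        positivity
      · have m1 : max (1 - δ) (1/2) < 1 := max_lt (by linarith) (by norm_num)
        have m3 : 1 - δ ≤ max (1 - δ) (1/2) := le_max_left _ _
        rw [Metric.mem_ball, dist_eq_norm]
        have e : (max (1 - δ) (1/2)) • y - y = (max (1 - δ) (1/2) - 1) • y := by module
        rw [e, norm_smul, Real.norm_eq_abs, abs_of_neg (by linarith)]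
        nlinarith [norm_nonneg y]
    exact hcl
  have hVb : ∀ y, ‖y‖ = 1 / 4 → 0 ≤ inner ℝ ν y → |V y| ≤ C * (inner ℝ ν y + ε) := by
    intro y hy h0
    rw [hV1 y hy.le h0]
    have := (τ1 (v y)).trans (h.absb hN hy.le)
    rwa [max_eq_left (by linarith)] at this
  have hgb : ∀ y, ‖y‖ ≤ 1 / 4 → 0 < inner ℝ ν y → |g y| ≤ C * (inner ℝ ν y + ε) + κ := by
    intro y hy h0
    have a1 := hgl g Hg hgo (fun y hy h0 => by
      have := abs_le.1 (hgV y hy)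
      have := abs_le.1 (hVb y hy h0)
      linarith) y hy h0
    have a2 := hgl (fun y => -g y) Hg.neg (fun y => by rw [hgo]) (fun y hy h0 => by
      have := abs_le.1 (hgV y hy)
      have := abs_le.1 (hVb y hy h0)
      linarith) y hy h0
    rw [abs_le]; constructor <;> linarith
  have hgb' : ∀ y, ‖y‖ ≤ 1 / 4 → |g y| ≤ C * (|inner ℝ ν y| + ε) + κ := by
    intro y hy
    rcases lt_trichotomy 0 (inner ℝ ν y) with h0 | h0 | h0
    · rw [abs_of_pos h0]; exact hgb y hy h0
    · have e : Rf ν y = y := by rw [Rf_apply, ← h0]; simp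
      have := hgo y
      rw [e] at this
      have : g y = 0 := by linarith
      rw [this, abs_zero]; positivity
    · have := hgb (Rf ν y) (by rw [hRb]; exact hy) (by rw [Rf_inner h.n]; linarith)
      rw [hgo, abs_neg, Rf_inner h.n] at this
      rwa [abs_of_neg h0]
  refine ⟨g, Hg, hgo, hgb', ?_⟩
  set U : Set E := D ∩ Metric.ball 0 (1/4) with hU
  have hUo : IsOpen U := h.o.inter Metric.isOpen_ball
  have hcl : closure U ⊆ Metric.closedBall 0 (1/4) :=
    (closure_mono inter_subset_right).trans Metric.closure_ball_subset_closedBall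
  have hcl2 : closure U ⊆ {y | -ε ≤ inner ℝ ν y} :=
    closure_minimal (fun y hy => (h.hout y hy.1 (by have := hy.2; simp at this; linarith)).le)
      (isClosed_le continuous_const (by fun_prop))
  have hfr : ∀ y ∈ frontier U, |v y - g y| ≤ 4 * C * ε + 2 * κ := by
    intro y hy
    rw [hUo.frontier_eq] at hy
    have y1 : ‖y‖ ≤ 1/4 := by simpa using hcl hy.1
    have y2 : -ε ≤ inner ℝ ν y := hcl2 hy.1
    have yb := h.absb hN y1
    rw [← hC] at yb
    have yg := hgb' y y1
    have hCe : 0 ≤ C * ε := by positivity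
    have small : |inner ℝ ν y| ≤ ε → |g y| ≤ 2 * C * ε + κ := fun hle => by nlinarith
    by_cases hD : y ∈ D
    · have y3 : ‖y‖ = 1/4 := by
        rcases y1.lt_or_eq with y4 | y4
        · exact absurd ⟨hD, by simpa using y4⟩ hy.2
        · exact y4
      rcases le_or_gt 0 (inner ℝ ν y) with h0 | h0
      · have a1 := abs_le.1 (hgV y y3)
        rw [hV1 y y1 h0] at a1
        have a2 := abs_le.1 (τ2 (v y))
        rw [abs_le]; constructor <;> linarith
      · have a1 := abs_le.1 (small (by rw [abs_of_neg h0]; linarith))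
        have a2 : max (inner ℝ ν y + ε) 0 ≤ ε := max_le (by linarith) he0
        have a3 := abs_le.1 (yb.trans (mul_le_mul_of_nonneg_left a2 hC0.le))
        rw [abs_le]; constructor <;> linarith
    · rw [h.z y (by linarith) hD, zero_sub, abs_neg]
      have : inner ℝ ν y ≤ ε := by
        by_contra hcon
        exact hD (h.hin y (by linarith) (not_le.1 hcon))
      have := small (abs_le.2 ⟨y2, this⟩)
      linarith
  have hclc : ContinuousOn v (closure U) := h.c.mono (hcl.trans (Metric.closedBall_subset_closedBall (by norm_num)))
  intro y hyD hy
  have hvs : ∀ x ∈ U, ViSub (cst κ) v x ∧ ViSub (cst κ) (fun y => -v y) x := fun x hx => by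
    have hx2 := hx.2
    simp at hx2
    obtain ⟨p, A, hj, hA⟩ := h.j x hx.1 (by linarith)
    have := abs_le.1 hA
    exact ⟨hj.vsub (by simp only [cst]; linarith), hj.neg.vsub (by simp only [cst, bt_neg]; linarith)⟩
  have c1 := har_comp hN Hg hUo (by norm_num : (0:ℝ) < 1/4) hk0.le inter_subset_right hclc (fun x hx => (hvs x hx).1)
    (e := 4 * C * ε + 2 * κ) (fun y hy => by linarith [(abs_le.1 (hfr y hy)).2])
  have c2 := har_comp hN (u := fun y => -v y) Hg.neg hUo (by norm_num : (0:ℝ) < 1/4) hk0.le inter_subset_right hclc.neg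
    (fun x hx => (hvs x hx).2)
    (e := 4 * C * ε + 2 * κ) (fun y hy => by linarith [(abs_le.1 (hfr y hy)).1])
  have hyc : y ∈ closure U := by
    have : y ∈ closure (Metric.ball (0:E) (1/4)) := by
      rw [closure_ball _ (by norm_num)]; simpa using hy
    exact h.o.inter_closure ⟨hyD, this⟩
  have d1 := c1 y hyc
  have d2 := c2 y hyc
  rw [abs_le]; constructor <;> linarith

end flat

/-! ## Part 13: scaled approximation -/
section flatscaled
variable {E : Type*} [NormedAddCommGroup E] [InnerProductSpace ℝ E] [FiniteDimensional ℝ E]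

lemma flat_taylor (hN : 1 ≤ dm E) {m : ℕ} (hm : m = 1 ∨ m = 2) : ∃ C : ℝ, 1 ≤ C ∧
    ∀ (ν : E) (D : Set E) (ε κ : ℝ) (v : E → ℝ), Flat ν D ε κ v →
    ∃ (a : ℝ) (c : Du E), c ν = 0 ∧ (m = 1 → c = 0) ∧ |a| ≤ C ∧ ‖c‖ ≤ C ∧
      ∀ y ∈ D, ‖y‖ ≤ 1 / 8 → |v y - inner ℝ ν y * (a + c y)| ≤ C * (ε + κ + ‖y‖ ^ (m + 1)) := by
  set M := 55 * dm E with hM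
  set B := 48 * dm E / (1 / 4) with hB
  have hB1 : 192 ≤ B := by rw [hB]; linarith
  have hM1 : 55 ≤ M := by linarith
  have hM0 : 0 ≤ M := by linarith
  have p1 : B ≤ B ^ 3 := le_self_pow₀ (by linarith) (by norm_num)
  have p2 : B ^ 2 ≤ B ^ 3 := pow_le_pow_right₀ (by linarith) (by norm_num)
  have p3 : B ^ (m + 1) ≤ B ^ 3 := pow_le_pow_right₀ (by linarith) (by rcases hm with rfl | rfl <;> norm_num)
  have q1 : B * M ≤ B ^ 3 * M := by gcongr
  refine ⟨B ^ 3 * M, by nlinarith, fun ν D ε κ v h => ?_⟩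
  obtain ⟨g, Hg, ho, hb, hv⟩ := h.har hN
  have he0 := h.e0
  have he1 := h.e1
  have hk0 := h.k0
  have hk1 := h.k1
  have hins : ∀ y : E, |inner ℝ ν y| ≤ ‖y‖ := fun y => by
    have := abs_real_inner_le_norm ν y
    rwa [h.n, one_mul] at this
  obtain ⟨a, c, h1, h2, h3, h4, h5⟩ := odd_taylor hN hm Hg h.n ho (r := 1/4) (M := M) (by norm_num) (fun y hy => by
    have hy' : ‖y‖ ≤ 1/4 := by simpa using hy
    refine (hb y hy').trans ?_
    have := hins y
    have : 144 * dm E * (|inner ℝ ν y| + ε) ≤ 144 * dm E * (1/4 + 1/8) := by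
      gcongr; linarith
    rw [hM]; linarith)
  rw [← hB] at h3 h4 h5
  refine ⟨a, c, h1, h2, h3.trans q1, h4.trans (by gcongr), fun y hy hy8 => ?_⟩
  have e1 := abs_le.1 (hv y hy (by linarith))
  have e2 := abs_le.1 (h5 y (by linarith))
  have e3 : B ^ (m + 1) * M * ‖y‖ ^ (m + 1) ≤ B ^ 3 * M * ‖y‖ ^ (m + 1) := by gcongr
  have e4 : 4 * (144 * dm E) * ε ≤ B ^ 3 * M * ε := by
    refine mul_le_mul_of_nonneg_right ?_ he0
    have : 192 * M ≤ B * M := by gcongr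
    linarith
  have e5 : 3 * κ ≤ B ^ 3 * M * κ := by gcongr; nlinarith
  rw [abs_le]; constructor <;> linarith

lemma bt_scale (A : Bi E) (r : ℝ) : bt (A.bilinearComp (r • ContinuousLinearMap.id ℝ E) (r • ContinuousLinearMap.id ℝ E)) =
    r ^ 2 * bt A := by
  simp [bt, Finset.mul_sum]
  refine Finset.sum_congr rfl fun i _ => ?_
  ring

lemma flat_scaled (hN : 1 ≤ dm E) {m : ℕ} (hm : m = 1 ∨ m = 2) : ∃ C : ℝ, 1 ≤ C ∧
    ∀ (ν x₀ : E) (D : Set E) (ε θ r M : ℝ) (v : E → ℝ), ‖ν‖ = 1 → IsOpen D → 0 < r → 0 < M → 0 ≤ ε → ε ≤ 1 / 8 →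
      0 < θ → θ ≤ 1 → ContinuousOn v (Metric.closedBall x₀ r) → (∀ x, ‖x - x₀‖ ≤ r → |v x| ≤ M) →
      (∀ x, ‖x - x₀‖ ≤ r → x ∉ D → v x = 0) →
      (∀ x ∈ D, ‖x - x₀‖ < r → ∃ p A, Jet v x p A ∧ |bt A| ≤ θ * M / r ^ 2) →
      (∀ x, ‖x - x₀‖ < r → ε * r < inner ℝ ν (x - x₀) → x ∈ D) →
      (∀ x ∈ D, ‖x - x₀‖ < r → -(ε * r) < inner ℝ ν (x - x₀)) →
    ∃ (a : ℝ) (c : Du E), c ν = 0 ∧ (m = 1 → c = 0) ∧ |a| ≤ C * M / r ∧ ‖c‖ ≤ C * M / r ^ 2 ∧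
      ∀ y ∈ D, ‖y - x₀‖ ≤ r / 8 → |v y - inner ℝ ν (y - x₀) * (a + c (y - x₀))| ≤
        C * M * (ε + θ + (‖y - x₀‖ / r) ^ (m + 1)) := by
  obtain ⟨C, hC, H⟩ := flat_taylor (E := E) hN hm
  refine ⟨C, hC, ?_⟩
  intro ν x₀ D ε θ r M v hν hD hr hM he0 he1 ht0 ht1 hc hb hz hj hin hout
  have hnr : ∀ y : E, ‖x₀ + r • y - x₀‖ = r * ‖y‖ := fun y => by
    rw [add_sub_cancel_left, norm_smul, Real.norm_eq_abs, abs_of_pos hr]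
  have hle : ∀ y : E, ‖y‖ ≤ 1 → ‖x₀ + r • y - x₀‖ ≤ r := fun y hy => by rw [hnr]; nlinarith
  have hlt : ∀ y : E, ‖y‖ < 1 → ‖x₀ + r • y - x₀‖ < r := fun y hy => by rw [hnr]; nlinarith
  have hinn : ∀ y : E, inner ℝ ν (x₀ + r • y - x₀) = r * inner ℝ ν y := fun y => by
    rw [add_sub_cancel_left, inner_smul_right]
  have hcont : Continuous fun y : E => x₀ + r • y := by fun_prop
  have hflat : Flat ν ((fun y => x₀ + r • y) ⁻¹' D) ε θ (fun y => M⁻¹ * v (x₀ + r • y)) :=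
    { o := hD.preimage hcont
      n := hν
      e0 := he0
      e1 := he1
      k0 := ht0
      k1 := ht1
      c := (hc.comp hcont.continuousOn (fun y hy => by
        rw [Metric.mem_closedBall, dist_eq_norm]; exact hle y (by simpa using hy))).const_smul M⁻¹
      b := fun x hx => by
        rw [abs_mul, abs_of_pos (by positivity : 0 < M⁻¹), inv_mul_le_iff₀ hM, mul_one]
        exact hb _ (hle x hx)
      z := fun x hx hxD => by rw [hz _ (hle x hx) hxD, mul_zero]
      j := fun x hx hx1 => by
        obtain ⟨p, A, hJ, hA⟩ := hj _ hx (hlt x hx1)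
        have := ((Jet.comp_affine (x₀ := x₀) (r • ContinuousLinearMap.id ℝ E) (z := x) (u := v) (p := p) (A := A)
          (by simpa using hJ)).smul M⁻¹)
        refine ⟨_, _, by simpa using this, ?_⟩
        rw [bt_smul, bt_scale, abs_mul, abs_mul, abs_of_pos (by positivity : 0 < M⁻¹), abs_of_pos (by positivity : 0 < r ^ 2)]
        rw [inv_mul_le_iff₀ hM, ← le_div_iff₀' (by positivity)]
        exact hA.trans (le_of_eq (by ring))
      hin := fun x hx hx2 => hin _ (hlt x hx) (by rw [hinn]; nlinarith)
      hout := fun x hx hx2 => by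
        have := hout _ hx (hlt x hx2)
        rw [hinn] at this
        by_contra hcon
        nlinarith }
  obtain ⟨a, c, h1, h2, h3, h4, h5⟩ := H _ _ _ _ _ hflat
  refine ⟨M * a / r, (M / r ^ 2) • c, by simp [h1], fun h => by simp [h2 h], ?_, ?_, fun y hy hy8 => ?_⟩
  · rw [abs_div, abs_mul, abs_of_pos hM, abs_of_pos hr]
    gcongr ?_ / r
    rw [mul_comm]; gcongr
  · rw [norm_smul, Real.norm_eq_abs, abs_of_pos (by positivity), div_mul_eq_mul_div, mul_comm]
    gcongr
  · have e : x₀ + r • (r⁻¹ • (y - x₀)) = y := by rw [smul_smul, mul_inv_cancel₀ hr.ne', one_smul]; abel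
    have hn : ‖r⁻¹ • (y - x₀)‖ = ‖y - x₀‖ / r := by
      rw [norm_smul, norm_inv, Real.norm_eq_abs, abs_of_pos hr]; ring
    have := h5 (r⁻¹ • (y - x₀)) (by simpa [mem_preimage, e] using hy) (by
      rw [hn, div_le_iff₀ hr]; linarith)
    rw [e, hn, inner_smul_right, map_smul, smul_eq_mul] at this
    have e2 : v y - inner ℝ ν (y - x₀) * (M * a / r + ((M / r ^ 2) • c) (y - x₀)) =
        M * (M⁻¹ * v y - r⁻¹ * inner ℝ ν (y - x₀) * (a + r⁻¹ * c (y - x₀))) := by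
      simp only [ContinuousLinearMap.smul_apply, smul_eq_mul]
      field_simp
    rw [e2, abs_mul, abs_of_pos hM]
    calc M * _ ≤ M * _ := mul_le_mul_of_nonneg_left this hM.le
      _ = _ := by ring

end flatscaled

/-! ## Part 14: expansions at boundary points -/
section bdryreg
variable {E : Type*} [NormedAddCommGroup E] [InnerProductSpace ℝ E] [FiniteDimensional ℝ E]

/-- quantitative `C^{2,α}` data on a set -/
structure CW (w : E → ℝ) (n : E → E) (A : E → Bi E) (U : Set E) (Λ α : ℝ) : Prop where
  j : ∀ y ∈ U, Jet w y (ip (n y)) (A y)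
  n0 : ∀ y ∈ U, ‖n y‖ ≤ Λ
  A0 : ∀ y ∈ U, ‖A y‖ ≤ Λ
  n1 : ∀ y ∈ U, ∀ y' ∈ U, ‖n y' - n y‖ ≤ Λ * ‖y' - y‖
  A1 : ∀ y ∈ U, ∀ y' ∈ U, ‖A y' - A y‖ ≤ Λ * ‖y' - y‖ ^ α
  w1 : ∀ y ∈ U, ∀ y' ∈ U, |w y' - w y - inner ℝ (n y) (y' - y)| ≤ Λ * ‖y' - y‖ ^ 2
  w2 : ∀ y ∈ U, ∀ y' ∈ U, |w y' - qd y (w y) (ip (n y)) (A y) y'| ≤ Λ * ‖y' - y‖ ^ (2 + α)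

lemma jetQ {w : E → ℝ} {y n : E} {A : Bi E} (h : Jet w y (ip n) A) (a : ℝ) (b : Du E) (z : E) :
    ∃ p B, Jet (fun y => w y * (a + b (y - z))) y p B ∧ bt B = (a + b (y - z)) * bt A + 2 * b n := by
  refine ⟨_, _, h.mul ((jet_const a y).add (jet_lin b z y)), ?_⟩
  simp only [zero_add, bt_add, bt_smul, bt_rk_left, bt_rk_right]
  have : bt (0 : Bi E) = 0 := by simp [bt]
  rw [this]; ring

open Classical in
/-- the constant used in the constraint at a boundary point -/
noncomputable def om (m : ℕ) (A : Bi E) : ℝ := if m = 1 then 0 else bt A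

lemma om_le (hN : 1 ≤ dm E) (m : ℕ) {A : Bi E} {Λ : ℝ} (h : ‖A‖ ≤ Λ) : |om m A| ≤ dm E * Λ := by
  have h0 : 0 ≤ ‖A‖ := ContinuousLinearMap.opNorm_nonneg A
  unfold om; split_ifs
  · simp; nlinarith
  · refine (bt_le A).trans ?_; gcongr

lemma om_diff (hN : 1 ≤ dm E) {m : ℕ} (hm : m = 1 ∨ m = 2) {α Λ r t : ℝ} (hα0 : 0 < α) (hα1 : α < 1)
    (hr : 0 < r) (hr1 : r ≤ 1) (ht : t ≤ r) (ht0 : 0 ≤ t) (hΛ : 0 ≤ Λ) {A A' : Bi E} (hA : ‖A‖ ≤ Λ)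
    (h : ‖A - A'‖ ≤ Λ * t ^ α) : |bt A - om m A'| ≤ dm E * Λ * r ^ ((m:ℝ) + α - 2) := by
  rcases hm with rfl | rfl
  · simp only [om, if_true, sub_zero]
    refine (bt_le A).trans ?_
    have h1 : 1 ≤ r ^ (((1:ℕ):ℝ) + α - 2) := Real.one_le_rpow_of_pos_of_le_one_of_nonpos hr hr1 (by push_cast; linarith)
    calc dm E * ‖A‖ ≤ dm E * Λ * 1 := by rw [mul_one]; gcongr
      _ ≤ _ := by gcongr
  · have : om 2 A' = bt A' := by simp [om]
    rw [this, ← bt_sub]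
    refine (bt_le _).trans ?_
    have e : (((2:ℕ):ℝ) + α - 2) = α := by push_cast; ring
    rw [e, mul_assoc]
    have : t ^ α ≤ r ^ α := Real.rpow_le_rpow ht0 ht hα0.le
    have : Λ * t ^ α ≤ Λ * r ^ α := by gcongr
    have : ‖A - A'‖ ≤ Λ * r ^ α := h.trans this
    gcongr

set_option maxHeartbeats 4000000 in
lemma bdry_reg (hN : 1 ≤ dm E) {m : ℕ} (hm : m = 1 ∨ m = 2) {α Λ : ℝ} (hα0 : 0 < α) (hα1 : α < 1) (hΛ : 1 ≤ Λ) :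
    ∃ d₀ C : ℝ, 0 < d₀ ∧ d₀ ≤ 1 ∧ 0 ≤ C ∧ ∀ (Ω : Set E) (z : E) (w : E → ℝ) (n : E → E) (A : E → Bi E) (u : E → ℝ)
      (d K f₀ : ℝ), IsOpen Ω → 0 < d → d ≤ d₀ → 0 < K → CW w n A (Metric.closedBall z d) Λ α → w z = 0 → 1 ≤ ‖n z‖ →
      (∀ y, ‖y - z‖ ≤ d → (y ∈ Ω ↔ 0 < w y)) → (m = 1 → f₀ = 0) → |f₀| ≤ K * d ^ ((m:ℝ) + α - 2) →
      ContinuousOn u (Metric.closedBall z d) → (∀ y, ‖y - z‖ ≤ d → |u y| ≤ K * d ^ ((m:ℝ) + α)) →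
      (∀ y, ‖y - z‖ ≤ d → y ∉ Ω → u y = 0) →
      (∀ r, 0 < r → r ≤ d → ∀ y ∈ Ω, ‖y - z‖ < r → ∃ p B, Jet u y p B ∧ |bt B + f₀| ≤ K * r ^ ((m:ℝ) + α - 2)) →
      ∃ (a : ℝ) (b : Du E), (m = 1 → b = 0) ∧ a * om m (A z) + 2 * b (n z) = -f₀ ∧
        |a| ≤ C * K * d ^ ((m:ℝ) + α - 1) ∧ ‖b‖ ≤ C * K * d ^ ((m:ℝ) + α - 2) ∧
        ∀ y ∈ Ω, ‖y - z‖ ≤ d → |u y - w y * (a + b (y - z))| ≤ C * K * ‖y - z‖ ^ ((m:ℝ) + α) := by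
  have hN0 : 0 < dm E := by linarith
  have hm1 : (1:ℝ) ≤ m := by rcases hm with rfl | rfl <;> norm_num
  have hm2 : (m:ℝ) ≤ 2 := by rcases hm with rfl | rfl <;> norm_num
  set s : ℝ := m + α with hs
  obtain ⟨Cf, hCf, hflat⟩ := flat_scaled (E := E) hN hm
  obtain ⟨l, hl0, hl1, hl2⟩ := exists_small (τ := m + 1 - s) (B := 4 * Cf) (by rw [hs]; linarith) (by positivity)
  have hl8 : l ≤ 1 / 8 := by
    have : l ^ (1:ℝ) ≤ l ^ ((m:ℝ) + 1 - s) := Real.rpow_le_rpow_of_exponent_ge hl0 (by linarith) (by linarith)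
    rw [Real.rpow_one] at this
    nlinarith
  have hls : 0 < l ^ s := by positivity
  have hlm : Cf * l ^ (m + 1) ≤ l ^ s / 2 := by
    have : l ^ (m + 1) = l ^ ((m:ℝ) + 1 - s) * l ^ s := by
      rw [← Real.rpow_add hl0, ← Real.rpow_natCast]; push_cast; ring_nf
    rw [this]
    nlinarith
  have hls1 : l ^ s ≤ 1 := Real.rpow_le_one hl0.le (by linarith) (by linarith)
  set G := dm E * Λ with hG
  have hG1 : 1 ≤ G := by rw [hG]; nlinarith
  set θ := l ^ s / (4 * Cf * (1 + Λ)) with hθ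
  have hθ0 : 0 < θ := by positivity
  have hθC : Cf * θ ≤ l ^ s / 4 := by
    have : Cf * θ = l ^ s / (4 * (1 + Λ)) := by rw [hθ]; field_simp
    rw [this]; gcongr; linarith
  have hθ1 : θ * (1 + Λ) ≤ 1 := by
    have : θ * (1 + Λ) = l ^ s / (4 * Cf) := by rw [hθ]; field_simp
    rw [this, div_le_one (by positivity)]; linarith
  obtain ⟨C', hC', hcamp⟩ := campanato (E := E) (Z0 := ℝ) (Z1 := ℝ) (Z2 := Du E)
    (C := Cf) (C2 := if m = 1 then 0 else Cf * (1 + G)) (L := 2 * Λ) (l := l) (s := s)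
    (by positivity) (by split_ifs <;> positivity) (by positivity) hl0 (by linarith) (by linarith)
    (by rcases hm with rfl | rfl
        · simp
        · right; rw [hs]; push_cast; linarith)
  -- choice of the radius
  set X := C' * G + (C' + 1) * (G + 2 * Λ) with hX
  have hX0 : 0 < X := by positivity
  set Y := 8 * Λ + 4 * Cf * Λ * (3 + G) / l ^ s with hY
  have hY0 : 0 < Y := by positivity
  obtain ⟨d₁, hd1, hd1', hd1''⟩ := exists_small (τ := α) (B := X / θ) hα0 (by positivity)
  refine ⟨min d₁ (1 / Y), C' * (2 / θ) + 1, by positivity, (min_le_left _ _).trans (by linarith), by positivity, ?_⟩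
  intro Ω z w n A u d K₁ f₀ hΩ hd hdd hK₁ hW hwz hnz hiff hmf hf₀ hcont hbd hz hjet
  have hd11 : d ≤ 1 := hdd.trans ((min_le_left _ _).trans (by linarith))
  have hdX : X * d ^ α ≤ θ / 2 := by
    have : d ^ α ≤ d₁ ^ α := Real.rpow_le_rpow hd.le (hdd.trans (min_le_left _ _)) hα0.le
    have h2 : X / θ * d ^ α ≤ 1 / 2 := le_trans (by gcongr) hd1''
    rw [div_mul_eq_mul_div, div_le_iff₀ hθ0] at h2; linarith
  have hdY : Y * d ≤ 1 := by
    have : d ≤ 1 / Y := hdd.trans (min_le_right _ _)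
    rwa [le_div_iff₀ hY0, mul_comm] at this
  have hdΛ : Λ * d ≤ 1 / 8 := by
    have : 8 * Λ * d ≤ Y * d := by
      have : 0 ≤ 4 * Cf * Λ * (3 + G) / l ^ s := by positivity
      gcongr; linarith
    linarith
  have hdε : Cf * (Λ * d) * (3 + G) ≤ l ^ s / 4 := by
    have : 4 * Cf * Λ * (3 + G) / l ^ s * d ≤ Y * d := by
      gcongr; rw [hY]; have : 0 ≤ Λ := by linarith
      linarith
    have := this.trans hdY
    rw [div_mul_eq_mul_div, div_le_iff₀ hls] at this
    linarith
  set K := 2 / θ * K₁ with hK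
  have hK0 : 0 < K := by positivity
  have hKK : K₁ = θ * K / 2 := by rw [hK]; field_simp
  have hKK1 : (1 + Λ) * K₁ ≤ K := by
    rw [hKK]; nlinarith
  set μ := ‖n z‖ with hmu
  have hmu0 : 0 < μ := by linarith
  set ν : E := μ⁻¹ • n z with hν
  have hν1 : ‖ν‖ = 1 := by rw [hν, norm_smul, norm_inv, norm_norm, inv_mul_cancel₀ hmu0.ne']
  have hnν : n z = μ • ν := by rw [hν, smul_smul, mul_inv_cancel₀ hmu0.ne', one_smul]
  have hzU : z ∈ Metric.closedBall z d := Metric.mem_closedBall_self hd.le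
  have hU : ∀ y, ‖y - z‖ ≤ d → y ∈ Metric.closedBall z d := fun y hy => by
    rwa [Metric.mem_closedBall, dist_eq_norm]
  set ω₀ := om m (A z) with hω₀
  have hωb : |ω₀| ≤ G := om_le hN m (hW.A0 z hzU)
  have hinν : ∀ y : E, inner ℝ (n z) y = μ * inner ℝ ν y := fun y => by
    rw [hnν, inner_smul_left]; simp
  have hins : ∀ y : E, |inner ℝ ν y| ≤ ‖y‖ := fun y => by
    have := abs_real_inner_le_norm ν y
    rwa [hν1, one_mul] at this
  have hwd : ∀ y, ‖y - z‖ ≤ d → |w y - μ * inner ℝ ν (y - z)| ≤ Λ * ‖y - z‖ ^ 2 := fun y hy => by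
    have := hW.w1 z hzU y (hU y hy)
    rwa [hwz, sub_zero, hinν] at this
  have hwl : ∀ y, ‖y - z‖ ≤ d → |w y| ≤ 2 * Λ * ‖y - z‖ := fun y hy => by
    have h1 := abs_le.1 (hwd y hy)
    have h2 : μ * |inner ℝ ν (y - z)| ≤ Λ * ‖y - z‖ := mul_le_mul (hW.n0 z hzU) (hins _) (abs_nonneg _) (by linarith)
    have h3 : Λ * ‖y - z‖ ^ 2 ≤ Λ * ‖y - z‖ := by
      have : ‖y - z‖ ^ 2 ≤ ‖y - z‖ := by nlinarith [norm_nonneg (y - z)]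
      gcongr
    rw [← abs_of_pos hmu0, ← abs_mul] at h2
    have h4 := abs_le.1 h2
    rw [abs_le]; constructor <;> linarith
  set b₀ : Du E := (-f₀ / (2 * μ)) • ip ν with hb₀
  have hb₀n : ‖b₀‖ ≤ K₁ * d ^ (s - 2) / 2 := by
    refine ContinuousLinearMap.opNorm_le_bound _ (by positivity) fun y => ?_
    rw [hb₀]
    simp only [ContinuousLinearMap.smul_apply, smul_eq_mul, ip_apply, Real.norm_eq_abs, abs_mul]
    refine mul_le_mul ?_ (hins y) (abs_nonneg _) (by positivity)
    rw [abs_div, abs_neg, abs_of_pos (by positivity : 0 < 2 * μ), div_le_div_iff₀ (by positivity) (by norm_num)]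
    nlinarith [abs_nonneg f₀]
  have hb₀v : 2 * b₀ (n z) = -f₀ := by
    rw [hb₀, hnν]
    simp only [ContinuousLinearMap.smul_apply, smul_eq_mul, ip_apply, inner_smul_right, real_inner_self_eq_norm_sq, hν1]
    field_simp
  have e2d : d ^ (s - 2) * d ^ 2 = d ^ s := by
    rw [← Real.rpow_natCast, ← Real.rpow_add hd]; norm_num
  set P : Set (ℝ × ℝ × Du E) := {q | (m = 1 → q.2.2 = 0) ∧ q.2.1 * ω₀ + 2 * q.2.2 (n z) = -f₀} with hP
  have hPc : IsClosed P := by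
    have e1 : IsClosed {q : ℝ × ℝ × Du E | q.2.1 * ω₀ + 2 * q.2.2 (n z) = -f₀} :=
      isClosed_eq (by fun_prop) continuous_const
    have e2 : IsClosed {q : ℝ × ℝ × Du E | m = 1 → q.2.2 = 0} := by
      by_cases h : m = 1
      · simp only [h, true_imp_iff]
        exact isClosed_eq (by fun_prop) continuous_const
      · simp [h]
    exact e2.inter e1
  have hΛ0 : 0 < Λ := by linarith
  obtain ⟨c0, a, b, hz', z1, z2, z3, z4⟩ := hcamp (fun _ a b y => w y * (a + b (y - z))) P u Ω z d K 0 0 b₀ hd hK0.le hPc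
    (fun c a b c' a' b' y _ hyd => by
      have e : w y * (a + b (y - z)) - w y * (a' + b' (y - z)) = w y * ((a - a') + (b - b') (y - z)) := by
        rw [ContinuousLinearMap.sub_apply]; ring
      rw [e, abs_mul]
      have h1 : |(a - a') + (b - b') (y - z)| ≤ ‖a - a'‖ + ‖b - b'‖ * ‖y - z‖ :=
        (abs_add_le _ _).trans (add_le_add (le_of_eq (Real.norm_eq_abs _).symm) ((b - b').le_opNorm _))
      have h2 := hwl y hyd
      calc |w y| * |(a - a') + (b - b') (y - z)| ≤ (2 * Λ * ‖y - z‖) * (‖a - a'‖ + ‖b - b'‖ * ‖y - z‖) := by gcongr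
        _ = 2 * Λ * (0 + ‖a - a'‖ * ‖y - z‖ + ‖b - b'‖ * ‖y - z‖ ^ 2) := by ring
        _ ≤ _ := by gcongr; positivity)
    (by
      intro r c a b hr hrd hPz ha hb hu
      have hPb : m = 1 → b = 0 := hPz.1
      have hPe : a * ω₀ + 2 * b (n z) = -f₀ := hPz.2
      have hr1 : r ≤ 1 := hrd.trans hd11
      have e1 : r ^ (s - 1) * r = r ^ s := by
        rw [Real.rpow_sub_one hr.ne']; field_simp
      have e2 : r ^ (s - 2) * r ^ 2 = r ^ s := by
        rw [← Real.rpow_natCast, ← Real.rpow_add hr]; norm_num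
      have hrs : 0 < r ^ s := by positivity
      have hdα : d ^ (s - 1) ≤ d ^ α := Real.rpow_le_rpow_of_exponent_ge hd hd11 (by rw [hs]; linarith)
      have ha' : |a| ≤ C' * K * d ^ α := by
        rw [sub_zero, Real.norm_eq_abs] at ha
        exact ha.trans (by gcongr)
      have hb' : ‖b‖ * r ≤ (C' + 1) * K * d ^ α * r ^ (s - 2) := by
        by_cases h : m = 1
        · rw [hPb h, norm_zero, zero_mul]; positivity
        · have hm2 : m = 2 := hm.resolve_left h
          have hsα : s - 2 = α := by rw [hs, hm2]; push_cast; ring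
          have : ‖b‖ ≤ (C' + 1) * K * d ^ α := by
            have h1 := norm_le_norm_add_norm_sub' b b₀
            rw [hsα] at hb hb₀n
            have : K₁ * d ^ α / 2 ≤ K * d ^ α := by
              have : 0 < d ^ α := by positivity
              have : K₁ * d ^ α ≤ K * d ^ α := by
                gcongr; nlinarith only [hKK1, hK₁, hΛ]
              linarith only [this, show 0 < K * d ^ α by positivity]
            linarith
          have h2 : r ≤ r ^ (s - 2) := by
            conv_lhs => rw [← Real.rpow_one r]
            exact Real.rpow_le_rpow_of_exponent_ge hr hr1 (by rw [hsα]; linarith)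
          gcongr
      set v : E → ℝ := fun y => u y - max (w y) 0 * (a + b (y - z)) with hv
      have hvΩ : ∀ y ∈ Ω, ‖y - z‖ ≤ d → v y = u y - w y * (a + b (y - z)) := fun y hy hyd => by
        simp only [hv]; rw [max_eq_left ((hiff y hyd).1 hy).le]
      have hvn : ∀ y, ‖y - z‖ ≤ d → y ∉ Ω → v y = 0 := fun y hyd hy => by
        simp only [hv]; rw [hz y hyd hy, max_eq_right (not_lt.1 fun h => hy ((hiff y hyd).2 h))]; simp
      have hεr : Λ * r ≤ 1 / 8 := le_trans (by gcongr) hdΛ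
      obtain ⟨a', c', k1, k2, k3, k4, k5⟩ := hflat ν z Ω (Λ * r) θ r (K * r ^ s) v hν1 hΩ hr (by positivity) (by positivity)
        hεr hθ0 (by nlinarith only [hθ1, hθ0, hΛ])
        (by
          refine ContinuousOn.sub (hcont.mono (Metric.closedBall_subset_closedBall hrd)) (ContinuousOn.mul ?_ (by fun_prop))
          refine ContinuousOn.sup (fun y hy => ?_) continuousOn_const
          exact (hW.j y (Metric.closedBall_subset_closedBall hrd hy)).continuousAt.continuousWithinAt)
        (fun y hy => by
          by_cases hyΩ : y ∈ Ω
          · rw [hvΩ y hyΩ (hy.trans hrd)]; exact hu y hyΩ hy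
          · rw [hvn y (hy.trans hrd) hyΩ, abs_zero]; positivity)
        (fun y hy hyΩ => hvn y (hy.trans hrd) hyΩ)
        (fun y hyΩ hy => by
          obtain ⟨p, B, hB, hBb⟩ := hjet r hr hrd y hyΩ hy
          have hyd : ‖y - z‖ ≤ d := hy.le.trans hrd
          have hyU := hU y hyd
          obtain ⟨q, B', hB', hBb'⟩ := jetQ (hW.j y hyU) a b z
          have hw0 := (hiff y hyd).1 hyΩ
          refine ⟨_, _, (hB.sub hB').congr ?_, ?_⟩
          · have : ∀ᶠ y' in 𝓝 y, 0 < w y' := (hW.j y hyU).continuousAt.eventually (lt_mem_nhds hw0)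
            filter_upwards [this] with y' hy'
            simp only [hv]; rw [max_eq_left hy'.le]
          · rw [bt_sub, hBb']
            have h1 := om_diff hN hm hα0 hα1 hr hr1 hy.le (norm_nonneg _) hΛ0.le (hW.A0 y hyU) (hW.A1 z hzU y hyU)
            rw [← hω₀, ← hs, ← hG] at h1
            have h2 : |b (y - z) * bt (A y)| ≤ ‖b‖ * r * G := by
              rw [abs_mul]
              refine mul_le_mul ((b.le_opNorm _).trans (by gcongr)) ((bt_le _).trans ?_) (abs_nonneg _) (by positivity)
              rw [hG]; have := hW.A0 y hyU; gcongr
            have h3 : |b (n y) - b (n z)| ≤ ‖b‖ * r * Λ := by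
              rw [← map_sub]
              refine (b.le_opNorm _).trans ?_
              calc ‖b‖ * ‖n y - n z‖ ≤ ‖b‖ * (Λ * r) := by
                    have := hW.n1 z hzU y hyU
                    have h5 : Λ * ‖y - z‖ ≤ Λ * r := by gcongr
                    gcongr; exact this.trans h5
                _ = _ := by ring
            have h4 : |a * (bt (A y) - ω₀)| ≤ (C' * K * d ^ α) * (G * r ^ (s - 2)) := by
              rw [abs_mul]; gcongr
            have e : bt B - ((a + b (y - z)) * bt (A y) + 2 * b (n y)) =
                (bt B + f₀) - a * (bt (A y) - ω₀) - b (y - z) * bt (A y) - 2 * (b (n y) - b (n z)) := by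
              linear_combination -hPe
            have e' : θ * (K * r ^ s) / r ^ 2 = θ * K * r ^ (s - 2) := by
              rw [← e2]; field_simp
            rw [e, e']
            have h5 : ‖b‖ * r * (G + 2 * Λ) ≤ (C' + 1) * K * d ^ α * r ^ (s - 2) * (G + 2 * Λ) := by gcongr
            have h6 : X * d ^ α * (K * r ^ (s - 2)) ≤ θ / 2 * (K * r ^ (s - 2)) := by gcongr
            have h7 : K₁ * r ^ (s - 2) = θ / 2 * (K * r ^ (s - 2)) := by rw [hKK]; ring
            have h8 : X * d ^ α * (K * r ^ (s - 2)) = (C' * K * d ^ α) * (G * r ^ (s - 2)) +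
              (C' + 1) * K * d ^ α * r ^ (s - 2) * (G + 2 * Λ) := by rw [hX]; ring
            have i1 := abs_le.1 hBb
            have i2 := abs_le.1 h2
            have i3 := abs_le.1 h3
            have i4 := abs_le.1 h4
            rw [abs_le]; constructor <;> linarith only [i1.1, i1.2, i2.1, i2.2, i3.1, i3.2, i4.1, i4.2, h5, h6, h7, h8])
        (fun y hy hyν => by
          have hyd : ‖y - z‖ ≤ d := hy.le.trans hrd
          rw [hiff y hyd]
          have h1 := abs_le.1 (hwd y hyd)
          have h2 : Λ * ‖y - z‖ ^ 2 ≤ Λ * r ^ 2 := by gcongr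
          have h3 : 0 < Λ * r * r := by positivity
          nlinarith only [h1, h2, h3, hyν, hnz])
        (fun y hyΩ hy => by
          have hyd : ‖y - z‖ ≤ d := hy.le.trans hrd
          have hw0 := (hiff y hyd).1 hyΩ
          have h1 := abs_le.1 (hwd y hyd)
          have h2 : Λ * ‖y - z‖ ^ 2 ≤ Λ * r ^ 2 := by gcongr
          have h3 : 0 < Λ * r * r := by positivity
          by_contra hcon
          push Not at hcon
          nlinarith only [h1, h2, h3, hcon, hnz, hw0])
      -- the update
      set t := -a' * ω₀ / (2 * μ ^ 2) with ht
      have q1 : Cf * (K * r ^ s) / r = Cf * K * r ^ (s - 1) := by rw [← e1]; field_simp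
      have q2 : Cf * (K * r ^ s) / r ^ 2 = Cf * K * r ^ (s - 2) := by rw [← e2]; field_simp
      have htb : |t| ≤ Cf * K * r ^ (s - 1) * G := by
        rw [ht, abs_div, abs_mul, abs_neg, abs_of_pos (by positivity : 0 < 2 * μ ^ 2)]
        rw [q1] at k3
        refine (div_le_self (by positivity) (by nlinarith only [hnz])).trans ?_
        gcongr
      have hcl : ‖μ⁻¹ • c'‖ ≤ Cf * K * r ^ (s - 2) := by
        rw [norm_smul, norm_inv, norm_norm, ← q2]
        exact (mul_le_of_le_one_left (norm_nonneg _) (inv_le_one_of_one_le₀ hnz)).trans k4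
      refine ⟨c, a + a' / μ, b + (μ⁻¹ • c' + t • ip ν), ⟨fun h => ?_, ?_⟩, ?_, ?_, ?_, ?_⟩
      · have : ω₀ = 0 := by rw [hω₀]; simp [om, h]
        show b + (μ⁻¹ • c' + t • ip ν) = 0
        rw [hPb h, k2 h, ht, this]; simp
      · show (a + a' / μ) * ω₀ + 2 * (b + (μ⁻¹ • c' + t • ip ν)) (n z) = -f₀
        rw [← hPe]
        have : (μ⁻¹ • c' + t • ip ν) (n z) = t * μ := by
          rw [hnν]
          simp [k1, inner_smul_right, real_inner_self_eq_norm_sq, hν1]; ring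
        rw [ContinuousLinearMap.add_apply, this, ht]; field_simp; ring
      · rw [sub_self, norm_zero]; positivity
      · rw [add_sub_cancel_left, Real.norm_eq_abs, abs_div, abs_of_pos hmu0, ← q1]
        exact (div_le_self (abs_nonneg _) hnz).trans k3
      · rw [add_sub_cancel_left]
        split_ifs with h
        · have : ω₀ = 0 := by rw [hω₀]; simp [om, h]
          rw [k2 h, ht, this]; simp
        · refine (norm_add_le _ _).trans ?_
          have h1 : ‖t • ip ν‖ ≤ |t| := by
            refine ContinuousLinearMap.opNorm_le_bound _ (abs_nonneg _) fun y => ?_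
            simp only [ContinuousLinearMap.smul_apply, smul_eq_mul, ip_apply, Real.norm_eq_abs, abs_mul]
            have := hins y
            gcongr
          have h2 : r ^ (s - 1) ≤ r ^ (s - 2) := Real.rpow_le_rpow_of_exponent_ge hr hr1 (by linarith)
          have h3 : Cf * K * r ^ (s - 1) * G ≤ Cf * K * r ^ (s - 2) * G := by gcongr
          linarith only [h1, h3, htb, hcl]
      · intro y hyΩ hy
        have hlr : l * r ≤ r / 8 := by linarith only [mul_le_mul_of_nonneg_right hl8 hr.le]
        have hylr : ‖y - z‖ ≤ r := hy.trans (mul_le_of_le_one_left hr.le (by linarith))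
        have hyd := hylr.trans hrd
        have h5 := k5 y hyΩ (hy.trans hlr)
        rw [hvΩ y hyΩ hyd] at h5
        set τ := inner ℝ ν (y - z) with hτ
        have e : u y - w y * (a + a' / μ + (b + (μ⁻¹ • c' + t • ip ν)) (y - z)) =
            (u y - w y * (a + b (y - z)) - τ * (a' + c' (y - z))) +
            (μ * τ - w y) * ((a' + c' (y - z)) / μ) - w y * (t * τ) := by
          simp only [ContinuousLinearMap.add_apply, ContinuousLinearMap.smul_apply, smul_eq_mul, ip_apply, ← hτ]
          field_simp; ring
        rw [e]
        have hy2 : ‖y - z‖ ^ 2 ≤ r ^ 2 := by gcongr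
        have j1 : |(μ * τ - w y) * ((a' + c' (y - z)) / μ)| ≤ Λ * r ^ 2 * (2 * (Cf * K * r ^ (s - 1))) := by
          rw [abs_mul]
          refine mul_le_mul ?_ ?_ (abs_nonneg _) (by positivity)
          · rw [abs_sub_comm]; exact (hwd y hyd).trans (by gcongr)
          · rw [abs_div, abs_of_pos hmu0]
            refine (div_le_self (abs_nonneg _) hnz).trans ((abs_add_le _ _).trans ?_)
            have h6 : |c' (y - z)| ≤ Cf * K * r ^ (s - 2) * r := by
              refine (c'.le_opNorm _).trans ?_
              rw [← q2]; gcongr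
            have h7 : r ^ (s - 2) * r = r ^ (s - 1) := by
              conv_lhs => rw [← Real.rpow_add_one hr.ne']
              ring_nf
            rw [q1] at k3
            rw [mul_assoc, h7] at h6
            linarith only [k3, h6]
        have j2 : |w y * (t * τ)| ≤ Λ * r ^ 2 * (Cf * K * r ^ (s - 1) * G) := by
          rw [abs_mul, abs_mul]
          have h8 : ‖y - z‖ ≤ r / 2 := by linarith only [hy, hlr, hr]
          have h7 := hins (y - z)
          rw [← hτ] at h7
          have h9 : |w y| ≤ Λ * r := (hwl y hyd).trans (by nlinarith only [h8, hΛ0])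
          calc |w y| * (|t| * |τ|) ≤ (Λ * r) * ((Cf * K * r ^ (s - 1) * G) * r) := by
                gcongr; exact h7.trans hylr
            _ = _ := by ring
        have e4 : r ^ 2 * r ^ (s - 1) = r * r ^ s := by rw [← e1]; ring
        have j3 : Λ * r ^ 2 * (2 * (Cf * K * r ^ (s - 1))) = 2 * (Cf * (Λ * r) * (K * r ^ s)) := by
          linear_combination 2 * Λ * Cf * K * e4
        have j4 : Λ * r ^ 2 * (Cf * K * r ^ (s - 1) * G) = G * (Cf * (Λ * r) * (K * r ^ s)) := by
          linear_combination Λ * Cf * K * G * e4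
        have j5 : Cf * (Λ * r) * (3 + G) ≤ l ^ s / 4 := le_trans (by gcongr) hdε
        have j6 : (‖y - z‖ / r) ^ (m + 1) ≤ l ^ (m + 1) := by
          gcongr; rwa [div_le_iff₀ hr]
        have j7 : Cf * (‖y - z‖ / r) ^ (m + 1) ≤ l ^ s / 2 := le_trans (by gcongr) hlm
        rw [Real.mul_rpow hl0.le hr.le]
        have hM : 0 < K * r ^ s := by positivity
        have j8 : (Cf * (Λ * r) * (3 + G) + Cf * θ + Cf * (‖y - z‖ / r) ^ (m + 1)) * (K * r ^ s) ≤ l ^ s * (K * r ^ s) :=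
          mul_le_mul_of_nonneg_right (by linarith only [j5, j7, hθC]) hM.le
        have i1 := abs_le.1 h5
        have i2 := abs_le.1 j1
        have i3 := abs_le.1 j2
        rw [j3] at i2
        rw [j4] at i3
        rw [abs_le]; constructor <;> linarith only [i1.1, i1.2, i2.1, i2.2, i3.1, i3.2, j8])
    ⟨fun h => by show b₀ = 0; rw [hb₀, hmf h]; simp, by show 0 * ω₀ + 2 * b₀ (n z) = -f₀; rw [zero_mul, zero_add, hb₀v]⟩
    (by
      intro y hy hyd
      rw [zero_add]
      have h1 : |w y * b₀ (y - z)| ≤ Λ * K₁ * d ^ s := by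
        rw [abs_mul]
        calc |w y| * |b₀ (y - z)| ≤ (2 * Λ * d) * ((K₁ * d ^ (s - 2) / 2) * d) := by
              refine mul_le_mul ((hwl y hyd).trans (by gcongr)) ((b₀.le_opNorm _).trans (by gcongr)) (abs_nonneg _) (by positivity)
          _ = Λ * K₁ * (d ^ (s - 2) * d ^ 2) := by ring
          _ = _ := by rw [e2d]
      have h2 := hbd y hyd
      have h3 : (1 + Λ) * K₁ * d ^ s ≤ K * d ^ s := by gcongr
      refine (abs_sub _ _).trans ?_
      linarith)
  have e1 : C' * K = C' * (2 / θ) * K₁ := by rw [hK]; ring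
  rw [e1] at z2 z3 z4
  refine ⟨a, b, hz'.1, hz'.2, ?_, ?_, fun y hy hyd => ?_⟩
  · rw [sub_zero, Real.norm_eq_abs] at z2
    have : 0 ≤ K₁ * d ^ (s - 1) := by positivity
    linarith
  · have h1 := norm_le_norm_add_norm_sub' b b₀
    have : 0 ≤ K₁ * d ^ (s - 2) := by positivity
    linarith
  · have : 0 ≤ K₁ * ‖y - z‖ ^ s := by positivity
    have := z4 y hy hyd
    linarith

end bdryreg

/-! ## Part 15: uniform expansions up to the boundary -/
section globexp
variable {E : Type*} [NormedAddCommGroup E] [InnerProductSpace ℝ E] [FiniteDimensional ℝ E]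

lemma rpow_le_two {t α β : ℝ} (ht : 0 ≤ t) (ht2 : t ≤ 2) (hβ : 0 ≤ β) (h : β ≤ α) (hαβ : α ≤ β + 1) :
    t ^ α ≤ 2 * t ^ β := by
  rcases ht.lt_or_eq with h0 | h0
  · have : t ^ α = t ^ (α - β) * t ^ β := by rw [← Real.rpow_add h0]; ring_nf
    rw [this]
    have h1 : t ^ (α - β) ≤ 2 ^ (α - β) := Real.rpow_le_rpow ht ht2 (by linarith)
    have h2 : (2:ℝ) ^ (α - β) ≤ 2 ^ (1:ℝ) := Real.rpow_le_rpow_of_exponent_le (by norm_num) (by linarith)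
    rw [Real.rpow_one] at h2
    have : 0 ≤ t ^ β := by positivity
    gcongr; linarith
  · rw [← h0]
    rcases hβ.lt_or_eq with hb | hb
    · rw [Real.zero_rpow (by linarith), Real.zero_rpow (by linarith)]; norm_num
    · rw [← hb, Real.rpow_zero]
      rcases (hb ▸ h : (0:ℝ) ≤ α).lt_or_eq with hc | hc
      · rw [Real.zero_rpow (by linarith)]; norm_num
      · rw [← hc, Real.rpow_zero]; norm_num

/-- interior expansion, for functions with jets -/
lemma int_reg_jet (hN : 1 ≤ dm E) {m : ℕ} (hm : m = 1 ∨ m = 2) {α : ℝ} (hα0 : 0 < α) (hα1 : α < 1) :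
    ∃ C : ℝ, 0 ≤ C ∧ ∀ (u : E → ℝ) (x : E) (d K : ℝ) (g : E → ℝ), 0 < d → d ≤ 1 → 0 < K →
      ContinuousOn u (Metric.closedBall x d) → (∀ y, ‖y - x‖ ≤ d → |u y| ≤ K * d ^ ((m:ℝ) + α)) →
      (∀ y, ‖y - x‖ < d → ∃ p B, Jet u y p B ∧ bt B = -g y) →
      (m = 1 → ∀ y, ‖y - x‖ < d → |g y| ≤ K) →
      (m = 2 → |g x| ≤ K * d ^ α ∧ ∀ y, ‖y - x‖ < d → |g y - g x| ≤ K * ‖y - x‖ ^ α) →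
      ∃ (p : Du E) (A : Bi E), (m = 1 → A = 0) ∧ ‖p‖ ≤ C * K ∧ ‖A‖ ≤ C * K ∧
        (∀ y, ‖y - x‖ ≤ d → |u y - qd x (u x) p A y| ≤ C * K * ‖y - x‖ ^ ((m:ℝ) + α)) ∧
        (∀ y, d ≤ ‖y - x‖ → |qd x (u x) p A y| ≤ (1 + 2 * C) * K * ‖y - x‖ ^ ((m:ℝ) + α)) := by
  have hm1 : (1:ℝ) ≤ m := by rcases hm with rfl | rfl <;> norm_num
  set s : ℝ := m + α with hs
  obtain ⟨C, hC, H⟩ := int_reg (E := E) hN hm (s := s) (by linarith) (by linarith)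
  refine ⟨C, hC, fun u x d K g hd hd1 hK hcont hbd hjet h1 h2 => ?_⟩
  have hs2 : m = 2 → s - 2 = α := fun h => by rw [hs, h]; push_cast; ring
  obtain ⟨c, p, A, -, r1, -, r3, r4, r5⟩ := H u x d K (if m = 1 then 0 else g x) hd hK (fun h => by simp [h])
    (by
      split_ifs with h
      · rw [abs_zero]; positivity
      · have h' := hm.resolve_left h
        rw [hs2 h']; exact (h2 h').1)
    hcont (fun y hy => hbd y (by rwa [Metric.mem_closedBall, dist_eq_norm] at hy)) (by
      intro r hr hrd y hy
      rw [Metric.mem_ball, dist_eq_norm] at hy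
      obtain ⟨p, B, hB, hBb⟩ := hjet y (hy.trans_le hrd)
      have key : |g y - (if m = 1 then 0 else g x)| ≤ K * r ^ (s - 2) := by
        split_ifs with h
        · rw [sub_zero]
          have : 1 ≤ r ^ (s - 2) := Real.one_le_rpow_of_pos_of_le_one_of_nonpos hr (hrd.trans hd1)
            (by rw [hs, h]; push_cast; linarith)
          refine (h1 h y (hy.trans_le hrd)).trans ?_
          nlinarith
        · have h' := hm.resolve_left h
          rw [hs2 h']
          refine ((h2 h').2 y (hy.trans_le hrd)).trans ?_
          gcongr
      have := abs_le.1 key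
      refine ⟨hB.vsub ?_, hB.vsup ?_⟩ <;> simp only [cst] <;> linarith)
  have hc : c = u x := by
    have := r5 x (Metric.mem_closedBall_self hd.le)
    simp only [qd, sub_self, map_zero, norm_zero] at this
    rw [Real.zero_rpow (by linarith)] at this
    simp at this
    linarith
  subst hc
  have hA : ‖A‖ ≤ C * K := by
    rcases hm with h | h
    · rw [r1 h, bi_norm_zero]; positivity
    · rw [hs2 h] at r4
      have : d ^ α ≤ 1 := Real.rpow_le_one hd.le hd1 hα0.le
      exact r4.trans (mul_le_of_le_one_right (by positivity) this)
  refine ⟨p, A, r1, ?_, hA, fun y hy => r5 y (by rwa [Metric.mem_closedBall, dist_eq_norm]), fun y hy => ?_⟩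
  · have : d ^ (s - 1) ≤ 1 := Real.rpow_le_one hd.le hd1 (by linarith)
    exact r3.trans (mul_le_of_le_one_right (by positivity) this)
  · set t := ‖y - x‖ with ht
    have ht0 : 0 < t := by linarith
    have e1 : t ^ (s - 1) * t = t ^ s := by rw [Real.rpow_sub_one ht0.ne']; field_simp
    have e2 : t ^ (s - 2) * t ^ 2 = t ^ s := by
      rw [← Real.rpow_natCast, ← Real.rpow_add ht0]; norm_num
    have hs0 : 0 ≤ s := by linarith
    have hs1 : 0 ≤ s - 1 := by linarith
    have i0 : |u x| ≤ K * t ^ s := (hbd x (by simpa using hd.le)).trans (by gcongr)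
    have i1 : ‖p‖ * t ≤ C * K * t ^ s := by
      rw [← e1, ← mul_assoc]; gcongr; exact r3.trans (by gcongr)
    have i2 : ‖A‖ * t ^ 2 ≤ C * K * t ^ s := by
      rcases hm with h | h
      · rw [r1 h, bi_norm_zero]; simp; positivity
      · rw [← e2, ← mul_assoc]
        have : 0 ≤ s - 2 := by rw [hs2 h]; linarith
        gcongr; exact r4.trans (by gcongr)
    refine (qd_le _ _ _ _ _).trans ?_
    have : 0 ≤ C * K * t ^ s := by positivity
    linarith

/-- expansion of `w · affine` -/
lemma prod_exp {m : ℕ} (hm : m = 1 ∨ m = 2) {α Λ C : ℝ} (hα0 : 0 < α) (hα1 : α < 1) (hΛ : 1 ≤ Λ) (hC : 0 ≤ C)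
    {w : E → ℝ} {n : E → E} {A : E → Bi E} {z : E} {d : ℝ} (hd : 0 < d) (hd1 : d ≤ 1)
    (hW : CW w n A (Metric.closedBall z d) Λ α) (hwz : w z = 0) {a : ℝ} {b : Du E} (ha : |a| ≤ C) (hb : ‖b‖ ≤ C)
    (hmb : m = 1 → b = 0) {x : E} (hx : ‖x - z‖ ≤ d) :
    ∃ (p : Du E) (B : Bi E), (m = 1 → B = 0) ∧ ‖p‖ ≤ 8 * Λ * C ∧ ‖B‖ ≤ 8 * Λ * C ∧ ∀ y, ‖y - z‖ ≤ d →
      |w y * (a + b (y - z)) - qd x (w x * (a + b (x - z))) p B y| ≤ 8 * Λ * C * ‖y - x‖ ^ ((m:ℝ) + α) := by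
  have hU : ∀ y, ‖y - z‖ ≤ d → y ∈ Metric.closedBall z d := fun y hy => by
    rwa [Metric.mem_closedBall, dist_eq_norm]
  have hzU : z ∈ Metric.closedBall z d := Metric.mem_closedBall_self hd.le
  have hΛ0 : 0 < Λ := by linarith
  have hbx : |b (x - z)| ≤ C := by
    refine (b.le_opNorm _).trans ?_
    have : ‖x - z‖ ≤ 1 := hx.trans hd1
    nlinarith [norm_nonneg b, norm_nonneg (x - z)]
  have hβ : |a + b (x - z)| ≤ 2 * C := (abs_add_le _ _).trans (by linarith)
  have hwx : |w x| ≤ 2 * Λ := by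
    have h1 := hW.w1 z hzU x (hU x hx)
    rw [hwz, sub_zero] at h1
    have h2 := abs_real_inner_le_norm (n z) (x - z)
    have h3 : ‖n z‖ * ‖x - z‖ ≤ Λ * 1 :=
      mul_le_mul (hW.n0 z hzU) (hx.trans hd1) (norm_nonneg _) hΛ0.le
    have h4 : Λ * ‖x - z‖ ^ 2 ≤ Λ * 1 := by
      gcongr; exact pow_le_one₀ (norm_nonneg _) (hx.trans hd1)
    have := abs_le.1 (h1.trans h4)
    have := abs_le.1 (h2.trans h3)
    rw [abs_le]; constructor <;> linarith
  have hnx := hW.n0 x (hU x hx)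
  have hAx := hW.A0 x (hU x hx)
  have hyx : ∀ y, ‖y - z‖ ≤ d → ‖y - x‖ ≤ 2 := fun y hy => by
    have := norm_sub_le (y - z) (x - z)
    rw [sub_sub_sub_cancel_right] at this
    linarith
  set β := a + b (x - z) with hβd
  have hip : ∀ y, |inner ℝ (n x) y| ≤ Λ * ‖y‖ := fun y => (abs_real_inner_le_norm _ _).trans (by gcongr)
  have hp : ‖β • ip (n x) + w x • b‖ ≤ 8 * Λ * C := by
    refine ContinuousLinearMap.opNorm_le_bound _ (by positivity) fun y => ?_
    simp only [ContinuousLinearMap.add_apply, ContinuousLinearMap.smul_apply, smul_eq_mul, ip_apply, Real.norm_eq_abs]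
    refine (abs_add_le _ _).trans ?_
    rw [abs_mul, abs_mul]
    have h1 : |b y| ≤ C * ‖y‖ := (b.le_opNorm _).trans (by gcongr)
    calc |β| * |inner ℝ (n x) y| + |w x| * |b y| ≤ (2 * C) * (Λ * ‖y‖) + 2 * Λ * (C * ‖y‖) := by
          have := hip y
          gcongr
      _ ≤ _ := by nlinarith [show 0 ≤ Λ * C * ‖y‖ by positivity]
  rcases hm with rfl | rfl
  · have hb0 := hmb rfl
    refine ⟨_, 0, fun _ => rfl, hp, by rw [bi_norm_zero]; positivity, fun y hy => ?_⟩
    have e : w y * (a + b (y - z)) - qd x (w x * β) (β • ip (n x) + w x • b) 0 y =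
        a * (w y - w x - inner ℝ (n x) (y - x)) := by
      simp [qd, hβd, hb0]; ring
    rw [e, abs_mul]
    have h1 := hW.w1 x (hU x hx) y (hU y hy)
    have h2 := rpow_le_two (norm_nonneg _) (hyx y hy) (show 0 ≤ ((1:ℕ):ℝ) + α by push_cast; linarith)
      (show ((1:ℕ):ℝ) + α ≤ (2:ℕ) by push_cast; linarith) (by push_cast; linarith)
    rw [Real.rpow_natCast] at h2
    calc |a| * |w y - w x - inner ℝ (n x) (y - x)| ≤ C * (Λ * (2 * ‖y - x‖ ^ (((1:ℕ):ℝ) + α))) := by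
          gcongr; exact h1.trans (by gcongr)
      _ ≤ _ := by nlinarith [show 0 ≤ Λ * C * ‖y - x‖ ^ (((1:ℕ):ℝ) + α) by positivity]
  · refine ⟨_, β • A x + rk (ip (n x)) b + rk b (ip (n x)), by norm_num, hp, ?_, fun y hy => ?_⟩
    · refine bi_norm_le_of (by positivity) fun v v' => ?_
      simp only [ContinuousLinearMap.add_apply, ContinuousLinearMap.smul_apply, smul_eq_mul, rk_apply, ip_apply]
      have h1 : ∀ y, |b y| ≤ C * ‖y‖ := fun y => (b.le_opNorm _).trans (by gcongr)
      have h2 : |A x v v'| ≤ Λ * ‖v‖ * ‖v'‖ := ((A x).le_opNorm₂ v v').trans (by gcongr)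
      have j1 : |β * A x v v'| ≤ 2 * C * (Λ * ‖v‖ * ‖v'‖) := by rw [abs_mul]; gcongr
      have j2 : |inner ℝ (n x) v * b v'| ≤ (Λ * ‖v‖) * (C * ‖v'‖) := by
        rw [abs_mul]; have := hip v; have := h1 v'; gcongr
      have j3 : |b v * inner ℝ (n x) v'| ≤ (C * ‖v‖) * (Λ * ‖v'‖) := by
        rw [abs_mul]; have := hip v'; have := h1 v; gcongr
      have : 0 ≤ Λ * C * ‖v‖ * ‖v'‖ := by positivity
      refine (abs_add_le _ _).trans ?_
      have := abs_add_le (β * A x v v') (inner ℝ (n x) v * b v')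
      linarith
    · have hby : b (y - z) = b (x - z) + b (y - x) := by rw [← map_add]; congr 1; abel
      have e : w y * (a + b (y - z)) -
          qd x (w x * β) (β • ip (n x) + w x • b) (β • A x + rk (ip (n x)) b + rk b (ip (n x))) y =
          β * (w y - qd x (w x) (ip (n x)) (A x) y) + b (y - x) * (w y - w x - inner ℝ (n x) (y - x)) := by
        rw [hby]
        simp only [qd, hβd, ContinuousLinearMap.add_apply, ContinuousLinearMap.smul_apply, smul_eq_mul, rk_apply, ip_apply]
        ring
      rw [e]
      have h1 := hW.w1 x (hU x hx) y (hU y hy)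
      have h2 := hW.w2 x (hU x hx) y (hU y hy)
      have h3 := rpow_le_two (norm_nonneg _) (hyx y hy) (show 0 ≤ ((2:ℕ):ℝ) + α by push_cast; linarith)
        (show ((2:ℕ):ℝ) + α ≤ (3:ℕ) by push_cast; linarith) (by push_cast; linarith)
      rw [Real.rpow_natCast] at h3
      push_cast at h3 ⊢
      have h4 : |b (y - x)| ≤ C * ‖y - x‖ := (b.le_opNorm _).trans (by gcongr)
      have j1 : |β * (w y - qd x (w x) (ip (n x)) (A x) y)| ≤ 2 * C * (Λ * ‖y - x‖ ^ (2 + α)) := by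
        rw [abs_mul]; gcongr
      have j2 : |b (y - x) * (w y - w x - inner ℝ (n x) (y - x))| ≤ C * Λ * (2 * ‖y - x‖ ^ (2 + α)) := by
        rw [abs_mul]
        calc _ ≤ (C * ‖y - x‖) * (Λ * ‖y - x‖ ^ 2) := by gcongr
          _ = C * Λ * ‖y - x‖ ^ 3 := by ring
          _ ≤ _ := by gcongr
      have : 0 ≤ Λ * C * ‖y - x‖ ^ (2 + α) := by positivity
      refine (abs_add_le _ _).trans ?_
      linarith

/-- uniform expansion at `x` -/
def Gd (u : E → ℝ) (Ω : Set E) (m : ℕ) (s C : ℝ) (x : E) : Prop :=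
  ∃ (p : Du E) (A : Bi E), (m = 1 → A = 0) ∧ ‖p‖ ≤ C ∧ ‖A‖ ≤ C ∧
    ∀ y ∈ Ω, |u y - qd x (u x) p A y| ≤ C * ‖y - x‖ ^ s

lemma Gd.mono {u : E → ℝ} {Ω : Set E} {m : ℕ} {s C C' : ℝ} {x : E} (h : Gd u Ω m s C x) (hC : C ≤ C') :
    Gd u Ω m s C' x := by
  obtain ⟨p, A, h1, h2, h3, h4⟩ := h
  exact ⟨p, A, h1, h2.trans hC, h3.trans hC, fun y hy => (h4 y hy).trans (by gcongr)⟩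

lemma Gd.far {u : E → ℝ} {Ω : Set E} {m : ℕ} {s C M δ R : ℝ} {x : E} (hs : 0 < s) (hC : 0 ≤ C) (hδ : 0 < δ)
    (hR : ∀ y ∈ Ω, ‖y - x‖ ≤ R) (hR0 : 0 ≤ R) (hM : ∀ y ∈ Ω, |u y| ≤ M) (hMx : |u x| ≤ M)
    (h : Gd u (Ω ∩ Metric.ball x δ) m s C x) : Gd u Ω m s (C + (2 * M + C * R + C * R ^ 2) / δ ^ s) x := by
  obtain ⟨p, A, h1, h2, h3, h4⟩ := h
  have hM0 : 0 ≤ M := (abs_nonneg _).trans hMx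
  have hA0 : 0 ≤ ‖A‖ := ContinuousLinearMap.opNorm_nonneg A
  have hX : 0 ≤ (2 * M + C * R + C * R ^ 2) / δ ^ s := by positivity
  refine ⟨p, A, h1, by linarith, h3.trans (by linarith), fun y hy => ?_⟩
  by_cases hyx : ‖y - x‖ < δ
  · refine (h4 y ⟨hy, by rwa [Metric.mem_ball, dist_eq_norm]⟩).trans ?_
    gcongr; linarith
  · push Not at hyx
    have q := qd_le x (u x) p A y
    have hr := hR y hy
    have i1 : ‖p‖ * ‖y - x‖ ≤ C * R := by gcongr
    have i2 : ‖A‖ * ‖y - x‖ ^ 2 ≤ C * R ^ 2 := by gcongr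
    have i3 := hM y hy
    have i4 : (2 * M + C * R + C * R ^ 2) / δ ^ s * δ ^ s ≤ (2 * M + C * R + C * R ^ 2) / δ ^ s * ‖y - x‖ ^ s := by
      gcongr
    rw [div_mul_cancel₀ _ (by positivity)] at i4
    have i5 : 0 ≤ C * ‖y - x‖ ^ s := by positivity
    have i6 : 0 ≤ C * R ^ 2 := by positivity
    refine (abs_sub _ _).trans ?_
    linarith

end globexp

/-! ## Part 16: global expansion -/
section globexp2
variable {E : Type*} [NormedAddCommGroup E] [InnerProductSpace ℝ E] [FiniteDimensional ℝ E]

/-- quantitative regularity of the boundary -/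
def BD (Ω : Set E) (Λ ρ α : ℝ) : Prop := ∀ z ∈ frontier Ω, ∃ (w : E → ℝ) (n : E → E) (A : E → Bi E),
  CW w n A (Metric.closedBall z ρ) Λ α ∧ w z = 0 ∧ 1 ≤ ‖n z‖ ∧ ∀ y, ‖y - z‖ ≤ ρ → (y ∈ Ω ↔ 0 < w y)

lemma CW.mono {w : E → ℝ} {n : E → E} {A : E → Bi E} {U V : Set E} {Λ α : ℝ} (h : CW w n A U Λ α) (hV : V ⊆ U) :
    CW w n A V Λ α where
  j y hy := h.j y (hV hy)
  n0 y hy := h.n0 y (hV hy)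
  A0 y hy := h.A0 y (hV hy)
  n1 y hy y' hy' := h.n1 y (hV hy) y' (hV hy')
  A1 y hy y' hy' := h.A1 y (hV hy) y' (hV hy')
  w1 y hy y' hy' := h.w1 y (hV hy) y' (hV hy')
  w2 y hy y' hy' := h.w2 y (hV hy) y' (hV hy')


def BP (u f : E → ℝ) (Ω : Set E) (m : ℕ) (α Λ d C : ℝ) (z : E) : Prop :=
  ∃ (w : E → ℝ) (n : E → E) (A : E → Bi E) (a : ℝ) (b : Du E), CW w n A (Metric.closedBall z d) Λ α ∧ w z = 0 ∧
    (m = 1 → b = 0) ∧ (m = 2 → f z + a * bt (A z) + 2 * b (n z) = 0) ∧ |a| ≤ C ∧ ‖b‖ ≤ C ∧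
    ∀ y ∈ Ω, ‖y - z‖ ≤ d → |u y - w y * (a + b (y - z))| ≤ C * ‖y - z‖ ^ ((m:ℝ) + α)

lemma bdry_exp (hN : 1 ≤ dm E) {m : ℕ} (hm : m = 1 ∨ m = 2) {α Λ ρ : ℝ} (hα0 : 0 < α) (hα1 : α < 1) (hΛ : 1 ≤ Λ)
    (hρ : 0 < ρ) {Ω : Set E} (hΩ : IsOpen Ω) (hBD : BD Ω Λ ρ α) {u f : E → ℝ} {M K : ℝ} (hu : Continuous u)
    (hu0 : ∀ x, x ∉ Ω → u x = 0) (hM : ∀ x, |u x| ≤ M) (hj : ∀ x ∈ Ω, ∃ p B, Jet u x p B ∧ bt B = -f x)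
    (hK : ∀ x ∈ closure Ω, |f x| ≤ K)
    (hf : m = 2 → ∀ x ∈ closure Ω, ∀ y ∈ closure Ω, |f x - f y| ≤ K * ‖x - y‖ ^ α) :
    ∃ d C : ℝ, 0 < d ∧ d ≤ 1 ∧ 0 ≤ C ∧ ∀ z ∈ frontier Ω, BP u f Ω m α Λ d C z := by
  obtain ⟨d₀, C, hd0, hd1, hC, H⟩ := bdry_reg (E := E) hN hm hα0 hα1 hΛ
  set d := min d₀ ρ with hdd
  have hd : 0 < d := lt_min hd0 hρ
  have hdl : d ≤ 1 := (min_le_left _ _).trans hd1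
  have hm1 : (1:ℝ) ≤ m := by rcases hm with rfl | rfl <;> norm_num
  have hM0 : 0 ≤ M := (abs_nonneg _).trans (hM 0)
  set s : ℝ := m + α with hs
  rcases (frontier Ω).eq_empty_or_nonempty with he | ⟨z₀, hz₀⟩
  · exact ⟨d, C, hd, hdl, hC, by simp [he]⟩
  have hK0 : 0 ≤ K := (abs_nonneg _).trans (hK z₀ (frontier_subset_closure hz₀))
  set K₁ := (M + K + 1) / d ^ s with hK₁
  have hds : 0 < d ^ s := by positivity
  have e1 : K₁ * d ^ s = M + K + 1 := div_mul_cancel₀ _ hds.ne'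
  have hK1 : 0 < K₁ := by positivity
  have hds1 : d ^ s ≤ 1 := Real.rpow_le_one hd.le hdl (by linarith)
  have hKK : K ≤ K₁ := by nlinarith
  have hs2 : m = 2 → s - 2 = α := fun h => by rw [hs, h]; push_cast; ring
  refine ⟨d, C * K₁, hd, hdl, by positivity, fun z hz => ?_⟩
  obtain ⟨w, n, A, hW, hwz, hn, hiff⟩ := hBD z hz
  have hW' := hW.mono (Metric.closedBall_subset_closedBall (min_le_right d₀ ρ))
  have hzc := frontier_subset_closure hz
  obtain ⟨a, b, h1, h2, h3, h4, h5⟩ := H Ω z w n A u d K₁ (if m = 1 then 0 else f z) hΩ hd (min_le_left _ _) hK1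
    hW' hwz hn (fun y hy => hiff y (hy.trans (min_le_right _ _))) (fun h => by simp [h])
    (by
      split_ifs with h
      · rw [abs_zero]; positivity
      · refine (hK z hzc).trans ?_
        have : d ^ s ≤ d ^ (s - 2) := Real.rpow_le_rpow_of_exponent_ge hd hdl (by linarith)
        nlinarith)
    hu.continuousOn (fun y _ => by rw [e1]; linarith [hM y]) (fun y _ hyΩ => hu0 y hyΩ)
    (by
      intro r hr hrd y hy hyr
      obtain ⟨p, B, hB, hBb⟩ := hj y hy
      refine ⟨p, B, hB, ?_⟩
      rw [hBb]
      split_ifs with h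
      · rw [add_zero, abs_neg]
        have : 1 ≤ r ^ (s - 2) := Real.one_le_rpow_of_pos_of_le_one_of_nonpos hr (hrd.trans hdl)
            (by rw [hs, h]; push_cast; linarith)
        have := hK y (subset_closure hy)
        nlinarith
      · have h' := hm.resolve_left h
        have := hf h' z hzc y (subset_closure hy)
        rw [hs2 h', neg_add_eq_sub]
        refine this.trans ?_
        rw [norm_sub_rev]
        gcongr)
  refine ⟨w, n, A, a, b, hW', hwz, h1, fun h => ?_, ?_, ?_, h5⟩
  · have hm' : m ≠ 1 := by omega
    simp only [om, if_neg hm'] at h2; linarith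
  · have : d ^ (s - 1) ≤ 1 := Real.rpow_le_one hd.le hdl (by linarith)
    exact h3.trans (mul_le_of_le_one_right (by positivity) this)
  · rcases hm with h | h
    · rw [h1 h, norm_zero]; positivity
    · have : d ^ (s - 2) ≤ 1 := Real.rpow_le_one hd.le hdl (by rw [hs2 h]; linarith)
      exact h4.trans (mul_le_of_le_one_right (by positivity) this)

lemma near_exp (hN : 1 ≤ dm E) {m : ℕ} (hm : m = 1 ∨ m = 2) {α Λ C₁ K : ℝ} (hα0 : 0 < α) (hα1 : α < 1) (hΛ : 1 ≤ Λ)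
    (hC₁ : 0 ≤ C₁) (hK0 : 0 ≤ K) : ∃ C : ℝ, 0 ≤ C ∧ ∀ (Ω : Set E) (u f : E → ℝ) (z x : E) (d d₁ : ℝ), d₁ ≤ 1 → 0 < d →
      d ≤ d₁ / 2 → ‖x - z‖ = d → Metric.ball x d ⊆ Ω → z ∈ closure Ω → Continuous u →
      (∀ x ∈ Ω, ∃ p B, Jet u x p B ∧ bt B = -f x) → (∀ x ∈ closure Ω, |f x| ≤ K) →
      (m = 2 → ∀ x ∈ closure Ω, ∀ y ∈ closure Ω, |f x - f y| ≤ K * ‖x - y‖ ^ α) → BP u f Ω m α Λ d₁ C₁ z →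
      Gd u (Ω ∩ Metric.ball x (d₁ / 2)) m (m + α) C x := by
  obtain ⟨C, hC, H⟩ := int_reg_jet (E := E) hN hm hα0 hα1
  have hm1 : (1:ℝ) ≤ m := by rcases hm with rfl | rfl <;> norm_num
  set s : ℝ := m + α with hs
  have hs0 : 0 ≤ s := by linarith
  set G := dm E * Λ with hG
  have hG0 : 0 ≤ G := by positivity
  set Kg := K + 4 * C₁ * G + 4 * C₁ * Λ with hKg
  have hKg0 : 0 ≤ Kg := by positivity
  set K₂ := C₁ * 4 ^ s + 2 * Kg + 1 with hK₂
  have h4s : 0 ≤ C₁ * 4 ^ s := by positivity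
  have hK2 : 0 < K₂ := by positivity
  refine ⟨(2 + 2 * C) * K₂ + 8 * Λ * C₁, by positivity, ?_⟩
  intro Ω u f z x d d₁ hd1 hd hdd hxz hball hzc hu hj hK hf ⟨w, n, A, a, b, hW, hwz, hm1b, hcon, ha, hb, hexp⟩
  have hU : ∀ y, ‖y - z‖ ≤ d₁ → y ∈ Metric.closedBall z d₁ := fun y hy => by
    rwa [Metric.mem_closedBall, dist_eq_norm]
  have hzU : z ∈ Metric.closedBall z d₁ := Metric.mem_closedBall_self (by linarith)
  have tri : ∀ y, ‖y - z‖ ≤ ‖y - x‖ + d := fun y => by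
    rw [← hxz]; exact norm_sub_le_norm_sub_add_norm_sub y x z
  set r := d / 2 with hr
  have hr0 : 0 < r := by positivity
  have hin : ∀ y, ‖y - x‖ ≤ r → y ∈ Ω := fun y hy => hball (by rw [Metric.mem_ball, dist_eq_norm]; linarith)
  have hyd : ∀ y, ‖y - x‖ ≤ r → ‖y - z‖ ≤ d₁ := fun y hy => by linarith [tri y]
  set Q : E → ℝ := fun y => w y * (a + b (y - z)) with hQ
  set g : E → ℝ := fun y => f y + (a + b (y - z)) * bt (A y) + 2 * b (n y) with hg
  have hbl : ∀ y, |b y| ≤ C₁ * ‖y‖ := fun y => (b.le_opNorm _).trans (by gcongr)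
  have hbtA : ∀ y, ‖y - z‖ ≤ d₁ → |bt (A y)| ≤ G := fun y hy =>
    (bt_le _).trans (by rw [hG]; have := hW.A0 y (hU y hy); gcongr)
  have hg1 : m = 1 → ∀ y, ‖y - x‖ < r → |g y| ≤ K₂ := by
    intro h y hy
    have hbz := hm1b h
    have i1 := hK y (subset_closure (hin y hy.le))
    have i2 : |a * bt (A y)| ≤ C₁ * G := by rw [abs_mul]; have := hbtA y (hyd y hy.le); gcongr
    simp only [hg, hbz, ContinuousLinearMap.zero_apply, add_zero, mul_zero]
    refine (abs_add_le _ _).trans ?_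
    have : 0 ≤ C₁ * G := by positivity
    have : 0 ≤ C₁ * Λ := by positivity
    linarith
  have hg2 : m = 2 → ∀ y ∈ closure Ω, ‖y - z‖ ≤ d₁ → ∀ y' ∈ closure Ω, ‖y' - z‖ ≤ d₁ →
      |g y - g y'| ≤ Kg * ‖y - y'‖ ^ α := by
    intro h y hy hyd y' hy' hyd'
    have i1 := hf h y hy y' hy'
    set t := ‖y - y'‖ with ht
    have ht0 : 0 ≤ t := norm_nonneg _
    have ht2 : t ≤ 2 := by
      have := norm_sub_le (y - z) (y' - z)
      rw [sub_sub_sub_cancel_right] at this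
      linarith
    have i2 := rpow_le_two ht0 ht2 hα0.le hα1.le (by linarith)
    rw [Real.rpow_one] at i2
    have i3 : |bt (A y) - bt (A y')| ≤ G * t ^ α := by
      rw [← bt_sub]; refine (bt_le _).trans ?_
      rw [hG, mul_assoc]; have := hW.A1 y' (hU y' hyd') y (hU y hyd); gcongr
    have i4 : |a + b (y - z)| ≤ 2 * C₁ := by
      refine (abs_add_le _ _).trans ?_
      have := hbl (y - z)
      have : C₁ * ‖y - z‖ ≤ C₁ * 1 := by gcongr; linarith
      linarith
    have i5 : |b (y - y')| ≤ C₁ * (2 * t ^ α) := (hbl _).trans (by gcongr)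
    have i6 : |b (n y - n y')| ≤ C₁ * (Λ * (2 * t ^ α)) := (hbl _).trans (by
      gcongr; exact (hW.n1 y' (hU y' hyd') y (hU y hyd)).trans (by gcongr))
    have e : g y - g y' = (f y - f y') + ((a + b (y - z)) * (bt (A y) - bt (A y')) + b (y - y') * bt (A y')) +
        2 * b (n y - n y') := by
      have : b (y - y') = b (y - z) - b (y' - z) := by rw [← map_sub]; congr 1; abel
      rw [this, map_sub b (n y)]
      simp only [hg]; ring
    rw [e]
    have j1 : |(a + b (y - z)) * (bt (A y) - bt (A y'))| ≤ 2 * C₁ * (G * t ^ α) := by rw [abs_mul]; gcongr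
    have j2 : |b (y - y') * bt (A y')| ≤ C₁ * (2 * t ^ α) * G := by
      rw [abs_mul]; have := hbtA y' hyd'; gcongr
    have k1 := abs_add_le ((f y - f y') + ((a + b (y - z)) * (bt (A y) - bt (A y')) + b (y - y') * bt (A y')))
      (2 * b (n y - n y'))
    have k2 := abs_add_le (f y - f y') ((a + b (y - z)) * (bt (A y) - bt (A y')) + b (y - y') * bt (A y'))
    have k3 := abs_add_le ((a + b (y - z)) * (bt (A y) - bt (A y'))) (b (y - y') * bt (A y'))
    have k4 : |2 * b (n y - n y')| = 2 * |b (n y - n y')| := by rw [abs_mul, abs_two]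
    rw [hKg]
    linarith only [k1, k2, k3, k4, j1, j2, i1, i6]
  have hxr : ‖x - x‖ ≤ r := by simpa using hr0.le
  have hxΩ := hin x hxr
  have hrα : d ^ α ≤ 2 * r ^ α := by
    have : d = 2 * r := by rw [hr]; ring
    rw [this, Real.mul_rpow (by norm_num) hr0.le]
    have : (2:ℝ) ^ α ≤ 2 ^ (1:ℝ) := Real.rpow_le_rpow_of_exponent_le (by norm_num) hα1.le
    rw [Real.rpow_one] at this
    gcongr
  obtain ⟨p, B, r1, r2, r3, r4, r5⟩ := H (fun y => u y - Q y) x r K₂ g hr0 (by linarith) hK2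
    (by
      refine hu.continuousOn.sub (ContinuousOn.mul (fun y hy => ?_) (by fun_prop))
      rw [Metric.mem_closedBall, dist_eq_norm] at hy
      exact (hW.j y (hU y (hyd y hy))).continuousAt.continuousWithinAt)
    (by
      intro y hy
      refine (hexp y (hin y hy) (hyd y hy)).trans ?_
      have : ‖y - z‖ ^ s ≤ (4 * r) ^ s := Real.rpow_le_rpow (norm_nonneg _) (by linarith [tri y]) hs0
      rw [Real.mul_rpow (by norm_num) hr0.le] at this
      calc C₁ * ‖y - z‖ ^ s ≤ C₁ * (4 ^ s * r ^ s) := by gcongr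
        _ = (C₁ * 4 ^ s) * r ^ s := by ring
        _ ≤ _ := by gcongr; linarith)
    (by
      intro y hy
      obtain ⟨p, B, hB, hBb⟩ := hj y (hin y hy.le)
      obtain ⟨q, B', hB', hBb'⟩ := jetQ (hW.j y (hU y (hyd y hy.le))) a b z
      refine ⟨_, _, hB.sub hB', ?_⟩
      rw [bt_sub, hBb, hBb']; simp only [hg]; ring)
    hg1
    (by
      intro h
      refine ⟨?_, fun y hy => ?_⟩
      · have e0 : g z = 0 := by simp only [hg, sub_self, map_zero, add_zero]; exact hcon h
        have := hg2 h x (subset_closure hxΩ) (hyd x hxr) z hzc (by simp; linarith)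
        rw [e0, sub_zero, hxz] at this
        have hrα0 : 0 ≤ r ^ α := by positivity
        calc |g x| ≤ Kg * d ^ α := this
          _ ≤ Kg * (2 * r ^ α) := by gcongr
          _ = (2 * Kg) * r ^ α := by ring
          _ ≤ _ := by gcongr; linarith
      · refine (hg2 h y (subset_closure (hin y hy.le)) (hyd y hy.le) x (subset_closure hxΩ) (hyd x hxr)).trans ?_
        gcongr; linarith)
  obtain ⟨p', B', t1, t2, t3, t4⟩ := prod_exp hm hα0 hα1 hΛ hC₁ (by linarith) hd1 hW hwz ha hb hm1b (hyd x hxr)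
  have hCK : 0 ≤ C * K₂ := by positivity
  refine ⟨p + p', B + B', fun h => by rw [r1 h, t1 h]; ext; simp, ?_, ?_, fun y hy => ?_⟩
  · refine (norm_add_le _ _).trans ?_; linarith
  · refine (bi_norm_add _ _).trans ?_; linarith
  · have hyx := hy.2
    rw [Metric.mem_ball, dist_eq_norm] at hyx
    have hydd : ‖y - z‖ ≤ d₁ := by linarith [tri y]
    have i1 := t4 y hydd
    have e : u y - qd x (u x) (p + p') (B + B') y = ((u y - Q y) - qd x (u x - Q x) p B y) +
        (Q y - qd x (Q x) p' B' y) := by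
      have := qd_add x (u x - Q x) (Q x) p p' B B' y
      rw [sub_add_cancel] at this
      rw [this]; ring
    rw [e]
    refine (abs_add_le _ _).trans ?_
    have key : |(u y - Q y) - qd x (u x - Q x) p B y| ≤ (2 + 2 * C) * K₂ * ‖y - x‖ ^ s := by
      rcases le_total (‖y - x‖) r with h | h
      · refine (r4 y h).trans ?_
        gcongr; linarith
      · have i2 := r5 y h
        have i3 := hexp y hy.1 hydd
        have : ‖y - z‖ ^ s ≤ (4 * ‖y - x‖) ^ s := Real.rpow_le_rpow (norm_nonneg _) (by linarith [tri y]) hs0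
        rw [Real.mul_rpow (by norm_num) (norm_nonneg _)] at this
        have i4 : C₁ * ‖y - z‖ ^ s ≤ K₂ * ‖y - x‖ ^ s :=
          calc C₁ * ‖y - z‖ ^ s ≤ C₁ * (4 ^ s * ‖y - x‖ ^ s) := by gcongr
            _ = (C₁ * 4 ^ s) * ‖y - x‖ ^ s := by ring
            _ ≤ _ := by gcongr; linarith
        refine (abs_sub _ _).trans ?_
        linarith
    linarith

/-- uniform expansions up to the boundary -/
theorem glob_exp (hN : 1 ≤ dm E) {m : ℕ} (hm : m = 1 ∨ m = 2) {α Λ ρ : ℝ} (hα0 : 0 < α) (hα1 : α < 1) (hΛ : 1 ≤ Λ)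
    (hρ : 0 < ρ) {Ω : Set E} (hΩ : IsOpen Ω) (hΩb : Bornology.IsBounded Ω) (hBD : BD Ω Λ ρ α) {u f : E → ℝ} {M K : ℝ}
    (hu : Continuous u)
    (hu0 : ∀ x, x ∉ Ω → u x = 0) (hM : ∀ x, |u x| ≤ M) (hj : ∀ x ∈ Ω, ∃ p B, Jet u x p B ∧ bt B = -f x)
    (hK : ∀ x ∈ closure Ω, |f x| ≤ K) (hK0 : 0 ≤ K)
    (hf : m = 2 → ∀ x ∈ closure Ω, ∀ y ∈ closure Ω, |f x - f y| ≤ K * ‖x - y‖ ^ α) :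
    ∃ C : ℝ, 0 ≤ C ∧ ∀ x ∈ closure Ω, Gd u (closure Ω) m (m + α) C x := by
  have hm1 : (1:ℝ) ≤ m := by rcases hm with rfl | rfl <;> norm_num
  have hs0 : 0 < (m:ℝ) + α := by linarith
  have hM0 : 0 ≤ M := (abs_nonneg _).trans (hM 0)
  obtain ⟨d, C₁, hd, hd1, hC₁, H₁⟩ := bdry_exp hN hm hα0 hα1 hΛ hρ hΩ hBD hu hu0 hM hj hK hf
  obtain ⟨C₂, hC₂, H₂⟩ := near_exp (E := E) hN hm hα0 hα1 hΛ hC₁ hK0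
  obtain ⟨C₃, hC₃, H₃⟩ := int_reg_jet (E := E) hN hm hα0 hα1
  obtain ⟨R, hR0, hR⟩ : ∃ R, 0 ≤ R ∧ ∀ x ∈ closure Ω, ∀ y ∈ Ω, ‖y - x‖ ≤ R := by
    refine ⟨Metric.diam (closure Ω), Metric.diam_nonneg, fun x hx y hy => ?_⟩
    rw [← dist_eq_norm]; exact Metric.dist_le_diam_of_mem hΩb.closure (subset_closure hy) hx
  set r := d / 4 with hr
  have hr0 : 0 < r := by positivity
  set s : ℝ := m + α with hs
  set K₃ := (M + K) / r ^ s + K + (if m = 2 then (M + K) / r ^ α else 0) + 1 with hK₃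
  have hK3a : (M + K) / r ^ s ≤ K₃ := by
    rw [hK₃]; split_ifs <;> nlinarith [show 0 ≤ (M + K) / r ^ α by positivity]
  have hK3b : K ≤ K₃ := by
    rw [hK₃]; have : 0 ≤ (M + K) / r ^ s := by positivity
    split_ifs <;> nlinarith [show 0 ≤ (M + K) / r ^ α by positivity]
  have hK3c : m = 2 → (M + K) / r ^ α ≤ K₃ := fun h => by
    rw [hK₃, if_pos h]; have : 0 ≤ (M + K) / r ^ s := by positivity
    linarith
  have hK30 : 0 < K₃ := by
    rw [hK₃]; have : 0 ≤ (M + K) / r ^ s := by positivity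
    split_ifs <;> nlinarith [show 0 ≤ (M + K) / r ^ α by positivity]
  set C₄ := 8 * Λ * C₁ + C₁ + C₂ + C₃ * K₃ with hC₄
  have hl : 0 ≤ Λ * C₁ := by positivity
  have hC₃K : 0 ≤ C₃ * K₃ := by positivity
  have hC₄0 : 0 ≤ C₄ := by positivity
  have loc : ∀ x ∈ closure Ω, Gd u (Ω ∩ Metric.ball x r) m s C₄ x := by
    intro x hx
    by_cases hxΩ : x ∈ Ω
    · by_cases hne : (Ωᶜ).Nonempty
      swap
      · exfalso
        have : Ω = univ := by rw [not_nonempty_iff_eq_empty, compl_empty_iff] at hne; exact hne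
        have hnt : Nontrivial E := by
          by_contra h
          rw [not_nontrivial_iff_subsingleton] at h
          have : dm E = 0 := by
            have : bt (ip : Bi E) = 0 := by
              rw [Subsingleton.elim (ip : Bi E) 0]; simp [bt]
            rw [bt_ip] at this; exact this
          linarith
        exact NormedSpace.unbounded_univ ℝ E (this ▸ hΩb)
      obtain ⟨z, hz, hzd⟩ := hΩ.isClosed_compl.exists_infDist_eq_dist hne x
      set δ := Metric.infDist x Ωᶜ with hδ
      have hball : Metric.ball x δ ⊆ Ω := fun y hy => by
        by_contra hyn
        have := Metric.infDist_le_dist_of_mem (x := x) (show y ∈ Ωᶜ from hyn)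
        rw [Metric.mem_ball, dist_comm] at hy
        linarith
      have hδ0 : 0 < δ := (hΩ.isClosed_compl.notMem_iff_infDist_pos hne).1 (by simpa using hxΩ)
      rcases le_or_gt δ (d / 2) with h | h
      · have hzc : z ∈ closure Ω := by
          have : z ∈ closure (Metric.ball x δ) := by
            rw [closure_ball x hδ0.ne', Metric.mem_closedBall, dist_comm, hzd]
          exact closure_mono hball this
        have hzf : z ∈ frontier Ω := by rw [frontier, hΩ.interior_eq]; exact ⟨hzc, hz⟩
        obtain ⟨p, A, h1, h2, h3, h4⟩ := (H₂ Ω u f z x δ d hd1 hδ0 h (by rw [← dist_eq_norm, hzd]) hball hzc hu hj hK hf (H₁ z hzf)).mono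
          (show C₂ ≤ C₄ by linarith)
        exact ⟨p, A, h1, h2, h3, fun y hy => h4 y ⟨hy.1, Metric.ball_subset_ball (by linarith) hy.2⟩⟩
      · have hin : ∀ y, ‖y - x‖ ≤ r → y ∈ Ω := fun y hy =>
          hball (by rw [Metric.mem_ball, dist_eq_norm]; linarith)
        obtain ⟨p, A, h1, h2, h3, h4, -⟩ := H₃ u x r K₃ f hr0 (by linarith) hK30 hu.continuousOn
          (fun y hy => by
            have : (M + K) / r ^ s * r ^ s ≤ K₃ * r ^ s := by gcongr
            rw [div_mul_cancel₀ _ (by positivity)] at this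
            linarith [hM y])
          (fun y hy => hj y (hin y hy.le)) (fun _ y hy => (hK y (subset_closure (hin y hy.le))).trans hK3b)
          (fun h => ⟨by
            have : (M + K) / r ^ α * r ^ α ≤ K₃ * r ^ α := by gcongr; exact hK3c h
            rw [div_mul_cancel₀ _ (by positivity)] at this
            linarith [hK x hx], fun y hy => (hf h y (subset_closure (hin y hy.le)) x hx).trans (by gcongr)⟩)
        refine ⟨p, A, h1, by linarith, h3.trans (by linarith), fun y hy => ?_⟩
        have hyx := hy.2
        rw [Metric.mem_ball, dist_eq_norm] at hyx
        refine (h4 y hyx.le).trans ?_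
        gcongr; linarith
    · have hxf : x ∈ frontier Ω := by rw [frontier, hΩ.interior_eq]; exact ⟨hx, hxΩ⟩
      obtain ⟨w, n, A, a, b, hW, hwz, hm1b, hcon, ha, hb, hexp⟩ := H₁ x hxf
      obtain ⟨p', B', t1, t2, t3, t4⟩ := prod_exp hm hα0 hα1 hΛ hC₁ hd hd1 hW hwz ha hb hm1b
        (x := x) (by simp; linarith)
      refine ⟨p', B', t1, by linarith, t3.trans (by linarith), fun y hy => ?_⟩
      have hyx := hy.2
      rw [Metric.mem_ball, dist_eq_norm] at hyx
      have i1 := t4 y (by linarith)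
      have i2 := hexp y hy.1 (by linarith)
      rw [hwz, zero_mul] at i1
      rw [hu0 x hxΩ]
      have e : u y - qd x 0 p' B' y = (u y - w y * (a + b (y - x))) + (w y * (a + b (y - x)) - qd x 0 p' B' y) := by ring
      rw [e]
      refine (abs_add_le _ _).trans ?_
      have : (C₁ + 8 * Λ * C₁) * ‖y - x‖ ^ s ≤ C₄ * ‖y - x‖ ^ s := by gcongr; linarith
      linarith
  refine ⟨C₄ + (2 * M + C₄ * R + C₄ * R ^ 2) / r ^ s, by positivity, fun x hx => ?_⟩
  obtain ⟨p, A, h1, h2, h3, h4⟩ := (loc x hx).far hs0 hC₄0 hr0 (hR x hx) hR0 (fun y _ => hM y) (hM x)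
  refine ⟨p, A, h1, h2, h3, fun y hy => ?_⟩
  refine closure_minimal (s := Ω) (t := {y | |u y - qd x (u x) p A y| ≤ _ * ‖y - x‖ ^ s}) h4 (isClosed_le ?_ ?_) hy
  · exact (hu.sub (qd_cont _ _ _ _)).abs
  · exact continuous_const.mul ((continuous_id.sub continuous_const).norm.rpow_const fun _ => Or.inr hs0.le)

end globexp2

/-! ## Part 17: geometry of the closure and Whitney-type lemmas -/
section geom
variable {E : Type*} [NormedAddCommGroup E] [InnerProductSpace ℝ E] [FiniteDimensional ℝ E]

lemma near_frontier {Ω : Set E} (hΩ : IsOpen Ω) {x : E} (hx : x ∈ closure Ω) {r : ℝ} (hr : 0 < r) :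
    Metric.ball x r ⊆ Ω ∨ ∃ z ∈ frontier Ω, ‖x - z‖ < r := by
  by_contra! h
  refine h.1 ((convex_ball x r).isPreconnected.subset_of_closure_inter_subset hΩ ?_ ?_)
  · exact mem_closure_iff.1 hx _ Metric.isOpen_ball (Metric.mem_ball_self hr)
  · rintro z ⟨hz, hzb⟩
    by_contra hzn
    have := h.2 z (by rw [frontier, hΩ.interior_eq]; exact ⟨hz, hzn⟩)
    rw [Metric.mem_ball, dist_comm, dist_eq_norm] at hzb
    linarith

lemma CW.up {w : E → ℝ} {n : E → E} {A : E → Bi E} {z : E} {Λ ρ α σ : ℝ} (hΛ : 0 ≤ Λ)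
    (h : CW w n A (Metric.closedBall z ρ) Λ α) (h2 : 2 * σ ≤ ρ) {x v : E} (hx : ‖x - z‖ ≤ σ) (hv : ‖v‖ ≤ σ) :
    w x + inner ℝ (n z) v - 2 * Λ * σ * ‖v‖ ≤ w (x + v) := by
  have hU : ∀ y, ‖y - z‖ ≤ ρ → y ∈ Metric.closedBall z ρ := fun y hy => by
    rwa [Metric.mem_closedBall, dist_eq_norm]
  have hσ : 0 ≤ σ := (norm_nonneg _).trans hv
  have hxU := hU x (by linarith)
  have hyU := hU (x + v) (by
    have := norm_add_le (x - z) v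
    rw [show x - z + v = x + v - z by abel] at this; linarith)
  have hzU := hU z (by simp; linarith)
  have h1 := h.w1 x hxU _ hyU
  rw [add_sub_cancel_left] at h1
  have h3 := abs_real_inner_le_norm (n x - n z) v
  have h4 := h.n1 z hzU x hxU
  have h5 : ‖n x - n z‖ * ‖v‖ ≤ (Λ * σ) * ‖v‖ := by gcongr; exact h4.trans (by gcongr)
  rw [inner_sub_left] at h3
  have h6 : Λ * ‖v‖ ^ 2 ≤ Λ * σ * ‖v‖ := by rw [pow_two, ← mul_assoc]; gcongr
  have := abs_le.1 h1
  have := abs_le.1 h3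
  linarith

lemma CW.nonneg {w : E → ℝ} {n : E → E} {A : E → Bi E} {z : E} {Λ ρ α : ℝ} {Ω : Set E}
    (h : CW w n A (Metric.closedBall z ρ) Λ α) (hiff : ∀ y, ‖y - z‖ ≤ ρ → (y ∈ Ω ↔ 0 < w y)) {x : E}
    (hx : x ∈ closure Ω) (hxz : ‖x - z‖ < ρ) : 0 ≤ w x := by
  by_contra! hlt
  have h1 : ∀ᶠ y in 𝓝 x, w y < 0 :=
    (h.j x (by rw [Metric.mem_closedBall, dist_eq_norm]; exact hxz.le)).continuousAt.eventually (gt_mem_nhds hlt)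
  have h2 : ∀ᶠ y in 𝓝 x, ‖y - z‖ < ρ :=
    (show Continuous fun y : E => ‖y - z‖ by fun_prop).continuousAt.eventually (gt_mem_nhds hxz)
  obtain ⟨y, hy, hy1, hy2⟩ := ((mem_closure_iff_frequently.1 hx).and_eventually (h1.and h2)).exists
  have := (hiff y hy2.le).1 hy
  linarith

lemma int_ball {Ω : Set E} (hΩ : IsOpen Ω) {Λ ρ α : ℝ} (hΛ : 1 ≤ Λ) (hρ : 0 < ρ) (hBD : BD Ω Λ ρ α) :
    ∃ r₀ : ℝ, 0 < r₀ ∧ ∀ x ∈ closure Ω, ∀ r, 0 < r → r ≤ r₀ → ∃ ξ, ‖ξ - x‖ ≤ r ∧ ∀ v, ‖v‖ ≤ r / 8 → ξ + v ∈ Ω := by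
  refine ⟨min (ρ / 2) (1 / (4 * Λ)), by positivity, fun x hx r hr hr0 => ?_⟩
  have hr1 : r ≤ ρ / 2 := hr0.trans (min_le_left _ _)
  have hr2 : r ≤ 1 / (4 * Λ) := hr0.trans (min_le_right _ _)
  rw [le_div_iff₀ (by positivity)] at hr2
  rcases near_frontier hΩ hx (show 0 < r / 4 by positivity) with h | ⟨z, hz, hxz⟩
  · refine ⟨x, by simpa using hr.le, fun v hv => h ?_⟩
    rw [Metric.mem_ball, dist_eq_norm, add_sub_cancel_left]; linarith
  · obtain ⟨w, n, A, hW, hwz, hn, hiff⟩ := hBD z hz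
    have hn0 : 0 < ‖n z‖ := by linarith
    set e := (r / (2 * ‖n z‖)) • n z with he
    have hen : ‖e‖ = r / 2 := by
      rw [he, norm_smul, Real.norm_eq_abs, abs_of_pos (by positivity)]; field_simp
    refine ⟨z + e, ?_, fun v hv => ?_⟩
    · have : z + e - x = e - (x - z) := by abel
      rw [this]; refine (norm_sub_le _ _).trans ?_; linarith
    · have hV : ‖e + v‖ ≤ 5 * r / 8 := (norm_add_le _ _).trans (by linarith)
      have h1 := hW.up (by linarith) (σ := r) (by linarith) (x := z) (v := e + v) (by simpa using hr.le) (by linarith)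
      rw [hwz, ← add_assoc] at h1
      have h2 : inner ℝ (n z) (e + v) = ‖n z‖ * (r / 2) + inner ℝ (n z) v := by
        rw [inner_add_right, he, inner_smul_right, real_inner_self_eq_norm_sq]; field_simp
      have h3 := abs_le.1 (abs_real_inner_le_norm (n z) v)
      have h4 : ‖n z‖ * ‖v‖ ≤ ‖n z‖ * (r / 8) := by gcongr
      have h5 : 2 * Λ * r * ‖e + v‖ ≤ 2 * Λ * r * (5 * r / 8) := by gcongr
      refine (hiff _ ?_).2 ?_
      · rw [show z + e + v - z = e + v by abel]; linarith
      · nlinarith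

lemma quasi {Ω : Set E} (hΩ : IsOpen Ω) {Λ ρ α : ℝ} (hΛ : 1 ≤ Λ) (hρ : 0 < ρ) (hBD : BD Ω Λ ρ α) :
    ∃ r₀ Q : ℝ, 0 < r₀ ∧ 0 ≤ Q ∧ ∀ x ∈ closure Ω, ∀ y ∈ closure Ω, ‖y - x‖ ≤ r₀ → ∃ x' y',
      segment ℝ x x' ⊆ closure Ω ∧ segment ℝ x' y' ⊆ closure Ω ∧ segment ℝ y y' ⊆ closure Ω ∧
      ‖x' - x‖ ≤ Q * ‖y - x‖ ∧ ‖y' - x'‖ ≤ Q * ‖y - x‖ ∧ ‖y' - y‖ ≤ Q * ‖y - x‖ := by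
  set B := 3 + 4 * Λ ^ 2 with hB
  have hB1 : 3 ≤ B := by nlinarith
  refine ⟨min (ρ / (4 * B)) (1 / (2 * Λ * B ^ 2)), B, by positivity, by linarith, fun x hx y hy ht => ?_⟩
  set t := ‖y - x‖ with htd
  have hr1 : t ≤ ρ / (4 * B) := ht.trans (min_le_left _ _)
  have hr2 : t ≤ 1 / (2 * Λ * B ^ 2) := ht.trans (min_le_right _ _)
  rw [le_div_iff₀ (by positivity)] at hr1 hr2
  rcases (norm_nonneg (y - x)).lt_or_eq with ht0 | ht0
  swap
  · have : y = x := by rw [← sub_eq_zero, ← norm_eq_zero]; exact ht0.symm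
    refine ⟨x, x, ?_, ?_, ?_, ?_⟩ <;> simp [this, hx, htd]
  rw [← htd] at ht0
  have hBt : 0 < B * t := by positivity
  rcases near_frontier hΩ hx (show 0 < 2 * t by positivity) with h | ⟨z, hz, hxz⟩
  · refine ⟨x, y, by simpa using hx, ?_, by simpa using hy, by simpa using hBt.le, ?_, by simpa using hBt.le⟩
    · refine ((convex_ball x (2 * t)).segment_subset (Metric.mem_ball_self (by positivity)) ?_).trans
        (h.trans subset_closure)
      rw [Metric.mem_ball, dist_eq_norm, ← htd]; linarith
    · rw [← htd]; nlinarith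
  obtain ⟨w, n, A, hW, hwz, hn, hiff⟩ := hBD z hz
  have hzU : z ∈ Metric.closedBall z ρ := Metric.mem_closedBall_self hρ.le
  set e := n z with he
  have heΛ : ‖e‖ ≤ Λ := hW.n0 z hzU
  have hyz : ‖y - z‖ ≤ 3 * t := by
    have := norm_add_le (y - x) (x - z)
    rw [sub_add_sub_cancel] at this; linarith
  set σ := B * t with hσ
  have hσρ : 2 * σ ≤ ρ := by linarith
  have hee : inner ℝ e e = ‖e‖ ^ 2 := real_inner_self_eq_norm_sq e
  have hxσ : ‖x - z‖ ≤ σ := by nlinarith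
  have hyσ : ‖y - z‖ ≤ σ := by nlinarith
  have hmem : ∀ a v, ‖a - z‖ ≤ σ → ‖v‖ ≤ σ → 0 < w (a + v) → a + v ∈ Ω := fun a v ha hv h => by
    refine (hiff _ ?_).2 h
    have := norm_add_le (a - z) v
    rw [show a - z + v = a + v - z by abel] at this; linarith
  have hen : ∀ θ ∈ Icc (0:ℝ) 1, ‖(θ * (4 * Λ * t)) • e‖ = θ * (4 * Λ * t) * ‖e‖ := fun θ hθ => by
    have := hθ.1
    rw [norm_smul, Real.norm_eq_abs, abs_of_nonneg (by positivity)]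
  have hΛt : 4 * Λ * t * ‖e‖ ≤ 4 * Λ ^ 2 * t := by
    have : 4 * Λ * t * ‖e‖ ≤ 4 * Λ * t * Λ := by gcongr
    linarith
  have hΛσ : 2 * Λ * σ < 1 := by
    have h1 : t * (2 * Λ * B ^ 2) = 2 * Λ * σ * B := by rw [hσ]; ring
    have h2 : 0 ≤ 2 * Λ * σ := by positivity
    nlinarith
  have vert : ∀ a ∈ closure Ω, ‖a - z‖ ≤ σ → segment ℝ a (a + (4 * Λ * t) • e) ⊆ closure Ω := by
    intro a ha haz b hb
    rw [segment_eq_image'] at hb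
    obtain ⟨θ, hθ, rfl⟩ := hb
    simp only [add_sub_cancel_left, smul_smul]
    rcases hθ.1.lt_or_eq with h0 | h0
    swap
    · simpa [← h0] using ha
    have hv := hen θ hθ
    have hvσ : ‖(θ * (4 * Λ * t)) • e‖ ≤ σ := by
      rw [hv]
      have : θ * (4 * Λ * t * ‖e‖) ≤ 1 * (4 * Λ * t * ‖e‖) := by gcongr; exact hθ.2
      rw [hσ, hB]; linarith
    refine subset_closure (hmem _ _ haz hvσ ?_)
    have h1 := hW.up (by linarith) hσρ haz hvσ
    have h2 := hW.nonneg hiff ha (by linarith)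
    rw [hv, inner_smul_right, ← he, hee] at h1
    have h3 : 0 < θ * (4 * Λ * t) * ‖e‖ := by positivity
    nlinarith
  have hnorm : ‖(4 * Λ * t) • e‖ ≤ B * t := by
    have := hen 1 (by simp)
    rw [one_mul] at this
    rw [this, hB]; linarith
  refine ⟨x + (4 * Λ * t) • e, y + (4 * Λ * t) • e, vert x hx hxσ, ?_, vert y hy hyσ,
    by rwa [add_sub_cancel_left], ?_, by rwa [add_sub_cancel_left]⟩
  · intro b hb
    rw [segment_eq_image'] at hb
    obtain ⟨θ, hθ, rfl⟩ := hb
    have e1 : x + (4 * Λ * t) • e + θ • (y + (4 * Λ * t) • e - (x + (4 * Λ * t) • e)) =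
        x + ((4 * Λ * t) • e + θ • (y - x)) := by rw [add_sub_add_right_eq_sub]; abel
    simp only [e1]
    have h1 : ‖θ • (y - x)‖ ≤ t := by
      rw [norm_smul, Real.norm_eq_abs, abs_of_nonneg hθ.1]; exact mul_le_of_le_one_left (norm_nonneg _) hθ.2
    have hvσ : ‖(4 * Λ * t) • e + θ • (y - x)‖ ≤ σ := by
      refine (norm_add_le _ _).trans ?_
      have := hen 1 (by simp)
      rw [one_mul] at this
      rw [this, hσ, hB]; linarith
    refine subset_closure (hmem _ _ hxσ hvσ ?_)
    have h2 := hW.up (by linarith) hσρ hxσ hvσ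
    have h3 := hW.nonneg hiff hx (by linarith)
    rw [inner_add_right, inner_smul_right, ← he, hee] at h2
    have h4 := abs_le.1 ((abs_real_inner_le_norm e (θ • (y - x))))
    have h5 : ‖e‖ * ‖θ • (y - x)‖ ≤ ‖e‖ * t := by gcongr
    have h6 : 2 * Λ * σ * ‖(4 * Λ * t) • e + θ • (y - x)‖ ≤ 2 * Λ * σ * σ := by gcongr
    have h7 : 2 * Λ * σ * σ = (t * (2 * Λ * B ^ 2)) * t := by rw [hσ]; ring
    have h8 : (t * (2 * Λ * B ^ 2)) * t ≤ 1 * t := by gcongr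
    have h9 : 4 * t * ‖e‖ ≤ 4 * Λ * t * ‖e‖ ^ 2 := by
      have : 1 * 1 ≤ Λ * ‖e‖ := by gcongr
      nlinarith [show 0 ≤ t * ‖e‖ by positivity]
    nlinarith
  · rw [add_sub_add_right_eq_sub, ← htd]; nlinarith

lemma seg_lip {F : Type*} [NormedAddCommGroup F] [NormedSpace ℝ F] {S : Set E} {h : E → F} {h' : E → E →L[ℝ] F} {P : ℝ}
    (hd : ∀ x ∈ S, HasFDerivWithinAt h (h' x) S x) (hP : ∀ x ∈ S, ‖h' x‖ ≤ P) {x y : E} (hs : segment ℝ x y ⊆ S) :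
    ‖h y - h x‖ ≤ P * ‖y - x‖ :=
  Convex.norm_image_sub_le_of_norm_hasFDerivWithin_le (fun z hz => (hd z (hs hz)).mono hs) (fun z hz => hP z (hs hz))
    (convex_segment x y) (left_mem_segment ℝ x y) (right_mem_segment ℝ x y)

/-- functions with bounded derivative on the closure are Lipschitz -/
lemma lip_of_deriv {F : Type*} [NormedAddCommGroup F] [NormedSpace ℝ F] {Ω : Set E} (hΩ : IsOpen Ω) {Λ ρ α : ℝ}
    (hΛ : 1 ≤ Λ) (hρ : 0 < ρ) (hBD : BD Ω Λ ρ α) {h : E → F} {h' : E → E →L[ℝ] F} {P M : ℝ}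
    (hd : ∀ x ∈ closure Ω, HasFDerivWithinAt h (h' x) (closure Ω) x) (hP : ∀ x ∈ closure Ω, ‖h' x‖ ≤ P)
    (hM : ∀ x ∈ closure Ω, ‖h x‖ ≤ M) :
    ∃ C : ℝ, 0 ≤ C ∧ ∀ x ∈ closure Ω, ∀ y ∈ closure Ω, ‖h y - h x‖ ≤ C * ‖y - x‖ := by
  obtain ⟨r₀, Q, hr, hQ, H⟩ := quasi hΩ hΛ hρ hBD
  refine ⟨|3 * P * Q| + |2 * M / r₀|, by positivity, fun x hx y hy => ?_⟩
  have hP0 : 0 ≤ P := (norm_nonneg _).trans (hP x hx)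
  have hM0 : 0 ≤ M := (norm_nonneg _).trans (hM x hx)
  rw [abs_of_nonneg (by positivity), abs_of_nonneg (by positivity)]
  rcases le_total ‖y - x‖ r₀ with ht | ht
  · obtain ⟨x', y', s1, s2, s3, l1, l2, l3⟩ := H x hx y hy ht
    have k1 := seg_lip hd hP s1
    have k2 := seg_lip hd hP s2
    have k3 := seg_lip hd hP s3
    have e : h y - h x = (h x' - h x) + (h y' - h x') - (h y' - h y) := by abel
    rw [e]
    refine (norm_sub_le _ _).trans ?_
    have := norm_add_le (h x' - h x) (h y' - h x')
    have m1 := mul_le_mul_of_nonneg_left l1 hP0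
    have m2 := mul_le_mul_of_nonneg_left l2 hP0
    have m3 := mul_le_mul_of_nonneg_left l3 hP0
    have : 0 ≤ 2 * M / r₀ * ‖y - x‖ := by positivity
    linarith
  · refine (norm_sub_le _ _).trans ?_
    have h1 := hM x hx
    have h2 := hM y hy
    have h3 : 2 * M / r₀ * r₀ ≤ 2 * M / r₀ * ‖y - x‖ := by gcongr
    rw [div_mul_cancel₀ _ hr.ne'] at h3
    have : 0 ≤ 3 * P * Q * ‖y - x‖ := by positivity
    linarith

lemma uniqueDiff_closure {Ω : Set E} (hΩ : IsOpen Ω) {Λ ρ α : ℝ} (hΛ : 1 ≤ Λ) (hρ : 0 < ρ) (hBD : BD Ω Λ ρ α) :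
    UniqueDiffOn ℝ (closure Ω) := by
  intro z hz
  by_cases hzΩ : z ∈ Ω
  · exact uniqueDiffWithinAt_of_mem_nhds (mem_of_superset (hΩ.mem_nhds hzΩ) subset_closure)
  obtain ⟨w, n, A, hW, hwz, hn, hiff⟩ := hBD z (by rw [frontier, hΩ.interior_eq]; exact ⟨hz, hzΩ⟩)
  have key : ∀ v, 0 < inner ℝ (n z) v → v ∈ Submodule.span ℝ (tangentConeAt ℝ (closure Ω) z) := by
    intro v hv
    have hv0 : 0 < ‖v‖ := norm_pos_iff.2 (by rintro rfl; simp at hv)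
    set ε := min (ρ / (2 * ‖v‖)) (inner ℝ (n z) v / (4 * Λ * ‖v‖ ^ 2)) with hε
    have hε0 : 0 < ε := by positivity
    have h1 : ε ≤ ρ / (2 * ‖v‖) := min_le_left _ _
    have h2 : ε ≤ inner ℝ (n z) v / (4 * Λ * ‖v‖ ^ 2) := min_le_right _ _
    rw [le_div_iff₀ (by positivity)] at h1 h2
    have h3 : (z + ε • v) - z ∈ tangentConeAt ℝ (closure Ω) z := by
      refine mem_tangentConeAt_of_openSegment_subset fun b hb => ?_
      rw [openSegment_eq_image'] at hb
      obtain ⟨θ, hθ, rfl⟩ := hb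
      simp only [add_sub_cancel_left, smul_smul]
      have hθ0 := hθ.1
      have hθ1 := hθ.2
      have hvv : ‖(θ * ε) • v‖ = θ * ε * ‖v‖ := by
        rw [norm_smul, Real.norm_eq_abs, abs_of_nonneg (by positivity)]
      have hvσ : ‖(θ * ε) • v‖ ≤ ε * ‖v‖ := by
        rw [hvv]; nlinarith [show 0 < ε * ‖v‖ by positivity]
      have h4 := hW.up (by linarith) (σ := ε * ‖v‖) (by linarith) (x := z) (by simp; positivity) hvσ
      refine subset_closure ((hiff _ ?_).2 ?_)
      · rw [add_sub_cancel_left]; nlinarith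
      · rw [hwz, hvv, inner_smul_right] at h4
        have : 0 < θ * ε := by positivity
        nlinarith
    rw [add_sub_cancel_left] at h3
    have := Submodule.smul_mem _ ε⁻¹ (Submodule.subset_span (R := ℝ) h3)
    rwa [inv_smul_smul₀ hε0.ne'] at this
  refine ⟨?_, subset_closure hz⟩
  have htop : Submodule.span ℝ (tangentConeAt ℝ (closure Ω) z) = ⊤ := by
    rw [eq_top_iff]
    intro v _
    have hnn : 1 ≤ ‖n z‖ ^ 2 := by nlinarith
    have hk : 0 < inner ℝ (n z) (v + (|inner ℝ (n z) v| + 1) • n z) := by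
      rw [inner_add_right, inner_smul_right, real_inner_self_eq_norm_sq]
      have := neg_abs_le (inner ℝ (n z) v)
      have := abs_nonneg (inner ℝ (n z) v)
      nlinarith
    have hk2 : 0 < inner ℝ (n z) (n z) := by rw [real_inner_self_eq_norm_sq]; linarith
    have := Submodule.sub_mem _ (key _ hk) (Submodule.smul_mem _ (|inner ℝ (n z) v| + 1) (key _ hk2))
    rwa [add_sub_cancel_right] at this
  rw [htop]; simp

/-- quadratic polynomials on balls -/
lemma quad_norm {c M ρ : ℝ} {l : Du E} {D : Bi E} (hD : ∀ a b, D a b = D b a) (hρ : 0 < ρ)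
    (h : ∀ v, ‖v‖ ≤ ρ → |c + l v + 1 / 2 * D v v| ≤ M) : ‖l‖ ≤ M / ρ ∧ ‖D‖ ≤ 8 * M / ρ ^ 2 := by
  have hM : 0 ≤ M := (abs_nonneg _).trans (h 0 (by simpa using hρ.le))
  have hl : ∀ v, ‖v‖ ≤ ρ → |l v| ≤ M ∧ |D v v| ≤ 4 * M := fun v hv => by
    have a1 := abs_le.1 (h v hv)
    have a2 := abs_le.1 (h (-v) (by simpa using hv))
    have a3 := abs_le.1 (h 0 (by simpa using hρ.le))
    simp only [map_neg, ContinuousLinearMap.neg_apply, neg_neg, map_zero, mul_zero, add_zero] at a2 a3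
    rw [abs_le, abs_le]; refine ⟨⟨?_, ?_⟩, ?_, ?_⟩ <;> linarith
  refine ⟨aff_norm (c := 0) hρ fun v hv => by rw [zero_add]; exact (hl v hv).1, ?_⟩
  refine bi_norm_le_of (by positivity) fun a b => ?_
  rcases eq_or_ne a 0 with rfl | ha
  · simp
  rcases eq_or_ne b 0 with rfl | hb
  · simp
  have ha0 := norm_pos_iff.2 ha
  have hb0 := norm_pos_iff.2 hb
  set a' := (ρ / (2 * ‖a‖)) • a with ha'
  set b' := (ρ / (2 * ‖b‖)) • b with hb'
  have na : ‖a'‖ = ρ / 2 := by rw [ha', norm_smul, Real.norm_eq_abs, abs_of_pos (by positivity)]; field_simp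
  have nb : ‖b'‖ = ρ / 2 := by rw [hb', norm_smul, Real.norm_eq_abs, abs_of_pos (by positivity)]; field_simp
  have h1 := abs_le.1 (hl (a' + b') ((norm_add_le _ _).trans (by linarith))).2
  have h2 := abs_le.1 (hl (a' - b') ((norm_sub_le _ _).trans (by linarith))).2
  have e : D a' b' = (D (a' + b') (a' + b') - D (a' - b') (a' - b')) / 4 := by
    simp only [map_add, map_sub, ContinuousLinearMap.add_apply, ContinuousLinearMap.sub_apply, hD b' a']; ring
  have h3 : |D a' b'| ≤ 2 * M := by rw [e, abs_le]; constructor <;> linarith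
  have e2 : D a' b' = ρ ^ 2 / (4 * ‖a‖ * ‖b‖) * D a b := by
    simp only [ha', hb', map_smul, ContinuousLinearMap.smul_apply, smul_eq_mul]; field_simp; ring
  rw [e2, abs_mul, abs_of_pos (by positivity)] at h3
  calc |D a b| = (ρ ^ 2 / (4 * ‖a‖ * ‖b‖) * |D a b|) * (4 * ‖a‖ * ‖b‖ / ρ ^ 2) := by field_simp
    _ ≤ 2 * M * (4 * ‖a‖ * ‖b‖ / ρ ^ 2) := by gcongr
    _ = _ := by ring

end geom

/-! ## Part 18: Whitney lemmas -/
section whit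
variable {E : Type*} [NormedAddCommGroup E] [InnerProductSpace ℝ E] [FiniteDimensional ℝ E]

/-- interior balls -/
def IB (S : Set E) (r₀ : ℝ) : Prop := ∀ x ∈ S, ∀ r, 0 < r → r ≤ r₀ → ∃ ξ, ‖ξ - x‖ ≤ r ∧ ∀ v, ‖v‖ ≤ r / 8 → ξ + v ∈ S

lemma whit_core {S : Set E} {r₀ : ℝ} (hIB : IB S r₀) {u : E → ℝ} {s C : ℝ} (hs : 0 ≤ s) (hC : 0 ≤ C) {x x' : E}
    (hx : x ∈ S) (ht0 : 0 < ‖x' - x‖) (ht : ‖x' - x‖ ≤ r₀) {p p' : Du E} {A A' : Bi E}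
    (hA : ∀ a b, A a b = A b a) (hA' : ∀ a b, A' a b = A' b a)
    (h : ∀ y ∈ S, |u y - qd x (u x) p A y| ≤ C * ‖y - x‖ ^ s)
    (h' : ∀ y ∈ S, |u y - qd x' (u x') p' A' y| ≤ C * ‖y - x'‖ ^ s) :
    ‖A' - A‖ ≤ 3000 * C * 3 ^ s * ‖x' - x‖ ^ (s - 2) ∧
    ‖p' - p - A (x' - x)‖ ≤ 3000 * C * 3 ^ s * ‖x' - x‖ ^ (s - 1) := by
  set t := ‖x' - x‖ with htd
  obtain ⟨ξ, hξ, hball⟩ := hIB x hx t ht0 ht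
  have hξ' : ‖ξ - x'‖ ≤ 2 * t := by
    have := norm_sub_le (ξ - x) (x' - x)
    rw [sub_sub_sub_cancel_right] at this; linarith
  set W := 3 ^ s * t ^ s with hW
  have hW0 : 0 ≤ W := by positivity
  have h3 : ∀ y : E, ‖y‖ ≤ 3 * t → C * ‖y‖ ^ s ≤ C * W := fun y hy => by
    rw [hW, ← Real.mul_rpow (by norm_num) ht0.le]; gcongr
  have key := quad_norm (c := qd x (u x) p A ξ - qd x' (u x') p' A' ξ) (l := (p + A (ξ - x)) - (p' + A' (ξ - x')))
    (D := A - A') (M := 2 * (C * W)) (ρ := t / 8) (fun a b => by simp [hA a b, hA' a b]) (by positivity) (by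
    intro v hv
    have hy := hball v hv
    have e1 : ξ + v - x = (ξ - x) + v := by abel
    have e2 : ξ + v - x' = (ξ - x') + v := by abel
    have i1 := h _ hy
    have i2 := h' _ hy
    have j1 := h3 (ξ + v - x) (by rw [e1]; refine (norm_add_le _ _).trans ?_; linarith)
    have j2 := h3 (ξ + v - x') (by rw [e2]; refine (norm_add_le _ _).trans ?_; linarith)
    have i1 := abs_le.1 i1
    have i2 := abs_le.1 i2
    have e : qd x (u x) p A ξ - qd x' (u x') p' A' ξ + ((p + A (ξ - x)) - (p' + A' (ξ - x'))) v +
        1 / 2 * (A - A') v v = qd x (u x) p A (ξ + v) - qd x' (u x') p' A' (ξ + v) := by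
      unfold qd
      rw [e1, e2]
      generalize ξ - x = a
      generalize ξ - x' = a'
      simp only [map_add, ContinuousLinearMap.add_apply, ContinuousLinearMap.sub_apply, hA v a, hA' v a']
      ring
    rw [e, abs_le]; constructor <;> linarith)
  obtain ⟨k1, k2⟩ := key
  have f1 : t ^ (s - 1) * t = t ^ s := by rw [Real.rpow_sub_one ht0.ne']; field_simp
  have f2 : t ^ (s - 2) * t ^ 2 = t ^ s := by
    rw [← Real.rpow_natCast, ← Real.rpow_add ht0]; norm_num
  have f3 : t ^ (s - 2) * t = t ^ (s - 1) := by
    have := Real.rpow_add_one ht0.ne' (s - 2)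
    rw [← this]; congr 1; ring
  have g1 : 2 * (C * W) / (t / 8) = 16 * C * 3 ^ s * t ^ (s - 1) := by
    rw [hW, ← f1]; field_simp; ring
  have g2 : 8 * (2 * (C * W)) / (t / 8) ^ 2 = 1024 * C * 3 ^ s * t ^ (s - 2) := by
    rw [hW, ← f2]; field_simp; ring
  rw [g1] at k1
  rw [g2] at k2
  have k2' : ‖A' - A‖ ≤ 1024 * C * 3 ^ s * t ^ (s - 2) := by rw [bi_sub_comm]; exact k2
  have hX : 0 ≤ C * 3 ^ s * t ^ (s - 2) := by positivity
  have hY : 0 ≤ C * 3 ^ s * t ^ (s - 1) := by positivity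
  refine ⟨by linarith, ?_⟩
  have e : p' - p - A (x' - x) = (A - A') (ξ - x') - ((p + A (ξ - x)) - (p' + A' (ξ - x'))) := by
    have : ξ - x = (ξ - x') + (x' - x) := by abel
    rw [this, map_add, ContinuousLinearMap.sub_apply]; abel
  rw [e]
  refine (norm_sub_le _ _).trans ?_
  have m1 : ‖(A - A') (ξ - x')‖ ≤ (1024 * C * 3 ^ s * t ^ (s - 2)) * (2 * t) :=
    (ContinuousLinearMap.le_opNorm (A - A') (ξ - x')).trans (by gcongr)
  have m2 : (1024 * C * 3 ^ s * t ^ (s - 2)) * (2 * t) = 2048 * (C * 3 ^ s * t ^ (s - 1)) := by rw [← f3]; ring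
  linarith

lemma hasFDerivWithinAt_of_rpow [NormedSpace ℝ E] {F : Type*} [NormedAddCommGroup F] [NormedSpace ℝ F] {S : Set E} {u : E → F} {x : E}
    {p : E →L[ℝ] F} {C s r : ℝ} (hs : 1 < s) (hr : 0 < r)
    (h : ∀ y ∈ S, ‖y - x‖ ≤ r → ‖u y - u x - p (y - x)‖ ≤ C * ‖y - x‖ ^ s) : HasFDerivWithinAt u p S x := by
  rw [hasFDerivWithinAt_iff_isLittleO]
  have h1 : (fun y => u y - u x - p (y - x)) =O[𝓝[S] x] fun y : E => ‖y - x‖ ^ s := by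
    refine IsBigO.of_bound C ?_
    have : ∀ᶠ y in 𝓝[S] x, ‖y - x‖ ≤ r := by
      filter_upwards [mem_nhdsWithin_of_mem_nhds (Metric.closedBall_mem_nhds x hr)] with y hy
      rwa [Metric.mem_closedBall, dist_eq_norm] at hy
    filter_upwards [this, self_mem_nhdsWithin] with y hy hyS
    rw [Real.norm_eq_abs (_ ^ s), abs_of_nonneg (by positivity : (0:ℝ) ≤ ‖y - x‖ ^ s)]; exact h y hyS hy
  have h2 : (fun y : E => ‖y - x‖ ^ s) =o[𝓝 x] fun y : E => y - x := by
    have h3 : (fun y : E => ‖y - x‖ ^ s) =O[𝓝 x] fun y : E => ‖y - x‖ ^ (s - 1) * ‖y - x‖ := by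
      refine IsBigO.of_bound 1 (Eventually.of_forall fun y => ?_)
      rcases (norm_nonneg (y - x)).lt_or_eq with h0 | h0
      · rw [Real.rpow_sub_one h0.ne', div_mul_cancel₀ _ h0.ne', one_mul]
      · rw [← h0, Real.zero_rpow (by linarith)]; simp
    have h4 : Tendsto (fun y : E => ‖y - x‖ ^ (s - 1)) (𝓝 x) (𝓝 0) := by
      have : Continuous fun y : E => ‖y - x‖ ^ (s - 1) :=
        (continuous_id.sub continuous_const).norm.rpow_const fun _ => Or.inr (by linarith)
      have := this.tendsto x
      simpa [Real.zero_rpow (show s - 1 ≠ 0 by linarith)] using this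
    have h5 := ((isLittleO_one_iff ℝ).2 h4).mul_isBigO (isBigO_refl (fun y : E => ‖y - x‖) (𝓝 x))
    simp only [one_mul] at h5
    exact (h3.trans_isLittleO h5).of_norm_right
  exact h1.trans_isLittleO (h2.mono nhdsWithin_le_nhds)

lemma qd_symm {x : E} {c C : ℝ} {p : Du E} {A : Bi E} (hA : ‖A‖ ≤ C) :
    ∃ A' : Bi E, ‖A'‖ ≤ C ∧ (∀ a b, A' a b = A' b a) ∧ ∀ y, qd x c p A' y = qd x c p A y := by
  have hC : 0 ≤ C := (ContinuousLinearMap.opNorm_nonneg A).trans hA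
  refine ⟨(1 / 2 : ℝ) • (A + A.flip), bi_norm_le_of hC fun a b => ?_, fun a b => ?_, fun y => ?_⟩
  · simp only [ContinuousLinearMap.smul_apply, ContinuousLinearMap.add_apply, ContinuousLinearMap.flip_apply, smul_eq_mul]
    have h1 : |A a b| ≤ C * ‖a‖ * ‖b‖ := (A.le_opNorm₂ a b).trans (by gcongr)
    have h2 : |A b a| ≤ C * ‖b‖ * ‖a‖ := (A.le_opNorm₂ b a).trans (by gcongr)
    rw [abs_mul, abs_of_pos (by norm_num : (0:ℝ) < 1 / 2)]
    have := abs_add_le (A a b) (A b a)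
    linarith
  · simp; ring
  · simp [qd, -map_sub]; ring

lemma whit1 {S : Set E} {r₀ : ℝ} (hr : 0 < r₀) (hIB : IB S r₀) {u : E → ℝ} {α C : ℝ} (hα0 : 0 < α)
    (hC : 0 ≤ C) (h : ∀ x ∈ S, Gd u S 1 ((1:ℕ) + α) C x) :
    ∃ (p : E → Du E) (C' : ℝ), 0 ≤ C' ∧ (∀ x ∈ S, HasFDerivWithinAt u (p x) S x ∧ ‖p x‖ ≤ C) ∧
      ∀ x ∈ S, ∀ y ∈ S, ‖p x - p y‖ ≤ C' * ‖x - y‖ ^ α := by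
  choose! p A hA0 hp hA hexp using h
  push_cast at hexp
  refine ⟨p, 3000 * C * 3 ^ (1 + α) + 2 * C / r₀ ^ α, by positivity, fun x hx => ⟨?_, hp x hx⟩, fun x' hx' x hx => ?_⟩
  · refine hasFDerivWithinAt_of_rpow (s := 1 + α) (C := C) (by linarith) one_pos fun y hy _ => ?_
    have := hexp x hx y hy
    rw [hA0 x hx rfl] at this
    simp only [qd, ContinuousLinearMap.zero_apply, mul_zero, add_zero] at this
    rwa [sub_sub, Real.norm_eq_abs]
  · have c1 : 0 ≤ 2 * C / r₀ ^ α := by positivity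
    have c2 : 0 ≤ 3000 * C * (3:ℝ) ^ (1 + α) := by positivity
    rcases (norm_nonneg (x' - x)).lt_or_eq with h0 | h0
    swap
    · have : x' = x := by rw [← sub_eq_zero, ← norm_eq_zero]; exact h0.symm
      rw [this]; simp; positivity
    rcases le_total ‖x' - x‖ r₀ with ht | ht
    · have := (whit_core hIB (by linarith) hC hx h0 ht (by simp [hA0 x hx rfl]) (by simp [hA0 x' hx' rfl])
        (hexp x hx) (hexp x' hx')).2
      rw [hA0 x hx rfl, ContinuousLinearMap.zero_apply, sub_zero, add_sub_cancel_left] at this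
      refine this.trans ?_
      gcongr; linarith
    · refine (norm_sub_le _ _).trans ?_
      have : 2 * C / r₀ ^ α * r₀ ^ α ≤ 2 * C / r₀ ^ α * ‖x' - x‖ ^ α := by gcongr
      rw [div_mul_cancel₀ _ (by positivity)] at this
      have := hp x hx
      have := hp x' hx'
      have : 0 ≤ 3000 * C * 3 ^ (1 + α) * ‖x' - x‖ ^ α := by positivity
      linarith

lemma whit2 {S : Set E} {r₀ : ℝ} (hr : 0 < r₀) (hIB : IB S r₀) {u : E → ℝ} {α C : ℝ} (hα0 : 0 < α)
    (hC : 0 ≤ C) (h : ∀ x ∈ S, Gd u S 2 ((2:ℕ) + α) C x) :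
    ∃ (p : E → Du E) (A : E → Bi E) (C' : ℝ), 0 ≤ C' ∧ (∀ x ∈ S, HasFDerivWithinAt u (p x) S x) ∧
      (∀ x ∈ S, HasFDerivWithinAt p (A x) S x) ∧ ∀ x ∈ S, ∀ y ∈ S, ‖A x - A y‖ ≤ C' * ‖x - y‖ ^ α := by
  have h' : ∀ x ∈ S, ∃ (p : Du E) (A : Bi E), ‖p‖ ≤ C ∧ ‖A‖ ≤ C ∧ (∀ a b, A a b = A b a) ∧
      ∀ y ∈ S, |u y - qd x (u x) p A y| ≤ C * ‖y - x‖ ^ (2 + α) := by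
    intro x hx
    obtain ⟨p, A, -, hp, hA, hexp⟩ := h x hx
    obtain ⟨A', hA', hs, hq⟩ := qd_symm (x := x) (c := u x) (p := p) hA
    refine ⟨p, A', hp, hA', hs, fun y hy => ?_⟩
    rw [hq]; exact_mod_cast hexp y hy
  choose! p A hp hA hsy hexp using h'
  have c2 : 0 ≤ 3000 * C * (3:ℝ) ^ (2 + α) := by positivity
  refine ⟨p, A, 3000 * C * 3 ^ (2 + α) + 2 * C / r₀ ^ α, by positivity, fun x hx => ?_, fun x hx => ?_,
    fun x' hx' x hx => ?_⟩
  · refine hasFDerivWithinAt_of_rpow (s := 2) (C := 2 * C) (by norm_num) one_pos fun y hy hyx => ?_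
    have h1 := hexp x hx y hy
    have h2 : ‖y - x‖ ^ (2 + α) ≤ ‖y - x‖ ^ (2:ℝ) :=
      Real.rpow_le_rpow_of_exponent_ge_of_imp (norm_nonneg _) hyx (by linarith) (fun _ h => by linarith)
    have h3 : |A x (y - x) (y - x)| ≤ C * ‖y - x‖ ^ 2 :=
      ((A x).le_opNorm₂ _ _).trans (by rw [mul_assoc, ← pow_two]; have := hA x hx; gcongr)
    rw [show (2:ℝ) = ((2:ℕ):ℝ) by norm_num, Real.rpow_natCast] at h2 ⊢
    push_cast at h2 ⊢
    have h4 : C * ‖y - x‖ ^ (2 + α) ≤ C * ‖y - x‖ ^ 2 := by gcongr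
    have h1 := abs_le.1 (h1.trans h4)
    have h3 := abs_le.1 h3
    simp only [qd] at h1
    have h5 : 0 ≤ C * ‖y - x‖ ^ 2 := by positivity
    rw [Real.norm_eq_abs, abs_le]; constructor <;> linarith
  · refine hasFDerivWithinAt_of_rpow (s := 1 + α) (C := 3000 * C * 3 ^ (2 + α)) (by linarith) hr fun y hy hyx => ?_
    rcases (norm_nonneg (y - x)).lt_or_eq with h0 | h0
    swap
    · have : y = x := by rw [← sub_eq_zero, ← norm_eq_zero]; exact h0.symm
      rw [this]; simp; positivity
    have := (whit_core hIB (by linarith) hC hx h0 hyx (hsy x hx) (hsy y hy) (hexp x hx) (hexp y hy)).2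
    rwa [show 2 + α - 1 = 1 + α by ring] at this
  · have c1 : 0 ≤ 2 * C / r₀ ^ α := by positivity
    rcases (norm_nonneg (x' - x)).lt_or_eq with h0 | h0
    swap
    · have : x' = x := by rw [← sub_eq_zero, ← norm_eq_zero]; exact h0.symm
      rw [this]
      have : A x - A x = 0 := by ext; simp
      rw [this, bi_norm_zero]; positivity
    rcases le_total ‖x' - x‖ r₀ with ht | ht
    · have := (whit_core hIB (by linarith) hC hx h0 ht (hsy x hx) (hsy x' hx') (hexp x hx) (hexp x' hx')).1
      rw [add_sub_cancel_left] at this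
      refine this.trans ?_
      gcongr; linarith
    · refine (bi_norm_sub _ _).trans ?_
      have : 2 * C / r₀ ^ α * r₀ ^ α ≤ 2 * C / r₀ ^ α * ‖x' - x‖ ^ α := by gcongr
      rw [div_mul_cancel₀ _ (by positivity)] at this
      have := hA x hx
      have := hA x' hx'
      have : 0 ≤ 3000 * C * 3 ^ (2 + α) * ‖x' - x‖ ^ α := by positivity
      linarith

end whit

section holder
variable {N : ℕ}

lemma c2h_of {α : NNReal} {Ω : Set (EuclideanSpace ℝ (Fin N))} (hU : UniqueDiffOn ℝ (closure Ω)) (hα : 0 < α)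
    {u : EuclideanSpace ℝ (Fin N) → ℝ} {p : EuclideanSpace ℝ (Fin N) → Du (EuclideanSpace ℝ (Fin N))}
    {A : EuclideanSpace ℝ (Fin N) → Bi (EuclideanSpace ℝ (Fin N))} {C : ℝ} (hC : 0 ≤ C)
    (hp : ∀ x ∈ closure Ω, HasFDerivWithinAt u (p x) (closure Ω) x)
    (hA : ∀ x ∈ closure Ω, HasFDerivWithinAt p (A x) (closure Ω) x)
    (hh : ∀ x ∈ closure Ω, ∀ y ∈ closure Ω, ‖A x - A y‖ ≤ C * ‖x - y‖ ^ (α:ℝ)) : C2HolderOnClosure α u Ω := by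
  have e1 : EqOn (fderivWithin ℝ u (closure Ω)) p (closure Ω) := fun x hx => (hp x hx).fderivWithin (hU x hx)
  have e2 : EqOn (fderivWithin ℝ p (closure Ω)) A (closure Ω) := fun x hx => (hA x hx).fderivWithin (hU x hx)
  have e3 : EqOn (fderivWithin ℝ (fderivWithin ℝ u (closure Ω)) (closure Ω)) A (closure Ω) := fun x hx => by
    rw [fderivWithin_congr e1 (e1 hx)]; exact e2 hx
  have hAh : HolderOnWith C.toNNReal α A (closure Ω) := by
    intro x hx y hy
    rw [edist_dist, edist_dist, ENNReal.ofReal_rpow_of_nonneg dist_nonneg α.coe_nonneg, ← ENNReal.ofReal_coe_nnreal,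
      Real.coe_toNNReal _ hC, ← ENNReal.ofReal_mul hC]
    refine ENNReal.ofReal_le_ofReal ?_
    rw [dist_eq_norm, dist_eq_norm]; exact hh x hx y hy
  refine ⟨?_, C.toNNReal, ?_⟩
  · have hAc : ContinuousOn A (closure Ω) := hAh.continuousOn hα
    rw [show (2 : WithTop ℕ∞) = 1 + 1 by norm_num]
    refine contDiffOn_succ_of_fderivWithin (fun x hx => (hp x hx).differentiableWithinAt) (by simp) ?_
    refine ContDiffOn.congr ?_ e1
    rw [show (1 : WithTop ℕ∞) = 0 + 1 by norm_num]
    refine contDiffOn_succ_of_fderivWithin (fun x hx => (hA x hx).differentiableWithinAt) (by simp) ?_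
    exact (contDiffOn_zero.2 hAc).congr e2
  · intro x hx y hy
    refine le_trans ?_ (hAh x hx y hy)
    rw [edist_dist, edist_dist]
    refine ENNReal.ofReal_le_ofReal ?_
    rw [dist_eq_norm, dist_eq_norm]
    refine ContinuousMultilinearMap.opNorm_le_bound (ContinuousLinearMap.opNorm_nonneg _) fun m => ?_
    rw [ContinuousMultilinearMap.sub_apply, iteratedFDerivWithin_two_apply _ hU hx, iteratedFDerivWithin_two_apply _ hU hy,
      e3 hx, e3 hy, Fin.prod_univ_two, ← mul_assoc]
    exact (A x - A y).le_opNorm₂ (m 0) (m 1)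

lemma of_c2h {α : NNReal} {Ω : Set (EuclideanSpace ℝ (Fin N))} (hU : UniqueDiffOn ℝ (closure Ω)) (hΩ : IsOpen Ω)
    (hΩb : Bornology.IsBounded Ω) {u : EuclideanSpace ℝ (Fin N) → ℝ} (h : C2HolderOnClosure α u Ω) :
    ∃ (p : EuclideanSpace ℝ (Fin N) → Du (EuclideanSpace ℝ (Fin N)))
      (A : EuclideanSpace ℝ (Fin N) → Bi (EuclideanSpace ℝ (Fin N))) (C M : ℝ), 0 ≤ C ∧
      (∀ x ∈ closure Ω, HasFDerivWithinAt u (p x) (closure Ω) x) ∧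
      (∀ x ∈ closure Ω, HasFDerivWithinAt p (A x) (closure Ω) x) ∧
      (∀ x ∈ closure Ω, ∀ y ∈ closure Ω, ‖A x - A y‖ ≤ C * ‖x - y‖ ^ (α:ℝ)) ∧
      (∀ x ∈ closure Ω, |u x| ≤ M ∧ ‖p x‖ ≤ M ∧ ‖A x‖ ≤ M) ∧
      ∀ x ∈ Ω, Jet u x (p x) (A x) ∧ p x = fderiv ℝ u x ∧ bt (A x) = lap u x := by
  obtain ⟨hc, C, hC⟩ := h
  set S := closure Ω with hS
  have hSc : IsCompact S := hΩb.isCompact_closure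
  have h1 : ContDiffOn ℝ 1 (fderivWithin ℝ u S) S := hc.fderivWithin hU (by norm_num)
  obtain ⟨M₀, hM₀⟩ := hSc.exists_bound_of_continuousOn hc.continuousOn
  obtain ⟨M₁, hM₁⟩ := hSc.exists_bound_of_continuousOn h1.continuousOn
  obtain ⟨M₂, hM₂'⟩ := hSc.exists_bound_of_continuousOn (hc.continuousOn_iteratedFDerivWithin (m := 2) (by norm_num) hU)
  have hM₂ : ∀ x ∈ S, ‖fderivWithin ℝ (fderivWithin ℝ u S) S x‖ ≤ M₂ := fun x hx => by
    have h0 := (norm_nonneg _).trans (hM₂' x hx)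
    refine bi_norm_le_of h0 fun a b => ?_
    have := (iteratedFDerivWithin ℝ 2 u S x).le_opNorm ![a, b]
    rw [iteratedFDerivWithin_two_apply _ hU hx, Fin.prod_univ_two] at this
    simp only [Matrix.cons_val_zero, Matrix.cons_val_one] at this
    rw [mul_assoc]
    exact this.trans (by gcongr; exact hM₂' x hx)
  refine ⟨fderivWithin ℝ u S, fderivWithin ℝ (fderivWithin ℝ u S) S, C, max M₀ (max M₁ M₂), C.coe_nonneg, fun x hx => ?_,
    fun x hx => ?_, fun x hx y hy => ?_, fun x hx => ⟨?_, ?_, ?_⟩, fun x hx => ?_⟩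
  · exact (hc.differentiableOn (by norm_num) x hx).hasFDerivWithinAt
  · exact (h1.differentiableOn (by norm_num) x hx).hasFDerivWithinAt
  · have hd := hC x hx y hy
    rw [edist_dist, edist_dist, ENNReal.ofReal_rpow_of_nonneg dist_nonneg α.coe_nonneg, ← ENNReal.ofReal_coe_nnreal,
      ← ENNReal.ofReal_mul C.coe_nonneg, ENNReal.ofReal_le_ofReal_iff (by positivity), dist_eq_norm, dist_eq_norm] at hd
    refine bi_norm_le_of (by positivity) fun a b => ?_
    have := (iteratedFDerivWithin ℝ 2 u S x - iteratedFDerivWithin ℝ 2 u S y).le_opNorm ![a, b]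
    rw [ContinuousMultilinearMap.sub_apply, iteratedFDerivWithin_two_apply _ hU hx, iteratedFDerivWithin_two_apply _ hU hy,
      Fin.prod_univ_two] at this
    simp only [Matrix.cons_val_zero, Matrix.cons_val_one] at this
    rw [ContinuousLinearMap.sub_apply, ContinuousLinearMap.sub_apply, mul_assoc]
    exact this.trans (by gcongr)
  · exact (hM₀ x hx).trans (le_max_left _ _)
  · exact (hM₁ x hx).trans ((le_max_left _ _).trans (le_max_right _ _))
  · exact (hM₂ x hx).trans ((le_max_right _ _).trans (le_max_right _ _))
  · have hev : ∀ y ∈ Ω, fderivWithin ℝ u S y = fderiv ℝ u y := fun y hy =>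
      fderivWithin_of_mem_nhds (mem_of_superset (hΩ.mem_nhds hy) subset_closure)
    have hca : ContDiffAt ℝ 2 u x := hc.contDiffAt (mem_of_superset (hΩ.mem_nhds hx) subset_closure)
    have e2 : fderivWithin ℝ (fderivWithin ℝ u S) S x = fderiv ℝ (fderiv ℝ u) x := by
      rw [fderivWithin_of_mem_nhds (mem_of_superset (hΩ.mem_nhds hx) subset_closure)]
      refine Filter.EventuallyEq.fderiv_eq ?_
      filter_upwards [hΩ.mem_nhds hx] with y hy using hev y hy
    rw [e2, hev x hx]
    exact ⟨jet_of_contDiffAt hca, rfl, (lap_eq hca).symm⟩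

end holder

/-! ## Part 19: smooth boundaries -/
section bdr
variable {E : Type*} [NormedAddCommGroup E] [InnerProductSpace ℝ E] [FiniteDimensional ℝ E]

lemma ip_symm (p : Du E) : ip ((InnerProductSpace.toDual ℝ E).symm p) = p := by
  ext v
  rw [ip_apply, ← InnerProductSpace.toDual_apply_apply, LinearIsometryEquiv.apply_symm_apply]

lemma cw_of {w : E → ℝ} (hw : ContDiff ℝ 2 w) {U : Set E} (hU : Convex ℝ U) {C α : ℝ} (hα : 0 < α) (hC : 0 ≤ C)
    (hn : ∀ y ∈ U, ‖fderiv ℝ w y‖ ≤ C) (hA : ∀ y ∈ U, ‖fderiv ℝ (fderiv ℝ w) y‖ ≤ C)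
    (hh : ∀ y ∈ U, ∀ y' ∈ U, ‖fderiv ℝ (fderiv ℝ w) y' - fderiv ℝ (fderiv ℝ w) y‖ ≤ C * ‖y' - y‖ ^ α) :
    CW w (fun y => (InnerProductSpace.toDual ℝ E).symm (fderiv ℝ w y)) (fderiv ℝ (fderiv ℝ w)) U C α := by
  have hw1 : ContDiff ℝ 1 (fderiv ℝ w) := hw.fderiv_right (by norm_num)
  have d1 : ∀ y, HasFDerivAt w (fderiv ℝ w y) y := fun y => (hw.differentiable (by norm_num) y).hasFDerivAt
  have d2 : ∀ y, HasFDerivAt (fderiv ℝ w) (fderiv ℝ (fderiv ℝ w) y) y := fun y =>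
    (hw1.differentiable (by norm_num) y).hasFDerivAt
  have hseg : ∀ y ∈ U, ∀ y' ∈ U, ∀ x ∈ segment ℝ y y', x ∈ U ∧ ‖x - y‖ ≤ ‖y' - y‖ := fun y hy y' hy' x hx => by
    refine ⟨hU.segment_subset hy hy' hx, ?_⟩
    have := norm_sub_le_of_mem_segment hx
    exact this
  have m1 : ∀ y ∈ U, ∀ y' ∈ U, ‖fderiv ℝ w y' - fderiv ℝ w y‖ ≤ C * ‖y' - y‖ := fun y hy y' hy' =>
    hU.norm_image_sub_le_of_norm_hasFDerivWithin_le (fun x hx => (d2 x).hasFDerivWithinAt) hA hy hy'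
  have m2 : ∀ y ∈ U, ∀ y' ∈ U, ‖fderiv ℝ w y' - fderiv ℝ w y - fderiv ℝ (fderiv ℝ w) y (y' - y)‖
      ≤ C * ‖y' - y‖ ^ α * ‖y' - y‖ := fun y hy y' hy' =>
    (convex_segment y y').norm_image_sub_le_of_norm_hasFDerivWithin_le' (fun x hx => (d2 x).hasFDerivWithinAt)
      (fun x hx => by
        have h := hseg y hy y' hy' x hx
        refine (hh y hy x h.1).trans ?_
        gcongr; exact h.2) (left_mem_segment ℝ y y') (right_mem_segment ℝ y y')
  refine ⟨fun y hy => ?_, fun y hy => ?_, hA, fun y hy y' hy' => ?_, hh, fun y hy y' hy' => ?_, fun y hy y' hy' => ?_⟩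
  · rw [ip_symm]; exact jet_of_contDiffAt hw.contDiffAt
  · rw [LinearIsometryEquiv.norm_map]; exact hn y hy
  · rw [← map_sub, LinearIsometryEquiv.norm_map]; exact m1 y hy y' hy'
  · rw [← ip_apply, ip_symm]
    have := (convex_segment y y').norm_image_sub_le_of_norm_hasFDerivWithin_le' (φ := fderiv ℝ w y)
      (C := C * ‖y' - y‖) (fun x hx => (d1 x).hasFDerivWithinAt)
      (fun x hx => by
        have h := hseg y hy y' hy' x hx
        refine (m1 y hy x h.1).trans ?_
        gcongr; exact h.2) (left_mem_segment ℝ y y') (right_mem_segment ℝ y y')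
    rw [Real.norm_eq_abs] at this
    rw [pow_two, ← mul_assoc]; exact this
  · rw [ip_symm]
    set A := fderiv ℝ (fderiv ℝ w) y with hAd
    have hs : ∀ a b, A a b = A b a := fun a b => (hw.contDiffAt.isSymmSndFDerivAt (by simp)).eq a b
    have d3 : ∀ x, HasFDerivAt (fun x => w x - 1 / 2 * A (x - y) (x - y)) (fderiv ℝ w x - A (x - y)) x := fun x => by
      have h1 : HasFDerivAt (fun x => x - y) (ContinuousLinearMap.id ℝ E) x := (hasFDerivAt_id x).sub_const y
      have h2 := (A.hasFDerivAt.comp x h1).clm_apply h1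
      refine ((d1 x).sub (h2.const_mul (1 / 2))).congr_fderiv ?_
      ext v
      simp only [ContinuousLinearMap.sub_apply, ContinuousLinearMap.smul_apply, ContinuousLinearMap.add_apply,
        ContinuousLinearMap.comp_apply, ContinuousLinearMap.id_apply, ContinuousLinearMap.flip_apply, Function.comp, smul_eq_mul]
      rw [hs v (x - y)]; ring
    have := (convex_segment y y').norm_image_sub_le_of_norm_hasFDerivWithin_le' (φ := fderiv ℝ w y)
      (C := C * ‖y' - y‖ ^ α * ‖y' - y‖) (fun x hx => (d3 x).hasFDerivWithinAt)
      (fun x hx => by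
        have h := hseg y hy y' hy' x hx
        rw [sub_right_comm]
        refine (m2 y hy x h.1).trans ?_
        gcongr; exact h.2; exact h.2) (left_mem_segment ℝ y y') (right_mem_segment ℝ y y')
    rw [Real.norm_eq_abs] at this
    refine (le_of_eq (congrArg _ ?_)).trans (this.trans (le_of_eq ?_))
    · simp only [qd, sub_self, map_zero, ContinuousLinearMap.zero_apply]; ring
    · rcases eq_or_ne (‖y' - y‖) 0 with h0 | h0
      · rw [h0, Real.zero_rpow (x := 2 + α) (by positivity)]; simp
      · rw [Real.rpow_add (by positivity), Real.rpow_two]; ring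

lemma cw_graph {F : Type*} [NormedAddCommGroup F] [InnerProductSpace ℝ F] [FiniteDimensional ℝ F] {ψ : F → ℝ}
    (hψ : ContDiff ℝ 2 ψ) {α : NNReal} (hα : 0 < α)
    (hH : ∀ K : Set F, IsCompact K → ∃ C : NNReal, HolderOnWith C α (iteratedFDeriv ℝ 2 ψ) K)
    {l : E →L[ℝ] F} (hl : ∀ v, ‖l v‖ ≤ ‖v‖) (m : Du E) (a : F) (b : ℝ) (z : E) (r : ℝ) :
    ∃ Λ, 1 ≤ Λ ∧ CW (fun y => (b + m y) - ψ (a + l y))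
      (fun y => (InnerProductSpace.toDual ℝ E).symm (fderiv ℝ (fun y => (b + m y) - ψ (a + l y)) y))
      (fderiv ℝ (fderiv ℝ (fun y => (b + m y) - ψ (a + l y)))) (Metric.closedBall z r) Λ α := by
  set w : E → ℝ := fun y => (b + m y) - ψ (a + l y) with hwd
  have hw : ContDiff ℝ 2 w := by
    have h1 : ContDiff ℝ 2 fun y => a + l y := contDiff_const.add l.contDiff
    have h2 : ContDiff ℝ 2 fun y => b + m y := contDiff_const.add m.contDiff
    exact h2.sub (hψ.comp h1)
  obtain hr | hr := lt_or_ge r 0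
  · refine ⟨1, le_rfl, ?_⟩
    have : Metric.closedBall z r = ∅ := Metric.closedBall_eq_empty.2 hr
    rw [this]
    constructor <;> simp
  have hψ1 : ContDiff ℝ 1 (fderiv ℝ ψ) := hψ.fderiv_right (by norm_num)
  have hl1 : ∀ y, HasFDerivAt (fun y => a + l y) l y := fun y => l.hasFDerivAt.const_add a
  have e1 : ∀ y, fderiv ℝ w y = m - (fderiv ℝ ψ (a + l y)).comp l := fun y => by
    have := (m.hasFDerivAt (x := y)).const_add b
    exact (this.sub (((hψ.differentiable (by norm_num) _).hasFDerivAt).comp y (hl1 y))).fderiv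
  have e2 : ∀ y u v, fderiv ℝ (fderiv ℝ w) y u v = - fderiv ℝ (fderiv ℝ ψ) (a + l y) (l u) (l v) := fun y u v => by
    have h2 := ((hψ1.differentiable (by norm_num) (a + l y)).hasFDerivAt).comp y (hl1 y)
    have h3 := ((h2.clm_comp (hasFDerivAt_const l y)).const_sub m)
    have : fderiv ℝ w = fun y => m - (fderiv ℝ ψ (a + l y)).comp l := funext e1
    rw [this]
    have h4 := h3.fderiv
    simp only [Function.comp_def] at h4
    rw [h4]
    simp
  obtain ⟨C, hC⟩ := hH _ (((isCompact_closedBall z r)).image (f := fun y => a + l y) (by fun_prop))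
  have hCh : ∀ y ∈ Metric.closedBall z r, ∀ y' ∈ Metric.closedBall z r,
      ‖fderiv ℝ (fderiv ℝ w) y' - fderiv ℝ (fderiv ℝ w) y‖ ≤ C * ‖y' - y‖ ^ (α:ℝ) := fun y hy y' hy' => by
    have hd := hC _ (mem_image_of_mem _ hy') _ (mem_image_of_mem _ hy)
    rw [edist_dist, edist_dist, ENNReal.ofReal_rpow_of_nonneg dist_nonneg α.coe_nonneg, ← ENNReal.ofReal_coe_nnreal,
      ← ENNReal.ofReal_mul C.coe_nonneg, ENNReal.ofReal_le_ofReal_iff (by positivity), dist_eq_norm, dist_eq_norm,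
      add_sub_add_left_eq_sub, ← map_sub] at hd
    refine bi_norm_le_of (by positivity) fun u v => ?_
    have := (iteratedFDeriv ℝ 2 ψ (a + l y') - iteratedFDeriv ℝ 2 ψ (a + l y)).le_opNorm ![l u, l v]
    rw [ContinuousMultilinearMap.sub_apply, iteratedFDeriv_two_apply, iteratedFDeriv_two_apply,
      Fin.prod_univ_two] at this
    simp only [Matrix.cons_val_zero, Matrix.cons_val_one] at this
    rw [ContinuousLinearMap.sub_apply, ContinuousLinearMap.sub_apply, e2, e2, mul_assoc, ← neg_sub', abs_neg]
    refine this.trans ?_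
    have := hl (y' - y)
    refine mul_le_mul (hd.trans ?_) (mul_le_mul (hl u) (hl v) (norm_nonneg _) (norm_nonneg _)) (by positivity) (by positivity)
    gcongr
  set B := ‖fderiv ℝ (fderiv ℝ w) z‖ + C * r ^ (α:ℝ) with hB
  have hB0 : 0 ≤ B := add_nonneg (ContinuousLinearMap.opNorm_nonneg _) (by positivity)
  have hz : z ∈ Metric.closedBall z r := Metric.mem_closedBall_self hr
  have hnr : ∀ y ∈ Metric.closedBall z r, ‖y - z‖ ≤ r := fun y hy => by rwa [Metric.mem_closedBall, dist_eq_norm] at hy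
  have hA : ∀ y ∈ Metric.closedBall z r, ‖fderiv ℝ (fderiv ℝ w) y‖ ≤ B := fun y hy => by
    have h1 := hCh z hz y hy
    have h2 := bi_norm_le (fderiv ℝ (fderiv ℝ w) y) (fderiv ℝ (fderiv ℝ w) z)
    have h3 := hnr y hy
    have : C * ‖y - z‖ ^ (α:ℝ) ≤ C * r ^ (α:ℝ) := by gcongr
    linarith
  have hw1 : ContDiff ℝ 1 (fderiv ℝ w) := hw.fderiv_right (by norm_num)
  have hn : ∀ y ∈ Metric.closedBall z r, ‖fderiv ℝ w y‖ ≤ ‖fderiv ℝ w z‖ + B * r := fun y hy => by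
    have h1 := (convex_closedBall z r).norm_image_sub_le_of_norm_hasFDerivWithin_le
      (fun x hx => ((hw1.differentiable (by norm_num) x).hasFDerivAt).hasFDerivWithinAt) hA hz hy
    have h2 := norm_le_insert (fderiv ℝ w z) (fderiv ℝ w y)
    have h3 := hnr y hy
    have : B * ‖y - z‖ ≤ B * r := by gcongr
    have := norm_le_norm_sub_add (fderiv ℝ w y) (fderiv ℝ w z)
    linarith
  have hBr : 0 ≤ B * r := by positivity
  have hp := norm_nonneg (fderiv ℝ w z)
  have hC0 := C.coe_nonneg
  refine ⟨1 + B + (‖fderiv ℝ w z‖ + B * r) + C, by linarith,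
    cw_of hw (convex_closedBall z r) (by exact_mod_cast hα) (by linarith) (fun y hy => (hn y hy).trans (by linarith))
    (fun y hy => (hA y hy).trans (by linarith)) fun y hy y' hy' => (hCh y hy y' hy').trans ?_⟩
  gcongr
  linarith

lemma CW.monoΛ {w : E → ℝ} {n : E → E} {A : E → Bi E} {U : Set E} {Λ Λ' α : ℝ} (h : CW w n A U Λ α) (hL : Λ ≤ Λ') :
    CW w n A U Λ' α where
  j := h.j
  n0 y hy := (h.n0 y hy).trans hL
  A0 y hy := (h.A0 y hy).trans hL
  n1 y hy y' hy' := (h.n1 y hy y' hy').trans (by gcongr)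
  A1 y hy y' hy' := (h.A1 y hy y' hy').trans (by gcongr)
  w1 y hy y' hy' := (h.w1 y hy y' hy').trans (by gcongr)
  w2 y hy y' hy' := (h.w2 y hy y' hy').trans (by gcongr)

lemma bd_of {N : ℕ} {α : NNReal} (hα : 0 < α) {Ω : Set (EuclideanSpace ℝ (Fin N))} (hΩ : IsOpen Ω)
    (hΩb : Bornology.IsBounded Ω) (h : IsC2HolderBoundary α Ω) : ∃ Λ ρ, 1 ≤ Λ ∧ 0 < ρ ∧ BD Ω Λ ρ α := by
  have hK : IsCompact (frontier Ω) := hΩb.isCompact_closure.of_isClosed_subset isClosed_frontier frontier_subset_closure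
  suffices H : ∃ Λ ρ : ℝ, 1 ≤ Λ ∧ 0 < ρ ∧ ∀ z ∈ frontier Ω, z ∈ frontier Ω → ∃ (w : EuclideanSpace ℝ (Fin N) → ℝ)
      (n : EuclideanSpace ℝ (Fin N) → EuclideanSpace ℝ (Fin N)) (A : EuclideanSpace ℝ (Fin N) → Bi (EuclideanSpace ℝ (Fin N))),
      CW w n A (Metric.closedBall z ρ) Λ α ∧ w z = 0 ∧ 1 ≤ ‖n z‖ ∧ ∀ y, ‖y - z‖ ≤ ρ → (y ∈ Ω ↔ 0 < w y) by
    obtain ⟨Λ, ρ, h1, h2, h3⟩ := H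
    exact ⟨Λ, ρ, h1, h2, fun z hz => h3 z hz hz⟩
  refine hK.induction_on (p := fun s => ∃ Λ ρ : ℝ, 1 ≤ Λ ∧ 0 < ρ ∧ ∀ z ∈ s, z ∈ frontier Ω →
      ∃ (w : EuclideanSpace ℝ (Fin N) → ℝ)
      (n : EuclideanSpace ℝ (Fin N) → EuclideanSpace ℝ (Fin N)) (A : EuclideanSpace ℝ (Fin N) → Bi (EuclideanSpace ℝ (Fin N))),
      CW w n A (Metric.closedBall z ρ) Λ α ∧ w z = 0 ∧ 1 ≤ ‖n z‖ ∧ ∀ y, ‖y - z‖ ≤ ρ → (y ∈ Ω ↔ 0 < w y)) ?_ ?_ ?_ ?_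
  · exact ⟨1, 1, le_rfl, one_pos, by simp⟩
  · rintro s t hst ⟨Λ, ρ, h1, h2, h3⟩
    exact ⟨Λ, ρ, h1, h2, fun z hz => h3 z (hst hz)⟩
  · rintro s t ⟨Λ, ρ, h1, h2, h3⟩ ⟨Λ', ρ', h1', h2', h3'⟩
    refine ⟨max Λ Λ', min ρ ρ', h1.trans (le_max_left _ _), lt_min h2 h2', fun z hz hzf => ?_⟩
    rcases hz with hz | hz
    · obtain ⟨w, n, A, hcw, a, b, c⟩ := h3 z hz hzf
      exact ⟨w, n, A, (hcw.mono (Metric.closedBall_subset_closedBall (min_le_left _ _))).monoΛ (le_max_left _ _), a, b,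
        fun y hy => c y (hy.trans (min_le_left _ _))⟩
    · obtain ⟨w, n, A, hcw, a, b, c⟩ := h3' z hz hzf
      exact ⟨w, n, A, (hcw.mono (Metric.closedBall_subset_closedBall (min_le_right _ _))).monoΛ (le_max_right _ _), a, b,
        fun y hy => c y (hy.trans (min_le_right _ _))⟩
  · intro z₀ hz₀
    obtain ⟨U, hUo, hzU, T, ψ, hψ, hH, hU⟩ := h z₀ hz₀
    obtain ⟨r, hr, hrU⟩ := Metric.isOpen_iff.1 hUo z₀ hzU
    set L := T.linearIsometryEquiv with hL
    have hT : ∀ y, T y = T 0 + L y := fun y => by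
      have := T.map_vadd 0 y
      rw [vadd_eq_add, add_zero, vadd_eq_add, add_comm] at this
      exact this
    set Lc : EuclideanSpace ℝ (Fin N) →L[ℝ] WithLp 2 (EuclideanSpace ℝ (Fin (N - 1)) × ℝ) := L.toLinearIsometry.toContinuousLinearMap
    set l := (WithLp.fstL 2 ℝ (EuclideanSpace ℝ (Fin (N - 1))) ℝ).comp Lc with hl
    set m := (WithLp.sndL 2 ℝ (EuclideanSpace ℝ (Fin (N - 1))) ℝ).comp Lc with hm
    have hT1 : ∀ y, (WithLp.equiv 2 _ (T y)).1 = (WithLp.equiv 2 _ (T 0)).1 + l y := fun y => by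
      rw [hT y]; rfl
    have hT2 : ∀ y, (WithLp.equiv 2 _ (T y)).2 = (WithLp.equiv 2 _ (T 0)).2 + m y := fun y => by
      rw [hT y]; rfl
    set a := (WithLp.equiv 2 _ (T 0)).1
    set b := (WithLp.equiv 2 _ (T 0)).2
    have hln : ∀ v, ‖l v‖ ≤ ‖v‖ := fun v => by
      refine (WithLp.norm_fst_le (x := L v)).trans ?_
      rw [L.norm_map]
    obtain ⟨Λ, hΛ1, hcw⟩ := cw_graph hψ hα hH hln m a b z₀ r
    set w : EuclideanSpace ℝ (Fin N) → ℝ := fun y => (b + m y) - ψ (a + l y) with hw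
    have hwU : ∀ y ∈ U, (y ∈ Ω ↔ 0 < w y) := fun y hy => by
      have := Set.ext_iff.1 hU y
      simp only [mem_inter_iff, hy, and_true, mem_setOf_eq, hT1, hT2] at this
      rw [this, hw, sub_pos]
    have hwc : ContDiff ℝ 2 w := by
      have h1 : ContDiff ℝ 2 fun y => a + l y := contDiff_const.add l.contDiff
      have h2 : ContDiff ℝ 2 fun y => b + m y := contDiff_const.add m.contDiff
      exact h2.sub (hψ.comp h1)
    set e : EuclideanSpace ℝ (Fin N) := L.symm (WithLp.toLp 2 (0, 1)) with he
    have hLe : L e = WithLp.toLp 2 (0, 1) := L.apply_symm_apply _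
    have hle : l e = 0 := by
      change (L e).fst = 0
      rw [hLe]; rfl
    have hme : m e = 1 := by
      change (L e).snd = 1
      rw [hLe]; rfl
    have hen : ‖e‖ = 1 := by
      rw [he, L.symm.norm_map, WithLp.prod_norm_eq_of_L2]; simp
    have hde : ∀ y, fderiv ℝ w y e = 1 := fun y => by
      have hd := (hwc.differentiable (by norm_num) y).hasFDerivAt
      have h1 : HasDerivAt (fun t : ℝ => y + t • e) e 0 := by
        simpa using ((hasDerivAt_id (0:ℝ)).smul_const e).const_add y
      have h2 : HasDerivAt (fun t : ℝ => w (y + t • e)) (fderiv ℝ w y e) 0 := by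
        have h0 : HasFDerivAt w (fderiv ℝ w y) (y + (0:ℝ) • e) := by simpa using hd
        exact h0.comp_hasDerivAt (0:ℝ) h1
      have h3 : (fun t : ℝ => w (y + t • e)) = fun t => w y + t := by
        funext t
        simp only [hw, map_add, map_smul, hle, hme, smul_zero, add_zero, smul_eq_mul, mul_one]; ring
      rw [h3] at h2
      exact h2.unique ((hasDerivAt_id (0:ℝ)).const_add (w y))
    refine ⟨Metric.ball z₀ (r / 2), mem_nhdsWithin_of_mem_nhds (Metric.ball_mem_nhds _ (by linarith)), Λ, r / 4, hΛ1,
      by linarith, fun z hz hzf => ?_⟩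
    have hzn : ‖z - z₀‖ < r / 2 := by rwa [Metric.mem_ball, dist_eq_norm] at hz
    have hyb : ∀ y, ‖y - z‖ ≤ r / 4 → ‖y - z₀‖ < r := fun y hy => by
      have := norm_sub_le_norm_sub_add_norm_sub y z z₀
      linarith
    have hzz : z ∈ U := hrU (by rw [Metric.mem_ball, dist_eq_norm]; linarith)
    refine ⟨w, _, _, hcw.mono fun y hy => ?_, ?_, ?_, fun y hy => hwU y (hrU ?_)⟩
    · rw [Metric.mem_closedBall, dist_eq_norm] at hy ⊢
      exact (hyb y hy).le
    · refine le_antisymm ?_ ?_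
      · by_contra! hlt
        exact (hΩ.frontier_eq ▸ hzf).2 ((hwU z hzz).2 hlt)
      · by_contra! hlt
        have h1 : ∀ᶠ y in 𝓝 z, w y < 0 := hwc.continuous.continuousAt.eventually (gt_mem_nhds hlt)
        have h2 := mem_closure_iff_frequently.1 (frontier_subset_closure hzf)
        obtain ⟨y, hy, h3, h4⟩ := (h2.and_eventually (h1.and (hUo.mem_nhds hzz))).exists
        exact absurd ((hwU y h4).1 hy) (not_lt.2 h3.le)
    · rw [LinearIsometryEquiv.norm_map]
      have := (fderiv ℝ w z).le_opNorm e
      rw [hde, hen] at this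
      simpa using this
    · rw [Metric.mem_ball, dist_eq_norm]; exact hyb y hy

end bdr

/-! ## Part 20: regularity of the Dirichlet problem, algebra of `C^{2,α}` functions -/
section dir

lemma lip_hol {E : Type*} [NormedAddCommGroup E] {S : Set E} (hS : Bornology.IsBounded S) {α : ℝ} (hα0 : 0 < α)
    (hα1 : α < 1) : ∃ D : ℝ, 0 ≤ D ∧ ∀ x ∈ S, ∀ y ∈ S, ‖x - y‖ ≤ D * ‖x - y‖ ^ α := by
  refine ⟨Metric.diam S ^ (1 - α), by positivity, fun x hx y hy => ?_⟩
  have h1 : ‖x - y‖ ≤ Metric.diam S := by rw [← dist_eq_norm]; exact Metric.dist_le_diam_of_mem hS hx hy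
  rcases (norm_nonneg (x - y)).eq_or_lt with h0 | h0
  · rw [← h0, Real.zero_rpow hα0.ne', mul_zero]
  · calc ‖x - y‖ = ‖x - y‖ ^ (1 - α) * ‖x - y‖ ^ α := by rw [← Real.rpow_add h0]; simp
      _ ≤ _ := by
        have : 0 ≤ 1 - α := by linarith
        gcongr

variable {N : ℕ}

lemma dirichlet (hN : 1 ≤ dm (EuclideanSpace ℝ (Fin N))) {α : NNReal} {Ω : Set (EuclideanSpace ℝ (Fin N))} (hΩ : IsOpen Ω)
    (hΩb : Bornology.IsBounded Ω) {Λ ρ : ℝ} (hΛ : 1 ≤ Λ) (hρ : 0 < ρ) (hBD : BD Ω Λ ρ α)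
    {F : EuclideanSpace ℝ (Fin N) → ℝ → Du (EuclideanSpace ℝ (Fin N)) → ℝ} {L K H : ℝ} (hF : Nice F (closure Ω) L K H α)
    {u : EuclideanSpace ℝ (Fin N) → ℝ} (huc : ContinuousOn u (closure Ω)) (hu0 : ∀ x ∈ frontier Ω, u x = 0)
    (hj : ∀ x ∈ Ω, ∃ p A, Jet u x p A ∧ bt A = -F x (u x) p) : C2HolderOnClosure α u Ω := by
  classical
  obtain ⟨r₀, hr₀, hib⟩ := int_ball hΩ hΛ hρ hBD
  have hIB : IB (closure Ω) r₀ := fun x hx r h1 h2 => by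
    obtain ⟨ξ, a, b⟩ := hib x hx r h1 h2
    exact ⟨ξ, a, fun v hv => subset_closure (b v hv)⟩
  have hU := uniqueDiff_closure hΩ hΛ hρ hBD
  have hcl : ∀ x ∈ closure Ω, x ∉ Ω → u x = 0 := fun x hx hxn => hu0 x (by rw [hΩ.frontier_eq]; exact ⟨hx, hxn⟩)
  set v : EuclideanSpace ℝ (Fin N) → ℝ := fun x => if x ∈ closure Ω then u x else 0 with hv
  have hvu : ∀ x ∈ closure Ω, v x = u x := fun x hx => if_pos hx
  have hv0 : ∀ x, x ∉ Ω → v x = 0 := fun x hx => by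
    by_cases h : x ∈ closure Ω
    · rw [hvu x h]; exact hcl x h hx
    · exact if_neg h
  have hvc : Continuous v := by
    refine continuous_if ?_ ?_ continuousOn_const
    · intro x hx
      exact hcl x (isClosed_closure.frontier_subset hx) fun hxo =>
        hx.2 (mem_interior.2 ⟨Ω, subset_closure, hΩ, hxo⟩)
    · rw [setOf_mem_eq, closure_closure]; exact huc
  obtain ⟨M, hM⟩ := hΩb.isCompact_closure.exists_bound_of_continuousOn huc
  have hvM : ∀ x, |v x| ≤ max M 0 := fun x => by
    by_cases h : x ∈ closure Ω
    · rw [hvu x h]; exact (hM x h).trans (le_max_left _ _)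
    · rw [hv0 x fun h' => h (subset_closure h'), abs_zero]; exact le_max_right _ _
  have hjv : ∀ x ∈ Ω, ∃ p A, Jet v x p A ∧ bt A = -F x (v x) p := fun x hx => by
    obtain ⟨p, A, h1, h2⟩ := hj x hx
    refine ⟨p, A, h1.congr ?_, by rw [hvu x (subset_closure hx)]; exact h2⟩
    filter_upwards [hΩ.mem_nhds hx] with y hy using (hvu y (subset_closure hy)).symm
  obtain ⟨C₁, hC₁, H₁⟩ := glob_exp hN (m := 1) (Or.inl rfl) hF.a0 hF.a1 hΛ hρ hΩ hΩb hBD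
    (f := fun x => F x (v x) (fderiv ℝ v x)) hvc hv0 hvM
    (fun x hx => by
      obtain ⟨p, A, h1, h2⟩ := hjv x hx
      exact ⟨p, A, h1, by rw [h1.hasFDerivAt.fderiv]; exact h2⟩) (fun x hx => hF.bdd x hx _ _) hF.K0 (by norm_num)
  obtain ⟨p, C₂, hC₂, hp, hpH⟩ := whit1 hr₀ hIB hF.a0 hC₁ H₁
  obtain ⟨C₃, hC₃, hvL⟩ := lip_of_deriv hΩ hΛ hρ hBD (fun x hx => (hp x hx).1) (fun x hx => (hp x hx).2) (fun x _ => hvM x)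
  obtain ⟨D, hD, hDl⟩ := lip_hol (hΩb.closure) hF.a0 hF.a1
  have hL0 := hF.L0
  have hH0 := hF.H0
  have hK0 := hF.K0
  obtain ⟨C₄, hC₄, H₄⟩ := glob_exp hN (m := 2) (K := K + (L * (C₃ * D + C₂) + H)) (Or.inr rfl) hF.a0 hF.a1 hΛ hρ hΩ hΩb hBD
    (f := fun x => F x (v x) (p x)) hvc hv0 hvM
    (fun x hx => by
      obtain ⟨q, A, h1, h2⟩ := hjv x hx
      have h3 := (hp x (subset_closure hx)).1.hasFDerivAt (mem_of_superset (hΩ.mem_nhds hx) subset_closure)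
      exact ⟨q, A, h1, by rw [h3.unique h1.hasFDerivAt]; exact h2⟩)
    (fun x hx => (hF.bdd x hx _ _).trans (le_add_of_nonneg_right (by positivity))) (by positivity)
    (fun _ x hx y hy => by
      have h1 := hF.lip x hx (v x) (v y) (p x) (p y)
      have h2 := hF.hol x hx y hy (v y) (p y)
      have h3 := abs_sub_le (F x (v x) (p x)) (F x (v y) (p y)) (F y (v y) (p y))
      have h4 := hvL y hy x hx
      rw [Real.norm_eq_abs] at h4
      have h5 := hpH x hx y hy
      have h6 := hDl x hx y hy
      have h7 : 0 ≤ ‖x - y‖ ^ (α:ℝ) := by positivity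
      have h8 : L * (|v x - v y| + ‖p x - p y‖) ≤ L * (C₃ * (D * ‖x - y‖ ^ (α:ℝ)) + C₂ * ‖x - y‖ ^ (α:ℝ)) := by
        gcongr
        exact h4.trans (by gcongr)
      have : 0 ≤ K * ‖x - y‖ ^ (α:ℝ) := by positivity
      refine h3.trans ((add_le_add (h1.trans h8) h2).trans ?_)
      linarith)
  obtain ⟨q, A, C₅, hC₅, a1, a2, a3⟩ := whit2 hr₀ hIB hF.a0 hC₄ H₄
  exact c2h_of hU (by exact_mod_cast hF.a0) hC₅ (fun x hx => (a1 x hx).congr (fun y hy => (hvu y hy).symm) (hvu x hx).symm) a2 a3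

lemma comb {α : NNReal} (hα : 0 < α) {Ω : Set (EuclideanSpace ℝ (Fin N))} (hU : UniqueDiffOn ℝ (closure Ω)) (hΩ : IsOpen Ω)
    (hΩb : Bornology.IsBounded Ω) {u v : EuclideanSpace ℝ (Fin N) → ℝ} (hu : C2HolderOnClosure α u Ω)
    (hv : C2HolderOnClosure α v Ω) (a b : ℝ) : C2HolderOnClosure α (fun x => a * u x + b * v x) Ω ∧
      ∀ x ∈ Ω, fderiv ℝ (fun x => a * u x + b * v x) x = a • fderiv ℝ u x + b • fderiv ℝ v x ∧
        lap (fun x => a * u x + b * v x) x = a * lap u x + b * lap v x := by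
  obtain ⟨p, A, C, M, hC, h1, h2, h3, h4, h5⟩ := of_c2h hU hΩ hΩb hu
  obtain ⟨q, B, C', M', hC', k1, k2, k3, k4, k5⟩ := of_c2h hU hΩ hΩb hv
  have hc : C2HolderOnClosure α (fun x => a * u x + b * v x) Ω := by
    refine c2h_of hU hα (p := fun x => a • p x + b • q x) (A := fun x => a • A x + b • B x) (C := |a| * C + |b| * C') (by positivity)
      (fun x hx => ((h1 x hx).const_mul a).add ((k1 x hx).const_mul b))
      (fun x hx => ((h2 x hx).const_smul a).add ((k2 x hx).const_smul b)) fun x hx y hy => ?_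
    have e : a • A x + b • B x - (a • A y + b • B y) = a • (A x - A y) + b • (B x - B y) := by
      ext c d; simp; ring
    rw [e]
    refine (bi_norm_add _ _).trans ?_
    have h6 := (bi_norm_smul a (A x - A y)).trans (mul_le_mul_of_nonneg_left (h3 x hx y hy) (abs_nonneg a))
    have h7 := (bi_norm_smul b (B x - B y)).trans (mul_le_mul_of_nonneg_left (k3 x hx y hy) (abs_nonneg b))
    linarith
  refine ⟨hc, fun x hx => ?_⟩
  obtain ⟨r, R, -, -, -, -, -, -, -, l5⟩ := of_c2h hU hΩ hΩb hc
  obtain ⟨i1, i2⟩ := (((h5 x hx).1.smul a).add ((k5 x hx).1.smul b)).unique (l5 x hx).1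
  rw [← (l5 x hx).2.1, ← (l5 x hx).2.2, ← i1, ← i2, bt_add, bt_smul, bt_smul, (h5 x hx).2.1, (h5 x hx).2.2,
    (k5 x hx).2.1, (k5 x hx).2.2]
  exact ⟨rfl, rfl⟩

end dir

/-! ## Part 21: truncation and existence -/
section core

/-- admissible nonlinearities -/
structure Adm {E : Type*} [NormedAddCommGroup E] [InnerProductSpace ℝ E] (f : E → ℝ → Du E → ℝ) (S : Set E) (α : ℝ) : Prop where
  lip : ∀ R : ℝ, ∃ L, 0 ≤ L ∧ ∀ x ∈ S, ∀ η η' p p', |η| ≤ R → |η'| ≤ R → ‖p‖ ≤ R → ‖p'‖ ≤ R →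
    |f x η p - f x η' p'| ≤ L * (|η - η'| + ‖p - p'‖)
  hol : ∀ R : ℝ, ∃ H, 0 ≤ H ∧ ∀ x ∈ S, ∀ y ∈ S, ∀ η p, |η| ≤ R → ‖p‖ ≤ R → |f x η p - f y η p| ≤ H * ‖x - y‖ ^ α
  gr : ∀ R : ℝ, ∃ K, 0 < K ∧ ∀ x ∈ S, ∀ η p, |η| ≤ R → |f x η p| ≤ K * (1 + ‖p‖ ^ 2)

/-- radial truncation -/
noncomputable def rad {V : Type*} [NormedAddCommGroup V] [NormedSpace ℝ V] (R : ℝ) (p : V) : V := (R / max R ‖p‖) • p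

section rad
variable {V : Type*} [NormedAddCommGroup V] [NormedSpace ℝ V] {R : ℝ}

lemma rad_eq (hR : 0 < R) {p : V} (h : ‖p‖ ≤ R) : rad R p = p := by
  rw [rad, max_eq_left h, div_self hR.ne', one_smul]

lemma rad_norm (hR : 0 < R) (p : V) : ‖rad R p‖ ≤ R ∧ ‖rad R p‖ ≤ ‖p‖ := by
  have hm : 0 < max R ‖p‖ := lt_max_of_lt_left hR
  rw [rad, norm_smul, Real.norm_eq_abs, abs_of_nonneg (by positivity), div_mul_eq_mul_div, div_le_iff₀ hm, div_le_iff₀ hm]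
  have := norm_nonneg p
  exact ⟨by gcongr; exact le_max_right _ _, by rw [mul_comm]; gcongr; exact le_max_left _ _⟩

lemma rad_lip (hR : 0 < R) (p q : V) : ‖rad R p - rad R q‖ ≤ 2 * ‖p - q‖ := by
  have hm : 0 < max R ‖p‖ := lt_max_of_lt_left hR
  have hm' : 0 < max R ‖q‖ := lt_max_of_lt_left hR
  have e : rad R p - rad R q = (R / max R ‖p‖) • (p - q) + (R / max R ‖p‖ - R / max R ‖q‖) • q := by
    rw [rad, rad, smul_sub, sub_smul]; abel
  rw [e]
  refine (norm_add_le _ _).trans ?_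
  have h1 : R / max R ‖p‖ ≤ 1 := by rw [div_le_one hm]; exact le_max_left _ _
  have h2 : ‖(R / max R ‖p‖) • (p - q)‖ ≤ ‖p - q‖ := by
    rw [norm_smul, Real.norm_eq_abs, abs_of_nonneg (by positivity)]
    exact mul_le_of_le_one_left (norm_nonneg _) h1
  have h3 : |max R ‖q‖ - max R ‖p‖| ≤ ‖p - q‖ := by
    have := abs_max_sub_max_le_abs ‖q‖ ‖p‖ R
    rw [max_comm R, max_comm R]
    refine this.trans ?_
    rw [norm_sub_rev]; exact abs_norm_sub_norm_le q p
  have h4 : ‖(R / max R ‖p‖ - R / max R ‖q‖) • q‖ ≤ ‖p - q‖ := by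
    have e2 : R / max R ‖p‖ - R / max R ‖q‖ = (R / max R ‖p‖) * ((max R ‖q‖ - max R ‖p‖) / max R ‖q‖) := by
      field_simp
    rw [norm_smul, Real.norm_eq_abs, e2, abs_mul, abs_of_nonneg (by positivity : 0 ≤ R / max R ‖p‖), abs_div, abs_of_pos hm']
    calc _ ≤ 1 * (‖p - q‖ / max R ‖q‖) * max R ‖q‖ := by gcongr; exact le_max_right _ _
      _ = _ := by field_simp
  linarith

end rad

lemma clamp_abs {M : ℝ} (hM : 0 ≤ M) (η : ℝ) : |max (-M) (min M η)| ≤ M :=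
  abs_le.2 ⟨le_max_left _ _, max_le (by linarith) (min_le_left _ _)⟩

lemma clamp_lip (M η η' : ℝ) : |max (-M) (min M η) - max (-M) (min M η')| ≤ |η - η'| := by
  rw [max_comm (-M), max_comm (-M)]
  refine (abs_max_sub_max_le_abs _ _ _).trans ?_
  rw [min_comm M, min_comm M]
  exact abs_inf_sub_inf_le_abs _ _ _

lemma clamp_eq {M η : ℝ} (h : |η| ≤ M) : max (-M) (min M η) = η := by
  rw [abs_le] at h
  rw [min_eq_right h.2, max_eq_right h.1]

lemma Adm.trunc {E : Type*} [NormedAddCommGroup E] [InnerProductSpace ℝ E] {f : E → ℝ → Du E → ℝ} {S : Set E} {α M R K : ℝ}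
    (h : Adm f S α) (hα0 : 0 < α) (hα1 : α < 1) (hM : 0 ≤ M) (hR : 0 < R) (hK0 : 0 < K)
    (hK : ∀ x ∈ S, ∀ η p, |η| ≤ M → |f x η p| ≤ K * (1 + ‖p‖ ^ 2)) :
    ∃ L H, Nice (fun x η p => f x (max (-M) (min M η)) (rad R p)) S L (K * (1 + R ^ 2)) H α := by
  obtain ⟨L, hL0, hL⟩ := h.lip (max M R)
  obtain ⟨H, hH0, hH⟩ := h.hol (max M R)
  have a1 : ∀ η, |max (-M) (min M η)| ≤ max M R := fun η => (clamp_abs hM η).trans (le_max_left _ _)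
  have a2 : ∀ p : Du E, ‖rad R p‖ ≤ max M R := fun p => (rad_norm hR p).1.trans (le_max_right _ _)
  refine ⟨2 * L, H, by positivity, by positivity, hH0, hα0, hα1, fun x hx η η' p p' => ?_, fun x hx η p => ?_,
    fun x hx y hy η p => hH x hx y hy _ _ (a1 _) (a2 _)⟩
  · refine (hL x hx _ _ _ _ (a1 η) (a1 η') (a2 p) (a2 p')).trans ?_
    have h1 := clamp_lip M η η'
    have h2 := rad_lip hR p p'
    have h3 := abs_nonneg (η - η')
    calc _ ≤ L * (2 * |η - η'| + 2 * ‖p - p'‖) := by gcongr; linarith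
      _ = _ := by ring
  · refine (hK x hx _ _ (clamp_abs hM η)).trans ?_
    have := (rad_norm hR p).1
    gcongr

lemma Adm.neg {E : Type*} [NormedAddCommGroup E] [InnerProductSpace ℝ E] {f : E → ℝ → Du E → ℝ} {S : Set E} {α : ℝ}
    (h : Adm f S α) : Adm (fl f) S α := by
  refine ⟨fun R => ?_, fun R => ?_, fun R => ?_⟩
  · obtain ⟨L, hL0, hL⟩ := h.lip R
    refine ⟨L, hL0, fun x hx η η' p p' h1 h2 h3 h4 => ?_⟩
    have := hL x hx (-η) (-η') (-p) (-p') (by rwa [abs_neg]) (by rwa [abs_neg]) (by rwa [norm_neg]) (by rwa [norm_neg])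
    rw [← neg_sub', abs_neg, ← neg_sub', norm_neg] at this
    rw [fl, fl, ← neg_sub', abs_neg]; exact this
  · obtain ⟨H, hH0, hH⟩ := h.hol R
    refine ⟨H, hH0, fun x hx y hy η p h1 h2 => ?_⟩
    rw [fl, fl, ← neg_sub', abs_neg]
    exact hH x hx y hy _ _ (by rwa [abs_neg]) (by rwa [norm_neg])
  · obtain ⟨K, hK0, hK⟩ := h.gr R
    refine ⟨K, hK0, fun x hx η p h1 => ?_⟩
    have := hK x hx (-η) (-p) (by rwa [abs_neg])
    rw [norm_neg] at this
    rw [fl, abs_neg]; exact this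

variable {N : ℕ}

lemma core0 (hN : 1 ≤ dm (EuclideanSpace ℝ (Fin N))) {α : NNReal} (hα0 : 0 < α) (hα1 : α < 1)
    {Ω : Set (EuclideanSpace ℝ (Fin N))} (hΩ : IsOpen Ω)
    (hΩb : Bornology.IsBounded Ω) {Λ ρ : ℝ} (hΛ : 1 ≤ Λ) (hρ : 0 < ρ) (hBD : BD Ω Λ ρ α)
    {f : EuclideanSpace ℝ (Fin N) → ℝ → Du (EuclideanSpace ℝ (Fin N)) → ℝ} (hf : Adm f (closure Ω) α)
    {s S : EuclideanSpace ℝ (Fin N) → ℝ} (hs : C2HolderOnClosure α s Ω) (hS : C2HolderOnClosure α S Ω)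
    (hs1 : ∀ x ∈ Ω, -lap s x ≤ f x (s x) (fderiv ℝ s x)) (hS1 : ∀ x ∈ Ω, f x (S x) (fderiv ℝ S x) ≤ -lap S x)
    (hs0 : ∀ x ∈ frontier Ω, s x = 0) (hS0 : ∀ x ∈ frontier Ω, S x = 0) (hle : ∀ x ∈ closure Ω, s x ≤ S x) :
    ∃ u, C2HolderOnClosure α u Ω ∧ (∀ x ∈ Ω, -lap u x = f x (u x) (fderiv ℝ u x)) ∧ (∀ x ∈ frontier Ω, u x = 0) ∧
      (∀ x ∈ closure Ω, s x ≤ u x ∧ u x ≤ S x) ∧ ∀ v, C2HolderOnClosure α v Ω →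
        (∀ x ∈ Ω, -lap v x = f x (v x) (fderiv ℝ v x)) → (∀ x ∈ frontier Ω, v x = 0) →
        (∀ x ∈ closure Ω, s x ≤ v x ∧ v x ≤ S x) → ∀ x ∈ closure Ω, v x ≤ u x := by
  have hU := uniqueDiff_closure hΩ hΛ hρ hBD
  obtain ⟨p, A, -, M₁, -, h1, -, -, h4, h5⟩ := of_c2h hU hΩ hΩb hs
  obtain ⟨q, B, -, M₂, -, k1, -, -, k4, k5⟩ := of_c2h hU hΩ hΩb hS
  obtain ⟨C₁, hC₁, hsL⟩ := lip_of_deriv hΩ hΛ hρ hBD h1 (fun x hx => (h4 x hx).2.1) (fun x hx => (h4 x hx).1)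
  obtain ⟨C₂, hC₂, hSL⟩ := lip_of_deriv hΩ hΛ hρ hBD k1 (fun x hx => (k4 x hx).2.1) (fun x hx => (k4 x hx).1)
  set M := |M₁| + |M₂| with hM
  have hM0 : 0 ≤ M := by positivity
  have hM1 : ∀ x ∈ closure Ω, |s x| ≤ M ∧ ‖p x‖ ≤ M := fun x hx => by
    have := le_abs_self M₁
    have := abs_nonneg M₂
    exact ⟨(h4 x hx).1.trans (by linarith), (h4 x hx).2.1.trans (by linarith)⟩
  have hM2 : ∀ x ∈ closure Ω, |S x| ≤ M ∧ ‖q x‖ ≤ M := fun x hx => by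
    have := le_abs_self M₂
    have := abs_nonneg M₁
    exact ⟨(k4 x hx).1.trans (by linarith), (k4 x hx).2.1.trans (by linarith)⟩
  obtain ⟨K, hK0, hK⟩ := hf.gr M
  obtain ⟨G, hG0, hG⟩ := global_grad (E := EuclideanSpace ℝ (Fin N)) hK0 hM0 (by linarith : 0 < C₁ + C₂ + 1)
  set R := G + M with hR
  have hR0 : 0 < R := by linarith
  obtain ⟨L, H, hF⟩ := hf.trunc (by exact_mod_cast hα0) (by exact_mod_cast hα1) hM0 hR0 hK0 hK
  set F : EuclideanSpace ℝ (Fin N) → ℝ → Du (EuclideanSpace ℝ (Fin N)) → ℝ :=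
    fun x η p => f x (max (-M) (min M η)) (rad R p) with hFd
  have hFe : ∀ x η p, |η| ≤ M → ‖p‖ ≤ R → F x η p = f x η p := fun x η p h1 h2 => by
    simp only [hFd]; rw [clamp_eq h1, rad_eq hR0 h2]
  have hFg : ∀ x ∈ closure Ω, ∀ η p, |F x η p| ≤ K * (1 + ‖p‖ ^ 2) := fun x hx η p => by
    refine (hK x hx _ _ (clamp_abs hM0 η)).trans ?_
    have := (rad_norm hR0 p).2
    gcongr
  have hbet : ∀ v : EuclideanSpace ℝ (Fin N) → ℝ, (∀ x ∈ closure Ω, s x ≤ v x ∧ v x ≤ S x) →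
      (∀ x ∈ closure Ω, |v x| ≤ M) ∧ (∀ x ∈ frontier Ω, v x = 0) ∧
      ∀ x ∈ closure Ω, ∀ y ∈ frontier Ω, |v x - v y| ≤ (C₁ + C₂ + 1) * ‖x - y‖ := fun v hv => by
    have hv0 : ∀ x ∈ frontier Ω, v x = 0 := fun x hx => by
      have := hv x (frontier_subset_closure hx)
      rw [hs0 x hx, hS0 x hx] at this
      linarith [this.1, this.2]
    refine ⟨fun x hx => ?_, hv0, fun x hx y hy => ?_⟩
    · have a := abs_le.1 (hM1 x hx).1
      have b := abs_le.1 (hM2 x hx).1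
      exact abs_le.2 ⟨by linarith [(hv x hx).1], by linarith [(hv x hx).2]⟩
    · have a := hsL y (frontier_subset_closure hy) x hx
      have b := hSL y (frontier_subset_closure hy) x hx
      rw [hs0 y hy, sub_zero, Real.norm_eq_abs] at a
      rw [hS0 y hy, sub_zero, Real.norm_eq_abs] at b
      rw [hv0 y hy, sub_zero]
      have c := abs_le.1 a
      have d := abs_le.1 b
      have e1 : 0 ≤ C₁ * ‖x - y‖ := by positivity
      have e2 : 0 ≤ C₂ * ‖x - y‖ := by positivity
      have e3 := norm_nonneg (x - y)
      rw [add_mul, add_mul, one_mul]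
      exact abs_le.2 ⟨by linarith [(hv x hx).1], by linarith [(hv x hx).2]⟩
  obtain ⟨u, huc, hub, huj, humax⟩ := perron hN (hF.mono subset_closure) hΩ hΩb hs.1.continuousOn hS.1.continuousOn
    (fun x hx => (h5 x hx).1.vsub (by
      have := hM1 x (subset_closure hx)
      rw [hFe x _ _ this.1 (by linarith [this.2]), (h5 x hx).2.1, (h5 x hx).2.2]; exact hs1 x hx))
    (fun x hx => ⟨_, _, (k5 x hx).1, by
      have := hM2 x (subset_closure hx)
      rw [hFe x _ _ this.1 (by linarith [this.2]), (k5 x hx).2.1, (k5 x hx).2.2]; exact hS1 x hx⟩)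
    hle (fun x hx => by rw [hs0 x hx, hS0 x hx])
  obtain ⟨b1, b2, b3⟩ := hbet u hub
  have hureg := dirichlet hN hΩ hΩb hΛ hρ hBD hF huc b2 huj
  refine ⟨u, hureg, fun x hx => ?_, b2, hub, fun v hv hv1 hv2 hv3 => ?_⟩
  · have hgr := hG Ω u hΩ hΩb huc b1 b3 (fun x hx => by
      obtain ⟨p, A, j1, j2⟩ := huj x hx
      refine ⟨p, A, j1, ?_⟩
      rw [j2, abs_neg]; exact hFg x (subset_closure hx) _ _)
    obtain ⟨_, _, -, -, -, -, -, -, -, l5⟩ := of_c2h hU hΩ hΩb hureg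
    obtain ⟨p, A, j1, j2⟩ := huj x hx
    obtain ⟨i1, i2⟩ := j1.unique (l5 x hx).1
    rw [hFe x _ _ (b1 x (subset_closure hx)) (by linarith [hgr x hx p j1.hasFDerivAt])] at j2
    rw [← (l5 x hx).2.1, ← (l5 x hx).2.2, ← i1, ← i2, j2, neg_neg]
  · obtain ⟨c1, c2, c3⟩ := hbet v hv3
    obtain ⟨_, _, -, -, -, -, -, -, -, l5⟩ := of_c2h hU hΩ hΩb hv
    have hgr := hG Ω v hΩ hΩb hv.1.continuousOn c1 c3 (fun x hx => by
      refine ⟨_, _, (l5 x hx).1, ?_⟩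
      rw [(l5 x hx).2.1, (l5 x hx).2.2, ← abs_neg, hv1 x hx]; exact hK x (subset_closure hx) _ _ (c1 x (subset_closure hx)))
    refine humax v ⟨hv.1.continuousOn, fun x hx => (hv3 x hx).1, fun x hx => (hv3 x hx).2, fun x hx => (l5 x hx).1.vsub ?_⟩
    rw [hFe x _ _ (c1 x (subset_closure hx)) (by linarith [hgr x hx _ (l5 x hx).1.hasFDerivAt]), (l5 x hx).2.1, (l5 x hx).2.2]
    exact (hv1 x hx).le

/-- the nonlinearity after subtracting the boundary data -/
lemma Adm.shift {Ω : Set (EuclideanSpace ℝ (Fin N))} {α : ℝ} (hα0 : 0 < α) (hα1 : α < 1) (hΩ : IsOpen Ω)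
    (hΩb : Bornology.IsBounded Ω) {Λ ρ : ℝ} (hΛ : 1 ≤ Λ) (hρ : 0 < ρ) (hBD : BD Ω Λ ρ α)
    {f : EuclideanSpace ℝ (Fin N) → ℝ → Du (EuclideanSpace ℝ (Fin N)) → ℝ} (hf : Adm f (closure Ω) α)
    {g : EuclideanSpace ℝ (Fin N) → ℝ} {p : EuclideanSpace ℝ (Fin N) → Du (EuclideanSpace ℝ (Fin N))}
    {A : EuclideanSpace ℝ (Fin N) → Bi (EuclideanSpace ℝ (Fin N))} {C M : ℝ} (hC : 0 ≤ C)
    (h1 : ∀ x ∈ closure Ω, HasFDerivWithinAt g (p x) (closure Ω) x)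
    (h2 : ∀ x ∈ closure Ω, HasFDerivWithinAt p (A x) (closure Ω) x)
    (h3 : ∀ x ∈ closure Ω, ∀ y ∈ closure Ω, ‖A x - A y‖ ≤ C * ‖x - y‖ ^ (α:ℝ))
    (h4 : ∀ x ∈ closure Ω, |g x| ≤ M ∧ ‖p x‖ ≤ M ∧ ‖A x‖ ≤ M) :
    Adm (fun x η q => f x (η + g x) (q + p x) + bt (A x)) (closure Ω) α := by
  obtain ⟨C₁, hC₁, hgL⟩ := lip_of_deriv hΩ hΛ hρ hBD h1 (fun x hx => (h4 x hx).2.1) (fun x hx => (h4 x hx).1)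
  obtain ⟨C₂, hC₂, hpL⟩ := lip_of_deriv hΩ hΛ hρ hBD h2 (fun x hx => (h4 x hx).2.2) (fun x hx => (h4 x hx).2.1)
  obtain ⟨D, hD, hDl⟩ := lip_hol (hΩb.closure) hα0 hα1
  have g1 : ∀ R η, |η| ≤ R → ∀ x ∈ closure Ω, |η + g x| ≤ R + M := fun R η h x hx =>
    (abs_add_le _ _).trans (add_le_add h (h4 x hx).1)
  have p1 : ∀ R (q : Du (EuclideanSpace ℝ (Fin N))), ‖q‖ ≤ R → ∀ x ∈ closure Ω, ‖q + p x‖ ≤ R + M := fun R q h x hx =>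
    (norm_add_le _ _).trans (add_le_add h (h4 x hx).2.1)
  have hd0 : 0 ≤ dm (EuclideanSpace ℝ (Fin N)) := Nat.cast_nonneg _
  refine ⟨fun R => ?_, fun R => ?_, fun R => ?_⟩
  · obtain ⟨L, hL0, hL⟩ := hf.lip (R + M)
    refine ⟨L, hL0, fun x hx η η' q q' a b c d => ?_⟩
    have := hL x hx _ _ _ _ (g1 R η a x hx) (g1 R η' b x hx) (p1 R q c x hx) (p1 R q' d x hx)
    rw [add_sub_add_right_eq_sub, add_sub_add_right_eq_sub] at this
    rw [add_sub_add_right_eq_sub]; exact this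
  · obtain ⟨L, hL0, hL⟩ := hf.lip (R + M)
    obtain ⟨H, hH0, hH⟩ := hf.hol (R + M)
    refine ⟨L * (C₁ * D + C₂ * D) + H + dm (EuclideanSpace ℝ (Fin N)) * C, by positivity, fun x hx y hy η q a b => ?_⟩
    have e1 := hL x hx _ _ _ _ (g1 R η a x hx) (g1 R η a y hy) (p1 R q b x hx) (p1 R q b y hy)
    have e2 := hH x hx y hy _ _ (g1 R η a y hy) (p1 R q b y hy)
    rw [add_sub_add_left_eq_sub, add_sub_add_left_eq_sub] at e1
    have e3 := bt_le (A x - A y)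
    rw [bt_sub] at e3
    have e4 := hgL y hy x hx
    rw [Real.norm_eq_abs] at e4
    have e5 := hpL y hy x hx
    have e6 := hDl x hx y hy
    have e7 : L * (|g x - g y| + ‖p x - p y‖) ≤ L * (C₁ * (D * ‖x - y‖ ^ α) + C₂ * (D * ‖x - y‖ ^ α)) := by
      gcongr
      · exact e4.trans (by gcongr)
      · exact e5.trans (by gcongr)
    have e8 : dm (EuclideanSpace ℝ (Fin N)) * ‖A x - A y‖ ≤ dm (EuclideanSpace ℝ (Fin N)) * (C * ‖x - y‖ ^ α) := by
      gcongr; exact h3 x hx y hy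
    have e9 : f x (η + g x) (q + p x) + bt (A x) - (f y (η + g y) (q + p y) + bt (A y)) =
        (f x (η + g x) (q + p x) - f x (η + g y) (q + p y)) + (f x (η + g y) (q + p y) - f y (η + g y) (q + p y)) +
        (bt (A x) - bt (A y)) := by ring
    simp only [e9]
    refine (abs_add_three _ _ _).trans ?_
    linarith
  · obtain ⟨K, hK0, hK⟩ := hf.gr (R + M)
    refine ⟨K * (1 + 2 * M ^ 2 + 2) + |dm (EuclideanSpace ℝ (Fin N)) * M|, by positivity, fun x hx η q a => ?_⟩
    have e1 := hK x hx _ (q + p x) (g1 R η a x hx)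
    have e2 : |bt (A x)| ≤ |dm (EuclideanSpace ℝ (Fin N)) * M| := (bt_le (A x)).trans
      ((mul_le_mul_of_nonneg_left (h4 x hx).2.2 hd0).trans (le_abs_self _))
    have e3 : ‖q + p x‖ ^ 2 ≤ 2 * ‖q‖ ^ 2 + 2 * M ^ 2 := by
      have b1 := p1 ‖q‖ q le_rfl x hx
      have : ‖q + p x‖ ^ 2 ≤ (‖q‖ + M) ^ 2 := by gcongr
      linarith [sq_nonneg (‖q‖ - M)]
    refine (abs_add_le _ _).trans ?_
    have e4 : K * (1 + ‖q + p x‖ ^ 2) ≤ K * ((1 + 2 * M ^ 2 + 2) * (1 + ‖q‖ ^ 2)) := by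
      gcongr
      nlinarith [sq_nonneg (‖q‖), sq_nonneg (M * ‖q‖), sq_nonneg M]
    have e5 : 0 ≤ |dm (EuclideanSpace ℝ (Fin N)) * M| * ‖q‖ ^ 2 := by positivity
    linarith

lemma core (hN : 1 ≤ dm (EuclideanSpace ℝ (Fin N))) {α : NNReal} (hα0 : 0 < α) (hα1 : α < 1)
    {Ω : Set (EuclideanSpace ℝ (Fin N))} (hΩ : IsOpen Ω)
    (hΩb : Bornology.IsBounded Ω) {Λ ρ : ℝ} (hΛ : 1 ≤ Λ) (hρ : 0 < ρ) (hBD : BD Ω Λ ρ α)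
    {f : EuclideanSpace ℝ (Fin N) → ℝ → Du (EuclideanSpace ℝ (Fin N)) → ℝ} (hf : Adm f (closure Ω) α)
    {g s S : EuclideanSpace ℝ (Fin N) → ℝ} (hg : C2HolderOnClosure α g Ω)
    (hs : C2HolderOnClosure α s Ω) (hS : C2HolderOnClosure α S Ω)
    (hs1 : ∀ x ∈ Ω, -lap s x ≤ f x (s x) (fderiv ℝ s x)) (hS1 : ∀ x ∈ Ω, f x (S x) (fderiv ℝ S x) ≤ -lap S x)
    (hs0 : ∀ x ∈ frontier Ω, s x = g x) (hS0 : ∀ x ∈ frontier Ω, S x = g x) (hle : ∀ x ∈ closure Ω, s x ≤ S x) :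
    ∃ u, C2HolderOnClosure α u Ω ∧ (∀ x ∈ Ω, -lap u x = f x (u x) (fderiv ℝ u x)) ∧ (∀ x ∈ frontier Ω, u x = g x) ∧
      (∀ x ∈ closure Ω, s x ≤ u x ∧ u x ≤ S x) ∧ ∀ v, C2HolderOnClosure α v Ω →
        (∀ x ∈ Ω, -lap v x = f x (v x) (fderiv ℝ v x)) → (∀ x ∈ frontier Ω, v x = g x) →
        (∀ x ∈ closure Ω, s x ≤ v x ∧ v x ≤ S x) → ∀ x ∈ closure Ω, v x ≤ u x := by
  have hU := uniqueDiff_closure hΩ hΛ hρ hBD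
  obtain ⟨p, A, C, M, hC, h1, h2, h3, h4, h5⟩ := of_c2h hU hΩ hΩb hg
  have hadm := hf.shift (by exact_mod_cast hα0) (by exact_mod_cast hα1) hΩ hΩb hΛ hρ hBD hC h1 h2 h3 h4
  have key : ∀ v, C2HolderOnClosure α v Ω → C2HolderOnClosure α (fun x => 1 * v x + (-1) * g x) Ω ∧
      ∀ x ∈ Ω, f x ((1 * v x + (-1) * g x) + g x) (fderiv ℝ (fun x => 1 * v x + (-1) * g x) x + p x) + bt (A x) =
        f x (v x) (fderiv ℝ v x) + lap g x ∧ lap (fun x => 1 * v x + (-1) * g x) x = lap v x - lap g x := fun v hv => by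
    obtain ⟨a, b⟩ := comb hα0 hU hΩ hΩb hv hg 1 (-1)
    refine ⟨a, fun x hx => ?_⟩
    rw [(b x hx).1, (b x hx).2, (h5 x hx).2.1, (h5 x hx).2.2]
    refine ⟨?_, by ring⟩
    congr 2
    · ring
    · rw [one_smul, neg_smul, one_smul, neg_add_cancel_right]
  obtain ⟨u, u1, u2, u3, u4, u5⟩ := core0 hN hα0 hα1 hΩ hΩb hΛ hρ hBD hadm (key s hs).1 (key S hS).1
    (fun x hx => by
      rw [((key s hs).2 x hx).1, ((key s hs).2 x hx).2]; linarith [hs1 x hx])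
    (fun x hx => by
      rw [((key S hS).2 x hx).1, ((key S hS).2 x hx).2]; linarith [hS1 x hx])
    (fun x hx => by rw [hs0 x hx]; ring) (fun x hx => by rw [hS0 x hx]; ring) (fun x hx => by linarith [hle x hx])
  obtain ⟨a, b⟩ := comb hα0 hU hΩ hΩb u1 hg 1 1
  refine ⟨_, a, fun x hx => ?_, fun x hx => by rw [u3 x hx]; ring, fun x hx =>
    ⟨by linarith [(u4 x hx).1], by linarith [(u4 x hx).2]⟩, fun v hv hv1 hv2 hv3 x hx => ?_⟩
  · have := u2 x hx
    rw [(h5 x hx).2.1, (h5 x hx).2.2] at this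
    rw [(b x hx).1, (b x hx).2, one_smul, one_smul]
    simp only [one_mul]
    linarith
  · have := u5 _ (key v hv).1 (fun x hx => by
      rw [((key v hv).2 x hx).1, ((key v hv).2 x hx).2, ← hv1 x hx]; ring) (fun x hx => by rw [hv2 x hx]; ring)
      (fun x hx => ⟨by linarith [(hv3 x hx).1], by linarith [(hv3 x hx).2]⟩) x hx
    linarith

end core

/-- **Amann's sub- and super-solution theorem (Lemma 2.3).** On a bounded domain `Ω` with
`C^{2,α}` boundary, for `g ∈ C^{2,α}` (given on `∂Ω` by a `C^{2,α}(Ω̄)` extension) and a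
continuous `f₁(x, η, ξ)` having continuous partial derivatives in `(η, ξ)`, satisfying the
uniform Hölder condition (AM1) and the quadratic growth condition (AM2): if the problem
`-Δu = f₁(x, u, ∇u)` in `Ω`, `u = g` on `∂Ω` has a sub solution `u̲ ∈ C^{2,α}(Ω̄)` and a
super solution `ū ∈ C^{2,α}(Ω̄)` with `u̲ ≤ ū` on `Ω̄`, then there exist a minimal solution
`ũ` and a maximal solution `û` in `[u̲, ū]`: both belong to `C^{2,α}(Ω̄)`, solve the problem
pointwise, lie between `u̲` and `ū`, and every solution `u ∈ [u̲, ū]` satisfies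
`ũ ≤ u ≤ û` pointwise. -/
theorem amann_sub_super_solution
    {N : ℕ} (α : NNReal) (hα0 : 0 < α) (hα1 : α < 1)
    (Ω : Set (EuclideanSpace ℝ (Fin N)))
    (hΩo : IsOpen Ω) (hΩconn : IsConnected Ω) (hΩb : Bornology.IsBounded Ω)
    (hbd : IsC2HolderBoundary α Ω)
    (g : EuclideanSpace ℝ (Fin N) → ℝ) (hg : C2HolderOnClosure α g Ω)
    (f₁ : EuclideanSpace ℝ (Fin N) → ℝ → EuclideanSpace ℝ (Fin N) → ℝ)
    (hf₁cont : ContinuousOn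
      (fun p : EuclideanSpace ℝ (Fin N) × ℝ × EuclideanSpace ℝ (Fin N) =>
        f₁ p.1 p.2.1 p.2.2)
      (closure Ω ×ˢ (univ : Set (ℝ × EuclideanSpace ℝ (Fin N)))))
    -- the partial derivatives of `f₁` with respect to `(η, ξ)` exist and are continuous
    (D : EuclideanSpace ℝ (Fin N) → ℝ → EuclideanSpace ℝ (Fin N) →
      (ℝ × EuclideanSpace ℝ (Fin N)) →L[ℝ] ℝ)
    (hD : ∀ x ∈ closure Ω, ∀ (η : ℝ) (ξ : EuclideanSpace ℝ (Fin N)),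
      HasFDerivAt (fun p : ℝ × EuclideanSpace ℝ (Fin N) => f₁ x p.1 p.2) (D x η ξ) (η, ξ))
    (hDcont : ContinuousOn
      (fun p : EuclideanSpace ℝ (Fin N) × ℝ × EuclideanSpace ℝ (Fin N) =>
        D p.1 p.2.1 p.2.2)
      (closure Ω ×ˢ (univ : Set (ℝ × EuclideanSpace ℝ (Fin N)))))
    -- (AM1): `f₁(·, η, ξ)` is α-Hölder on `Ω̄`, uniformly for `(η, ξ)` in bounded sets
    (hAM1 : ∀ B : Set (ℝ × EuclideanSpace ℝ (Fin N)), Bornology.IsBounded B →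
      ∃ C : NNReal, ∀ (η : ℝ) (ξ : EuclideanSpace ℝ (Fin N)), (η, ξ) ∈ B →
        HolderOnWith C α (fun x => f₁ x η ξ) (closure Ω))
    -- (AM2): quadratic growth in the gradient variable
    (hAM2 : ∃ f₂ : ℝ → ℝ, (∀ ρ : ℝ, 0 ≤ ρ → 0 ≤ f₂ ρ) ∧
      ∀ ρ : ℝ, 0 ≤ ρ → ∀ x ∈ closure Ω, ∀ η ∈ Set.Icc (-ρ) ρ,
        ∀ ξ : EuclideanSpace ℝ (Fin N), |f₁ x η ξ| ≤ f₂ ρ * (1 + ‖ξ‖ ^ 2))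
    -- sub solution and super solution
    (usub usup : EuclideanSpace ℝ (Fin N) → ℝ)
    (husubreg : C2HolderOnClosure α usub Ω)
    (husupreg : C2HolderOnClosure α usup Ω)
    (hsub : ∀ x ∈ Ω, -lap usub x ≤ f₁ x (usub x) (gradient usub x))
    (hsubbdry : ∀ x ∈ frontier Ω, usub x = g x)
    (hsup : ∀ x ∈ Ω, -lap usup x ≥ f₁ x (usup x) (gradient usup x))
    (hsupbdry : ∀ x ∈ frontier Ω, usup x = g x)
    (hle : ∀ x ∈ closure Ω, usub x ≤ usup x) :
    ∃ umin umax : EuclideanSpace ℝ (Fin N) → ℝ,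
      (C2HolderOnClosure α umin Ω ∧
        (∀ x ∈ Ω, -lap umin x = f₁ x (umin x) (gradient umin x)) ∧
        (∀ x ∈ frontier Ω, umin x = g x) ∧
        (∀ x ∈ closure Ω, usub x ≤ umin x ∧ umin x ≤ usup x)) ∧
      (C2HolderOnClosure α umax Ω ∧
        (∀ x ∈ Ω, -lap umax x = f₁ x (umax x) (gradient umax x)) ∧
        (∀ x ∈ frontier Ω, umax x = g x) ∧
        (∀ x ∈ closure Ω, usub x ≤ umax x ∧ umax x ≤ usup x)) ∧
      ∀ u : EuclideanSpace ℝ (Fin N) → ℝ,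
        C2HolderOnClosure α u Ω →
        (∀ x ∈ Ω, -lap u x = f₁ x (u x) (gradient u x)) →
        (∀ x ∈ frontier Ω, u x = g x) →
        (∀ x ∈ closure Ω, usub x ≤ u x ∧ u x ≤ usup x) →
        ∀ x ∈ closure Ω, umin x ≤ u x ∧ u x ≤ umax x := by
  obtain rfl | hNpos := Nat.eq_zero_or_pos N
  · have hx0 : ∀ x : EuclideanSpace ℝ (Fin 0), x = 0 := fun x => Subsingleton.elim _ _
    have hΩu : ∀ x, x ∈ Ω := fun x => by
      obtain ⟨y, hy⟩ := hΩconn.nonempty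
      rw [Subsingleton.elim x y]; exact hy
    have hl : ∀ (u : EuclideanSpace ℝ (Fin 0) → ℝ) x, lap u x = 0 := fun u x => by simp [lap]
    have hfr : ∀ x, x ∉ frontier Ω := fun x hx => (hΩo.frontier_eq ▸ hx).2 (hΩu x)
    have hC : ∀ c : ℝ, C2HolderOnClosure α (fun _ : EuclideanSpace ℝ (Fin 0) => c) Ω := fun c =>
      ⟨contDiffOn_const, 0, fun x _ y _ => by rw [Subsingleton.elim x y]; simp⟩
    have h0 := hΩu 0
    set k : ℝ → ℝ := fun η => f₁ 0 η 0 with hk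
    have hkc : Continuous k := by
      rw [← continuousOn_univ]
      exact hf₁cont.comp (f := fun η : ℝ => ((0 : EuclideanSpace ℝ (Fin 0)), η, (0 : EuclideanSpace ℝ (Fin 0))))
        (by fun_prop) fun η _ => ⟨subset_closure h0, mem_univ _⟩
    have k1 : 0 ≤ k (usub 0) := by
      have := hsub 0 h0
      rwa [hl, neg_zero, hx0 (gradient usub 0)] at this
    have k2 : k (usup 0) ≤ 0 := by
      have := hsup 0 h0
      rwa [hl, neg_zero, hx0 (gradient usup 0)] at this
    set Z := Icc (usub 0) (usup 0) ∩ k ⁻¹' {0} with hZ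
    have hZc : IsCompact Z := isCompact_Icc.inter_right (isClosed_singleton.preimage hkc)
    have hZn : Z.Nonempty := by
      obtain ⟨η, h1, h2⟩ := intermediate_value_Icc' (hle 0 (subset_closure h0)) hkc.continuousOn ⟨k2, k1⟩
      exact ⟨η, h1, h2⟩
    have hsol : ∀ c ∈ Z, C2HolderOnClosure α (fun _ : EuclideanSpace ℝ (Fin 0) => c) Ω ∧
        (∀ x ∈ Ω, -lap (fun _ => c) x = f₁ x c (gradient (fun _ => c) x)) ∧
        (∀ x ∈ frontier Ω, c = g x) ∧ (∀ x ∈ closure Ω, usub x ≤ c ∧ c ≤ usup x) := fun c hc => by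
      refine ⟨hC c, fun x _ => ?_, fun x hx => absurd hx (hfr x), fun x _ => ?_⟩
      · rw [hl, hx0 (gradient _ x), hx0 x, neg_zero]; exact hc.2.symm
      · rw [hx0 x]; exact hc.1
    obtain ⟨a, ha, ha'⟩ := hZc.exists_isLeast hZn
    obtain ⟨b, hb, hb'⟩ := hZc.exists_isGreatest hZn
    refine ⟨fun _ => a, fun _ => b, hsol a ha, hsol b hb, fun u _ h1 _ h2 x hx => ?_⟩
    have : u 0 ∈ Z := by
      refine ⟨h2 0 (subset_closure h0), ?_⟩
      have := h1 0 h0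
      rw [hl, neg_zero, hx0 (gradient u 0)] at this
      exact this.symm
    rw [hx0 x]
    exact ⟨ha' this, hb' this⟩
  have hN : 1 ≤ dm (EuclideanSpace ℝ (Fin N)) := by
    rw [dm, finrank_euclideanSpace_fin]; exact_mod_cast hNpos
  obtain ⟨Λ, ρ, hΛ, hρ, hBD⟩ := bd_of hα0 hΩo hΩb hbd
  have hU := uniqueDiff_closure hΩo hΛ hρ hBD
  set f : EuclideanSpace ℝ (Fin N) → ℝ → Du (EuclideanSpace ℝ (Fin N)) → ℝ :=
    fun x η p => f₁ x η ((InnerProductSpace.toDual ℝ _).symm p) with hfd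
  have hgrad : ∀ (u : EuclideanSpace ℝ (Fin N) → ℝ) x, f x (u x) (fderiv ℝ u x) = f₁ x (u x) (gradient u x) := fun u x => rfl
  have hf : Adm f (closure Ω) α := by
    refine ⟨fun R => ?_, fun R => ?_, fun R => ?_⟩
    · have hKc : IsCompact (closure Ω ×ˢ (Icc (-R) R ×ˢ Metric.closedBall (0 : EuclideanSpace ℝ (Fin N)) R)) :=
        hΩb.isCompact_closure.prod (isCompact_Icc.prod (isCompact_closedBall _ _))
      obtain ⟨L, hL⟩ := hKc.exists_bound_of_continuousOn (hDcont.mono (prod_mono le_rfl (subset_univ _)))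
      refine ⟨|L|, abs_nonneg _, fun x hx η η' p p' h1 h2 h3 h4 => ?_⟩
      have hm : ∀ (η : ℝ) (p : Du (EuclideanSpace ℝ (Fin N))), |η| ≤ R → ‖p‖ ≤ R →
          (η, (InnerProductSpace.toDual ℝ _).symm p) ∈ Icc (-R) R ×ˢ Metric.closedBall (0 : EuclideanSpace ℝ (Fin N)) R :=
        fun η p h1 h2 => ⟨abs_le.1 h1, by rw [mem_closedBall_zero_iff, LinearIsometryEquiv.norm_map]; exact h2⟩
      have := ((convex_Icc (-R) R).prod (convex_closedBall (0 : EuclideanSpace ℝ (Fin N)) R)).norm_image_sub_le_of_norm_hasFDerivWithin_le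
        (f := fun q : ℝ × EuclideanSpace ℝ (Fin N) => f₁ x q.1 q.2) (f' := fun q => D x q.1 q.2) (C := |L|)
        (fun q _ => (hD x hx q.1 q.2).hasFDerivWithinAt)
        (fun q hq => (hL (x, q) ⟨hx, hq⟩).trans (le_abs_self L)) (hm η' p' h2 h4) (hm η p h1 h3)
      refine this.trans (mul_le_mul_of_nonneg_left ?_ (abs_nonneg L))
      rw [Prod.mk_sub_mk, ← map_sub, Prod.norm_def]
      refine max_le ?_ ?_
      · exact le_add_of_nonneg_right (norm_nonneg _)
      · change ‖(InnerProductSpace.toDual ℝ (EuclideanSpace ℝ (Fin N))).symm (p - p')‖ ≤ _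
        rw [LinearIsometryEquiv.norm_map]; exact le_add_of_nonneg_left (abs_nonneg _)
    · obtain ⟨C, hC⟩ := hAM1 (Icc (-R) R ×ˢ Metric.closedBall 0 R) ((Metric.isBounded_Icc _ _).prod Metric.isBounded_closedBall)
      refine ⟨C, C.coe_nonneg, fun x hx y hy η p h1 h2 => ?_⟩
      have hd := hC η ((InnerProductSpace.toDual ℝ _).symm p) ⟨abs_le.1 h1, by
        rw [mem_closedBall_zero_iff, LinearIsometryEquiv.norm_map]; exact h2⟩ x hx y hy
      rw [edist_dist, edist_dist, ENNReal.ofReal_rpow_of_nonneg dist_nonneg α.coe_nonneg, ← ENNReal.ofReal_coe_nnreal,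
        ← ENNReal.ofReal_mul C.coe_nonneg, ENNReal.ofReal_le_ofReal_iff (by positivity), dist_eq_norm, dist_eq_norm] at hd
      exact hd
    · obtain ⟨f₂, h0, h⟩ := hAM2
      refine ⟨f₂ |R| + 1, by linarith [h0 |R| (abs_nonneg R)], fun x hx η p h1 => ?_⟩
      have := h |R| (abs_nonneg R) x hx η (abs_le.1 (h1.trans (le_abs_self R))) ((InnerProductSpace.toDual ℝ _).symm p)
      rw [LinearIsometryEquiv.norm_map] at this
      exact this.trans (by gcongr; linarith)
  obtain ⟨umax, m1, m2, m3, m4, m5⟩ := core hN hα0 hα1 hΩo hΩb hΛ hρ hBD hf hg husubreg husupreg hsub hsup hsubbdry hsupbdry hle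
  have key : ∀ v, C2HolderOnClosure α v Ω → C2HolderOnClosure α (fun x => (-1) * v x + 0 * v x) Ω ∧
      ∀ x ∈ Ω, fl f x ((-1) * v x + 0 * v x) (fderiv ℝ (fun x => (-1) * v x + 0 * v x) x) = - f x (v x) (fderiv ℝ v x) ∧
        lap (fun x => (-1) * v x + 0 * v x) x = - lap v x := fun v hv => by
    obtain ⟨a, b⟩ := comb hα0 hU hΩo hΩb hv hv (-1) 0
    refine ⟨a, fun x hx => ?_⟩
    rw [(b x hx).1, (b x hx).2, fl]
    refine ⟨?_, by ring⟩
    congr 2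
    · ring
    · rw [zero_smul, add_zero, neg_smul, one_smul, neg_neg]
  obtain ⟨w, w1, w2, w3, w4, w5⟩ := core hN hα0 hα1 hΩo hΩb hΛ hρ hBD hf.neg (key g hg).1 (key _ husupreg).1 (key _ husubreg).1
    (fun x hx => by
      rw [((key _ husupreg).2 x hx).1, ((key _ husupreg).2 x hx).2, hgrad]; linarith [hsup x hx])
    (fun x hx => by
      rw [((key _ husubreg).2 x hx).1, ((key _ husubreg).2 x hx).2, hgrad]; linarith [hsub x hx])
    (fun x hx => by rw [hsupbdry x hx]) (fun x hx => by rw [hsubbdry x hx]) (fun x hx => by linarith [hle x hx])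
  refine ⟨fun x => (-1) * w x + 0 * w x, umax, ⟨(key w w1).1, fun x hx => ?_, fun x hx => ?_, fun x hx => ?_⟩,
    ⟨m1, m2, m3, m4⟩, fun u h1 h2 h3 h4 x hx => ⟨?_, m5 u h1 h2 h3 h4 x hx⟩⟩
  · have e2 := w2 x hx
    rw [← hgrad (fun x => (-1) * w x + 0 * w x) x, ((key w w1).2 x hx).2]
    rw [← fl_fl f, fl]
    have e3 := (comb hα0 hU hΩo hΩb w1 w1 (-1) 0).2 x hx
    rw [e3.1, zero_smul, add_zero, neg_smul, one_smul, neg_neg, zero_mul, add_zero, neg_one_mul, neg_neg]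
    rw [neg_neg (fderiv ℝ w x), ← e2, neg_neg]
  · have := w3 x hx
    linarith
  · have := w4 x hx
    exact ⟨by linarith [this.2], by linarith [this.1]⟩
  · have := w5 _ (key u h1).1 (fun x hx => by
      rw [((key u h1).2 x hx).1, ((key u h1).2 x hx).2, hgrad, ← h2 x hx]) (fun x hx => by rw [h3 x hx])
      (fun x hx => ⟨by linarith [(h4 x hx).2], by linarith [(h4 x hx).1]⟩) x hx
    linarith
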